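/- For every function f : ℕ → (0,∞) with f(n) → ∞ and f(n)·(log log n)/(log n) → 0 as n → ∞, there exist D ∈ ℕ and a sequence of finite connected simple graphs G_n = (V_n, E_n) with maximal degree at most D and |V_n| → ∞ such that: (i) there are constants c,C > 0 with c·t_mix(G_n) ≤ girth(G_n) ≤ C·t_mix(G_n) for all n; (ii) the sequence of lazy simple random walks on G_n satisfies t_rel(G_n)/t_mix(G_n) → 0 (the product condition) but does not exhibit pre-cutoff, i.e. sup_{0<ε<1/2} limsup_n t_mix(G_n,ε)/t_mix(G_n,1−ε) = ∞; and (iii) there exist edge weights c_e^{(n)} ≥ 1 on E_n with max_{e∈E_n} c_e^{(n)} → 1 as n → ∞ (an o(1)-perturbation) such that the sequence of lazy random walks on the weighted networks (G_n,(c_e^{(n)})) exhibits total variation cutoff and there are constants c',C' > 0 with c'·f(|V_n|) ≤ t_mix(G_n,(c_e^{(n)}))/t_mix(G_n) ≤ C'·f(|V_n|) for all n. -/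

import Mathlib

open Filter Finset

noncomputable section

variable {V : Type} [Fintype V] [DecidableEq V]

/-- `P` is a row-stochastic matrix. -/
def IsStoch (P : Matrix V V ℝ) : Prop :=
  (∀ i j, 0 ≤ P i j) ∧ ∀ i, ∑ j, P i j = 1

/-- `π` is a probability vector with full support. -/
def IsProb (π : V → ℝ) : Prop := (∀ i, 0 < π i) ∧ ∑ i, π i = 1

/-- reversibility: `π x * P x y = π y * P y x`. -/
def Rev (P : Matrix V V ℝ) (π : V → ℝ) : Prop := ∀ i j, π i * P i j = π j * P j i

/-- irreducibility -/
def Irred (P : Matrix V V ℝ) : Prop := ∀ i j, ∃ t : ℕ, 0 < (P ^ t) i j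

/-- the lazy version `(I + P)/2` of a chain -/
def lazyM (P : Matrix V V ℝ) : Matrix V V ℝ := (2 : ℝ)⁻¹ • (1 + P)

/-- total variation distance -/
def tvDist (μ ν : V → ℝ) : ℝ := (∑ x, |μ x - ν x|) / 2

/-- worst-case total variation distance from stationarity at time `t` -/
def dTV (P : Matrix V V ℝ) (π : V → ℝ) (t : ℕ) : ℝ := ⨆ x, tvDist ((P ^ t) x) π

/-- the `ε` total-variation mixing time -/
def mixTime (P : Matrix V V ℝ) (π : V → ℝ) (ε : ℝ) : ℕ := sInf {t : ℕ | dTV P π t ≤ ε}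

/-- worst-case separation distance at time `t` -/
def dSep (P : Matrix V V ℝ) (π : V → ℝ) (t : ℕ) : ℝ := 1 - ⨅ x, ⨅ y, ((P ^ t) x y) / π y

/-- the `ε` separation time -/
def sepTime (P : Matrix V V ℝ) (π : V → ℝ) (ε : ℝ) : ℕ := sInf {t : ℕ | dSep P π t ≤ ε}

/-- the heat kernel `H_t = exp (t (P - I))` of the associated continuous-time chain -/
def heatKer (P : Matrix V V ℝ) (t : ℝ) : Matrix V V ℝ :=
  ∑' k : ℕ, (t ^ k / (Nat.factorial k : ℝ)) • ((P - 1) ^ k)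

/-- separation distance of the continuous-time chain -/
def dSepC (P : Matrix V V ℝ) (π : V → ℝ) (t : ℝ) : ℝ := 1 - ⨅ x, ⨅ y, (heatKer P t) x y / π y

/-- the `ε` separation time of the continuous-time chain -/
def sepTimeC (P : Matrix V V ℝ) (π : V → ℝ) (ε : ℝ) : ℝ := sInf {t : ℝ | 0 ≤ t ∧ dSepC P π t ≤ ε}

/-- degree of a vertex -/
def deg (G : SimpleGraph V) (v : V) : ℕ := Nat.card {u // G.Adj v u}

open Classical in
/-- transition matrix of the lazy simple random walk on `G` -/
def walkMat (G : SimpleGraph V) : Matrix V V ℝ :=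
  Matrix.of fun v u => if v = u then 1/2 else if G.Adj v u then 1 / (2 * (deg G v : ℝ)) else 0

/-- stationary distribution of the (lazy) simple random walk on `G` -/
def degSta (G : SimpleGraph V) (v : V) : ℝ := (deg G v : ℝ) / ∑ u, (deg G u : ℝ)

/-- the `ε` total-variation mixing time of the lazy simple random walk on `G` -/
def tmixG (G : SimpleGraph V) (ε : ℝ) : ℕ := mixTime (walkMat G) (degSta G) ε

/-- the second largest eigenvalue of a reversible transition matrix -/
def lam2 (P : Matrix V V ℝ) : ℝ :=
  sSup {μ : ℝ | μ ≠ 1 ∧ ∃ f : V → ℝ, f ≠ 0 ∧ P.mulVec f = μ • f}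

/-- the relaxation time `1/(1-λ₂)` -/
def trel (P : Matrix V V ℝ) : ℝ := 1 / (1 - lam2 P)

/-- the relaxation time of the lazy simple random walk on `G` -/
def trelG (G : SimpleGraph V) : ℝ := trel (walkMat G)

/-- transition matrix of the lazy random walk on the network with edge weights `w` -/
def wMat (w : V → V → ℝ) : Matrix V V ℝ :=
  Matrix.of fun v u => if v = u then 1/2 else w v u / (2 * ∑ x, w v x)

/-- stationary distribution of the lazy random walk on the network with edge weights `w` -/
def wSta (w : V → V → ℝ) (v : V) : ℝ := (∑ x, w v x) / ∑ u, ∑ x, w u x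

/-- `w` is a valid system of edge weights on the graph `G`: symmetric, positive on edges
and vanishing off the edges. -/
def GoodWeights (G : SimpleGraph V) (w : V → V → ℝ) : Prop :=
  (∀ u v, w u v = w v u) ∧ (∀ u v, G.Adj u v → 0 < w u v) ∧ ∀ u v, ¬ G.Adj u v → w u v = 0

/-- the `ε` total-variation mixing time of the lazy random walk on the weighted network -/
def tmixW (w : V → V → ℝ) (ε : ℝ) : ℕ := mixTime (wMat w) (wSta w) ε

/-- the probability of a discrete trajectory -/
def pathProb (P : Matrix V V ℝ) {k : ℕ} (w : Fin (k+1) → V) : ℝ :=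
  ∏ i : Fin k, P (w i.castSucc) (w i.succ)

/-- `P_x[T_y = k]`: probability that the chain started at `x` first hits `y` at time `k` -/
def firstHit (P : Matrix V V ℝ) (x y : V) (k : ℕ) : ℝ :=
  ∑ w : Fin (k+1) → V,
    if w 0 = x ∧ w (Fin.last k) = y ∧ ∀ i : Fin k, w i.castSucc ≠ y then pathProb P w else 0

/-- the restriction of `P - I` to the complement of `y` -/
def restrQ (P : Matrix V V ℝ) (y : V) : Matrix {w : V // w ≠ y} {w : V // w ≠ y} ℝ :=
  Matrix.of fun a b => P a.1 b.1 - if a = b then 1 else 0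

/-- `exp (t A)` where `A` is the restriction of `P - I` to the complement of `y` -/
def heatRestr (P : Matrix V V ℝ) (y : V) (t : ℝ) :
    Matrix {w : V // w ≠ y} {w : V // w ≠ y} ℝ :=
  ∑' k : ℕ, (t ^ k / (Nat.factorial k : ℝ)) • (restrQ P y ^ k)

/-- `P_x[T_B < r]` for the chain `P`: the probability that the set `B` is hit before time `r` -/
def hitByTime (P : Matrix V V ℝ) (B : Finset V) (x : V) (r : ℕ) : ℝ :=
  ∑ k ∈ Finset.range r, ∑ w : Fin (k+1) → V,
    if w 0 = x ∧ w (Fin.last k) ∈ B ∧ ∀ i : Fin k, w i.castSucc ∉ B then pathProb P w else 0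

set_option linter.unusedSectionVars false

section

/-! ### Weighted networks -/

/-- total weight of the edges at `x` -/
def wdeg (w : V → V → ℝ) (x : V) : ℝ := ∑ u, w x u

/-- symmetric nonnegative loopless edge weights with positive total weight at every vertex -/
structure IsNet (w : V → V → ℝ) : Prop where
  symm : ∀ x y, w x y = w y x
  nonneg : ∀ x y, 0 ≤ w x y
  diag : ∀ x, w x x = 0
  pos : ∀ x, 0 < wdeg w x

/-- the graph Laplacian of the network -/
def wlap (w : V → V → ℝ) (f : V → ℝ) (x : V) : ℝ := ∑ u, w x u * (f u - f x)

/-- the Dirichlet energy, each edge being counted twice -/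
def energy (w : V → V → ℝ) (f : V → ℝ) : ℝ := ∑ x, ∑ y, w x y * (f x - f y) ^ 2

/-- the transition operator of the lazy walk -/
def wop (w : V → V → ℝ) (f : V → ℝ) (x : V) : ℝ := ((wMat w).mulVec f) x

/-- Poincaré inequality with constant `Λ` -/
def Poinc (w : V → V → ℝ) (Λ : ℝ) : Prop :=
  ∀ f : V → ℝ, ∃ a : ℝ, ∑ x, wdeg w x * (f x - a) ^ 2 ≤ Λ * energy w f

variable {w : V → V → ℝ}

lemma energy_nonneg (hw : IsNet w) (f : V → ℝ) : 0 ≤ energy w f :=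
  sum_nonneg fun _ _ => sum_nonneg fun _ _ => mul_nonneg (hw.nonneg _ _) (sq_nonneg _)

lemma IsNet.sum_pos [Nonempty V] (hw : IsNet w) : 0 < ∑ x, wdeg w x :=
  Finset.sum_pos (fun x _ => hw.pos x) univ_nonempty

lemma wlap_eq (w : V → V → ℝ) (f : V → ℝ) (x : V) :
    wlap w f x = ∑ u, w x u * f u - wdeg w x * f x := by
  simp [wlap, wdeg, mul_sub, sum_sub_distrib, sum_mul]

lemma wop_eq (hw : IsNet w) (f : V → ℝ) (x : V) :
    wop w f x = f x + wlap w f x / (2 * wdeg w x) := by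
  have hc := hw.pos x
  have h1 : wop w f x = f x / 2 + ∑ u, w x u * f u / (2 * wdeg w x) := by
    simp only [wop, Matrix.mulVec, dotProduct, wMat, Matrix.of_apply]
    rw [← add_sum_erase _ _ (mem_univ x), ← add_sum_erase univ (fun u => w x u * f u / _) (mem_univ x)]
    simp only [if_true, hw.diag, zero_mul, zero_div, zero_add]
    congr 1
    · ring
    · refine sum_congr rfl fun u hu => ?_
      rw [if_neg (ne_of_mem_erase hu).symm, wdeg]
      ring
  rw [h1, wlap_eq, ← sum_div]
  field_simp
  ring

lemma wop_mul (hw : IsNet w) (f : V → ℝ) (x : V) :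
    wdeg w x * wop w f x = ∑ u, w x u * ((f x + f u) / 2) := by
  have hc := hw.pos x
  rw [wop_eq hw, wlap_eq]
  have : ∑ u, w x u * ((f x + f u) / 2) = (wdeg w x * f x + ∑ u, w x u * f u) / 2 := by
    simp only [wdeg, sum_mul, ← sum_add_distrib, sum_div]
    exact sum_congr rfl fun _ _ => by ring
  rw [this]
  field_simp
  ring

lemma wMat_nonneg (hw : IsNet w) (x y : V) : 0 ≤ wMat w x y := by
  have := hw.pos x
  simp only [wMat, Matrix.of_apply]
  split_ifs
  · norm_num
  · exact div_nonneg (hw.nonneg _ _) (by unfold wdeg at this; positivity)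

lemma wop_mono (hw : IsNet w) {f g : V → ℝ} (h : ∀ x, f x ≤ g x) (x : V) :
    wop w f x ≤ wop w g x :=
  sum_le_sum fun u _ => mul_le_mul_of_nonneg_left (h u) (wMat_nonneg hw x u)

lemma wop_const (hw : IsNet w) (a : ℝ) (x : V) : wop w (fun _ => a) x = a := by
  rw [wop_eq hw]; simp [wlap]

lemma wop_add (w : V → V → ℝ) (f g : V → ℝ) (x : V) :
    wop w (fun y => f y + g y) x = wop w f x + wop w g x := by
  simp [wop, Matrix.mulVec, dotProduct, mul_add, sum_add_distrib]

lemma wop_sub (w : V → V → ℝ) (f g : V → ℝ) (x : V) :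
    wop w (fun y => f y - g y) x = wop w f x - wop w g x := by
  simp [wop, Matrix.mulVec, dotProduct, mul_sub, sum_sub_distrib]

lemma wop_smul (w : V → V → ℝ) (a : ℝ) (f : V → ℝ) (x : V) :
    wop w (fun y => a * f y) x = a * wop w f x := by
  simp only [wop, Matrix.mulVec, dotProduct, mul_sum]
  exact sum_congr rfl fun _ _ => by ring

lemma wop_add_const (hw : IsNet w) (f : V → ℝ) (a : ℝ) (x : V) :
    wop w (fun y => f y + a) x = wop w f x + a := by
  rw [wop_add, wop_const hw]

lemma wop_iterate (w : V → V → ℝ) (t : ℕ) (f : V → ℝ) (x : V) :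
    (wop w)^[t] f x = ((wMat w ^ t).mulVec f) x := by
  induction t generalizing x with
  | zero => simp
  | succ t ih =>
    rw [Function.iterate_succ_apply', pow_succ', ← Matrix.mulVec_mulVec]
    change (wMat w).mulVec _ x = _
    rw [show (wop w)^[t] f = (wMat w ^ t).mulVec f from funext ih]

lemma sum_wdeg_wop (hw : IsNet w) (f : V → ℝ) :
    ∑ x, wdeg w x * wop w f x = ∑ x, wdeg w x * f x := by
  simp only [wop_mul hw]
  simp only [wdeg, sum_mul]
  have h : ∑ x, ∑ u, w x u * f u = ∑ x, ∑ u, w x u * f x := by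
    rw [sum_comm]
    exact sum_congr rfl fun _ _ => sum_congr rfl fun _ _ => by rw [hw.symm]
  calc _ = ((∑ x, ∑ u, w x u * f x) + ∑ x, ∑ u, w x u * f u) / 2 := by
        rw [← sum_add_distrib, sum_div]
        refine sum_congr rfl fun _ _ => ?_
        rw [← sum_add_distrib, sum_div]
        exact sum_congr rfl fun _ _ => by ring
    _ = _ := by rw [h]; ring

lemma sum_wop_sq_le (hw : IsNet w) (f : V → ℝ) :
    ∑ x, wdeg w x * wop w f x ^ 2 ≤ ∑ x, wdeg w x * f x ^ 2 - energy w f / 4 := by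
  have h1 : ∀ x, wdeg w x * wop w f x ^ 2 ≤ ∑ u, w x u * ((f x + f u) / 2) ^ 2 := by
    intro x
    have hc := hw.pos x
    have hcs : (∑ u, w x u * ((f x + f u) / 2)) ^ 2
        ≤ (∑ u, w x u) * ∑ u, w x u * ((f x + f u) / 2) ^ 2 := by
      refine sum_sq_le_sum_mul_sum_of_sq_le_mul _ (fun _ _ => hw.nonneg _ _)
        (fun _ _ => mul_nonneg (hw.nonneg _ _) (sq_nonneg _)) fun _ _ => le_of_eq (by ring)
    rw [← wop_mul hw] at hcs
    have : wdeg w x * (wdeg w x * wop w f x ^ 2)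
        ≤ wdeg w x * ∑ u, w x u * ((f x + f u) / 2) ^ 2 := by
      calc _ = (wdeg w x * wop w f x) ^ 2 := by ring
        _ ≤ _ := hcs
    exact le_of_mul_le_mul_left this hc
  have h : ∑ x, ∑ u, w x u * f u ^ 2 = ∑ x, ∑ u, w x u * f x ^ 2 := by
    rw [sum_comm]
    exact sum_congr rfl fun _ _ => sum_congr rfl fun _ _ => by rw [hw.symm]
  calc _ ≤ ∑ x, ∑ u, w x u * ((f x + f u) / 2) ^ 2 := sum_le_sum fun x _ => h1 x
    _ = ((∑ x, ∑ u, w x u * f x ^ 2) + ∑ x, ∑ u, w x u * f u ^ 2) / 2 - energy w f / 4 := by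
      rw [energy, ← sum_add_distrib, sum_div, sum_div, ← sum_sub_distrib]
      refine sum_congr rfl fun _ _ => ?_
      rw [← sum_add_distrib, sum_div, sum_div, ← sum_sub_distrib]
      exact sum_congr rfl fun _ _ => by ring
    _ = _ := by rw [h]; simp only [wdeg, sum_mul]; ring

lemma Poinc.sum_sq_le {Λ : ℝ} (hw : IsNet w) (hP : Poinc w Λ) (f : V → ℝ)
    (hf : ∑ x, wdeg w x * f x = 0) : ∑ x, wdeg w x * f x ^ 2 ≤ Λ * energy w f := by
  obtain ⟨a, ha⟩ := hP f
  refine le_trans ?_ ha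
  have : ∑ x, wdeg w x * (f x - a) ^ 2
      = ∑ x, wdeg w x * f x ^ 2 - 2 * a * ∑ x, wdeg w x * f x + ∑ x, wdeg w x * a ^ 2 := by
    rw [mul_sum, ← sum_sub_distrib, ← sum_add_distrib]
    exact sum_congr rfl fun _ _ => by ring
  rw [this, hf]
  have : 0 ≤ ∑ x, wdeg w x * a ^ 2 :=
    sum_nonneg fun x _ => mul_nonneg (hw.pos x).le (sq_nonneg _)
  linarith

lemma Poinc.contract {Λ : ℝ} (hw : IsNet w) (hΛ : 0 < Λ) (hP : Poinc w Λ) (f : V → ℝ)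
    (hf : ∑ x, wdeg w x * f x = 0) :
    ∑ x, wdeg w x * wop w f x ^ 2 ≤ (1 - 1 / (4 * Λ)) * ∑ x, wdeg w x * f x ^ 2 := by
  have h1 := sum_wop_sq_le hw f
  have h2 := hP.sum_sq_le hw f hf
  have h3 : 1 / (4 * Λ) * ∑ x, wdeg w x * f x ^ 2 ≤ energy w f / 4 := by
    rw [div_mul_eq_mul_div, div_le_iff₀ (by positivity)]
    linarith
  linarith

lemma Poinc.contract_iterate {Λ : ℝ} (hw : IsNet w) (hΛ : 1 ≤ Λ) (hP : Poinc w Λ) (f : V → ℝ)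
    (hf : ∑ x, wdeg w x * f x = 0) (t : ℕ) :
    ∑ x, wdeg w x * (wop w)^[t] f x = 0 ∧
    ∑ x, wdeg w x * (wop w)^[t] f x ^ 2 ≤ (1 - 1 / (4 * Λ)) ^ t * ∑ x, wdeg w x * f x ^ 2 := by
  induction t with
  | zero => simpa using hf
  | succ t ih =>
    simp only [Function.iterate_succ_apply']
    refine ⟨by rw [sum_wdeg_wop hw]; exact ih.1, ?_⟩
    refine (hP.contract hw (by linarith) _ ih.1).trans ?_
    rw [pow_succ', mul_assoc]
    refine mul_le_mul_of_nonneg_left ih.2 ?_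
    rw [sub_nonneg, div_le_one (by positivity)]; linarith

lemma trel_le_of_poinc [Nonempty V] {Λ : ℝ} (hw : IsNet w) (hΛ : 1 ≤ Λ) (hP : Poinc w Λ) :
    0 ≤ trel (wMat w) ∧ trel (wMat w) ≤ 8 * Λ := by
  have hpos : 0 < 1 / (8 * Λ) := by positivity
  have hle1 : 1 / (8 * Λ) ≤ 1 := by rw [div_le_one (by positivity)]; linarith
  have key : lam2 (wMat w) ≤ 1 - 1 / (8 * Λ) := by
    refine Real.sSup_le ?_ (by linarith)
    rintro μ ⟨hμ, f, hf0, hf⟩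
    have hwop : ∀ x, wop w f x = μ * f x := fun x => by
      have := congrFun hf x
      simpa [wop] using this
    have hmean : ∑ x, wdeg w x * f x = 0 := by
      have := sum_wdeg_wop hw f
      simp only [hwop] at this
      have h2 : ∑ x, wdeg w x * (μ * f x) = μ * ∑ x, wdeg w x * f x := by
        rw [mul_sum]; exact sum_congr rfl fun _ _ => by ring
      rw [h2] at this
      have h3 : (μ - 1) * ∑ x, wdeg w x * f x = 0 := by linarith
      exact (mul_eq_zero.mp h3).resolve_left (sub_ne_zero.mpr hμ)
    have hc := hP.contract hw (by linarith) f hmean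
    simp only [hwop] at hc
    have hS : 0 < ∑ x, wdeg w x * f x ^ 2 := by
      obtain ⟨x, hx⟩ := Function.ne_iff.mp hf0
      exact Finset.sum_pos' (fun x _ => mul_nonneg (hw.pos x).le (sq_nonneg _))
        ⟨x, mem_univ _, mul_pos (hw.pos x) (by have : f x ≠ 0 := hx; positivity)⟩
    have h2 : ∑ x, wdeg w x * (μ * f x) ^ 2 = μ ^ 2 * ∑ x, wdeg w x * f x ^ 2 := by
      rw [mul_sum]; exact sum_congr rfl fun _ _ => by ring
    rw [h2] at hc
    have h3 := le_of_mul_le_mul_right hc hS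
    have h4 : 1 / (4 * Λ) = 2 * (1 / (8 * Λ)) := by field_simp; norm_num
    rw [h4] at h3
    nlinarith [sq_nonneg (μ - 1)]
  have h1 : 1 / (8 * Λ) ≤ 1 - lam2 (wMat w) := by linarith
  refine ⟨div_nonneg zero_le_one (by linarith), ?_⟩
  have := one_div_le_one_div_of_le hpos h1
  simpa [trel] using this

end

section

variable {w : V → V → ℝ}

/-! ### Survival probabilities -/

open Classical in
/-- the probability that the lazy walk started at `x` does not visit `Q` up to time `t` -/
def surv (w : V → V → ℝ) (Q : Set V) : ℕ → V → ℝ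
  | 0, x => if x ∈ Q then 0 else 1
  | t + 1, x => if x ∈ Q then 0 else wop w (surv w Q t) x

lemma surv_of_mem (w : V → V → ℝ) {Q : Set V} {x : V} (hx : x ∈ Q) (t : ℕ) : surv w Q t x = 0 := by
  cases t <;> simp [surv, hx]

lemma surv_zero (w : V → V → ℝ) {Q : Set V} {x : V} (hx : x ∉ Q) : surv w Q 0 x = 1 := by
  simp [surv, hx]

lemma surv_succ (w : V → V → ℝ) {Q : Set V} {x : V} (hx : x ∉ Q) (t : ℕ) :
    surv w Q (t + 1) x = wop w (surv w Q t) x := by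
  simp [surv, hx]

lemma surv_nonneg (hw : IsNet w) (Q : Set V) (t : ℕ) (x : V) : 0 ≤ surv w Q t x := by
  induction t generalizing x with
  | zero => simp only [surv]; split_ifs <;> norm_num
  | succ t ih =>
    by_cases hx : x ∈ Q
    · rw [surv_of_mem w hx]
    · rw [surv_succ w hx]
      exact (wop_const hw 0 x).symm.trans_le (wop_mono hw ih x)

lemma surv_le_one (hw : IsNet w) (Q : Set V) (t : ℕ) (x : V) : surv w Q t x ≤ 1 := by
  induction t generalizing x with
  | zero => simp only [surv]; split_ifs <;> norm_num
  | succ t ih =>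
    by_cases hx : x ∈ Q
    · rw [surv_of_mem w hx]; exact zero_le_one
    · rw [surv_succ w hx]
      exact (wop_mono hw ih x).trans_eq (wop_const hw 1 x)

/-- comparison principle for survival probabilities -/
lemma surv_le_of_super (hw : IsNet w) (Q : Set V) (F : ℕ → V → ℝ)
    (h0 : ∀ t x, x ∈ Q → 0 ≤ F t x) (h1 : ∀ x, x ∉ Q → 1 ≤ F 0 x)
    (h2 : ∀ t x, x ∉ Q → wop w (F t) x ≤ F (t + 1) x ∨ 1 ≤ F (t + 1) x) (t : ℕ) (x : V) :
    surv w Q t x ≤ F t x := by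
  induction t generalizing x with
  | zero =>
    by_cases hx : x ∈ Q
    · rw [surv_of_mem w hx]; exact h0 _ _ hx
    · rw [surv_zero w hx]; exact h1 _ hx
  | succ t ih =>
    by_cases hx : x ∈ Q
    · rw [surv_of_mem w hx]; exact h0 _ _ hx
    · rcases h2 t x hx with h | h
      · rw [surv_succ w hx]; exact (wop_mono hw ih x).trans h
      · exact (surv_le_one hw _ _ _).trans h

lemma surv_succ_le (hw : IsNet w) (Q : Set V) (t : ℕ) (x : V) :
    surv w Q (t + 1) x ≤ surv w Q t x := by
  induction t generalizing x with
  | zero =>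
    by_cases hx : x ∈ Q
    · rw [surv_of_mem w hx, surv_of_mem w hx]
    · rw [surv_zero w hx]; exact surv_le_one hw _ _ _
  | succ t ih =>
    by_cases hx : x ∈ Q
    · rw [surv_of_mem w hx, surv_of_mem w hx]
    · rw [surv_succ w hx, surv_succ w hx]; exact wop_mono hw ih x

lemma surv_antitone (hw : IsNet w) (Q : Set V) (x : V) : Antitone fun t => surv w Q t x :=
  antitone_nat_of_succ_le fun t => surv_succ_le hw Q t x

/-- if every point of `B` hits `Q` quickly then the survival of `Q` is controlled by that of `B` -/
lemma surv_add_le (hw : IsNet w) (Q B : Set V) (tb : ℕ) (κ : ℝ) (hκ : 0 ≤ κ)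
    (h : ∀ y ∈ B, surv w Q tb y ≤ κ) (ta : ℕ) (x : V) :
    surv w Q (ta + tb) x ≤ surv w B ta x + κ := by
  induction ta generalizing x with
  | zero =>
    by_cases hx : x ∈ B
    · rw [surv_of_mem w hx]; simpa using h x hx
    · rw [surv_zero w hx]; linarith [surv_le_one hw Q (0 + tb) x]
  | succ t ih =>
    by_cases hx : x ∈ Q
    · rw [surv_of_mem w hx]; linarith [surv_nonneg hw B (t + 1) x]
    by_cases hB : x ∈ B
    · rw [surv_of_mem w hB]
      have := surv_antitone hw Q x (show tb ≤ t + 1 + tb by omega)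
      simp only at this
      linarith [h x hB]
    · rw [show t + 1 + tb = (t + tb) + 1 by ring, surv_succ w hx, surv_succ w hB,
        ← wop_add_const hw]
      exact wop_mono hw ih x

/-- killing the walk also on `A` costs at most `g + tε` -/
lemma surv_le_surv_union (hw : IsNet w) (Q A : Set V) (g : V → ℝ) (ε : ℝ) (hε : 0 ≤ ε)
    (hg0 : ∀ x, 0 ≤ g x) (hgA : ∀ x ∈ A, 1 ≤ g x)
    (hg : ∀ x, x ∉ Q → x ∉ A → wop w g x ≤ g x + ε) (t : ℕ) (x : V) :
    surv w Q t x ≤ surv w (Q ∪ A) t x + g x + t * ε := by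
  refine surv_le_of_super hw Q (fun t x => surv w (Q ∪ A) t x + g x + t * ε) ?_ ?_ ?_ t x
  · intro t x _
    have := surv_nonneg hw (Q ∪ A) t x
    have := hg0 x
    positivity
  · intro x hx
    by_cases hA : x ∈ A
    · have := surv_nonneg hw (Q ∪ A) 0 x
      have := hgA x hA
      simp only [Nat.cast_zero, zero_mul]; linarith
    · have : x ∉ Q ∪ A := by simp [hx, hA]
      have h0 := hg0 x
      simp only [surv_zero w this, Nat.cast_zero, zero_mul]; linarith
  · intro t x hx
    by_cases hA : x ∈ A
    · right
      have := surv_nonneg hw (Q ∪ A) (t + 1) x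
      have := hgA x hA
      have : 0 ≤ ((t + 1 : ℕ) : ℝ) * ε := by positivity
      linarith
    · left
      have h1 : x ∉ Q ∪ A := by simp [hx, hA]
      rw [surv_succ w h1, wop_add_const hw, wop_add]
      have := hg x hx hA
      push_cast; linarith

lemma mul_surv_le (hw : IsNet w) (B : Set V) (u : V → ℝ) (hu : ∀ x, 0 ≤ u x)
    (hdrift : ∀ x, x ∉ B → wop w u x ≤ u x - 1) (t : ℕ) (x : V) :
    t * surv w B t x ≤ u x := by
  have key : ∀ t x, ∑ s ∈ range t, surv w B s x ≤ u x := by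
    intro t
    induction t with
    | zero => intro x; simpa using hu x
    | succ t ih =>
      intro x
      by_cases hx : x ∈ B
      · simpa [surv_of_mem w hx] using hu x
      · have h1 : ∀ t x, x ∉ B → ∑ s ∈ range (t + 1), surv w B s x
            = 1 + wop w (fun y => ∑ s ∈ range t, surv w B s y) x := by
          intro t x hx
          induction t with
          | zero => simp [surv_zero w hx, wop_const hw]
          | succ t ih =>
            rw [sum_range_succ, ih, surv_succ w hx, add_assoc, ← wop_add]
            simp only [sum_range_succ]
        rw [h1 t x hx]
        have := wop_mono hw ih x
        linarith [hdrift x hx]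
  refine le_trans ?_ (key t x)
  calc (t : ℝ) * surv w B t x = ∑ _s ∈ range t, surv w B t x := by simp
    _ ≤ ∑ s ∈ range t, surv w B s x :=
      sum_le_sum fun s hs => surv_antitone hw B x (mem_range.mp hs).le

/-- lower comparison principle for the iterates of the transition operator -/
lemma sub_le_iterate (hw : IsNet w) (f : V → ℝ) (hf : ∀ x, 0 ≤ f x) (F : ℕ → V → ℝ)
    (h0 : ∀ x, F 0 x ≤ f x)
    (h2 : ∀ t x, F (t + 1) x ≤ wop w (F t) x ∨ F (t + 1) x ≤ 0) (t : ℕ) (x : V) :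
    F t x ≤ (wop w)^[t] f x := by
  have hnn : ∀ t x, 0 ≤ (wop w)^[t] f x := by
    intro t
    induction t with
    | zero => simpa using hf
    | succ t ih =>
      intro x
      rw [Function.iterate_succ_apply']
      exact (wop_const hw 0 x).symm.trans_le (wop_mono hw ih x)
  induction t generalizing x with
  | zero => simpa using h0 x
  | succ t ih =>
    rcases h2 t x with h | h
    · rw [Function.iterate_succ_apply']; exact h.trans (wop_mono hw ih x)
    · exact h.trans (hnn _ _)

lemma iterate_mono_bounds (hw : IsNet w) (f : V → ℝ) (b : ℝ) (hf : ∀ x, f x ≤ b) (t : ℕ) (x : V) :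
    (wop w)^[t] f x ≤ b := by
  induction t generalizing x with
  | zero => simpa using hf x
  | succ t ih =>
    rw [Function.iterate_succ_apply']
    exact (wop_mono hw ih x).trans_eq (wop_const hw b x)

/-- exponential `L²` decay of survival probabilities from a Dirichlet Poincaré inequality -/
lemma surv_sq_le (hw : IsNet w) (Z : Set V) {Λ : ℝ} (hΛ : 1 ≤ Λ)
    (hP : ∀ f : V → ℝ, (∀ x ∈ Z, f x = 0) → ∑ x, wdeg w x * f x ^ 2 ≤ Λ * energy w f)
    (t : ℕ) (y : V) :
    wdeg w y * surv w Z t y ^ 2 ≤ (1 - 1 / (4 * Λ)) ^ t * ∑ x, wdeg w x := by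
  have hq : 0 ≤ 1 - 1 / (4 * Λ) := by
    rw [sub_nonneg, div_le_one (by positivity)]; linarith
  have key : ∑ x, wdeg w x * surv w Z t x ^ 2 ≤ (1 - 1 / (4 * Λ)) ^ t * ∑ x, wdeg w x := by
    induction t with
    | zero =>
      rw [pow_zero, one_mul]
      refine sum_le_sum fun x _ => ?_
      have h0 := surv_nonneg hw Z 0 x
      have h1 := surv_le_one hw Z 0 x
      have : surv w Z 0 x ^ 2 ≤ 1 := pow_le_one₀ h0 h1
      nlinarith [hw.pos x]
    | succ t ih =>
      have h1 : ∑ x, wdeg w x * surv w Z (t + 1) x ^ 2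
          ≤ ∑ x, wdeg w x * wop w (surv w Z t) x ^ 2 := by
        refine sum_le_sum fun x _ => ?_
        by_cases hx : x ∈ Z
        · rw [surv_of_mem w hx]
          have := (hw.pos x).le
          simp only [ne_eq, OfNat.ofNat_ne_zero, not_false_eq_true, zero_pow, mul_zero]
          positivity
        · rw [surv_succ w hx]
      have h2 := sum_wop_sq_le hw (surv w Z t)
      have h3 := hP (surv w Z t) (fun x hx => surv_of_mem w hx t)
      have h4 : 1 / (4 * Λ) * ∑ x, wdeg w x * surv w Z t x ^ 2 ≤ energy w (surv w Z t) / 4 := by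
        rw [div_mul_eq_mul_div, div_le_iff₀ (by positivity)]
        linarith
      calc _ ≤ (1 - 1 / (4 * Λ)) * ∑ x, wdeg w x * surv w Z t x ^ 2 := by linarith
        _ ≤ (1 - 1 / (4 * Λ)) * ((1 - 1 / (4 * Λ)) ^ t * ∑ x, wdeg w x) :=
          mul_le_mul_of_nonneg_left ih hq
        _ = _ := by ring
  refine le_trans ?_ key
  exact single_le_sum (f := fun x => wdeg w x * surv w Z t x ^ 2)
    (fun x _ => mul_nonneg (hw.pos x).le (sq_nonneg _)) (mem_univ y)

/-- Barta-type bound: a positive function with negative drift controls the energy -/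
lemma sum_sq_mul_drift_le (hw : IsNet w) (φ : V → ℝ) (hφ : ∀ x, 0 < φ x) (g : V → ℝ) :
    ∑ x, g x ^ 2 * (-wlap w φ x / φ x) ≤ energy w g / 2 := by
  have e1 : ∀ x, g x ^ 2 * (-wlap w φ x / φ x) = ∑ u, w x u * (g x ^ 2 / φ x * (φ x - φ u)) := by
    intro x
    rw [wlap, ← sum_neg_distrib, sum_div, mul_sum]
    exact sum_congr rfl fun _ _ => by ring
  have e2 : ∑ x, ∑ u, w x u * (g x ^ 2 / φ x * (φ x - φ u))
      = ∑ x, ∑ u, w x u * (g u ^ 2 / φ u * (φ u - φ x)) := by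
    rw [sum_comm]
    exact sum_congr rfl fun _ _ => sum_congr rfl fun _ _ => by rw [hw.symm]
  have e3 : 2 * ∑ x, g x ^ 2 * (-wlap w φ x / φ x) ≤ energy w g := by
    simp only [e1]
    rw [two_mul]
    nth_rw 2 [e2]
    rw [← sum_add_distrib, energy]
    refine sum_le_sum fun x _ => ?_
    rw [← sum_add_distrib]
    refine sum_le_sum fun u _ => ?_
    rw [← mul_add]
    refine mul_le_mul_of_nonneg_left ?_ (hw.nonneg _ _)
    have h1 := hφ x
    have h2 := hφ u
    have : (g x - g u) ^ 2 - (g x ^ 2 / φ x * (φ x - φ u) + g u ^ 2 / φ u * (φ u - φ x))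
        = (g x * φ u - g u * φ x) ^ 2 / (φ x * φ u) := by
      field_simp
      ring
    have h3 : 0 ≤ (g x * φ u - g u * φ x) ^ 2 / (φ x * φ u) := by positivity
    linarith
  linarith

end

section

variable {w : V → V → ℝ}

/-! ### Total variation distance and mixing times -/

lemma wMat_pow_sum (hw : IsNet w) (t : ℕ) (x : V) : ∑ y, (wMat w ^ t) x y = 1 := by
  have h := wop_iterate w t (fun _ => 1) x
  have h2 : (wop w)^[t] (fun _ => (1 : ℝ)) = fun _ => 1 := by
    induction t with
    | zero => rfl
    | succ t ih =>
      rw [Function.iterate_succ_apply', ih (wop_iterate w t _ x)]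
      exact funext fun x => wop_const hw 1 x
  rw [h2] at h
  simpa [Matrix.mulVec, dotProduct] using h.symm

lemma wSta_sum [Nonempty V] (hw : IsNet w) : ∑ y, wSta w y = 1 := by
  have : ∑ y, wSta w y = (∑ y, wdeg w y) / ∑ y, wdeg w y := by
    rw [sum_div]; rfl
  rw [this, div_self hw.sum_pos.ne']

lemma tvDist_eq_max (μ ν : V → ℝ) (h : ∑ x, μ x = ∑ x, ν x) :
    tvDist μ ν = ∑ x, if ν x < μ x then μ x - ν x else 0 := by
  have h1 : ∀ x, |μ x - ν x| = 2 * (if ν x < μ x then μ x - ν x else 0) - (μ x - ν x) := by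
    intro x
    split_ifs with h
    · rw [abs_of_pos (by linarith)]; ring
    · rw [abs_of_nonpos (by linarith)]; ring
  rw [tvDist]
  simp only [h1]
  rw [sum_sub_distrib, ← mul_sum, sum_sub_distrib, h]
  ring

lemma sub_le_tvDist (μ ν : V → ℝ) (h : ∑ x, μ x = ∑ x, ν x) (f : V → ℝ)
    (h0 : ∀ x, 0 ≤ f x) (h1 : ∀ x, f x ≤ 1) :
    ∑ x, μ x * f x - ∑ x, ν x * f x ≤ tvDist μ ν := by
  rw [tvDist_eq_max μ ν h, ← sum_sub_distrib]
  refine sum_le_sum fun x _ => ?_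
  split_ifs with hx
  · nlinarith [h0 x, h1 x]
  · nlinarith [h0 x, h1 x]

lemma tvDist_le_dTV (P : Matrix V V ℝ) (π : V → ℝ) (t : ℕ) (x : V) :
    tvDist ((P ^ t) x) π ≤ dTV P π t :=
  le_ciSup (f := fun x => tvDist ((P ^ t) x) π) (Set.finite_range _).bddAbove x

lemma iterate_sub_le_dTV [Nonempty V] (hw : IsNet w) (f : V → ℝ)
    (h0 : ∀ x, 0 ≤ f x) (h1 : ∀ x, f x ≤ 1) (t : ℕ) (x : V) :
    (wop w)^[t] f x - ∑ y, wSta w y * f y ≤ dTV (wMat w) (wSta w) t := by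
  refine le_trans ?_ (tvDist_le_dTV _ _ t x)
  have := sub_le_tvDist ((wMat w ^ t) x) (wSta w)
    (by rw [wMat_pow_sum hw, wSta_sum hw]) f h0 h1
  rwa [wop_iterate]

lemma dTV_le_of_hit [Nonempty V] (hw : IsNet w) {Λ ε κ η : ℝ} (hΛ : 1 ≤ Λ) (hP : Poinc w Λ)
    (hε : 0 < ε) (t t1 : ℕ)
    (hit : ∀ Q : Set V, (∑ x, Qᶜ.indicator (wdeg w) x ≤ η * ∑ x, wdeg w x) →
      ∀ x, surv w Q t x ≤ κ)
    (hη : 4 * Λ * (1 - 1 / (4 * Λ)) ^ t1 ≤ ε ^ 2 * η) :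
    dTV (wMat w) (wSta w) (t + t1) ≤ ε + κ := by
  classical
  refine ciSup_le fun x => ?_
  set μ := (wMat w ^ (t + t1)) x with hμ
  have hS := hw.sum_pos
  set f : V → ℝ := fun y => if wSta w y < μ y then 1 else 0 with hf
  set p := ∑ y, wSta w y * f y with hp
  have hst : ∀ y, 0 ≤ wSta w y := fun y => div_nonneg (hw.pos y).le hS.le
  have hf0 : ∀ y, 0 ≤ f y := fun y => by simp only [hf]; split_ifs <;> norm_num
  have hf1 : ∀ y, f y ≤ 1 := fun y => by simp only [hf]; split_ifs <;> norm_num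
  have hp0 : 0 ≤ p := sum_nonneg fun y _ => mul_nonneg (hst y) (hf0 y)
  have hp1 : p ≤ 1 := by
    rw [← wSta_sum hw]
    exact sum_le_sum fun y _ => mul_le_of_le_one_right (hst y) (hf1 y)
  set g : V → ℝ := fun y => f y - p with hg
  have hq : 0 ≤ 1 - 1 / (4 * Λ) := by
    rw [sub_nonneg, div_le_one (by positivity)]; linarith
  have hmean : ∑ y, wdeg w y * g y = 0 := by
    have h1 : ∑ y, wdeg w y * f y = p * ∑ y, wdeg w y := by
      rw [hp, sum_mul]
      refine sum_congr rfl fun y _ => ?_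
      have : wSta w y = wdeg w y / ∑ z, wdeg w z := rfl
      rw [this]; field_simp
    simp only [hg, mul_sub, sum_sub_distrib, h1, ← sum_mul]; ring
  have hgsq : ∑ y, wdeg w y * g y ^ 2 ≤ ∑ y, wdeg w y := by
    refine sum_le_sum fun y _ => mul_le_of_le_one_right (hw.pos y).le ?_
    have h1 : |g y| ≤ 1 := abs_le.mpr ⟨by simp only [hg]; linarith [hf0 y], by
      simp only [hg]; linarith [hf1 y]⟩
    rw [← sq_abs]; exact pow_le_one₀ (abs_nonneg _) h1
  have hit' : ∀ s y, (wop w)^[s] g y ≤ 1 := fun s y =>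
    iterate_mono_bounds hw g 1 (fun y => by simp only [hg]; linarith [hf1 y]) s y
  set Q : Set V := {y | ∀ s ≤ t, (wop w)^[s + t1] g y ≤ ε} with hQ
  have hQc : ∑ y, Qᶜ.indicator (wdeg w) y ≤ η * ∑ y, wdeg w y := by
    have h1 : ∀ y, ε ^ 2 * Qᶜ.indicator (wdeg w) y
        ≤ ∑ s ∈ range (t + 1), wdeg w y * (wop w)^[s + t1] g y ^ 2 := by
      intro y
      by_cases hy : y ∈ Q
      · rw [Set.indicator_of_notMem (by simpa using hy), mul_zero]
        exact sum_nonneg fun s _ => mul_nonneg (hw.pos y).le (sq_nonneg _)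
      · rw [Set.indicator_of_mem (by simpa using hy)]
        simp only [hQ, Set.mem_ofPred_eq, not_forall, not_le] at hy
        obtain ⟨s, hs, hsε⟩ := hy
        refine le_trans ?_ (single_le_sum
          (f := fun s => wdeg w y * (wop w)^[s + t1] g y ^ 2)
          (fun s _ => mul_nonneg (hw.pos y).le (sq_nonneg _)) (mem_range.mpr (by omega : s < t + 1)))
        rw [mul_comm]
        exact mul_le_mul_of_nonneg_left (pow_le_pow_left₀ hε.le hsε.le 2) (hw.pos y).le
    have h2 : ε ^ 2 * ∑ y, Qᶜ.indicator (wdeg w) y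
        ≤ ∑ s ∈ range (t + 1), (1 - 1 / (4 * Λ)) ^ (s + t1) * ∑ y, wdeg w y := by
      rw [mul_sum]
      refine (sum_le_sum fun y _ => h1 y).trans ?_
      rw [sum_comm]
      refine sum_le_sum fun s _ => ?_
      refine (hP.contract_iterate hw hΛ g hmean (s + t1)).2.trans ?_
      exact mul_le_mul_of_nonneg_left hgsq (pow_nonneg hq _)
    have h3 : ∑ s ∈ range (t + 1), (1 - 1 / (4 * Λ)) ^ (s + t1)
        ≤ 4 * Λ * (1 - 1 / (4 * Λ)) ^ t1 := by
      simp only [pow_add, ← sum_mul]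
      refine mul_le_mul_of_nonneg_right ?_ (pow_nonneg hq _)
      have := geom_sum_mul_neg (1 - 1 / (4 * Λ)) (t + 1)
      have h5 : 0 ≤ (1 - 1 / (4 * Λ)) ^ (t + 1) := pow_nonneg hq _
      have h4 : (∑ i ∈ range (t + 1), (1 - 1 / (4 * Λ)) ^ i) * (1 / (4 * Λ)) ≤ 1 := by
        rw [sub_sub_cancel] at this; linarith
      rwa [mul_one_div, div_le_one (by positivity)] at h4
    rw [← sum_mul] at h2
    have h6 : ε ^ 2 * ∑ y, Qᶜ.indicator (wdeg w) y ≤ ε ^ 2 * (η * ∑ y, wdeg w y) := by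
      refine h2.trans ?_
      rw [← mul_assoc]
      exact mul_le_mul_of_nonneg_right (h3.trans hη) hS.le
    exact le_of_mul_le_mul_left h6 (by positivity)
  have hsv := hit Q hQc x
  have key : ∀ s ≤ t, ∀ y, (wop w)^[s + t1] g y ≤ ε + surv w Q s y := by
    intro s
    induction s with
    | zero =>
      intro _ y
      by_cases hy : y ∈ Q
      · rw [surv_of_mem w hy, add_zero]; exact hy 0 (Nat.zero_le _)
      · rw [surv_zero w hy]; linarith [hit' (0 + t1) y]
    | succ s ih =>
      intro hs y
      by_cases hy : y ∈ Q
      · rw [surv_of_mem w hy, add_zero]; exact hy _ hs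
      · rw [surv_succ w hy, show s + 1 + t1 = (s + t1) + 1 by ring,
          Function.iterate_succ_apply', add_comm ε, ← wop_add_const hw]
        refine wop_mono hw (fun z => ?_) y
        have := ih (by omega) z
        linarith
  have hfin : tvDist μ (wSta w) = (wop w)^[t + t1] g x := by
    rw [tvDist_eq_max _ _ (by rw [hμ, wMat_pow_sum hw, wSta_sum hw]), wop_iterate]
    have h1 : ((wMat w ^ (t + t1)).mulVec g) x = ∑ y, μ y * f y - p := by
      simp only [Matrix.mulVec, dotProduct, hg, mul_sub, sum_sub_distrib, ← sum_mul, ← hμ]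
      rw [hμ, wMat_pow_sum hw, one_mul]
    rw [h1, hp, ← sum_sub_distrib]
    refine sum_congr rfl fun y _ => ?_
    simp only [hf]
    split_ifs <;> ring
  rw [hfin]
  linarith [key t le_rfl x]

lemma exists_dTV_le [Nonempty V] (hw : IsNet w) {Λ ε : ℝ} (hΛ : 1 ≤ Λ) (hP : Poinc w Λ)
    (hε : 0 < ε) : ∃ t, dTV (wMat w) (wSta w) t ≤ ε := by
  obtain ⟨x0, -, hx0⟩ := exists_min_image univ (wdeg w) univ_nonempty
  have hS := hw.sum_pos
  set η := wdeg w x0 / (2 * ∑ x, wdeg w x) with hη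
  have hηpos : 0 < η := div_pos (hw.pos x0) (by positivity)
  have hq1 : 1 - 1 / (4 * Λ) < 1 := by
    have : 0 < 1 / (4 * Λ) := by positivity
    linarith
  have hq : 0 ≤ 1 - 1 / (4 * Λ) := by
    rw [sub_nonneg, div_le_one (by positivity)]; linarith
  obtain ⟨t1, ht1⟩ := exists_pow_lt_of_lt_one
    (show 0 < ε ^ 2 * η / (4 * Λ) by positivity) hq1
  refine ⟨0 + t1, ?_⟩
  have := dTV_le_of_hit hw hΛ hP hε 0 t1 (η := η) (κ := 0) ?_ ?_
  · simpa using this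
  · intro Q hQ x
    have hx : x ∈ Q := by
      by_contra hx
      have h1 : wdeg w x ≤ ∑ x, Qᶜ.indicator (wdeg w) x := by
        have := single_le_sum (f := Qᶜ.indicator (wdeg w))
          (fun y _ => Set.indicator_nonneg (fun y _ => (hw.pos y).le) y) (mem_univ x)
        rwa [Set.indicator_of_mem (show x ∈ Qᶜ from hx)] at this
      have h2 : η * ∑ x, wdeg w x = wdeg w x0 / 2 := by rw [hη]; field_simp
      linarith [hx0 x (mem_univ x), hw.pos x0]
    rw [surv_of_mem w hx]
  · rw [lt_div_iff₀ (by positivity)] at ht1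
    linarith

lemma mixTime_le {P : Matrix V V ℝ} {π : V → ℝ} {ε : ℝ} {t : ℕ} (h : dTV P π t ≤ ε) :
    mixTime P π ε ≤ t := Nat.sInf_le h

lemma le_tmixW [Nonempty V] (hw : IsNet w) {Λ ε : ℝ} (hΛ : 1 ≤ Λ) (hP : Poinc w Λ)
    (hε : 0 < ε) {s : ℕ} (h : ∀ t < s, ε < dTV (wMat w) (wSta w) t) : s ≤ tmixW w ε := by
  have hmem : dTV (wMat w) (wSta w) (tmixW w ε) ≤ ε :=
    Nat.sInf_mem (s := {t | dTV (wMat w) (wSta w) t ≤ ε}) (exists_dTV_le hw hΛ hP hε)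
  by_contra hlt
  exact absurd hmem (not_le.mpr (h _ (not_le.mp hlt)))

lemma tmixW_anti [Nonempty V] (hw : IsNet w) {Λ ε ε' : ℝ} (hΛ : 1 ≤ Λ) (hP : Poinc w Λ)
    (hε : 0 < ε) (h : ε ≤ ε') : tmixW w ε' ≤ tmixW w ε := by
  have hmem : dTV (wMat w) (wSta w) (tmixW w ε) ≤ ε :=
    Nat.sInf_mem (s := {t | dTV (wMat w) (wSta w) t ≤ ε}) (exists_dTV_le hw hΛ hP hε)
  exact mixTime_le (hmem.trans h)

end

section

variable {w : V → V → ℝ}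

lemma wop_exp_le (hw : IsNet w) (φ : V → ℝ) {θ β m : ℝ} (x : V) (hθ : 0 ≤ θ) (hβ : θ * β ≤ 1)
    (hinc : ∀ u, w x u ≠ 0 → |φ u - φ x| ≤ β) (hdrift : wop w φ x ≤ φ x + m) :
    wop w (fun y => Real.exp (θ * φ y)) x
      ≤ Real.exp (θ * m + θ ^ 2 * β ^ 2) * Real.exp (θ * φ x) := by
  have hc := hw.pos x
  have hd : wlap w φ x ≤ 2 * wdeg w x * m := by
    rw [wop_eq hw] at hdrift
    have : wlap w φ x / (2 * wdeg w x) ≤ m := by linarith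
    rw [div_le_iff₀ (by positivity)] at this
    linarith
  have h1 : wlap w (fun y => Real.exp (θ * φ y)) x
      ≤ Real.exp (θ * φ x) * (θ * wlap w φ x + θ ^ 2 * β ^ 2 * wdeg w x) := by
    rw [wlap, wlap, wdeg, mul_sum, mul_sum, ← sum_add_distrib, mul_sum]
    refine sum_le_sum fun u _ => ?_
    by_cases h0 : w x u = 0
    · simp [h0]
    have hb := hinc u h0
    have hab : |θ * (φ u - φ x)| ≤ 1 := by
      rw [abs_mul, abs_of_nonneg hθ]
      exact (mul_le_mul_of_nonneg_left hb hθ).trans hβ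
    have h2 := (abs_le.mp (Real.abs_exp_sub_one_sub_id_le hab)).2
    have h3 : (φ u - φ x) ^ 2 ≤ β ^ 2 := sq_le_sq' (by linarith [(abs_le.mp hb).1]) (abs_le.mp hb).2
    have h4 : Real.exp (θ * φ u) = Real.exp (θ * φ x) * Real.exp (θ * (φ u - φ x)) := by
      rw [← Real.exp_add]; congr 1; ring
    have h5 : Real.exp (θ * (φ u - φ x)) - 1 ≤ θ * (φ u - φ x) + θ ^ 2 * β ^ 2 := by nlinarith
    rw [h4]
    have := mul_le_mul_of_nonneg_left h5
      (mul_nonneg (hw.nonneg x u) (Real.exp_pos (θ * φ x)).le)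
    linarith
  have h2 : wop w (fun y => Real.exp (θ * φ y)) x
      ≤ Real.exp (θ * φ x) * (1 + (θ * m + θ ^ 2 * β ^ 2)) := by
    rw [wop_eq hw]
    have h3 : wlap w (fun y => Real.exp (θ * φ y)) x / (2 * wdeg w x)
        ≤ Real.exp (θ * φ x) * (θ * m + θ ^ 2 * β ^ 2) := by
      rw [div_le_iff₀ (by positivity)]
      refine h1.trans ?_
      rw [mul_assoc (Real.exp _)]
      refine mul_le_mul_of_nonneg_left ?_ (Real.exp_pos _).le
      have := mul_le_mul_of_nonneg_left hd hθ
      nlinarith [mul_nonneg (sq_nonneg (θ * β)) hc.le]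
    linarith
  refine h2.trans ?_
  rw [mul_comm]
  refine mul_le_mul_of_nonneg_right ?_ (Real.exp_pos _).le
  linarith [Real.add_one_le_exp (θ * m + θ ^ 2 * β ^ 2)]

open Classical in
/-- unit edge weights -/
def unitW (G : SimpleGraph V) (u v : V) : ℝ := if G.Adj u v then 1 else 0

lemma wdeg_unitW (G : SimpleGraph V) (v : V) : wdeg (unitW G) v = deg G v := by
  classical
  rw [wdeg, deg, Nat.card_eq_fintype_card, Fintype.card_subtype]
  simp [unitW]

lemma wMat_unitW (G : SimpleGraph V) : wMat (unitW G) = walkMat G := by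
  ext v u
  have := wdeg_unitW G v
  rw [wdeg] at this
  simp only [wMat, walkMat, Matrix.of_apply, this]
  split_ifs with h1 h2 <;> simp [unitW, *]

lemma wSta_unitW (G : SimpleGraph V) : wSta (unitW G) = degSta G := by
  ext v
  have h := wdeg_unitW G
  simp only [wdeg] at h
  simp only [wSta, degSta, h]

lemma tmixW_unitW (G : SimpleGraph V) (ε : ℝ) : tmixW (unitW G) ε = tmixG G ε := by
  rw [tmixW, tmixG, wMat_unitW, wSta_unitW]

end

section

/-! ### Random functions: expansion and few short cycles -/

lemma card_constrained {d M : ℕ} (T : Fin d × Fin M → Finset (Fin M)) :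
    (#{f : Fin d × Fin M → Fin M | ∀ p, f p ∈ T p} : ℝ) = ∏ p, (#(T p) : ℝ) := by
  have : ({f : Fin d × Fin M → Fin M | ∀ p, f p ∈ T p} : Finset _) = Fintype.piFinset T := by
    ext f; simp [Fintype.mem_piFinset]
  rw [this, Fintype.card_piFinset, Nat.cast_prod]

lemma choose_le_three_pow (M t : ℕ) (ht : 0 < t) :
    (M.choose t : ℝ) ≤ (3 * M / t) ^ t := by
  have h1 : (M.choose t : ℝ) ≤ (M ^ t : ℝ) / (t.factorial : ℝ) := Nat.choose_le_pow_div t M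
  have h2 : (t : ℝ) ^ t / (t.factorial : ℝ) ≤ Real.exp t :=
    Real.pow_div_factorial_le_exp (t : ℝ) (by positivity) t
  have h3 : Real.exp t ≤ 3 ^ t := by
    rw [show (t : ℝ) = t * 1 by ring, Real.exp_nat_mul]
    exact pow_le_pow_left₀ (Real.exp_pos _).le Real.exp_one_lt_three.le t
  have ht' : (0 : ℝ) < t := by exact_mod_cast ht
  have hf : (0 : ℝ) < (t.factorial : ℝ) := by exact_mod_cast t.factorial_pos
  refine h1.trans ?_
  rw [div_pow, div_le_div_iff₀ hf (by positivity), mul_pow]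
  have h4 : (t : ℝ) ^ t ≤ 3 ^ t * (t.factorial : ℝ) := by
    rw [div_le_iff₀ hf] at h2
    exact h2.trans (mul_le_mul_of_nonneg_right h3 hf.le)
  calc (M : ℝ) ^ t * t ^ t ≤ (M : ℝ) ^ t * (3 ^ t * (t.factorial : ℝ)) :=
        mul_le_mul_of_nonneg_left h4 (by positivity)
    _ = _ := by ring

/-- the set `S` is mapped into `T` by all the functions, where `T ⊇ S` is barely larger -/
def BadPair (d M : ℕ) (S T : Finset (Fin M)) (f : Fin d × Fin M → Fin M) : Prop :=
  S ⊆ T ∧ T.Nonempty ∧ 4 * #T ≤ 5 * #S ∧ 6 * #T ≤ 5 * M ∧ ∀ p : Fin d × Fin M, p.2 ∈ S → f p ∈ T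

open Classical in
lemma card_badPair_le {M : ℕ} (hM : 0 < M) (S T : Finset (Fin M)) :
    (#{f | BadPair 30 M S T f} : ℝ)
      ≤ (if T.Nonempty ∧ 6 * #T ≤ 5 * M then ((#T : ℝ) / M) ^ (24 * #T) else 0)
        * (M : ℝ) ^ (30 * M) := by
  by_cases h : S ⊆ T ∧ T.Nonempty ∧ 4 * #T ≤ 5 * #S ∧ 6 * #T ≤ 5 * M
  · obtain ⟨hST, hne, h45, h65⟩ := h
    rw [if_pos ⟨hne, h65⟩]
    have hM' : (0 : ℝ) < M := by exact_mod_cast hM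
    have h1 : (#{f | BadPair 30 M S T f} : ℝ)
        ≤ (#{f : Fin 30 × Fin M → Fin M | ∀ p, f p ∈ (if p.2 ∈ S then T else univ)} : ℝ) := by
      norm_cast
      refine card_le_card fun f hf => ?_
      simp only [mem_filter, mem_univ, true_and] at hf ⊢
      intro p
      split_ifs with hp
      · exact hf.2.2.2.2 p hp
      · exact mem_univ _
    refine h1.trans ?_
    rw [card_constrained]
    have h2 : ∀ p : Fin 30 × Fin M, (#(if p.2 ∈ S then T else univ) : ℝ)
        = (if p.2 ∈ S then (#T : ℝ) / M else 1) * M := by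
      intro p
      split_ifs
      · field_simp
      · simp
    simp only [h2]
    rw [prod_mul_distrib]
    have h3 : ∏ p : Fin 30 × Fin M, (if p.2 ∈ S then (#T : ℝ) / M else 1)
        = ((#T : ℝ) / M) ^ (30 * #S) := by
      rw [Fintype.prod_prod_type]
      have : ∏ x : Fin M, (if x ∈ S then (#T : ℝ) / M else 1) = ((#T : ℝ) / M) ^ #S := by
        rw [prod_ite, prod_const, prod_const_one, mul_one]
        simp
      simp only [this]
      rw [prod_const, ← pow_mul, mul_comm]
      simp
    rw [h3]
    have hq1 : (#T : ℝ) / M ≤ 1 := by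
      rw [div_le_one hM']
      have : #T ≤ Fintype.card (Fin M) := card_le_univ T
      rw [Fintype.card_fin] at this
      exact_mod_cast this
    have h4 : ∏ _p : Fin 30 × Fin M, (M : ℝ) = (M : ℝ) ^ (30 * M) := by simp
    rw [h4]
    exact mul_le_mul_of_nonneg_right
      (pow_le_pow_of_le_one (by positivity) hq1 (by omega)) (by positivity)
  · have : ({f | BadPair 30 M S T f} : Finset _) = ∅ := by
      refine filter_eq_empty_iff.mpr fun f _ hf => h ⟨hf.1, hf.2.1, hf.2.2.1, hf.2.2.2.1⟩
    rw [this]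
    simp only [card_empty, Nat.cast_zero]
    split_ifs <;> positivity

/-- some set is barely enlarged by the functions -/
def NonExpanding (d M : ℕ) (f : Fin d × Fin M → Fin M) : Prop :=
  ∃ T S : Finset (Fin M), BadPair d M S T f

open Classical in
lemma card_nonexpanding_le {M : ℕ} (hM : 0 < M) :
    (#{f | NonExpanding 30 M f} : ℝ) ≤ (1 / 9) * (M : ℝ) ^ (30 * M) := by
  have hM' : (0 : ℝ) < M := by exact_mod_cast hM
  have h1 : (#{f | NonExpanding 30 M f} : ℝ)
      ≤ ∑ T : Finset (Fin M), ∑ S ∈ T.powerset, (#{f | BadPair 30 M S T f} : ℝ) := by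
    have : ({f | NonExpanding 30 M f} : Finset _)
        ⊆ univ.biUnion fun T : Finset (Fin M) => T.powerset.biUnion fun S =>
          ({f | BadPair 30 M S T f} : Finset _) := by
      intro f hf
      simp only [mem_filter, mem_univ, true_and, mem_biUnion, mem_powerset] at hf ⊢
      obtain ⟨T, S, h⟩ := hf
      exact ⟨T, S, h.1, h⟩
    have h2 := (card_le_card this).trans (card_biUnion_le.trans
      (sum_le_sum fun T _ => card_biUnion_le))
    exact_mod_cast h2
  refine h1.trans ?_
  set G : ℕ → ℝ := fun t => 2 ^ t * (if 0 < t ∧ 6 * t ≤ 5 * M then ((t : ℝ) / M) ^ (24 * t) else 0)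
    with hG
  have h2 : ∀ T : Finset (Fin M), ∑ S ∈ T.powerset, (#{f | BadPair 30 M S T f} : ℝ)
      ≤ G #T * (M : ℝ) ^ (30 * M) := by
    intro T
    refine (sum_le_sum fun S _ => card_badPair_le hM S T).trans ?_
    rw [sum_const, card_powerset, nsmul_eq_mul, hG]
    simp only [card_pos]
    push_cast
    exact le_of_eq (by ring)
  refine (sum_le_sum fun T _ => h2 T).trans ?_
  rw [← sum_mul]
  refine mul_le_mul_of_nonneg_right ?_ (by positivity)
  have h3 : ∑ T : Finset (Fin M), G #T = ∑ t ∈ range (M + 1), M.choose t • G t := by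
    rw [← powerset_univ, sum_powerset_apply_card]; simp
  rw [h3]
  have h4 : ∀ t ∈ range (M + 1), M.choose t • G t ≤ if t = 0 then 0 else (1 / 10 : ℝ) ^ t := by
    intro t _
    by_cases ht : t = 0
    · simp [ht, hG]
    rw [if_neg ht, hG]
    simp only
    split_ifs with hc
    · have ht' : (0 : ℝ) < t := by exact_mod_cast hc.1
      rw [nsmul_eq_mul]
      have h5 := choose_le_three_pow M t hc.1
      have h6 : (t : ℝ) / M ≤ 5 / 6 := by
        rw [div_le_div_iff₀ hM' (by norm_num)]
        have := hc.2
        have : (6 * t : ℝ) ≤ 5 * M := by exact_mod_cast this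
        linarith
      calc (M.choose t : ℝ) * (2 ^ t * ((t : ℝ) / M) ^ (24 * t))
          ≤ (3 * M / t) ^ t * (2 ^ t * ((t : ℝ) / M) ^ (24 * t)) :=
            mul_le_mul_of_nonneg_right h5 (by positivity)
        _ = (6 * ((t : ℝ) / M) ^ 23) ^ t := by
            rw [pow_mul, ← mul_pow, ← mul_pow]
            congr 1
            field_simp
            norm_num
        _ ≤ (1 / 10 : ℝ) ^ t := by
            refine pow_le_pow_left₀ (by positivity) ?_ t
            calc 6 * ((t : ℝ) / M) ^ 23 ≤ 6 * (5 / 6) ^ 23 :=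
                  mul_le_mul_of_nonneg_left (pow_le_pow_left₀ (by positivity) h6 23) (by norm_num)
              _ ≤ 1 / 10 := by norm_num
    · simp
  refine (sum_le_sum h4).trans ?_
  rw [sum_range_succ', if_pos rfl, add_zero]
  have h5 : ∀ t ∈ range M, (if t + 1 = 0 then (0 : ℝ) else (1 / 10 : ℝ) ^ (t + 1))
      = (1 / 10) * (1 / 10) ^ t := by
    intro t _
    rw [if_neg (by omega), pow_succ']
  rw [sum_congr rfl h5, ← mul_sum]
  have h6 := geom_sum_mul_neg (1 / 10 : ℝ) M
  have : (0 : ℝ) ≤ (1 / 10) ^ M := by positivity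
  linarith

/-- codes for closed walks of length `k + 1` -/
abbrev CycCode (d M k : ℕ) : Type := (Fin (k + 1) → Fin M) × (Fin (k + 1) → Fin d × Bool)

/-- the coordinate read by the `j`-th step of a code -/
def codeCoord {d M k : ℕ} (c : CycCode d M k) (j : Fin (k + 1)) : Fin d × Fin M :=
  ((c.2 j).1, if (c.2 j).2 then c.1 j else c.1 (j + 1))

/-- the value that the `j`-th step of a code prescribes -/
def codeVal {d M k : ℕ} (c : CycCode d M k) (j : Fin (k + 1)) : Fin M :=
  if (c.2 j).2 then c.1 (j + 1) else c.1 j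

/-- the code is realised by `f` with distinct coordinates -/
def Realises {d M k : ℕ} (f : Fin d × Fin M → Fin M) (c : CycCode d M k) : Prop :=
  Function.Injective (codeCoord c) ∧ ∀ j, f (codeCoord c j) = codeVal c j

open Classical in
lemma card_realises_le {d M k : ℕ} (hM : 0 < M) (c : CycCode d M k) :
    (#{f | Realises f c} : ℝ) * (M : ℝ) ^ (k + 1) ≤ (M : ℝ) ^ (d * M) := by
  have hM' : (0 : ℝ) < M := by exact_mod_cast hM
  by_cases hc : Function.Injective (codeCoord c)
  · have h1 : (#{f | Realises f c} : ℝ) ≤ (#{f : Fin d × Fin M → Fin M | ∀ p, f p ∈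
        (if p ∈ univ.image (codeCoord c) then
          univ.filter (fun v : Fin M => ∃ j, codeCoord c j = p ∧ codeVal c j = v)
          else univ)} : ℝ) := by
      norm_cast
      refine card_le_card fun f hf => ?_
      simp only [mem_filter, mem_univ, true_and] at hf ⊢
      intro p
      split_ifs with hp
      · obtain ⟨j, -, rfl⟩ := mem_image.mp hp
        simp only [mem_filter, mem_univ, true_and]
        exact ⟨j, rfl, (hf.2 j).symm⟩
      · exact mem_univ _
    rw [card_constrained] at h1
    have h2 : ∏ p : Fin d × Fin M, ((#(if p ∈ univ.image (codeCoord c) then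
        univ.filter (fun v : Fin M => ∃ j, codeCoord c j = p ∧ codeVal c j = v) else univ) : ℕ) : ℝ)
        ≤ ∏ p : Fin d × Fin M, (if p ∈ univ.image (codeCoord c) then (1 / M : ℝ) else 1) * M := by
      refine prod_le_prod (fun _ _ => by positivity) fun p _ => ?_
      split_ifs with hp
      · rw [one_div, inv_mul_cancel₀ hM'.ne']
        norm_cast
        refine card_le_one.mpr ?_
        simp only [mem_filter, mem_univ, true_and]
        rintro a ⟨j, hj, rfl⟩ b ⟨j', hj', rfl⟩
        rw [hc (hj.trans hj'.symm)]
      · simp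
    have h3 : ∏ p : Fin d × Fin M, (if p ∈ univ.image (codeCoord c) then (1 / M : ℝ) else 1) * M
        = (1 / M : ℝ) ^ (k + 1) * (M : ℝ) ^ (d * M) := by
      rw [prod_mul_distrib, prod_ite, prod_const, prod_const_one, mul_one]
      congr 1
      · congr 1
        rw [filter_mem_eq_inter, univ_inter, card_image_of_injective _ hc]
        simp
      · simp
    calc _ ≤ ((1 / M : ℝ) ^ (k + 1) * (M : ℝ) ^ (d * M)) * (M : ℝ) ^ (k + 1) :=
          mul_le_mul_of_nonneg_right (h1.trans (h2.trans h3.le)) (by positivity)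
      _ = _ := by rw [one_div, inv_pow]; field_simp
  · have : ({f | Realises f c} : Finset _) = ∅ :=
      filter_eq_empty_iff.mpr fun f _ hf => hc hf.1
    rw [this]; simp

open Classical in
lemma sum_card_realises_le {d M g : ℕ} (hd : 1 ≤ d) (hM : 0 < M) :
    ∑ f : Fin d × Fin M → Fin M, (∑ k ∈ range g, #{c : CycCode d M k | Realises f c} : ℝ)
      ≤ (2 * d : ℝ) ^ (g + 1) * (M : ℝ) ^ (d * M) := by
  have hM' : (0 : ℝ) < M := by exact_mod_cast hM
  have hd' : (1 : ℝ) ≤ d := by exact_mod_cast hd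
  rw [sum_comm]
  have h1 : ∀ k, ∑ f : Fin d × Fin M → Fin M, (#{c : CycCode d M k | Realises f c} : ℝ)
      ≤ (2 * d : ℝ) ^ (k + 1) * (M : ℝ) ^ (d * M) := by
    intro k
    have e1 : ∑ f : Fin d × Fin M → Fin M, (#{c : CycCode d M k | Realises f c} : ℝ)
        = ∑ c : CycCode d M k, (#{f | Realises f c} : ℝ) := by
      simp only [card_filter]
      push_cast
      rw [sum_comm]
    rw [e1]
    have e2 : ∀ c : CycCode d M k, (#{f | Realises f c} : ℝ)
        ≤ (M : ℝ) ^ (d * M) / (M : ℝ) ^ (k + 1) := fun c => by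
      rw [le_div_iff₀ (by positivity)]; exact card_realises_le hM c
    refine (sum_le_sum fun c _ => e2 c).trans ?_
    rw [sum_const, card_univ, nsmul_eq_mul]
    simp only [CycCode, Fintype.card_prod, Fintype.card_fun, Fintype.card_fin, Fintype.card_bool]
    push_cast
    rw [mul_comm (d : ℝ) 2]
    field_simp
    exact le_rfl
  refine (sum_le_sum fun k _ => h1 k).trans ?_
  rw [← sum_mul]
  refine mul_le_mul_of_nonneg_right ?_ (by positivity)
  induction g with
  | zero => simp
  | succ g ih =>
    rw [sum_range_succ]
    have : (0 : ℝ) ≤ (2 * d) ^ (g + 1) := by positivity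
    calc _ ≤ (2 * d : ℝ) ^ (g + 1) + (2 * d) ^ (g + 1) := by linarith
      _ ≤ (2 * d : ℝ) ^ (g + 1) * (2 * d) := by nlinarith
      _ = _ := by ring

lemma card_fun_cast (d M : ℕ) :
    ((Fintype.card (Fin d × Fin M → Fin M) : ℕ) : ℝ) = (M : ℝ) ^ (d * M) := by
  simp

open Classical in
lemma exists_good_of_average {Ω : Type} [Fintype Ω] [Nonempty Ω] (P : Ω → Prop) (N : Ω → ℕ)
    {M : ℕ} (hM : 0 < M) {Y : ℝ} (hP : (#{f | P f} : ℝ) ≤ 1 / 9 * (Fintype.card Ω : ℝ))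
    (hN : ∑ f, (N f : ℝ) ≤ Y * (Fintype.card Ω : ℝ)) (hY : 400 * Y ≤ M) :
    ∃ f, ¬ P f ∧ 200 * N f ≤ M := by
  have hM' : (0 : ℝ) < M := by exact_mod_cast hM
  have hX : (0 : ℝ) < Fintype.card Ω := by exact_mod_cast Fintype.card_pos
  by_contra hcon
  push Not at hcon
  have h3 : ∀ f : Ω, 1 ≤ (if P f then (1 : ℝ) else 0) + 200 / M * N f := by
    intro f
    split_ifs with h
    · have : (0 : ℝ) ≤ 200 / M * N f := by positivity
      linarith
    · have h5 : (M : ℝ) < 200 * N f := by exact_mod_cast hcon f h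
      rw [zero_add, div_mul_eq_mul_div, le_div_iff₀ hM']
      linarith
  have h4 := sum_le_sum fun f (_ : f ∈ (univ : Finset Ω)) => h3 f
  rw [sum_add_distrib, ← mul_sum, sum_const, card_univ, nsmul_eq_mul, mul_one, sum_boole] at h4
  have h6 : 200 / M * ∑ f, (N f : ℝ) ≤ 200 / M * (Y * Fintype.card Ω) :=
    mul_le_mul_of_nonneg_left hN (by positivity)
  have h7 : 200 / M * (Y * Fintype.card Ω) ≤ Fintype.card Ω / 2 := by
    rw [div_mul_eq_mul_div, div_le_iff₀ hM']
    nlinarith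
  linarith

open Classical in
lemma exists_good_function {M g : ℕ} (hM : 0 < M) (hg : 400 * 60 ^ (g + 1) ≤ M) :
    ∃ f : Fin 30 × Fin M → Fin M,
      (∀ S T : Finset (Fin M), ¬ BadPair 30 M S T f) ∧
      200 * ∑ k ∈ range g, #{c : CycCode 30 M k | Realises f c} ≤ M := by
  have : Nonempty (Fin M) := ⟨⟨0, hM⟩⟩
  have h2 := sum_card_realises_le (d := 30) (g := g) (by norm_num) hM
  obtain ⟨f, hf, hf2⟩ := exists_good_of_average
    (NonExpanding 30 M)
    (fun f => ∑ k ∈ range g, #{c : CycCode 30 M k | Realises f c}) hM (Y := 60 ^ (g + 1))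
    (by rw [card_fun_cast]; exact card_nonexpanding_le hM)
    (by
      rw [card_fun_cast]
      push_cast
      refine h2.trans_eq ?_
      congr 2
      norm_num)
    (by exact_mod_cast hg)
  exact ⟨f, fun S T h => hf ⟨T, S, h⟩, hf2⟩

end

section

/-! ### From random functions to expanders of large girth -/

/-- the relation generated by a family of functions -/
def FunRel {d M : ℕ} (f : Fin d × Fin M → Fin M) (x y : Fin M) : Prop :=
  ∃ i, f (i, x) = y ∨ f (i, y) = x

open Classical in
/-- base points of the realised codes of length at most `g` -/
def shortBase {d M : ℕ} (f : Fin d × Fin M → Fin M) (g : ℕ) : Finset (Fin M) :=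
  (range g).biUnion fun k => ({c : CycCode d M k | Realises f c} : Finset _).image fun c => c.1 0

open Classical in
lemma card_shortBase_le {d M : ℕ} (f : Fin d × Fin M → Fin M) (g : ℕ) :
    #(shortBase f g) ≤ ∑ k ∈ range g, #{c : CycCode d M k | Realises f c} :=
  card_biUnion_le.trans (sum_le_sum fun _ _ => card_image_le)

lemma mem_shortBase {d M g : ℕ} (f : Fin d × Fin M → Fin M) (G : SimpleGraph (Fin M))
    (v : Fin M) (p : G.Walk v v) (hp : p.IsCycle) (hlen : p.length ≤ g)
    (hrel : ∀ j < p.length, FunRel f (p.getVert j) (p.getVert (j + 1))) : v ∈ shortBase f g := by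
  classical
  obtain ⟨k, hk⟩ : ∃ k, p.length = k + 1 :=
    ⟨p.length - 1, by have := hp.three_le_length; omega⟩
  set vs : Fin (k + 1) → Fin M := fun j => p.getVert j with hvs
  have hnext : ∀ j : Fin (k + 1), vs (j + 1) = p.getVert (j + 1) := by
    intro j
    by_cases hj : j = Fin.last k
    · subst hj
      simp only [hvs, Fin.last_add_one, Fin.val_zero, Fin.val_last, SimpleGraph.Walk.getVert_zero]
      rw [← hk, SimpleGraph.Walk.getVert_length]
    · simp only [hvs]
      rw [Fin.val_add_one_of_lt (lt_of_le_of_ne (Fin.le_last j) hj)]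
  have hch : ∀ j : Fin (k + 1), ∃ l : Fin d × Bool,
      f (l.1, if l.2 then vs j else vs (j + 1)) = if l.2 then vs (j + 1) else vs j := by
    intro j
    obtain ⟨i, hi | hi⟩ := hrel j (by rw [hk]; exact j.2)
    · exact ⟨(i, true), by simpa [hnext] using hi⟩
    · exact ⟨(i, false), by simpa [hnext] using hi⟩
  choose lab hlab using hch
  have hedge : ∀ j : Fin (k + 1), ∀ h : (j : ℕ) < p.edges.length,
      p.edges[(j : ℕ)] = s(codeVal (vs, lab) j, (codeCoord (vs, lab) j).2) := by
    intro j h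
    rw [SimpleGraph.Walk.getElem_edges_eq_edge_getElem_darts,
      SimpleGraph.Walk.darts_getElem_eq_getVert]
    simp only [codeVal, codeCoord]
    split_ifs
    · rw [hnext, Sym2.eq_swap]; rfl
    · rw [hnext]; rfl
  have hreal : Realises f ((vs, lab) : CycCode d M k) := by
    have hval : ∀ j, f (codeCoord (vs, lab) j) = codeVal (vs, lab) j := fun j => hlab j
    refine ⟨fun j j' h => ?_, hval⟩
    have hlt : ∀ j : Fin (k + 1), (j : ℕ) < p.edges.length := fun j => by
      rw [SimpleGraph.Walk.length_edges, hk]; exact j.2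
    have h2 : p.edges[(j : ℕ)]'(hlt j) = p.edges[(j' : ℕ)]'(hlt j') := by
      rw [hedge, hedge, ← hval, ← hval, h]
    exact Fin.ext ((hp.edges_nodup.getElem_inj_iff).mp h2)
  refine mem_biUnion.mpr ⟨k, mem_range.mpr (by omega), mem_image.mpr ⟨(vs, lab), ?_, ?_⟩⟩
  · simpa using hreal
  · simp [hvs]

open Classical in
/-- outer vertex boundary -/
def nbd (A : V → V → Prop) (S : Finset V) : Finset V := {y | y ∉ S ∧ ∃ x ∈ S, A x y}

lemma exists_expanding_core (A : V → V → Prop) (R : Finset V)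
    (hexp : ∀ S : Finset V, S.Nonempty → 3 * #S ≤ 2 * Fintype.card V → #S < 4 * #(nbd A S))
    (hR : 100 * #R ≤ Fintype.card V) :
    ∃ C : Finset V, Disjoint C R ∧ 100 * #Cᶜ ≤ 9 * Fintype.card V ∧
      ∀ S ⊆ C, S.Nonempty → 2 * #S ≤ #C → #S < 8 * #(nbd A S ∩ C) := by
  classical
  set P : Finset (Finset V) :=
    univ.filter fun U => Disjoint U R ∧ 3 * #U ≤ 2 * Fintype.card V ∧ 8 * #(nbd A U \ R) ≤ #U
    with hP
  have hne : P.Nonempty := ⟨∅, by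
    rw [hP, mem_filter]
    refine ⟨mem_univ _, disjoint_empty_left _, by simp, ?_⟩
    have : nbd A (∅ : Finset V) = ∅ := by
      rw [nbd, filter_eq_empty_iff]; simp
    simp [this]⟩
  obtain ⟨U, hU, hmax⟩ := exists_max_image P card hne
  simp only [hP, mem_filter, mem_univ, true_and] at hU
  obtain ⟨hUR, hU3, hU8⟩ := hU
  have hUsmall : #U ≤ 8 * #R := by
    rcases U.eq_empty_or_nonempty with rfl | hUne
    · simp
    · have h1 := hexp U hUne hU3
      have h2 : #(nbd A U) ≤ #(nbd A U \ R) + #R := by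
        have := card_le_card_sdiff_add_card (s := nbd A U) (t := R)
        omega
      omega
  refine ⟨(R ∪ U)ᶜ, ?_, ?_, ?_⟩
  · rw [disjoint_left]; intro x hx hx'; simp [hx'] at hx
  · rw [compl_compl]
    have := card_union_le R U
    omega
  · intro S hSC hSne hS2
    by_contra hcon
    rw [not_lt] at hcon
    have hSU : Disjoint U S := by
      rw [disjoint_right]; intro x hx hx'
      have := hSC hx
      simp [hx'] at this
    have hSR : Disjoint S R := by
      rw [disjoint_left]; intro x hx hx'
      have := hSC hx
      simp [hx'] at this
    have hcC : #(R ∪ U)ᶜ ≤ Fintype.card V := card_le_univ _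
    have hcU : #(U ∪ S) = #U + #S := card_union_of_disjoint hSU
    have hmem : U ∪ S ∈ P := by
      simp only [hP, mem_filter, mem_univ, true_and]
      refine ⟨disjoint_union_left.mpr ⟨hUR, hSR⟩, by omega, ?_⟩
      have hsub : nbd A (U ∪ S) \ R ⊆ (nbd A U \ R) ∪ (nbd A S ∩ (R ∪ U)ᶜ) := by
        intro y hy
        simp only [nbd, Finset.mem_sdiff, mem_filter, mem_univ, true_and, mem_union, mem_inter,
          mem_compl, not_or] at hy ⊢
        obtain ⟨⟨⟨hyU, hyS⟩, x, hx | hx, hxy⟩, hyR⟩ := hy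
        · exact Or.inl ⟨⟨hyU, x, hx, hxy⟩, hyR⟩
        · exact Or.inr ⟨⟨hyS, x, hx, hxy⟩, hyR, hyU⟩
      have := (card_le_card hsub).trans (card_union_le _ _)
      omega
    have := hmax _ hmem
    have := hSne.card_pos
    omega

open Classical in
lemma coarea (A : V → V → Prop) (C : Finset V)
    (hexp : ∀ S ⊆ C, S.Nonempty → 2 * #S ≤ #C → #S < 8 * #(nbd A S ∩ C)) :
    ∀ (n : ℕ) (p : V → ℝ) (S : Finset V), #S = n → S ⊆ C → 2 * #S ≤ #C → (∀ x, 0 ≤ p x) →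
      (∀ x ∉ S, p x = 0) →
      ∑ x ∈ S, p x ≤ 8 * ∑ x ∈ C, ∑ y ∈ C, if A x y then max (p x - p y) 0 else 0 := by
  intro n
  induction n using Nat.strong_induction_on with
  | _ n ih =>
    intro p S hn hSC hS2 hp hpS
    have hnn : ∀ q : V → ℝ, 0 ≤ ∑ x ∈ C, ∑ y ∈ C, if A x y then max (q x - q y) 0 else 0 :=
      fun q => sum_nonneg fun x _ => sum_nonneg fun y _ => by
        split_ifs
        · exact le_max_right _ _
        · exact le_rfl
    rcases S.eq_empty_or_nonempty with rfl | hne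
    · simpa using hnn p
    obtain ⟨x0, hx0, hmin⟩ := exists_min_image S p hne
    set m := p x0 with hm
    set p' : V → ℝ := fun x => if x ∈ S then p x - m else 0 with hp'
    set S' := S.erase x0 with hS'
    have hcard : #S' < #S := card_erase_lt_of_mem hx0
    have hsub' : S' ⊆ S := erase_subset _ _
    have h1 := ih #S' (by omega) p' S' rfl (hsub'.trans hSC) (by omega)
      (fun x => by
        simp only [hp']
        split_ifs with h
        · linarith [hmin x h]
        · exact le_rfl)
      (fun x hx => by
        simp only [hp']
        split_ifs with h
        · have : x = x0 := by by_contra hne; exact hx (mem_erase.mpr ⟨hne, h⟩)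
          rw [this]; ring
        · rfl)
    have h2 : ∑ x ∈ S, p x = ∑ x ∈ S', p' x + #S * m := by
      have : ∑ x ∈ S, p' x = ∑ x ∈ S', p' x := by
        rw [hS', ← add_sum_erase S p' hx0]
        simp [hp', hx0, hm]
      rw [← this, ← nsmul_eq_mul, ← sum_const, ← sum_add_distrib]
      exact sum_congr rfl fun x hx => by simp [hp', hx]
    have h3 : ∀ x y, (if A x y then max (p x - p y) 0 else 0)
        = (if A x y then max (p' x - p' y) 0 else 0) + (if A x y ∧ x ∈ S ∧ y ∉ S then m else 0) := by
      intro x y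
      by_cases hA : A x y
      · simp only [hA, if_true, true_and]
        by_cases hx : x ∈ S <;> by_cases hy : y ∈ S
        · simp [hp', hx, hy]
        · simp only [hp', hx, hy, hpS y hy, if_true, if_false, not_false_eq_true, and_self,
            sub_zero]
          rw [max_eq_left (hp x), max_eq_left (by linarith [hmin x hx])]; ring
        · have := hmin y hy
          simp only [hp', hx, hy, hpS x hx, if_true, if_false, false_and,
            add_zero]
          rw [max_eq_right (by linarith [hp y]), max_eq_right (by linarith)]
        · simp [hp', hx, hy, hpS x hx, hpS y hy]
      · simp [hA]
    have h4 : (#S : ℝ) * m ≤ 8 * ∑ x ∈ C, ∑ y ∈ C, if A x y ∧ x ∈ S ∧ y ∉ S then m else 0 := by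
      have hb := hexp S hSC hne hS2
      have h5 : (#(nbd A S ∩ C) : ℝ) * m
          ≤ ∑ x ∈ C, ∑ y ∈ C, if A x y ∧ x ∈ S ∧ y ∉ S then m else 0 := by
        rw [sum_comm, ← nsmul_eq_mul, ← sum_const]
        refine le_trans (sum_le_sum ?_) (sum_le_sum_of_subset_of_nonneg inter_subset_right ?_)
        · intro y hy
          simp only [nbd, mem_inter, mem_filter, mem_univ, true_and] at hy
          obtain ⟨⟨hyS, x, hx, hxy⟩, hyC⟩ := hy
          refine le_trans ?_ (single_le_sum (f := fun x => if A x y ∧ x ∈ S ∧ y ∉ S then m else 0)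
            (fun z _ => ?_) (hSC hx))
          · simp [hxy, hx, hyS]
          · split_ifs
            · exact hp x0
            · exact le_rfl
        · intro y _ _
          refine sum_nonneg fun z _ => ?_
          split_ifs
          · exact hp x0
          · exact le_rfl
      have h6 : (#S : ℝ) ≤ 8 * #(nbd A S ∩ C) := by exact_mod_cast hb.le
      have h7 : (#S : ℝ) * m ≤ 8 * #(nbd A S ∩ C) * m := mul_le_mul_of_nonneg_right h6 (hp x0)
      linarith
    simp only [h3, sum_add_distrib]
    rw [h2]
    linarith

lemma exists_median (C : Finset V) (f : V → ℝ) :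
    ∃ m : ℝ, 2 * #{x ∈ C | m < f x} ≤ #C ∧ 2 * #{x ∈ C | f x < m} ≤ #C := by
  classical
  rcases C.eq_empty_or_nonempty with rfl | hne
  · exact ⟨0, by simp⟩
  obtain ⟨xm, hxm, hmax⟩ := exists_max_image C f hne
  set P := C.filter fun x => 2 * #{y ∈ C | f x < f y} ≤ #C with hP
  have hPne : P.Nonempty := ⟨xm, by
    rw [hP, mem_filter]
    refine ⟨hxm, ?_⟩
    rw [filter_eq_empty_iff.mpr fun y hy => not_lt.mpr (hmax y hy)]; simp⟩
  obtain ⟨x0, hx0, hmin⟩ := exists_min_image P f hPne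
  refine ⟨f x0, (mem_filter.mp hx0).2, ?_⟩
  rcases ({x ∈ C | f x < f x0} : Finset V).eq_empty_or_nonempty with he | he
  · rw [he]; simp
  obtain ⟨x1, hx1, hmax1⟩ := exists_max_image _ f he
  rw [mem_filter] at hx1
  have h1 : x1 ∉ P := fun h => not_lt.mpr (hmin x1 h) hx1.2
  have h2 : #C < 2 * #{y ∈ C | f x1 < f y} := by
    by_contra hcon
    exact h1 (mem_filter.mpr ⟨hx1.1, not_lt.mp hcon⟩)
  have h3 : #{x ∈ C | f x < f x0} + #{y ∈ C | f x1 < f y} ≤ #C := by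
    rw [← card_union_of_disjoint]
    · exact card_le_card (union_subset (filter_subset _ _) (filter_subset _ _))
    · rw [disjoint_left]
      intro z hz hz'
      exact not_lt.mpr (hmax1 z hz) (mem_filter.mp hz').2
  omega

end

section

open Classical in
lemma sum_sq_le_of_small_support (A : V → V → Prop) (hA : ∀ x y, A x y → A y x) (C : Finset V)
    (hexp : ∀ S ⊆ C, S.Nonempty → 2 * #S ≤ #C → #S < 8 * #(nbd A S ∩ C)) {D : ℕ} (hD0 : 0 < D)
    (hD : ∀ x ∈ C, #{y ∈ C | A x y} ≤ D) (g : V → ℝ) (S : Finset V) (hSC : S ⊆ C)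
    (hS : 2 * #S ≤ #C) (hgS : ∀ x ∉ S, g x = 0) :
    ∑ x ∈ C, g x ^ 2 ≤ 256 * D * ∑ x ∈ C, ∑ y ∈ C, if A x y then (g x - g y) ^ 2 else 0 := by
  have hD' : (0 : ℝ) < D := by exact_mod_cast hD0
  have h1 := coarea A C hexp #S (fun x => g x ^ 2) S rfl hSC hS (fun x => sq_nonneg _)
    (fun x hx => by simp [hgS x hx])
  have h2 : ∑ x ∈ C, g x ^ 2 = ∑ x ∈ S, g x ^ 2 :=
    (sum_subset hSC fun x _ hx => by simp [hgS x hx]).symm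
  have h3 : ∑ x ∈ C, ∑ y ∈ C, (if A x y then g x ^ 2 else 0) ≤ D * ∑ x ∈ C, g x ^ 2 := by
    rw [mul_sum]
    refine sum_le_sum fun x hx => ?_
    rw [← sum_filter, sum_const, nsmul_eq_mul]
    exact mul_le_mul_of_nonneg_right (by exact_mod_cast hD x hx) (sq_nonneg _)
  have h4 : ∑ x ∈ C, ∑ y ∈ C, (if A x y then g y ^ 2 else 0) ≤ D * ∑ x ∈ C, g x ^ 2 := by
    rw [sum_comm]
    refine le_trans (le_of_eq ?_) h3
    refine sum_congr rfl fun x _ => sum_congr rfl fun y _ => ?_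
    simp only [show A y x ↔ A x y from ⟨hA _ _, hA _ _⟩]
  have h5 : ∑ x ∈ C, ∑ y ∈ C, (if A x y then max (g x ^ 2 - g y ^ 2) 0 else 0)
      ≤ 16 * D * ∑ x ∈ C, ∑ y ∈ C, (if A x y then (g x - g y) ^ 2 else 0)
        + (1 / (32 * D)) * (∑ x ∈ C, ∑ y ∈ C, (if A x y then g x ^ 2 else 0)
          + ∑ x ∈ C, ∑ y ∈ C, (if A x y then g y ^ 2 else 0)) := by
    simp only [mul_sum, ← sum_add_distrib]
    refine sum_le_sum fun x _ => sum_le_sum fun y _ => ?_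
    split_ifs
    · refine max_le ?_ (by positivity)
      have h6 : 0 ≤ (32 * D * (g x - g y) - (g x + g y)) ^ 2 / (64 * D) := by positivity
      have h7 : (32 * D * (g x - g y) - (g x + g y)) ^ 2 / (64 * D)
          = 16 * D * (g x - g y) ^ 2 - (g x ^ 2 - g y ^ 2) + (g x + g y) ^ 2 / (64 * D) := by
        field_simp; ring
      have h8 : (g x + g y) ^ 2 / (64 * D) ≤ 1 / (32 * D) * (g x ^ 2 + g y ^ 2) := by
        rw [show 1 / (32 * D) * (g x ^ 2 + g y ^ 2) = (2 * (g x ^ 2 + g y ^ 2)) / (64 * (D : ℝ)) by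
          field_simp; ring]
        gcongr
        nlinarith [sq_nonneg (g x - g y)]
      linarith
    · simp
  have h9 : (1 / (32 * (D : ℝ))) * (D * ∑ x ∈ C, g x ^ 2 + D * ∑ x ∈ C, g x ^ 2)
      = (∑ x ∈ C, g x ^ 2) / 16 := by field_simp; ring
  have h10 : (1 / (32 * (D : ℝ))) * (∑ x ∈ C, ∑ y ∈ C, (if A x y then g x ^ 2 else 0)
          + ∑ x ∈ C, ∑ y ∈ C, (if A x y then g y ^ 2 else 0)) ≤ (∑ x ∈ C, g x ^ 2) / 16 := by
    rw [← h9]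
    exact mul_le_mul_of_nonneg_left (add_le_add h3 h4) (by positivity)
  rw [← h2] at h1
  linarith

open Classical in
lemma core_poincare (A : V → V → Prop) (hA : ∀ x y, A x y → A y x) (C : Finset V)
    (hexp : ∀ S ⊆ C, S.Nonempty → 2 * #S ≤ #C → #S < 8 * #(nbd A S ∩ C)) {D : ℕ} (hD0 : 0 < D)
    (hD : ∀ x ∈ C, #{y ∈ C | A x y} ≤ D) (f : V → ℝ) :
    ∃ m, ∑ x ∈ C, (f x - m) ^ 2
      ≤ 256 * D * ∑ x ∈ C, ∑ y ∈ C, if A x y then (f x - f y) ^ 2 else 0 := by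
  obtain ⟨m, hm1, hm2⟩ := exists_median C f
  refine ⟨m, ?_⟩
  have key : ∀ a b : ℝ, (max a 0 - max b 0) ^ 2 + (max (-a) 0 - max (-b) 0) ^ 2 ≤ (a - b) ^ 2 := by
    intro a b
    rcases le_total a 0 with ha | ha <;> rcases le_total b 0 with hb | hb
    · rw [max_eq_right ha, max_eq_right hb, max_eq_left (by linarith), max_eq_left (by linarith)]
      nlinarith
    · rw [max_eq_right ha, max_eq_left hb, max_eq_left (by linarith), max_eq_right (by linarith)]
      nlinarith
    · rw [max_eq_left ha, max_eq_right hb, max_eq_right (by linarith), max_eq_left (by linarith)]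
      nlinarith
    · rw [max_eq_left ha, max_eq_left hb, max_eq_right (by linarith), max_eq_right (by linarith)]
      nlinarith
  have key2 : ∀ a : ℝ, a ^ 2 = max a 0 ^ 2 + max (-a) 0 ^ 2 := by
    intro a
    rcases le_total a 0 with ha | ha
    · rw [max_eq_right ha, max_eq_left (by linarith)]; ring
    · rw [max_eq_left ha, max_eq_right (by linarith)]; ring
  set gp : V → ℝ := fun x => if x ∈ C then max (f x - m) 0 else 0 with hgp
  set gm : V → ℝ := fun x => if x ∈ C then max (-(f x - m)) 0 else 0 with hgm
  have h1 := sum_sq_le_of_small_support A hA C hexp hD0 hD gp {x ∈ C | m < f x}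
    (filter_subset _ _) hm1 (fun x hx => by
      simp only [hgp]
      split_ifs with h
      · simp only [mem_filter, h, true_and, not_lt] at hx
        exact max_eq_right (by linarith)
      · rfl)
  have h2 := sum_sq_le_of_small_support A hA C hexp hD0 hD gm {x ∈ C | f x < m}
    (filter_subset _ _) hm2 (fun x hx => by
      simp only [hgm]
      split_ifs with h
      · simp only [mem_filter, h, true_and, not_lt] at hx
        exact max_eq_right (by linarith)
      · rfl)
  have h3 : ∑ x ∈ C, (f x - m) ^ 2 = ∑ x ∈ C, gp x ^ 2 + ∑ x ∈ C, gm x ^ 2 := by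
    rw [← sum_add_distrib]
    refine sum_congr rfl fun x hx => ?_
    simp only [hgp, hgm, hx, if_true]
    exact key2 _
  have h4 : (∑ x ∈ C, ∑ y ∈ C, if A x y then (gp x - gp y) ^ 2 else 0)
      + (∑ x ∈ C, ∑ y ∈ C, if A x y then (gm x - gm y) ^ 2 else 0)
      ≤ ∑ x ∈ C, ∑ y ∈ C, if A x y then (f x - f y) ^ 2 else 0 := by
    simp only [← sum_add_distrib]
    refine sum_le_sum fun x hx => sum_le_sum fun y hy => ?_
    split_ifs
    · simp only [hgp, hgm, hx, hy, if_true]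
      refine (key _ _).trans (le_of_eq (by ring))
    · simp
  rw [h3]
  have h5 : (0 : ℝ) ≤ 256 * D := by positivity
  nlinarith [mul_le_mul_of_nonneg_left h4 h5]

/-- The graph induced by `A` on `C`, with every vertex outside `C` attached as a pendant. -/
def pendantGraph (A : V → V → Prop) (hA : ∀ x y, A x y → A y x) (C : Finset V) (att : V → V) :
    SimpleGraph V where
  Adj x y := x ≠ y ∧ ((x ∈ C ∧ y ∈ C ∧ A x y) ∨ (x ∉ C ∧ y = att x) ∨ (y ∉ C ∧ x = att y))
  symm := ⟨fun x y h => ⟨h.1.symm, by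
    rcases h.2 with ⟨h1, h2, h3⟩ | h | h
    · exact Or.inl ⟨h2, h1, hA _ _ h3⟩
    · exact Or.inr (Or.inr h)
    · exact Or.inr (Or.inl h)⟩⟩
  loopless := ⟨fun x h => h.1 rfl⟩

lemma deg_eq_card_filter (G : SimpleGraph V) [DecidableRel G.Adj] (v : V) :
    deg G v = #{u | G.Adj v u} := by
  rw [deg, Nat.card_eq_fintype_card, Fintype.card_subtype]

lemma pendantGraph_mem_of_cycle (A : V → V → Prop) (hA : ∀ x y, A x y → A y x) (C : Finset V)
    (att : V → V) (hatt : ∀ x ∉ C, att x ∈ C) {v : V}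
    (p : (pendantGraph A hA C att).Walk v v) (hp : p.IsCycle) {u : V} (hu : u ∈ p.support) :
    u ∈ C := by
  by_contra huC
  have hc := hp.rotate hu
  have hone : ∀ z, (pendantGraph A hA C att).Adj u z → z = att u := by
    rintro z ⟨_, ⟨h, _⟩ | ⟨_, h⟩ | ⟨h, h'⟩⟩
    · exact absurd h huC
    · exact h
    · exact absurd (h' ▸ hatt z h) huC
  have hnil := hc.not_nil
  have h1 := hone _ (SimpleGraph.Walk.adj_snd hnil)
  have h2 := hone _ (SimpleGraph.Walk.adj_penultimate hnil).symm
  exact hc.snd_ne_penultimate (h1.trans h2.symm)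

open Classical in
lemma pendantGraph_poincare (A : V → V → Prop) (hA : ∀ x y, A x y → A y x) (C : Finset V)
    (att : V → V) (hatt : ∀ x ∉ C, att x ∈ C)
    (hinj : ∀ x ∉ C, ∀ y ∉ C, att x = att y → x = y) {Λ : ℝ} (hΛ : 0 ≤ Λ) (f : V → ℝ) {m : ℝ}
    (hm : ∑ x ∈ C, (f x - m) ^ 2 ≤ Λ * ∑ x ∈ C, ∑ y ∈ C, if A x y then (f x - f y) ^ 2 else 0) :
    ∑ x, (f x - m) ^ 2 ≤ (3 * Λ + 2) * energy (unitW (pendantGraph A hA C att)) f := by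
  set E := energy (unitW (pendantGraph A hA C att)) f with hE
  have hterm : ∀ x y, 0 ≤ unitW (pendantGraph A hA C att) x y * (f x - f y) ^ 2 := by
    intro x y
    unfold unitW
    split_ifs
    · simpa using sq_nonneg _
    · simp
  have h1 : (∑ x ∈ C, ∑ y ∈ C, if A x y then (f x - f y) ^ 2 else 0) ≤ E := by
    rw [hE, energy]
    refine le_trans (sum_le_sum fun x hx => ?_)
      (sum_le_sum_of_subset_of_nonneg (subset_univ C) fun x _ _ => sum_nonneg fun y _ => hterm x y)
    refine le_trans (sum_le_sum fun y hy => ?_)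
      (sum_le_sum_of_subset_of_nonneg (subset_univ C) fun y _ _ => hterm x y)
    split_ifs with h
    · rcases eq_or_ne x y with rfl | hne
      · simp
      · rw [unitW, if_pos (show (pendantGraph A hA C att).Adj x y from ⟨hne, Or.inl ⟨hx, hy, h⟩⟩)]
        simp
    · exact hterm x y
  have h2 : ∑ x ∈ Cᶜ, (f x - f (att x)) ^ 2 ≤ E := by
    rw [hE, energy]
    refine le_trans (sum_le_sum fun x hx => ?_)
      (sum_le_sum_of_subset_of_nonneg (subset_univ Cᶜ) fun x _ _ => sum_nonneg fun y _ => hterm x y)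
    rw [mem_compl] at hx
    refine le_trans ?_ (single_le_sum (fun y _ => hterm x y) (mem_univ (att x)))
    rw [unitW, if_pos (show (pendantGraph A hA C att).Adj x (att x) from
      ⟨fun h => hx (h ▸ hatt x hx), Or.inr (Or.inl ⟨hx, rfl⟩)⟩)]
    simp
  have h3 : ∑ x ∈ Cᶜ, (f (att x) - m) ^ 2 ≤ ∑ x ∈ C, (f x - m) ^ 2 := by
    rw [← sum_image (s := Cᶜ) (g := att) (f := fun x => (f x - m) ^ 2)
      (fun x hx y hy h => hinj x (by simpa using hx) y (by simpa using hy) h)]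
    refine sum_le_sum_of_subset_of_nonneg ?_ fun _ _ _ => sq_nonneg _
    intro y hy
    obtain ⟨x, hx, rfl⟩ := mem_image.mp hy
    exact hatt x (mem_compl.mp hx)
  have h4 : ∑ x ∈ Cᶜ, (f x - m) ^ 2
      ≤ 2 * ∑ x ∈ Cᶜ, (f x - f (att x)) ^ 2 + 2 * ∑ x ∈ Cᶜ, (f (att x) - m) ^ 2 := by
    rw [mul_sum, mul_sum, ← sum_add_distrib]
    refine sum_le_sum fun x _ => ?_
    nlinarith [sq_nonneg ((f x - f (att x)) - (f (att x) - m))]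
  rw [← sum_add_sum_compl C]
  have := mul_le_mul_of_nonneg_left h1 hΛ
  linarith

lemma exists_injective_att (C : Finset V) (hC : 2 * #Cᶜ ≤ Fintype.card V) :
    ∃ att : V → V, (∀ x ∉ C, att x ∈ C) ∧ ∀ x ∉ C, ∀ y ∉ C, att x = att y → x = y := by
  classical
  have h : #Cᶜ ≤ #C := by have := card_compl C; have := card_le_univ C; omega
  obtain ⟨S, hSC, hS⟩ := exists_subset_card_eq h
  let e := Finset.equivOfCardEq hS.symm
  refine ⟨fun x => if hx : x ∈ Cᶜ then (e ⟨x, hx⟩ : V) else x, ?_, ?_⟩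
  · intro x hx
    simp only [dif_pos (mem_compl.mpr hx)]
    exact hSC (e _).2
  · intro x hx y hy hxy
    simp only [dif_pos (mem_compl.mpr hx), dif_pos (mem_compl.mpr hy)] at hxy
    simpa using e.injective (Subtype.ext hxy)

open Classical in
theorem exists_expander : ∃ (D : ℕ) (Λ : ℝ), 1 ≤ Λ ∧ ∀ M g : ℕ, 400 * 60 ^ (g + 1) ≤ M →
    ∃ H : SimpleGraph (Fin M), (∀ v, deg H v ≤ D) ∧
      (∀ v, ∀ p : H.Walk v v, p.IsCycle → g < p.length) ∧
      ∀ f : Fin M → ℝ, ∃ a, ∑ x, (f x - a) ^ 2 ≤ Λ * energy (unitW H) f := by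
  refine ⟨6031, 3 * (256 * 6030) + 2, by norm_num, fun M g hM => ?_⟩
  have hM0 : 0 < M := lt_of_lt_of_le (by positivity) hM
  obtain ⟨f, hexp, hcyc⟩ := exists_good_function hM0 hM
  set A : Fin M → Fin M → Prop := FunRel f with hAdef
  have hA : ∀ x y, A x y → A y x := fun x y ⟨i, hi⟩ => ⟨i, hi.symm⟩
  set heavy : Finset (Fin M) := {x | 6000 < #{p | f p = x}} with hheavy
  have hheavyc : 6000 * #heavy ≤ 30 * M := by
    have h1 : ∑ x : Fin M, #{p | f p = x} = 30 * M := by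
      rw [← card_eq_sum_card_fiberwise (fun p _ => mem_coe.mpr (mem_univ (f p)))]
      simp
    rw [← h1, mul_comm, ← smul_eq_mul, ← sum_const]
    refine le_trans (sum_le_sum fun x hx => ?_) (sum_le_sum_of_subset (subset_univ heavy))
    exact ((mem_filter.mp hx).2).le
  have hR : 100 * #(shortBase f g ∪ heavy) ≤ Fintype.card (Fin M) := by
    have h1 := card_union_le (shortBase f g) heavy
    have h2 := card_shortBase_le f g
    rw [Fintype.card_fin]
    omega
  obtain ⟨C, hCR, hCc, hCexp⟩ := exists_expanding_core A (shortBase f g ∪ heavy) (by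
    intro S hS hS3
    rw [Fintype.card_fin] at hS3
    by_contra hcon
    rw [not_lt] at hcon
    have hcard : #(S ∪ nbd A S) ≤ #S + #(nbd A S) := card_union_le _ _
    refine hexp S (S ∪ nbd A S) ⟨subset_union_left, hS.mono subset_union_left, by omega, by omega,
      fun p hp => ?_⟩
    by_cases h : f p ∈ S
    · exact mem_union_left _ h
    · refine mem_union_right _ ?_
      simp only [nbd, mem_filter, mem_univ, true_and]
      exact ⟨h, p.2, hp, p.1, Or.inl rfl⟩) hR
  have hdegA : ∀ x ∈ C, #{y | A x y} ≤ 6030 := by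
    intro x hx
    have hxh : x ∉ heavy := fun h => disjoint_left.mp hCR hx (mem_union_right _ h)
    simp only [hheavy, mem_filter, mem_univ, true_and, not_lt] at hxh
    have hsub : ({y | A x y} : Finset (Fin M))
        ⊆ univ.image (fun i : Fin 30 => f (i, x))
          ∪ ({p | f p = x} : Finset (Fin 30 × Fin M)).image Prod.snd := by
      intro y hy
      simp only [mem_filter, mem_univ, true_and] at hy
      obtain ⟨i, hi | hi⟩ := hy
      · exact mem_union_left _ (mem_image.mpr ⟨i, mem_univ _, hi⟩)
      · exact mem_union_right _ (mem_image.mpr ⟨(i, y), by simpa using hi, rfl⟩)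
    have h1 := (card_le_card hsub).trans (card_union_le _ _)
    have h2 := card_image_le (s := (univ : Finset (Fin 30))) (f := fun i : Fin 30 => f (i, x))
    have h3 := card_image_le (s := ({p | f p = x} : Finset (Fin 30 × Fin M))) (f := Prod.snd)
    rw [card_univ, Fintype.card_fin] at h2
    omega
  obtain ⟨att, hatt, hinj⟩ := exists_injective_att C (by omega)
  refine ⟨pendantGraph A hA C att, ?_, ?_, ?_⟩
  · intro v
    rw [deg_eq_card_filter]
    by_cases hv : v ∈ C
    · have hsub : ({u | (pendantGraph A hA C att).Adj v u} : Finset (Fin M))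
          ⊆ ({y | A v y} : Finset (Fin M)) ∪ ({u | u ∉ C ∧ v = att u} : Finset (Fin M)) := by
        intro u hu
        simp only [mem_filter, mem_univ, true_and, mem_union] at hu ⊢
        rcases hu.2 with h | h | h
        · exact Or.inl h.2.2
        · exact absurd hv h.1
        · exact Or.inr h
      have h1 := (card_le_card hsub).trans (card_union_le _ _)
      have h2 : #({u | u ∉ C ∧ v = att u} : Finset (Fin M)) ≤ 1 := by
        rw [card_le_one]
        intro a ha b hb
        simp only [mem_filter, mem_univ, true_and] at ha hb
        exact hinj a ha.1 b hb.1 (ha.2.symm.trans hb.2)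
      have := hdegA v hv
      omega
    · have hsub : ({u | (pendantGraph A hA C att).Adj v u} : Finset (Fin M)) ⊆ {att v} := by
        intro u hu
        simp only [mem_filter, mem_univ, true_and, mem_singleton] at hu ⊢
        rcases hu.2 with h | h | h
        · exact absurd h.1 hv
        · exact h.2
        · exact absurd (h.2 ▸ hatt u h.1) hv
      have := card_le_card hsub
      rw [card_singleton] at this
      omega
  · intro v p hp
    by_contra hlen
    rw [not_lt] at hlen
    have hvC := pendantGraph_mem_of_cycle A hA C att hatt p hp p.start_mem_support
    refine disjoint_left.mp hCR hvC (mem_union_left _ (mem_shortBase f _ v p hp hlen ?_))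
    intro j hj
    have hadj := p.adj_getVert_succ hj
    have h1 := pendantGraph_mem_of_cycle A hA C att hatt p hp (p.getVert_mem_support j)
    have h2 := pendantGraph_mem_of_cycle A hA C att hatt p hp (p.getVert_mem_support (j + 1))
    rcases hadj.2 with h | h | h
    · exact h.2.2
    · exact absurd h1 h.1
    · exact absurd h2 h.1
  · intro φ
    obtain ⟨m, hm⟩ := core_poincare A hA C hCexp (D := 6030) (by norm_num)
      (fun x hx => (card_le_card (filter_subset_filter _ (subset_univ C))).trans (hdegA x hx)) φ
    exact ⟨m, by
      have := pendantGraph_poincare A hA C att hatt hinj (Λ := 256 * (6030 : ℕ)) (by positivity) φ hm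
      simpa using this⟩

end

section

section glue

/-- A rooted tree, some of whose vertices (the leaves) are joined injectively to the vertices of
a graph `H`. -/
structure Glue (T B : Type) where
  par : T → T
  depth : T → ℕ
  lf : T → Prop
  att : T → B
  H : SimpleGraph B
  root : T
  par_root : par root = root
  depth_par : ∀ t, t ≠ root → depth (par t) + 1 = depth t
  att_inj : ∀ t t', lf t → lf t' → att t = att t' → t = t'

variable {T B : Type} [Fintype T] [DecidableEq T] [Fintype B] [DecidableEq B] (S : Glue T B)

open Classical in
/-- edge weights: `pw t` on the edge from `t` to its parent, `1` on all other edges -/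
def Glue.wt (pw : T → ℝ) : T ⊕ B → T ⊕ B → ℝ
  | .inl t, .inl t' => (if S.par t = t' then pw t else 0) + (if S.par t' = t then pw t' else 0)
  | .inl t, .inr b => if S.lf t ∧ S.att t = b then 1 else 0
  | .inr b, .inl t => if S.lf t ∧ S.att t = b then 1 else 0
  | .inr b, .inr b' => unitW S.H b b'

/-- adjacency of the glued graph -/
def Glue.adj : T ⊕ B → T ⊕ B → Prop
  | .inl t, .inl t' => t ≠ t' ∧ (S.par t = t' ∨ S.par t' = t)
  | .inl t, .inr b => S.lf t ∧ S.att t = b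
  | .inr b, .inl t => S.lf t ∧ S.att t = b
  | .inr b, .inr b' => S.H.Adj b b'

/-- the glued graph -/
def Glue.graph : SimpleGraph (T ⊕ B) where
  Adj := S.adj
  symm := ⟨by
    rintro (t | b) (t' | b') h
    · exact ⟨h.1.symm, h.2.symm⟩
    · exact h
    · exact h
    · exact SimpleGraph.Adj.symm (G := S.H) h⟩
  loopless := ⟨by
    rintro (t | b) h
    · exact h.1 rfl
    · exact S.H.loopless.irrefl _ h⟩

/-- weights vanishing at the root and in `[1, 1+δ]` elsewhere -/
structure Glue.WtOk (pw : T → ℝ) (δ : ℝ) : Prop where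
  root : pw S.root = 0
  one_le : ∀ t, t ≠ S.root → 1 ≤ pw t
  le : ∀ t, t ≠ S.root → pw t ≤ 1 + δ

lemma Glue.par_ne {t : T} (ht : t ≠ S.root) : S.par t ≠ t := fun h => by
  have := S.depth_par t ht; rw [h] at this; omega

lemma Glue.par_par_ne {t t' : T} (ht : t ≠ S.root) (h : S.par t = t') : S.par t' ≠ t := by
  intro h'
  have h1 := S.depth_par t ht
  by_cases hr : t' = S.root
  · rw [hr, S.par_root] at h'; exact ht h'.symm
  · have h2 := S.depth_par t' hr
    rw [h] at h1; rw [h'] at h2; omega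

lemma Glue.wt_zero {pw : T → ℝ} {δ : ℝ} (hp : S.WtOk pw δ) (u v : T ⊕ B) (h : ¬ S.adj u v) :
    S.wt pw u v = 0 := by
  rcases u with t | b <;> rcases v with t' | b'
  · have h0 : ∀ t, S.par t = t → pw t = 0 := fun t h => by
      by_cases hr : t = S.root
      · rw [hr, hp.root]
      · exact absurd h (S.par_ne hr)
    simp only [Glue.adj, not_and, not_or] at h
    simp only [Glue.wt]
    by_cases ht : t = t'
    · subst ht
      by_cases h1 : S.par t = t
      · simp [h0 t h1]
      · simp [h1]
    · obtain ⟨h1, h2⟩ := h ht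
      simp [h1, h2]
  · simp only [Glue.adj] at h
    simp [Glue.wt, h]
  · simp only [Glue.adj] at h
    simp [Glue.wt, h]
  · simp only [Glue.adj] at h
    simp [Glue.wt, unitW, h]

lemma Glue.wt_bounds {pw : T → ℝ} {δ : ℝ} (hδ : 0 ≤ δ) (hp : S.WtOk pw δ) (u v : T ⊕ B)
    (h : S.adj u v) : 1 ≤ S.wt pw u v ∧ S.wt pw u v ≤ 1 + δ := by
  rcases u with t | b <;> rcases v with t' | b'
  · obtain ⟨hne, h | h⟩ := h
    · have hr : t ≠ S.root := fun hr => by rw [hr, S.par_root] at h; exact hne (hr.trans h)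
      have := S.par_par_ne hr h
      simp only [Glue.wt, h, this, if_true, if_false, add_zero]
      exact ⟨hp.one_le t hr, hp.le t hr⟩
    · have hr : t' ≠ S.root := fun hr => by rw [hr, S.par_root] at h; exact hne (h.symm.trans hr.symm)
      have := S.par_par_ne hr h
      simp only [Glue.wt, h, this, if_true, if_false, zero_add]
      exact ⟨hp.one_le t' hr, hp.le t' hr⟩
  · simp only [Glue.adj] at h
    simp [Glue.wt, h, hδ]
  · simp only [Glue.adj] at h
    simp [Glue.wt, h, hδ]
  · simp only [Glue.adj] at h
    simp [Glue.wt, unitW, h, hδ]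

lemma Glue.wt_eq_unitW {pw : T → ℝ} (hp : S.WtOk pw 0) : S.wt pw = unitW S.graph := by
  funext u v
  by_cases h : S.adj u v
  · obtain ⟨h1, h2⟩ := S.wt_bounds le_rfl hp u v h
    rw [unitW, if_pos (show S.graph.Adj u v from h)]; linarith
  · rw [S.wt_zero hp u v h, unitW, if_neg (show ¬ S.graph.Adj u v from h)]

lemma Glue.wt_symm (pw : T → ℝ) (u v : T ⊕ B) : S.wt pw u v = S.wt pw v u := by
  rcases u with t | b <;> rcases v with t' | b'
  · simp only [Glue.wt]; ring
  · simp only [Glue.wt]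
  · simp only [Glue.wt]
  · simp only [Glue.wt, unitW]
    by_cases h : S.H.Adj b b'
    · rw [if_pos h, if_pos h.symm]
    · rw [if_neg h, if_neg fun h' => h h'.symm]

lemma Glue.goodWeights {pw : T → ℝ} {δ : ℝ} (hδ : 0 ≤ δ) (hp : S.WtOk pw δ) :
    GoodWeights S.graph (S.wt pw) :=
  ⟨S.wt_symm pw, fun u v h => lt_of_lt_of_le one_pos (S.wt_bounds hδ hp u v h).1,
    fun u v h => S.wt_zero hp u v h⟩

lemma GoodWeights.isNet {G : SimpleGraph V} {w : V → V → ℝ} (hw : GoodWeights G w)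
    (hG : ∀ v, ∃ u, G.Adj v u) : IsNet w := by
  have hnn : ∀ x y, 0 ≤ w x y := fun x y => by
    by_cases h : G.Adj x y
    · exact (hw.2.1 x y h).le
    · exact (hw.2.2 x y h).ge
  refine ⟨hw.1, hnn, fun x => hw.2.2 x x (G.loopless.irrefl x), fun x => ?_⟩
  obtain ⟨u, hu⟩ := hG x
  exact lt_of_lt_of_le (hw.2.1 x u hu) (single_le_sum (fun y _ => hnn x y) (mem_univ u))

open Classical in
lemma Glue.sum_inl (pw : T → ℝ) (t : T) (g : T ⊕ B → ℝ) :
    ∑ u, S.wt pw (.inl t) u * g u = pw t * g (.inl (S.par t))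
      + (∑ t', if S.par t' = t then pw t' * g (.inl t') else 0)
      + if S.lf t then g (.inr (S.att t)) else 0 := by
  rw [Fintype.sum_sum_type]
  simp only [Glue.wt]
  congr 1
  · simp only [add_mul, sum_add_distrib, ite_mul, zero_mul]
    congr 1
    simp
  · by_cases h : S.lf t <;> simp [h]

open Classical in
lemma Glue.sum_inr (pw : T → ℝ) (b : B) (g : T ⊕ B → ℝ) :
    ∑ u, S.wt pw (.inr b) u * g u = (∑ t, if S.lf t ∧ S.att t = b then g (.inl t) else 0)
      + ∑ b', unitW S.H b b' * g (.inr b') := by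
  rw [Fintype.sum_sum_type]
  simp [Glue.wt]

/-- the function equal to `φ` on the tree and to `c` on `H` -/
def Glue.lift (_ : Glue T B) (φ : T → ℝ) (c : ℝ) : T ⊕ B → ℝ := Sum.elim φ fun _ => c

open Classical in
lemma Glue.wlap_lift_inl (pw : T → ℝ) (φ : T → ℝ) (c : ℝ) (t : T) :
    wlap (S.wt pw) (S.lift φ c) (.inl t) = pw t * (φ (S.par t) - φ t)
      + (∑ t', if S.par t' = t then pw t' * (φ t' - φ t) else 0)
      + if S.lf t then c - φ t else 0 := by
  rw [wlap, S.sum_inl pw t fun u => S.lift φ c u - S.lift φ c (.inl t)]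
  simp [Glue.lift]

lemma Glue.wlap_lift_inr (pw : T → ℝ) (φ : T → ℝ) (c : ℝ) (b : B) :
    (∃ t, S.lf t ∧ wlap (S.wt pw) (S.lift φ c) (.inr b) = φ t - c) ∨
      wlap (S.wt pw) (S.lift φ c) (.inr b) = 0 := by
  classical
  rw [wlap, S.sum_inr pw b fun u => S.lift φ c u - S.lift φ c (.inr b)]
  simp only [Glue.lift, Sum.elim_inl, Sum.elim_inr, sub_self, mul_zero, sum_const_zero, add_zero]
  by_cases h : ∃ t, S.lf t ∧ S.att t = b
  · obtain ⟨t, ht, htb⟩ := h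
    left
    refine ⟨t, ht, ?_⟩
    rw [sum_eq_single t]
    · simp [ht, htb]
    · intro t' _ hne
      rw [if_neg]
      rintro ⟨h1, h2⟩
      exact hne (S.att_inj t' t h1 ht (h2.trans htb.symm))
    · simp
  · right
    refine sum_eq_zero fun t _ => if_neg fun h' => h ⟨t, h'⟩

lemma Glue.wdeg_inr_le (pw : T → ℝ) (b : B) : wdeg (S.wt pw) (.inr b) ≤ deg S.H b + 1 := by
  classical
  have h1 := S.sum_inr pw b fun _ => 1
  simp only [mul_one] at h1
  have h2 := wdeg_unitW S.H b
  rw [wdeg] at h2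
  rw [wdeg, h1, h2, add_comm]
  gcongr
  rw [← sum_filter, sum_const, nsmul_eq_mul, mul_one]
  have : #{t | S.lf t ∧ S.att t = b} ≤ 1 := by
    rw [card_le_one]
    intro t ht t' ht'
    simp only [mem_filter, mem_univ, true_and] at ht ht'
    exact S.att_inj t t' ht.1 ht'.1 (ht.2.trans ht'.2.symm)
  exact_mod_cast this

lemma Glue.energy_H_le {pw : T → ℝ} (hw : IsNet (S.wt pw)) (f : T ⊕ B → ℝ) :
    energy (unitW S.H) (fun b => f (.inr b)) ≤ energy (S.wt pw) f := by
  have h0 : ∀ x, 0 ≤ ∑ y, S.wt pw x y * (f x - f y) ^ 2 :=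
    fun x => sum_nonneg fun y _ => mul_nonneg (hw.nonneg x y) (sq_nonneg _)
  rw [energy, energy, Fintype.sum_sum_type]
  refine le_trans ?_ (le_add_of_nonneg_left (sum_nonneg fun t _ => h0 _))
  refine sum_le_sum fun b _ => ?_
  rw [Fintype.sum_sum_type]
  exact le_add_of_nonneg_left (sum_nonneg fun t _ => mul_nonneg (hw.nonneg _ _) (sq_nonneg _))

lemma Glue.one_le_wdeg {pw : T → ℝ} {δ : ℝ} (hδ : 0 ≤ δ) (hp : S.WtOk pw δ)
    (hw : IsNet (S.wt pw)) (u : T ⊕ B) : 1 ≤ wdeg (S.wt pw) u := by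
  by_contra hcon
  have h : ∀ v, S.wt pw u v = 0 := fun v => by
    by_contra hne
    have hadj : S.adj u v := by by_contra h; exact hne (S.wt_zero hp u v h)
    have h1 := (S.wt_bounds hδ hp u v hadj).1
    exact hcon (h1.trans (single_le_sum (fun y _ => hw.nonneg u y) (mem_univ v)))
  have := hw.pos u
  rw [wdeg, sum_eq_zero fun v _ => h v] at this
  exact lt_irrefl _ this

lemma Glue.connected (hH : S.H.Connected) (hlf : ∃ t, S.lf t) : S.graph.Connected := by
  have hroot : ∀ n t, S.depth t ≤ n → S.graph.Reachable (.inl t) (.inl S.root) := by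
    intro n
    induction n with
    | zero =>
      intro t ht
      by_cases h : t = S.root
      · rw [h]
      · have := S.depth_par t h; omega
    | succ n ih =>
      intro t ht
      by_cases h : t = S.root
      · rw [h]
      · have h1 := S.depth_par t h
        have hadj : S.graph.Adj (.inl t) (.inl (S.par t)) := ⟨(S.par_ne h).symm, Or.inl rfl⟩
        exact hadj.reachable.trans (ih _ (by omega))
  obtain ⟨l, hl⟩ := hlf
  have hB : ∀ b b', S.graph.Reachable (.inr b) (.inr b') := by
    intro b b'
    obtain ⟨p⟩ := hH.preconnected b b'
    exact ⟨p.map ⟨Sum.inr, fun h => h⟩⟩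
  have hadj : S.graph.Adj (.inr (S.att l)) (.inl l) := ⟨hl, rfl⟩
  have hall : ∀ u, S.graph.Reachable u (.inl S.root) := by
    rintro (t | b)
    · exact hroot _ t le_rfl
    · exact (hB b (S.att l)).trans (hadj.reachable.trans (hroot _ l le_rfl))
  have : Nonempty (T ⊕ B) := ⟨.inl S.root⟩
  exact ⟨fun u v => (hall u).trans (hall v).symm⟩

lemma connected_of_poincare [Nonempty V] (H : SimpleGraph V) {Λ : ℝ}
    (hP : ∀ f : V → ℝ, ∃ a, ∑ x, (f x - a) ^ 2 ≤ Λ * energy (unitW H) f) : H.Connected := by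
  classical
  refine ⟨fun u v => ?_⟩
  obtain ⟨a, ha⟩ := hP fun x => if H.Reachable u x then 1 else 0
  have he : energy (unitW H) (fun x => if H.Reachable u x then (1 : ℝ) else 0) = 0 := by
    rw [energy]
    refine sum_eq_zero fun x _ => sum_eq_zero fun y _ => ?_
    by_cases h : H.Adj x y
    · have : H.Reachable u x ↔ H.Reachable u y :=
        ⟨fun h' => h'.trans h.reachable, fun h' => h'.trans h.symm.reachable⟩
      simp [this]
    · simp [unitW, h]
  rw [he, mul_zero] at ha
  have h0 := (sum_eq_zero_iff_of_nonneg fun x _ => sq_nonneg _).mp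
    (le_antisymm ha (sum_nonneg fun x _ => sq_nonneg _))
  have hu := h0 u (mem_univ u)
  have hv := h0 v (mem_univ v)
  rw [if_pos (SimpleGraph.Reachable.refl u)] at hu
  by_contra hcon
  rw [if_neg hcon] at hv
  have h1 := pow_eq_zero_iff (two_ne_zero) |>.mp hu
  have h2 := pow_eq_zero_iff (two_ne_zero) |>.mp hv
  linarith

end glue

end

section

section girth

variable {T B : Type} [Fintype T] [DecidableEq T] [Fintype B] [DecidableEq B] (S : Glue T B)

open SimpleGraph

/-- the inclusion of `H` in the glued graph -/
def Glue.incl : S.H →g S.graph := ⟨Sum.inr, fun h => h⟩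

lemma Glue.exists_lift_walk {u v : T ⊕ B} (p : S.graph.Walk u v)
    (hp : ∀ t, .inl t ∉ p.support) : ∀ b b', (hu : u = .inr b) → (hv : v = .inr b') →
      ∃ q : S.H.Walk b b', p.copy hu hv = q.map S.incl := by
  induction p with
  | nil =>
    rintro b b' rfl hv
    obtain rfl : b = b' := Sum.inr_injective hv
    exact ⟨.nil, rfl⟩
  | @cons u w v h p ih =>
    rintro b b' rfl rfl
    rcases w with t | c
    · exact absurd (by simp) (hp t)
    · obtain ⟨q, hq⟩ := ih (fun t ht => hp t (by simp [ht])) c b' rfl rfl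
      rw [Walk.copy_rfl_rfl] at hq
      refine ⟨.cons (show S.H.Adj b c from h) q, ?_⟩
      subst hq
      rfl

lemma Glue.exists_exit {u v : T ⊕ B} (p : S.graph.Walk u v) : ∀ b t, u = .inr b → v = .inl t →
    ∃ b' t', ∃ q : S.H.Walk b b', S.lf t' ∧ S.att t' = b' ∧ q.length ≤ p.length ∧
      s(Sum.inl t', Sum.inr b') ∈ p.edges := by
  induction p with
  | nil => rintro b t rfl h; cases h
  | @cons u w v h p ih =>
    rintro b t rfl rfl
    rcases w with t' | c
    · exact ⟨b, t', .nil, h.1, h.2, by simp, by simp [Sym2.eq_swap]⟩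
    · obtain ⟨b', t', q, h1, h2, h3, h4⟩ := ih c t rfl rfl
      exact ⟨b', t', .cons (show S.H.Adj b c from h) q, h1, h2, Nat.succ_le_succ h3,
        by simp [h4]⟩

lemma Glue.exists_entry {u v : T ⊕ B} (p : S.graph.Walk u v) : ∀ t b, u = .inl t →
    .inr b ∈ p.support → ∃ t1 b1, ∃ (A : S.graph.Walk u (.inl t1))
      (h : S.graph.Adj (.inl t1) (.inr b1)) (C : S.graph.Walk (.inr b1) v),
      p = A.append (.cons h C) := by
  induction p with
  | nil => rintro t b rfl h; simp at h
  | @cons u w v h p ih =>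
    rintro t b rfl hb
    rcases w with t' | c
    · obtain ⟨t1, b1, A, h1, C, hC⟩ := ih t' b rfl (by simpa using hb)
      exact ⟨t1, b1, .cons h A, h1, C, by rw [hC]; rfl⟩
    · exact ⟨t, c, .nil, h, p, rfl⟩

theorem Glue.le_length_of_isCycle {g : ℕ} (hH : ∀ b, ∀ p : S.H.Walk b b, p.IsCycle → g ≤ p.length)
    (hW : ∀ t t', S.lf t → S.lf t' → t ≠ t' → ∀ p : S.H.Walk (S.att t) (S.att t'), g ≤ p.length)
    {v : T ⊕ B} (p : S.graph.Walk v v) (hp : p.IsCycle) : g ≤ p.length := by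
  classical
  by_cases htree : ∃ t, .inl t ∈ p.support
  swap
  · push Not at htree
    rcases v with t | b
    · exact absurd p.start_mem_support (htree t)
    · obtain ⟨q, hq⟩ := S.exists_lift_walk p htree b b rfl rfl
      rw [Walk.copy_rfl_rfl] at hq
      have h1 : (q.map S.incl).length = q.length := Walk.length_map ..
      have h2 : (q.map S.incl).IsCycle ↔ q.IsCycle :=
        Walk.isCycle_map_iff_of_injective Sum.inr_injective
      subst hq
      exact (hH b q (h2.mp hp)).trans h1.ge
  by_cases hbulk : ∃ b, .inr b ∈ p.support
  · obtain ⟨t0, ht0⟩ := htree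
    obtain ⟨b0, hb0⟩ := hbulk
    have hc := hp.rotate ht0
    have hlen : (p.rotate _ ht0).length = p.length := by rw [Walk.length_rotate]
    have hb0' : (Sum.inr b0 : T ⊕ B) ∈ (p.rotate _ ht0).support := by
      simpa using hb0
    obtain ⟨t1, b1, A, h, C, hAC⟩ := S.exists_entry _ t0 b0 rfl hb0'
    obtain ⟨b', t', q, h1, h2, h3, h4⟩ := S.exists_exit C b1 t0 rfl rfl
    have hnd := hc.isTrail.edges_nodup
    rw [hAC, Walk.edges_append, Walk.edges_cons] at hnd
    have hnot := (List.nodup_cons.mp (List.nodup_append.mp hnd).2.1).1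
    have hne : t1 ≠ t' := by
      rintro rfl
      have hb : b1 = b' := h.2.symm.trans h2
      exact hnot (hb ▸ h4)
    have hl2 : (A.append (.cons h C)).length = A.length + (C.length + 1) := by
      rw [Walk.length_append, Walk.length_cons]
    rw [← hAC] at hl2
    obtain ⟨h5, h6⟩ : S.lf t1 ∧ S.att t1 = b1 := h
    subst h6
    subst h2
    have := hW t1 t' h5 h1 hne q
    omega
  · exfalso
    push Not at hbulk
    set X : Finset T := {t | .inl t ∈ p.support} with hX
    obtain ⟨t, ht, hmax⟩ := exists_max_image X S.depth
      (by obtain ⟨t, ht⟩ := htree; exact ⟨t, by simp [hX, ht]⟩)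
    have ht' : .inl t ∈ p.support := by simpa [hX] using ht
    have hc := hp.rotate ht'
    have hone : ∀ u, S.graph.Adj (.inl t) u → u ∈ (p.rotate _ ht').support → u = .inl (S.par t) := by
      rintro (t' | b) hu hmem
      · obtain ⟨hne, h | h⟩ := hu
        · rw [h]
        · exfalso
          have hr : t' ≠ S.root := fun hr => by
            rw [hr, S.par_root] at h; exact hne (h.symm.trans hr.symm)
          have h1 := S.depth_par t' hr
          have h2 := hmax t' (by
            rw [hX, mem_filter]
            exact ⟨mem_univ _, by simpa using hmem⟩)
          rw [h] at h1
          omega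
      · exact absurd (by simpa using hmem) (hbulk b)
    have hnil := hc.not_nil
    have h1 := hone _ (Walk.adj_snd hnil) (Walk.getVert_mem_support _ _)
    have h2 := hone _ (Walk.adj_penultimate hnil).symm (Walk.getVert_mem_support _ _)
    exact hc.snd_ne_penultimate (h1.trans h2.symm)

theorem Glue.exists_cycle {l l' : T} (hl : S.lf l) (hl' : S.lf l') (hne : l ≠ l')
    (hpar : S.par l = S.par l') (hr : l ≠ S.root) (hr' : l' ≠ S.root)
    (q : S.H.Walk (S.att l) (S.att l')) :
    ∃ p : S.graph.Walk (.inl l) (.inl l), p.IsCycle ∧ p.length ≤ q.length + 4 := by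
  classical
  have e1 : S.graph.Adj (.inl l) (.inr (S.att l)) := ⟨hl, rfl⟩
  have e2 : S.graph.Adj (.inr (S.att l')) (.inl l') := ⟨hl', rfl⟩
  have e3 : S.graph.Adj (.inl l') (.inl (S.par l)) :=
    ⟨by rw [hpar]; exact (S.par_ne hr').symm, Or.inl hpar.symm⟩
  have e4 : S.graph.Adj (.inl (S.par l)) (.inl l) := ⟨S.par_ne hr, Or.inr rfl⟩
  obtain ⟨q', hq', hq'e⟩ : ∃ q' : S.graph.Walk (.inr (S.att l)) (.inr (S.att l')),
      q'.length = q.length ∧ ∀ e ∈ q'.edges, Sum.inl l ∉ e := by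
    refine ⟨q.map S.incl, Walk.length_map .., fun e he => ?_⟩
    have he' : e ∈ q.edges.map (Sym2.map S.incl) := by
      rw [← Walk.edges_map]; exact he
    obtain ⟨e', _, rfl⟩ := List.mem_map.mp he'
    induction e' using Sym2.ind with
    | _ x y =>
      rw [Sym2.map_mk, Sym2.mem_iff]
      rintro (h | h) <;> cases h
  let p0 : S.graph.Walk (.inr (S.att l)) (.inl l) :=
    q'.append (.cons e2 (.cons e3 (.cons e4 .nil)))
  have hp0 : s(Sum.inl l, Sum.inr (S.att l)) ∉ p0.edges := by
    intro h
    simp only [p0, Walk.edges_append, Walk.edges_cons, Walk.edges_nil,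
      List.mem_append, List.mem_cons, List.not_mem_nil, or_false] at h
    rcases h with h | h | h | h
    · exact hq'e _ h (Sym2.mem_mk_left _ _)
    · rw [Sym2.eq_iff] at h
      rcases h with ⟨h, _⟩ | ⟨h, _⟩
      · cases h
      · exact hne (Sum.inl_injective h)
    · rw [Sym2.eq_iff] at h
      rcases h with ⟨_, h⟩ | ⟨_, h⟩ <;> cases h
    · rw [Sym2.eq_iff] at h
      rcases h with ⟨_, h⟩ | ⟨_, h⟩ <;> cases h
  refine ⟨.cons e1 p0.bypass, ?_, ?_⟩
  · rw [Walk.cons_isCycle_iff]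
    exact ⟨p0.bypass_isPath, fun h => hp0 (p0.edges_bypass_subset_edges h)⟩
  · have := p0.length_bypass_le_length
    simp only [Walk.length_cons]
    have h2 : p0.length = q.length + 3 := by simp [p0, hq']
    omega

theorem Glue.girth_bounds {g C : ℕ}
    (hH : ∀ b, ∀ p : S.H.Walk b b, p.IsCycle → g ≤ p.length)
    (hW : ∀ t t', S.lf t → S.lf t' → t ≠ t' → ∀ p : S.H.Walk (S.att t) (S.att t'), g ≤ p.length)
    (hd : ∀ b b', ∃ q : S.H.Walk b b', q.length ≤ C)
    {l l' : T} (hl : S.lf l) (hl' : S.lf l') (hne : l ≠ l')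
    (hpar : S.par l = S.par l') (hr : l ≠ S.root) (hr' : l' ≠ S.root) :
    ¬ S.graph.IsAcyclic ∧ g ≤ S.graph.girth ∧ S.graph.girth ≤ C + 4 := by
  obtain ⟨q, hq⟩ := hd (S.att l) (S.att l')
  obtain ⟨p, hp, hpl⟩ := S.exists_cycle hl hl' hne hpar hr hr' q
  have hac : ¬ S.graph.IsAcyclic := fun h => h p hp
  refine ⟨hac, ?_, ?_⟩
  · obtain ⟨a, w, hw, he⟩ := S.graph.exists_girth_eq_length.mpr hac
    rw [he]
    exact S.le_length_of_isCycle hH hW w hw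
  · have := S.graph.girth_le_length hp
    omega

end girth

end

section

section separated

open Classical in
lemma card_ball_le (H : SimpleGraph V) {D : ℕ} (hD : ∀ v, deg H v ≤ D) (n : ℕ) (v : V) :
    #{u | ∃ p : H.Walk v u, p.length ≤ n} ≤ (D + 1) ^ (n + 1) := by
  induction n generalizing v with
  | zero =>
    refine (card_le_one.mpr ?_).trans (Nat.one_le_pow _ _ (by omega))
    intro a ha b hb
    simp only [mem_filter, mem_univ, true_and] at ha hb
    obtain ⟨p, hp⟩ := ha
    obtain ⟨q, hq⟩ := hb
    have h1 := SimpleGraph.Walk.eq_of_length_eq_zero (Nat.le_zero.mp hp)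
    have h2 := SimpleGraph.Walk.eq_of_length_eq_zero (Nat.le_zero.mp hq)
    rw [← h1, ← h2]
  | succ n ih =>
    have hsub : ({u | ∃ p : H.Walk v u, p.length ≤ n + 1} : Finset V) ⊆
        {v} ∪ ({w | H.Adj v w} : Finset V).biUnion fun w => {u | ∃ p : H.Walk w u, p.length ≤ n} := by
      intro u hu
      simp only [mem_filter, mem_univ, true_and] at hu
      obtain ⟨p, hp⟩ := hu
      cases p with
      | nil => simp
      | @cons _ w _ h p =>
        rw [SimpleGraph.Walk.length_cons] at hp
        refine mem_union_right _ (mem_biUnion.mpr ⟨w, by simpa using h, ?_⟩)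
        rw [mem_filter]
        exact ⟨mem_univ _, p, by omega⟩
    refine (card_le_card hsub).trans ((card_union_le _ _).trans ?_)
    rw [card_singleton]
    have h1 : #(({w | H.Adj v w} : Finset V).biUnion fun w =>
        ({u | ∃ p : H.Walk w u, p.length ≤ n} : Finset V)) ≤ D * (D + 1) ^ (n + 1) := by
      refine (card_biUnion_le_card_mul _ _ _ fun w _ => ih w).trans ?_
      refine Nat.mul_le_mul_right _ ?_
      rw [← deg_eq_card_filter]
      exact hD v
    have h2 : 1 ≤ (D + 1) ^ (n + 1) := Nat.one_le_pow _ _ (by omega)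
    calc _ ≤ 1 + D * (D + 1) ^ (n + 1) := Nat.add_le_add_left h1 1
      _ ≤ (D + 1) ^ (n + 1) + D * (D + 1) ^ (n + 1) := Nat.add_le_add_right h2 _
      _ = (D + 1) ^ (n + 1 + 1) := by ring

lemma exists_separated (H : SimpleGraph V) {D : ℕ} (hD : ∀ v, deg H v ≤ D) (g : ℕ) :
    ∃ W : Finset V, (∀ a ∈ W, ∀ b ∈ W, a ≠ b → ∀ p : H.Walk a b, g ≤ p.length) ∧
      Fintype.card V ≤ #W * (D + 1) ^ (g + 1) := by
  classical
  set X : Finset (Finset V) :=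
    {W | ∀ a ∈ W, ∀ b ∈ W, a ≠ b → ∀ p : H.Walk a b, g ≤ p.length} with hX
  obtain ⟨W, hW, hmax⟩ := exists_max_image X card ⟨∅, by simp [hX]⟩
  have hW' : ∀ a ∈ W, ∀ b ∈ W, a ≠ b → ∀ p : H.Walk a b, g ≤ p.length := by
    rw [hX, mem_filter] at hW; exact hW.2
  refine ⟨W, hW', ?_⟩
  have hcover : (univ : Finset V) ⊆ W.biUnion fun w => {u | ∃ p : H.Walk w u, p.length ≤ g} := by
    intro u _
    by_contra hu
    simp only [mem_biUnion, mem_filter, mem_univ, true_and, not_exists, not_and, not_le] at hu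
    have huW : u ∉ W := fun h => by
      have := hu u h .nil
      simp at this
    have hins : insert u W ∈ X := by
      rw [hX, mem_filter]
      refine ⟨mem_univ _, fun a ha b hb hab p => ?_⟩
      rw [mem_insert] at ha hb
      rcases ha with rfl | ha <;> rcases hb with rfl | hb
      · exact absurd rfl hab
      · have := hu b hb p.reverse
        rw [SimpleGraph.Walk.length_reverse] at this
        exact this.le
      · exact (hu a ha p).le
      · exact hW' a ha b hb hab p
    have := hmax _ hins
    rw [card_insert_of_notMem huW] at this
    omega
  calc Fintype.card V = #(univ : Finset V) := rfl
    _ ≤ _ := card_le_card hcover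
    _ ≤ _ := card_biUnion_le_card_mul _ _ _ fun w _ => card_ball_le H hD g w

lemma isNet_unitW (H : SimpleGraph V) (hH : ∀ v, ∃ u, H.Adj v u) : IsNet (unitW H) := by
  refine GoodWeights.isNet (G := H) ⟨fun u v => ?_, fun u v h => ?_, fun u v h => ?_⟩ hH
  · by_cases h : H.Adj u v
    · rw [unitW, unitW, if_pos h, if_pos h.symm]
    · rw [unitW, unitW, if_neg h, if_neg fun h' => h h'.symm]
  · rw [unitW, if_pos h]; exact one_pos
  · rw [unitW, if_neg h]

lemma exists_walk_of_iterate_ne_zero (H : SimpleGraph V) (hw : IsNet (unitW H)) (f : V → ℝ)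
    (v : V) (t : ℕ) (h : (wop (unitW H))^[t] f v ≠ 0) :
    ∃ u, f u ≠ 0 ∧ ∃ p : H.Walk v u, p.length ≤ t := by
  induction t generalizing v with
  | zero => exact ⟨v, h, .nil, le_rfl⟩
  | succ t ih =>
    rw [Function.iterate_succ_apply', wop_eq hw] at h
    by_cases h0 : (wop (unitW H))^[t] f v = 0
    · have h1 : wlap (unitW H) ((wop (unitW H))^[t] f) v ≠ 0 := by
        intro h1; rw [h0, h1] at h; simp at h
      obtain ⟨u, _, hu⟩ := exists_ne_zero_of_sum_ne_zero h1
      have hadj : H.Adj v u := by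
        by_contra hn
        rw [unitW, if_neg hn, zero_mul] at hu
        exact hu rfl
      rw [h0, sub_zero] at hu
      obtain ⟨x, hx, p, hp⟩ := ih u (right_ne_zero_of_mul hu)
      exact ⟨x, hx, .cons hadj p, Nat.succ_le_succ hp⟩
    · obtain ⟨x, hx, p, hp⟩ := ih v h0
      exact ⟨x, hx, p, by omega⟩

lemma wop_iterate_add_const {w : V → V → ℝ} (hw : IsNet w) (f : V → ℝ) (c : ℝ) (t : ℕ) :
    (wop w)^[t] (fun y => f y + c) = fun y => (wop w)^[t] f y + c := by
  induction t with
  | zero => rfl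
  | succ t ih =>
    funext y
    rw [Function.iterate_succ_apply', Function.iterate_succ_apply', ih, wop_add_const hw]

lemma exists_short_walk (H : SimpleGraph V) (hH : ∀ v, ∃ u, H.Adj v u) {D : ℕ}
    (hD : ∀ v, deg H v ≤ D) {Λ : ℝ} (hΛ : 1 ≤ Λ) (hP : Poinc (unitW H) Λ) (t : ℕ)
    (ht : (D : ℝ) ^ 3 * (Fintype.card V : ℝ) ^ 2 * (1 - 1 / (4 * Λ)) ^ t < 1) (b b' : V) :
    ∃ p : H.Walk b b', p.length ≤ t := by
  have hw := isNet_unitW H hH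
  by_contra hcon
  push Not at hcon
  set f : V → ℝ := fun y => if y = b' then 1 else 0 with hf
  set S := ∑ x, wdeg (unitW H) x with hS
  have : Nonempty V := ⟨b⟩
  have hSpos : 0 < S := hw.sum_pos
  set a := wdeg (unitW H) b' / S with ha
  have h1 : ∀ v, 1 ≤ wdeg (unitW H) v := fun v => by
    obtain ⟨u, hu⟩ := hH v
    refine le_trans ?_ (single_le_sum (fun y _ => hw.nonneg v y) (mem_univ u))
    rw [unitW, if_pos hu]
  have hdle : ∀ v, wdeg (unitW H) v ≤ D := fun v => by
    rw [wdeg_unitW]; exact_mod_cast hD v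
  have hsumf : ∑ x, wdeg (unitW H) x * f x = wdeg (unitW H) b' := by simp [hf]
  have hmean : ∑ x, wdeg (unitW H) x * (f x + -a) = 0 := by
    simp only [mul_add, sum_add_distrib, hsumf, ← sum_mul]
    rw [← hS, ha]
    field_simp
    ring
  have hzero : (wop (unitW H))^[t] f b = 0 := by
    by_contra hne
    obtain ⟨u, hu, p, hp⟩ := exists_walk_of_iterate_ne_zero H hw f b t hne
    have : u = b' := by by_contra h; simp [hf, h] at hu
    subst this
    exact absurd hp (not_le.mpr (hcon p))
  have h2 := (hP.contract_iterate hw hΛ _ hmean t).2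
  rw [wop_iterate_add_const hw] at h2
  have h3 : wdeg (unitW H) b * a ^ 2 ≤
      ∑ x, wdeg (unitW H) x * ((wop (unitW H))^[t] f x + -a) ^ 2 := by
    refine le_trans (le_of_eq ?_) (single_le_sum
      (f := fun x => wdeg (unitW H) x * ((wop (unitW H))^[t] f x + -a) ^ 2)
      (fun y _ => mul_nonneg (hw.pos y).le (sq_nonneg _)) (mem_univ b))
    simp only [hzero]
    ring
  have h4 : ∑ x, wdeg (unitW H) x * (f x + -a) ^ 2 ≤ D := by
    have e : ∑ x, wdeg (unitW H) x * (f x + -a) ^ 2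
        = ∑ x, wdeg (unitW H) x * f x - a * ∑ x, wdeg (unitW H) x * f x
          - a * ∑ x, wdeg (unitW H) x * (f x + -a) := by
      rw [mul_sum, mul_sum, ← sum_sub_distrib, ← sum_sub_distrib]
      refine sum_congr rfl fun x _ => ?_
      have : f x ^ 2 = f x := by by_cases h : x = b' <;> simp [hf, h]
      linear_combination (wdeg (unitW H) x) * this
    rw [e, hmean, hsumf]
    have : 0 ≤ a * wdeg (unitW H) b' := mul_nonneg (div_nonneg (hw.pos b').le hSpos.le) (hw.pos b').le
    linarith [hdle b']
  have hρ : 0 ≤ (1 - 1 / (4 * Λ)) ^ t := by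
    apply pow_nonneg
    rw [sub_nonneg, div_le_one (by linarith)]
    linarith
  have hSle : S ≤ D * Fintype.card V := by
    rw [hS]
    refine (sum_le_sum fun x _ => hdle x).trans ?_
    rw [sum_const, nsmul_eq_mul, card_univ, mul_comm]
  have hD1 : (1 : ℝ) ≤ D := (h1 b).trans (hdle b)
  have ha1 : 1 ≤ a * (D * Fintype.card V) := by
    have : a * S = wdeg (unitW H) b' := by rw [ha]; field_simp
    calc (1 : ℝ) ≤ a * S := by rw [this]; exact h1 b'
      _ ≤ _ := mul_le_mul_of_nonneg_left hSle (div_nonneg (hw.pos b').le hSpos.le)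
  have h5 : a ^ 2 ≤ (1 - 1 / (4 * Λ)) ^ t * D := by
    have : a ^ 2 ≤ wdeg (unitW H) b * a ^ 2 := le_mul_of_one_le_left (sq_nonneg a) (h1 b)
    exact this.trans (h3.trans (h2.trans (mul_le_mul_of_nonneg_left h4 hρ)))
  have h6 : (1 : ℝ) ≤ (a * (D * Fintype.card V)) ^ 2 := one_le_pow₀ ha1
  have h7 : (a * (D * Fintype.card V : ℝ)) ^ 2
      ≤ (1 - 1 / (4 * Λ)) ^ t * D * (D * Fintype.card V) ^ 2 := by
    rw [mul_pow]
    exact mul_le_mul_of_nonneg_right h5 (sq_nonneg _)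
  have h8 : (1 - 1 / (4 * Λ)) ^ t * D * (D * Fintype.card V : ℝ) ^ 2
      = (D : ℝ) ^ 3 * (Fintype.card V : ℝ) ^ 2 * (1 - 1 / (4 * Λ)) ^ t := by ring
  linarith

lemma Poinc.of_sum_sq (H : SimpleGraph V) {D : ℕ} (hD : ∀ v, deg H v ≤ D) {Λ : ℝ}
    (hP : ∀ f : V → ℝ, ∃ a, ∑ x, (f x - a) ^ 2 ≤ Λ * energy (unitW H) f) :
    Poinc (unitW H) (D * Λ) := by
  intro f
  obtain ⟨a, ha⟩ := hP f
  refine ⟨a, ?_⟩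
  calc ∑ x, wdeg (unitW H) x * (f x - a) ^ 2 ≤ ∑ x, (D : ℝ) * (f x - a) ^ 2 := by
        refine sum_le_sum fun x _ => mul_le_mul_of_nonneg_right ?_ (sq_nonneg _)
        rw [wdeg_unitW]; exact_mod_cast hD x
    _ ≤ D * Λ * energy (unitW H) f := by
        rw [← mul_sum, mul_assoc]
        exact mul_le_mul_of_nonneg_left ha (Nat.cast_nonneg D)

end separated

end

section

section tree

/-- parameters of the tree: `r` is the length of a block, `m` the height of the binary trees hung
at the slow vertices, `H` the height of the slow region and `H + F` the height of the tree -/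
structure TP where
  r : ℕ
  m : ℕ
  H : ℕ
  F : ℕ

variable (P : TP)

/-- the sign of a step down the tree -/
def sgn (a : Fin 4) : ℤ := if a.val < 2 then -1 else 1

/-- the sum of the signs in the current block -/
def TP.bs : List (Fin 4) → ℤ
  | [] => 0
  | a :: x => if (x.length + 1) % P.r = 0 then 0 else TP.bs x + sgn a

/-- all the completed blocks have negative sums -/
def TP.alive : List (Fin 4) → Prop
  | [] => True
  | a :: x => TP.alive x ∧ ((x.length + 1) % P.r = 0 → P.bs x + sgn a < 0)

/-- the vertices at which a binary tree is hung -/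
def TP.slow (x : List (Fin 4)) : Prop := P.alive x ∧ x.length < P.H

lemma TP.slow.tail {P : TP} {a : Fin 4} {x : List (Fin 4)} (h : P.slow (a :: x)) : P.slow x :=
  ⟨h.1.1, by have := h.2; rw [List.length_cons] at this; omega⟩

/-- the pairs (vertex of the 4-ary tree, vertex of the binary tree hung there) -/
def TP.valid (p : List (Fin 4) × List Bool) : Prop :=
  p.1.length ≤ P.H + P.F ∧ p.2.length ≤ P.m ∧ (p.2 ≠ [] → P.slow p.1) ∧ p.2.getLast? ≠ some true

lemma TP.finite_valid : {p | P.valid p}.Finite := by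
  refine ((List.finite_length_le (Fin 4) (P.H + P.F)).prod
    (List.finite_length_le Bool P.m)).subset ?_
  rintro ⟨x, y⟩ h
  exact ⟨h.1, h.2.1⟩

/-- the vertices of the tree -/
def TP.set : Finset (List (Fin 4) × List Bool) := P.finite_valid.toFinset

lemma TP.mem_set {p : List (Fin 4) × List Bool} : p ∈ P.set ↔ P.valid p := by
  simp [TP.set]

/-- the vertices of the tree -/
abbrev TP.T := {p // p ∈ P.set}

/-- parent -/
def rpar : List (Fin 4) × List Bool → List (Fin 4) × List Bool
  | (x, []) => (x.tail, [])
  | (x, _ :: y) => (x, y)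

/-- weight of a step down the 4-ary tree -/
def cw (δ : ℝ) (a : Fin 4) : ℝ := if a.val < 2 then 1 + δ else 1

/-- weight of the edge to the parent, on the 4-ary tree -/
def cp (δ : ℝ) : List (Fin 4) → ℝ
  | [] => 0
  | a :: _ => cw δ a

/-- weight of the edge to the parent -/
def rpw (δ : ℝ) : List (Fin 4) × List Bool → ℝ
  | (x, []) => cp δ x
  | (_, _ :: _) => 1

lemma TP.valid_rpar {p : List (Fin 4) × List Bool} (h : P.valid p) : P.valid (rpar p) := by
  obtain ⟨x, y⟩ := p
  obtain ⟨h1, h2, h3, h4⟩ := h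
  cases y with
  | nil => exact ⟨by simp only [rpar, List.length_tail]; simp only at h1; omega, by simp [rpar],
      by simp [rpar], by simp [rpar]⟩
  | cons b y =>
    refine ⟨h1, by simp only [rpar]; simp only [List.length_cons] at h2; omega,
      fun _ => h3 (by simp), ?_⟩
    cases y with
    | nil => simp [rpar]
    | cons c y => simpa [rpar] using h4

/-- `t` is at the vertex `x` of the 4-ary tree and at depth `q` in the tree hung there -/
lemma TP.base_mem {x : List (Fin 4)} (hx : x.length ≤ P.H + P.F) : (x, []) ∈ P.set :=
  P.mem_set.mpr ⟨hx, by simp, by simp, by simp⟩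

/-- the root of the tree -/
def TP.root : P.T := ⟨([], []), P.base_mem (Nat.zero_le _)⟩

/-- side conditions on the parameters -/
structure TP.Ok (P : TP) : Prop where
  hm : 1 ≤ P.m
  hH : 1 ≤ P.H
  hF : 1 ≤ P.F

/-- a graph `G` without isolated vertices, with distinct vertices of `G` assigned to the leaves -/
structure TP.Net (P : TP) (B : Type) where
  ok : P.Ok
  G : SimpleGraph B
  hG : ∀ b, ∃ b', G.Adj b b'
  att : P.T → B
  att_inj : ∀ t t' : P.T, t.1.1.length = P.H + P.F → t'.1.1.length = P.H + P.F →
    att t = att t' → t = t'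

/-- the tree glued to the graph -/
def TP.Net.S {P : TP} {B : Type} (N : P.Net B) :
    Glue P.T B where
  par t := ⟨rpar t.1, P.mem_set.mpr (P.valid_rpar (P.mem_set.mp t.2))⟩
  depth t := t.1.1.length + t.1.2.length
  lf t := t.1.1.length = P.H + P.F
  att := N.att
  H := N.G
  root := P.root
  par_root := rfl
  depth_par := by
    rintro ⟨⟨x, y⟩, h⟩ hr
    cases y with
    | nil =>
      cases x with
      | nil => exact absurd rfl hr
      | cons a x => simp [rpar]
    | cons b y => simp [rpar]; omega
  att_inj := N.att_inj

variable {B : Type} [Fintype B] [DecidableEq B]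

/-- weights of the edges to the parents -/
def TP.pw (δ : ℝ) (t : P.T) : ℝ := rpw δ t.1

variable {δ : ℝ}

lemma cw_bounds (hδ : 0 ≤ δ) (a : Fin 4) : 1 ≤ cw δ a ∧ cw δ a ≤ 1 + δ := by
  unfold cw; split_ifs <;> constructor <;> linarith

lemma cp_bounds (hδ : 0 ≤ δ) (x : List (Fin 4)) : 0 ≤ cp δ x ∧ cp δ x ≤ 1 + δ := by
  cases x with
  | nil => simp only [cp]; constructor <;> linarith
  | cons a x => have := cw_bounds hδ a; simp only [cp]; constructor <;> linarith

lemma sum_cw (δ : ℝ) : ∑ a, cw δ a = 4 + 2 * δ := by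
  rw [Fin.sum_univ_four]; norm_num [cw]; ring

variable {P}

lemma TP.Net.wtOk (N : P.Net B) (hδ : 0 ≤ δ) : N.S.WtOk (P.pw δ) δ := by
  have h : ∀ t : P.T, t ≠ P.root → 1 ≤ P.pw δ t ∧ P.pw δ t ≤ 1 + δ := by
    rintro ⟨⟨x, y⟩, h⟩ hr
    cases y with
    | nil =>
      cases x with
      | nil => exact absurd rfl hr
      | cons a x => exact cw_bounds hδ a
    | cons b y => exact ⟨le_rfl, by simp only [TP.pw, rpw]; linarith⟩
  exact ⟨rfl, fun t ht => (h t ht).1, fun t ht => (h t ht).2⟩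

open Classical in
lemma TP.sum_kids_base (hP : P.Ok) (δ : ℝ) (g : List (Fin 4) × List Bool → ℝ) {x : List (Fin 4)}
    (hx : x.length ≤ P.H + P.F) (h0 : x = [] → g ([], []) = 0) :
    ∑ t : P.T, (if rpar t.1 = (x, []) then rpw δ t.1 * g t.1 else 0)
      = (if x.length < P.H + P.F then ∑ a, cw δ a * g (a :: x, []) else 0)
        + if P.slow x then g (x, [false]) else 0 := by
  have e1 := sum_coe_sort P.set
    fun p => if rpar p = (x, []) then rpw δ p * g p else 0
  rw [e1]
  set K : Finset (List (Fin 4) × List Bool) :=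
    (univ.image fun a : Fin 4 => (a :: x, ([] : List Bool))) ∪ {(x, [false])} with hK
  have hKd : Disjoint (univ.image fun a : Fin 4 => (a :: x, ([] : List Bool))) {(x, [false])} := by
    rw [disjoint_singleton_right]; simp
  have hv1 : ∀ a : Fin 4, (a :: x, ([] : List Bool)) ∈ P.set ↔ x.length < P.H + P.F := by
    intro a
    rw [P.mem_set]
    simp only [TP.valid, List.length_cons, List.length_nil, ne_eq, not_true_eq_false,
      IsEmpty.forall_iff, List.getLast?_nil]
    simp
  have hv2 : (x, [false]) ∈ P.set ↔ P.slow x := by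
    rw [P.mem_set]
    have := hP.hm
    simp [TP.valid, hx, this]
  have e2 : ∑ p ∈ P.set, (if rpar p = (x, []) then rpw δ p * g p else 0)
      = ∑ p ∈ K, if p ∈ P.set then rpw δ p * g p else 0 := by
    rw [← sum_filter, ← sum_filter]
    symm
    refine sum_subset_zero_on_sdiff ?_ ?_ fun _ _ => rfl
    · intro p hp
      rw [mem_filter] at hp ⊢
      refine ⟨hp.2, ?_⟩
      have := hp.1
      rw [hK, mem_union, mem_image, mem_singleton] at this
      rcases this with ⟨a, _, rfl⟩ | rfl <;> rfl
    · rintro ⟨z, y⟩ hp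
      rw [Finset.mem_sdiff, mem_filter, mem_filter] at hp
      obtain ⟨⟨h1, h2⟩, h3⟩ := hp
      cases y with
      | nil =>
        cases z with
        | nil =>
          have : x = [] := by simpa [rpar] using h2.symm
          rw [h0 this, mul_zero]
        | cons a z =>
          exfalso
          apply h3
          have : z = x := by simpa [rpar] using h2
          subst this
          exact ⟨by simp [hK], h1⟩
      | cons b y =>
        exfalso
        apply h3
        obtain ⟨rfl, rfl⟩ : z = x ∧ y = [] := by simpa [rpar] using h2
        have hb : b = false := by
          have := (P.mem_set.mp h1).2.2.2
          simpa using this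
        subst hb
        exact ⟨by simp [hK], h1⟩
  rw [e2, hK, sum_union hKd, sum_image fun a _ b _ h => by simpa using h, sum_singleton]
  simp only [hv1, hv2]
  congr 1
  · by_cases h : x.length < P.H + P.F <;> simp [h, rpw, cp]
  · simp [rpw]

open Classical in
lemma TP.sum_kids_hold (δ : ℝ) (g : List (Fin 4) × List Bool → ℝ) {x : List (Fin 4)}
    {y : List Bool} (hy : y ≠ []) (hxy : (x, y) ∈ P.set) :
    ∑ t : P.T, (if rpar t.1 = (x, y) then rpw δ t.1 * g t.1 else 0)
      = if y.length < P.m then g (x, false :: y) + g (x, true :: y) else 0 := by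
  have e1 := sum_coe_sort P.set
    fun p => if rpar p = (x, y) then rpw δ p * g p else 0
  rw [e1]
  set K : Finset (List (Fin 4) × List Bool) := {(x, false :: y), (x, true :: y)} with hK
  have hv := P.mem_set.mp hxy
  have hv1 : ∀ b : Bool, (x, b :: y) ∈ P.set ↔ y.length < P.m := by
    intro b
    rw [P.mem_set]
    constructor
    · intro h
      have := h.2.1
      simp only [List.length_cons] at this
      omega
    · intro h
      refine ⟨hv.1, by simp only [List.length_cons]; omega, fun _ => hv.2.2.1 hy, ?_⟩
      have := hv.2.2.2
      obtain ⟨c, y', rfl⟩ := List.exists_cons_of_ne_nil hy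
      simpa using this
  have e2 : ∑ p ∈ P.set, (if rpar p = (x, y) then rpw δ p * g p else 0)
      = ∑ p ∈ K, if p ∈ P.set then rpw δ p * g p else 0 := by
    rw [← sum_filter, ← sum_filter]
    symm
    refine sum_subset_zero_on_sdiff ?_ ?_ fun _ _ => rfl
    · intro p hp
      rw [mem_filter] at hp ⊢
      refine ⟨hp.2, ?_⟩
      have := hp.1
      rw [hK, mem_insert, mem_singleton] at this
      rcases this with rfl | rfl <;> rfl
    · rintro ⟨z, y'⟩ hp
      rw [Finset.mem_sdiff, mem_filter, mem_filter] at hp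
      obtain ⟨⟨h1, h2⟩, h3⟩ := hp
      exfalso
      cases y' with
      | nil =>
        have : [] = y := (Prod.mk.inj h2).2
        exact hy this.symm
      | cons b y' =>
        apply h3
        obtain ⟨rfl, rfl⟩ : z = x ∧ y' = y := by simpa [rpar] using h2
        refine ⟨?_, h1⟩
        cases b <;> simp [hK]
  rw [e2, hK, sum_pair (by simp), if_congr (hv1 false) rfl rfl, if_congr (hv1 true) rfl rfl]
  by_cases h : y.length < P.m <;> simp [h, rpw]

end tree

end

section

section treelap

variable {P : TP} {B : Type} [Fintype B] [DecidableEq B] (N : P.Net B)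

/-- the edge weights of the network -/
def TP.Net.w (δ : ℝ) : P.T ⊕ B → P.T ⊕ B → ℝ := N.S.wt (P.pw δ)

/-- the function `Φ x q` on the tree, `c` on the graph -/
def TP.Net.fn (_ : P.Net B) (Φ : List (Fin 4) → ℕ → ℝ) (c : ℝ) : P.T ⊕ B → ℝ :=
  Sum.elim (fun t => Φ t.1.1 t.1.2.length) fun _ => c

open Classical in
/-- the network Laplacian at a vertex of the 4-ary tree -/
def TP.LB (P : TP) (δ : ℝ) (Φ : List (Fin 4) → ℕ → ℝ) (c : ℝ) (x : List (Fin 4)) : ℝ :=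
  cp δ x * (Φ x.tail 0 - Φ x 0)
    + (if x.length < P.H + P.F then ∑ a, cw δ a * (Φ (a :: x) 0 - Φ x 0) else c - Φ x 0)
    + if P.slow x then Φ x 1 - Φ x 0 else 0

/-- the network Laplacian at a vertex of a binary tree -/
def TP.LH (P : TP) (Φ : List (Fin 4) → ℕ → ℝ) (x : List (Fin 4)) (q : ℕ) : ℝ :=
  (Φ x (q - 1) - Φ x q) + if q < P.m then 2 * (Φ x (q + 1) - Φ x q) else 0

open Classical in
/-- the total weight at a vertex of the 4-ary tree -/
def TP.cB (P : TP) (δ : ℝ) (x : List (Fin 4)) : ℝ :=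
  cp δ x + (if x.length < P.H + P.F then 4 + 2 * δ else 1) + if P.slow x then 1 else 0

/-- the total weight at a vertex of a binary tree -/
def TP.cH (P : TP) (q : ℕ) : ℝ := 1 + if q < P.m then 2 else 0

/-- the vertex `x` of the 4-ary tree -/
def TP.bv (x : List (Fin 4)) (hx : x.length ≤ P.H + P.F) : P.T := ⟨(x, []), P.base_mem hx⟩

lemma TP.Net.ind {p : P.T ⊕ B → Prop} (hb : ∀ x hx, p (.inl (P.bv x hx)))
    (hh : ∀ x q (t : P.T), P.slow x → 1 ≤ q → q ≤ P.m → t.1.1 = x → t.1.2.length = q → p (.inl t))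
    (hB : ∀ b, p (.inr b)) (u : P.T ⊕ B) : p u := by
  rcases u with ⟨⟨x, y⟩, h⟩ | b
  · have hv := P.mem_set.mp h
    by_cases hy : y = []
    · subst hy
      exact hb x hv.1
    · exact hh x y.length _ (hv.2.2.1 hy) (List.length_pos_iff.mpr hy) hv.2.1 rfl rfl
  · exact hB b

variable {δ : ℝ}

lemma TP.Net.isNet (hδ : 0 ≤ δ) : IsNet (N.w δ) := by
  refine GoodWeights.isNet (N.S.goodWeights hδ (N.wtOk hδ)) ?_
  rintro (t | b)
  · by_cases h : t = P.root
    · subst h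
      have hm := N.ok.hH
      refine ⟨.inl (P.bv [0] (by simp; omega)), ?_, Or.inr rfl⟩
      intro h
      have := congrArg (fun t : P.T => t.1.1) h
      simp [TP.root, TP.bv] at this
    · exact ⟨.inl (N.S.par t), (N.S.par_ne h).symm, Or.inl rfl⟩
  · obtain ⟨b', hb'⟩ := N.hG b
    exact ⟨.inr b', hb'⟩

lemma TP.Net.fn_bv (Φ : List (Fin 4) → ℕ → ℝ) (c : ℝ) (x : List (Fin 4)) (hx) :
    N.fn Φ c (.inl (P.bv x hx)) = Φ x 0 := rfl

lemma TP.Net.par_eq_iff (t t' : P.T) : N.S.par t = t' ↔ rpar t.1 = t'.1 := by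
  rw [Subtype.ext_iff]; rfl

lemma TP.Net.wlap_bv (Φ : List (Fin 4) → ℕ → ℝ) (c : ℝ) (x : List (Fin 4)) (hx) :
    wlap (N.w δ) (N.fn Φ c) (.inl (P.bv x hx)) = P.LB δ Φ c x := by
  classical
  have h1 := N.S.wlap_lift_inl (P.pw δ) (fun t => Φ t.1.1 t.1.2.length) c (P.bv x hx)
  have h2 := P.sum_kids_base N.ok δ (fun p => Φ p.1 p.2.length - Φ x 0) hx
    (fun h => by subst h; simp)
  simp only [TP.Net.par_eq_iff] at h1
  have h3 : (∑ t' : P.T, if rpar t'.1 = (P.bv x hx).1 then P.pw δ t' * (Φ t'.1.1 t'.1.2.length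
      - Φ (P.bv x hx).1.1 (P.bv x hx).1.2.length) else 0) = _ := h2
  rw [h3] at h1
  refine h1.trans ?_
  have e1 : P.pw δ (P.bv x hx) = cp δ x := rfl
  have e2 : N.S.lf (P.bv x hx) ↔ ¬ x.length < P.H + P.F := by
    rw [not_lt]; exact ⟨fun h => h.ge, fun h => le_antisymm hx h⟩
  have e3 : (N.S.par (P.bv x hx)).1 = (x.tail, []) := rfl
  rw [e1, e3, if_congr e2 rfl rfl, TP.LB]
  simp only [TP.bv, List.length_nil, List.length_singleton]
  by_cases h : x.length < P.H + P.F
  · simp [h, add_assoc]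
  · simp only [h, if_false, not_false_eq_true, if_true]; ring

lemma TP.Net.wlap_hold (Φ : List (Fin 4) → ℕ → ℝ) (c : ℝ) {x : List (Fin 4)} {q : ℕ} (t : P.T)
    (hx : P.slow x) (hq : 1 ≤ q) (h1 : t.1.1 = x) (h2 : t.1.2.length = q) :
    wlap (N.w δ) (N.fn Φ c) (.inl t) = P.LH Φ x q := by
  classical
  obtain ⟨⟨x', y⟩, ht⟩ := t
  simp only at h1 h2
  subst h1 h2
  have hy : y ≠ [] := List.length_pos_iff.mp hq
  have h1 := N.S.wlap_lift_inl (P.pw δ) (fun t => Φ t.1.1 t.1.2.length) c ⟨(x', y), ht⟩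
  have h2 := P.sum_kids_hold δ (fun p => Φ p.1 p.2.length - Φ x' y.length) hy ht
  simp only [TP.Net.par_eq_iff] at h1
  have h3 : (∑ t' : P.T, if rpar t'.1 = (x', y) then P.pw δ t' * (Φ t'.1.1 t'.1.2.length
      - Φ x' y.length) else 0) = _ := h2
  rw [h3] at h1
  refine h1.trans ?_
  obtain ⟨b, y', rfl⟩ := List.exists_cons_of_ne_nil hy
  have e1 : P.pw δ ⟨(x', b :: y'), ht⟩ = 1 := rfl
  have e2 : ¬ N.S.lf ⟨(x', b :: y'), ht⟩ := by
    have := hx.2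
    have hF := N.ok.hF
    change ¬ x'.length = P.H + P.F
    omega
  have e3 : (N.S.par ⟨(x', b :: y'), ht⟩).1 = (x', y') := rfl
  rw [e1, e3, if_neg e2, TP.LH]
  simp only [List.length_cons, Nat.add_sub_cancel]
  split_ifs <;> ring

lemma TP.Net.wlap_inr (Φ : List (Fin 4) → ℕ → ℝ) (c : ℝ) (b : B) :
    (∃ x, ∃ hx : x.length = P.H + P.F, wlap (N.w δ) (N.fn Φ c) (.inr b) = Φ x 0 - c) ∨
      wlap (N.w δ) (N.fn Φ c) (.inr b) = 0 := by
  rcases N.S.wlap_lift_inr (P.pw δ) (fun t => Φ t.1.1 t.1.2.length) c b with ⟨t, ht, h⟩ | h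
  · left
    have hl : t.1.1.length = P.H + P.F := ht
    have hy : t.1.2 = [] := by
      by_contra hy
      have := ((P.mem_set.mp t.2).2.2.1 hy).2
      omega
    rw [hy] at h
    exact ⟨t.1.1, hl, h⟩
  · exact Or.inr h

lemma TP.Net.wdeg_bv (x : List (Fin 4)) (hx) : wdeg (N.w δ) (.inl (P.bv x hx)) = P.cB δ x := by
  classical
  have h1 := N.S.sum_inl (P.pw δ) (P.bv x hx) fun _ => 1
  have h2 := P.sum_kids_base N.ok δ (fun p => if p = ([], []) then 0 else 1) hx (fun _ => by simp)
  simp only [TP.Net.par_eq_iff, mul_one] at h1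
  have h3 := Eq.trans (sum_congr rfl fun (t : P.T) _ => (?_ :
    (if rpar t.1 = (P.bv x hx).1 then P.pw δ t else 0) = _)) h2
  swap
  · 
    by_cases h : t.1 = ([], [])
    · simp only [h, if_true, mul_zero, TP.pw, rpw, cp]
      rfl
    · simp only [h, if_false, mul_one, TP.pw]
      rfl
  rw [h3] at h1
  refine h1.trans ?_
  have e1 : P.pw δ (P.bv x hx) = cp δ x := rfl
  have e2 : N.S.lf (P.bv x hx) ↔ ¬ x.length < P.H + P.F := by
    rw [not_lt]; exact ⟨fun h => h.ge, fun h => le_antisymm hx h⟩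
  rw [e1, if_congr e2 rfl rfl, TP.cB]
  by_cases h : x.length < P.H + P.F
  · simp [h, sum_cw, add_assoc]
  · simp only [h, if_false, not_false_eq_true, if_true]; simp; ring

lemma TP.Net.wdeg_hold {x : List (Fin 4)} {q : ℕ} (t : P.T)
    (hx : P.slow x) (hq : 1 ≤ q) (h1 : t.1.1 = x) (h2 : t.1.2.length = q) :
    wdeg (N.w δ) (.inl t) = P.cH q := by
  classical
  obtain ⟨⟨x', y⟩, ht⟩ := t
  simp only at h1 h2
  subst h1 h2
  have hy : y ≠ [] := List.length_pos_iff.mp hq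
  have h1 := N.S.sum_inl (P.pw δ) ⟨(x', y), ht⟩ fun _ => 1
  have h2 := P.sum_kids_hold δ (fun _ => 1) hy ht
  simp only [TP.Net.par_eq_iff, mul_one] at h1 h2
  have h3 : (∑ t' : P.T, if rpar t'.1 = (x', y) then P.pw δ t' else 0) = _ := h2
  rw [h3] at h1
  refine h1.trans ?_
  obtain ⟨b, y', rfl⟩ := List.exists_cons_of_ne_nil hy
  have e1 : P.pw δ ⟨(x', b :: y'), ht⟩ = 1 := rfl
  have e2 : ¬ N.S.lf ⟨(x', b :: y'), ht⟩ := by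
    have := hx.2
    have hF := N.ok.hF
    change ¬ x'.length = P.H + P.F
    omega
  rw [e1, if_neg e2, TP.cH]
  split_ifs <;> norm_num

lemma TP.Net.wop_bv (hδ : 0 ≤ δ) (Φ : List (Fin 4) → ℕ → ℝ) (c : ℝ) (x : List (Fin 4)) (hx) :
    wop (N.w δ) (N.fn Φ c) (.inl (P.bv x hx)) = Φ x 0 + P.LB δ Φ c x / (2 * P.cB δ x) := by
  rw [wop_eq (N.isNet hδ), N.wlap_bv, N.wdeg_bv, N.fn_bv]

lemma TP.Net.wop_hold (hδ : 0 ≤ δ) (Φ : List (Fin 4) → ℕ → ℝ) (c : ℝ) {x : List (Fin 4)} {q : ℕ}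
    (t : P.T) (hx : P.slow x) (hq : 1 ≤ q) (h1 : t.1.1 = x) (h2 : t.1.2.length = q) :
    wop (N.w δ) (N.fn Φ c) (.inl t) = Φ x q + P.LH Φ x q / (2 * P.cH q) := by
  rw [wop_eq (N.isNet hδ), N.wlap_hold _ _ t hx hq h1 h2, N.wdeg_hold t hx hq h1 h2]
  subst h1 h2; rfl

/-- the increments of `Φ` along the edges at a vertex of the tree -/
lemma TP.Net.abs_sub_le (hδ : 0 ≤ δ) {Φ : List (Fin 4) → ℕ → ℝ} {c β : ℝ} (hβ : 0 ≤ β)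
    (h1 : ∀ a x, x.length < P.H + P.F → |Φ (a :: x) 0 - Φ x 0| ≤ β)
    (h2 : ∀ x q, P.slow x → q < P.m → |Φ x (q + 1) - Φ x q| ≤ β)
    (h3 : ∀ x, x.length = P.H + P.F → |Φ x 0 - c| ≤ β) (u v : P.T ⊕ B) (huv : N.w δ u v ≠ 0) :
    |N.fn Φ c v - N.fn Φ c u| ≤ β := by
  have hadj : N.S.adj u v := by
    by_contra h; exact huv (N.S.wt_zero (N.wtOk hδ) u v h)
  have hpar : ∀ t : P.T, |N.fn Φ c (.inl t) - N.fn Φ c (.inl (N.S.par t))| ≤ β := by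
    rintro ⟨⟨x, y⟩, h⟩
    have hv := P.mem_set.mp h
    cases y with
    | nil =>
      cases x with
      | nil =>
        change |Φ [] 0 - Φ [] 0| ≤ β
        simpa using hβ
      | cons a x =>
        refine h1 a x ?_
        have := hv.1
        simp only [List.length_cons] at this
        omega
    | cons b y =>
      refine h2 x y.length (hv.2.2.1 (by simp)) ?_
      have := hv.2.1
      simp only [List.length_cons] at this
      omega
  have hlf : ∀ t : P.T, t.1.1.length = P.H + P.F → |N.fn Φ c (.inl t) - c| ≤ β := by
    intro t ht
    have hy : t.1.2 = [] := by
      by_contra hy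
      have := ((P.mem_set.mp t.2).2.2.1 hy).2
      omega
    have := h3 t.1.1 ht
    simpa [TP.Net.fn, hy] using this
  rcases u with t | b <;> rcases v with t' | b'
  · rcases hadj.2 with h | h
    · rw [← h, abs_sub_comm]; exact hpar t
    · rw [← h]; exact hpar t'
  · rw [abs_sub_comm]; exact hlf t hadj.1
  · exact hlf t' hadj.1
  · simpa [TP.Net.fn] using hβ

end treelap

end

section

section taufn

/-- the expected duration of a visit, as a function of the depth in a binary tree -/
def tau (m q : ℕ) : ℝ := 8 * 2 ^ m * (1 - (1 / 2) ^ q) - 6 * q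

lemma tau_zero (m : ℕ) : tau m 0 = 0 := by simp [tau]

lemma tau_one (m : ℕ) : tau m 1 = 4 * 2 ^ m - 6 := by simp [tau]; ring

lemma tau_succ_sub (m q : ℕ) : tau m (q + 1) - tau m q = 4 * 2 ^ m * (1 / 2) ^ q - 6 := by
  simp only [tau, pow_succ]; push_cast; ring

lemma two_pow_mul_half_pow {m q : ℕ} (h : q ≤ m) : (1 : ℝ) ≤ 2 ^ m * (1 / 2) ^ q := by
  obtain ⟨k, rfl⟩ := Nat.exists_eq_add_of_le h
  rw [pow_add, mul_comm ((2:ℝ) ^ q), mul_assoc, ← mul_pow]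
  norm_num
  exact one_le_pow₀ (by norm_num)

lemma tau_nonneg {m q : ℕ} (h : q ≤ m) : 0 ≤ tau m q := by
  induction q with
  | zero => rw [tau_zero]
  | succ q ih =>
    have h1 := tau_succ_sub m q
    have h2 := two_pow_mul_half_pow h
    rw [pow_succ] at h2
    linarith [ih (by omega)]

lemma tau_le (m q : ℕ) : tau m q ≤ 8 * 2 ^ m := by
  have h1 : (0:ℝ) ≤ (1 / 2) ^ q := by positivity
  have h2 : (0:ℝ) < 2 ^ m := by positivity
  have h3 : (0:ℝ) ≤ 6 * q := by positivity
  rw [tau]; nlinarith [mul_nonneg h1 h2.le]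

lemma abs_tau_succ_sub {m q : ℕ} (h : q < m) : |tau m (q + 1) - tau m q| ≤ 4 * 2 ^ m := by
  have h1 := tau_succ_sub m q
  have h2 := two_pow_mul_half_pow (show q + 1 ≤ m from h)
  rw [pow_succ] at h2
  have h3 : ((1:ℝ) / 2) ^ q ≤ 1 := pow_le_one₀ (by norm_num) (by norm_num)
  have h4 : (0:ℝ) < 2 ^ m := by positivity
  rw [h1, abs_le]
  constructor <;> nlinarith

lemma TP.LH_tau (P : TP) (U a : List (Fin 4) → ℝ) (x : List (Fin 4)) {q : ℕ} (h1 : 1 ≤ q)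
    (h2 : q ≤ P.m) : P.LH (fun x q => U x + a x * tau P.m q) x q = -(2 * a x * P.cH q) := by
  obtain ⟨q, rfl⟩ := Nat.exists_eq_add_of_le' h1
  have e1 := tau_succ_sub P.m q
  have e2 := tau_succ_sub P.m (q + 1)
  rw [pow_succ] at e2
  rw [TP.LH, TP.cH, Nat.add_sub_cancel]
  split_ifs with h
  · linear_combination (-a x) * e1 + 2 * a x * e2
  · have : P.m = q + 1 := by omega
    rw [this] at e1 ⊢
    have e3 : (2:ℝ) ^ (q + 1) * (1 / 2) ^ q = 2 := by
      rw [pow_succ, mul_assoc, mul_comm (2:ℝ), ← mul_assoc, ← mul_pow]; norm_num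
    linear_combination (-a x) * e1 - 4 * a x * e3

lemma TP.LB_tau (P : TP) (δ : ℝ) (U a : List (Fin 4) → ℝ) (c : ℝ) (x : List (Fin 4)) :
    P.LB δ (fun x q => U x + a x * tau P.m q) c x = P.LB δ (fun x _ => U x) c x
      + (open Classical in if P.slow x then a x * tau P.m 1 else 0) := by
  simp only [TP.LB, tau_zero]
  split_ifs <;> simp

lemma TP.not_slow_of_le {P : TP} {x : List (Fin 4)} (h : P.H ≤ x.length) : ¬ P.slow x :=
  fun h' => by have := h'.2; omega

lemma TP.cB_le (P : TP) {δ : ℝ} (hδ : 0 ≤ δ) (x : List (Fin 4)) : P.cB δ x ≤ 6 + 3 * δ := by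
  have := (cp_bounds hδ x).2
  rw [TP.cB]; split_ifs <;> linarith

lemma TP.cB_leaf_le (P : TP) {δ : ℝ} (hδ : 0 ≤ δ) {x : List (Fin 4)}
    (h : x.length = P.H + P.F) : P.cB δ x ≤ 2 + δ := by
  have := (cp_bounds hδ x).2
  rw [TP.cB, if_neg (by omega), if_neg (TP.not_slow_of_le (by omega))]; linarith

lemma TP.cB_pos (P : TP) {δ : ℝ} (hδ : 0 ≤ δ) (x : List (Fin 4)) : 1 ≤ P.cB δ x := by
  have := (cp_bounds hδ x).1
  rw [TP.cB]; split_ifs <;> linarith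

lemma TP.cH_pos (P : TP) (q : ℕ) : 1 ≤ P.cH q ∧ P.cH q ≤ 3 := by
  rw [TP.cH]; split_ifs <;> constructor <;> norm_num

lemma sum_cw_mul_const (δ c : ℝ) : ∑ a, cw δ a * c = (4 + 2 * δ) * c := by
  rw [← sum_mul, sum_cw]

lemma one_le_cp {δ : ℝ} (hδ : 0 ≤ δ) {x : List (Fin 4)} (hx : x ≠ []) : 1 ≤ cp δ x := by
  cases x with
  | nil => exact absurd rfl hx
  | cons a x => exact (cw_bounds hδ a).1

variable {P : TP} {B : Type} [Fintype B] [DecidableEq B] (N : P.Net B) {δ : ℝ}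

lemma TP.Net.wop_bv_le (hδ : 0 ≤ δ) {Φ : List (Fin 4) → ℕ → ℝ} {c : ℝ} {x : List (Fin 4)} (hx)
    {d : ℝ} (h : P.LB δ Φ c x ≤ d * (2 * P.cB δ x)) :
    wop (N.w δ) (N.fn Φ c) (.inl (P.bv x hx)) ≤ Φ x 0 + d := by
  have := P.cB_pos hδ x
  rw [N.wop_bv hδ, add_le_add_iff_left, div_le_iff₀ (by positivity)]
  exact h

lemma TP.Net.le_wop_bv (hδ : 0 ≤ δ) {Φ : List (Fin 4) → ℕ → ℝ} {c : ℝ} {x : List (Fin 4)} (hx)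
    {d : ℝ} (h : d * (2 * P.cB δ x) ≤ P.LB δ Φ c x) :
    Φ x 0 + d ≤ wop (N.w δ) (N.fn Φ c) (.inl (P.bv x hx)) := by
  have := P.cB_pos hδ x
  rw [N.wop_bv hδ, add_le_add_iff_left, le_div_iff₀ (by positivity)]
  exact h

lemma TP.Net.wop_hold_tau (hδ : 0 ≤ δ) (U : List (Fin 4) → ℝ) (a c : ℝ) {x : List (Fin 4)} {q : ℕ}
    (t : P.T) (hx : P.slow x) (hq : 1 ≤ q) (hm : q ≤ P.m) (h1 : t.1.1 = x) (h2 : t.1.2.length = q) :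
    wop (N.w δ) (N.fn (fun x q => U x + a * tau P.m q) c) (.inl t) = U x + a * tau P.m q - a := by
  have := (P.cH_pos q).1
  rw [N.wop_hold hδ _ _ t hx hq h1 h2, P.LH_tau U (fun _ => a) _ hq hm]
  field_simp
  ring

lemma TP.Net.wdeg_inr_le (hδ : 0 ≤ δ) {D : ℕ} (hD : ∀ b, deg N.G b ≤ D) (b : B) :
    wdeg (N.w δ) (.inr b) ≤ D + 1 := by
  have h1 := N.S.wdeg_inr_le (P.pw δ) b
  have h2 : ((deg N.G b : ℕ) : ℝ) ≤ D := by exact_mod_cast hD b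
  exact h1.trans (by simpa [TP.Net.S] using h2)

lemma TP.Net.one_le_wdeg (hδ : 0 ≤ δ) (u : P.T ⊕ B) : 1 ≤ wdeg (N.w δ) u :=
  N.S.one_le_wdeg hδ (N.wtOk hδ) (N.isNet hδ) u

end taufn

end

section

section dirichlet

/-- a positive superharmonic function on the tree -/
def TP.psi (P : TP) (x : List (Fin 4)) : ℝ := 8 * (3 / 2) ^ (P.H + P.F - x.length)

lemma TP.psi_pos (P : TP) (x : List (Fin 4)) : 0 < P.psi x := by unfold TP.psi; positivity

lemma TP.psi_cons (P : TP) {x : List (Fin 4)} (h : x.length < P.H + P.F) (a : Fin 4) :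
    P.psi (a :: x) = 2 / 3 * P.psi x := by
  rw [TP.psi, TP.psi, List.length_cons,
    show P.H + P.F - x.length = P.H + P.F - (x.length + 1) + 1 by omega, pow_succ]
  ring

lemma TP.cp_mul_psi_tail (P : TP) {x : List (Fin 4)} (h : x.length ≤ P.H + P.F) (δ : ℝ) :
    cp δ x * (P.psi x.tail - P.psi x) = cp δ x * (P.psi x / 2) := by
  cases x with
  | nil => simp [cp]
  | cons a x =>
    rw [List.length_cons] at h
    rw [List.tail_cons, P.psi_cons (by omega)]; ring

lemma TP.LB_psi_le (P : TP) {δ : ℝ} (hδ : 0 ≤ δ) (hδ' : δ ≤ 1 / 20) {x : List (Fin 4)}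
    (hx : x.length ≤ P.H + P.F) :
    P.LB δ (fun x q => P.psi x + P.psi x / (16 * 2 ^ P.m) * tau P.m q) 1 x
      ≤ -(P.cB δ x * P.psi x / 12) := by
  classical
  have hp := P.psi_pos x
  have hc := cp_bounds hδ x
  have hcB := P.cB_le hδ x
  have h2 : (0:ℝ) < 2 ^ P.m := by positivity
  have h3 : P.psi x / (16 * 2 ^ P.m) * tau P.m 1 ≤ P.psi x / 4 := by
    rw [tau_one, div_mul_eq_mul_div, div_le_iff₀ (by positivity)]
    nlinarith
  rw [P.LB_tau, TP.LB, P.cp_mul_psi_tail hx]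
  rcases hx.lt_or_eq with h | h
  · simp only [h, if_true, P.psi_cons h, sum_cw_mul_const]
    have h4 : P.cB δ x * P.psi x ≤ (6 + 3 * δ) * P.psi x := mul_le_mul_of_nonneg_right hcB hp.le
    have h5 : cp δ x * (P.psi x / 2) ≤ (1 + δ) * (P.psi x / 2) :=
      mul_le_mul_of_nonneg_right hc.2 (by positivity)
    have h6 : 0 ≤ δ * P.psi x := by positivity
    have h7 : δ * P.psi x ≤ 1 / 20 * P.psi x := mul_le_mul_of_nonneg_right hδ' hp.le
    split_ifs <;> nlinarith
  · have h8 : P.psi x = 8 := by rw [TP.psi, h]; simp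
    have hcl := P.cB_leaf_le hδ h
    have hs : ¬ P.slow x := TP.not_slow_of_le (by omega)
    simp only [h, lt_irrefl, if_false, hs, h8]
    linarith

lemma TP.LH_psi_le (P : TP) (x : List (Fin 4)) {q : ℕ} (h1 : 1 ≤ q) (h2 : q ≤ P.m) :
    P.LH (fun x q => P.psi x + P.psi x / (16 * 2 ^ P.m) * tau P.m q) x q
      ≤ -(P.cH q * (P.psi x + P.psi x / (16 * 2 ^ P.m) * tau P.m q) / (12 * 2 ^ P.m)) := by
  have hp := P.psi_pos x
  have h3 : (0:ℝ) < 2 ^ P.m := by positivity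
  have hc := (P.cH_pos q).1
  rw [P.LH_tau P.psi _ x h1 h2, neg_le_neg_iff, div_le_iff₀ (by positivity)]
  have h4 : P.psi x / (16 * 2 ^ P.m) * tau P.m q ≤ P.psi x / 2 := by
    rw [div_mul_eq_mul_div, div_le_iff₀ (by positivity)]
    have := tau_le P.m q
    nlinarith
  have h5 : 2 * (P.psi x / (16 * 2 ^ P.m)) * P.cH q * (12 * 2 ^ P.m)
      = P.cH q * (3 / 2 * P.psi x) := by field_simp; ring
  rw [h5]
  exact mul_le_mul_of_nonneg_left (by linarith) (by linarith)

variable {P : TP} {B : Type} [Fintype B] [DecidableEq B] (N : P.Net B) {δ : ℝ}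

/-- the vertices where the walk is slow -/
def TP.Z (P : TP) (B : Type) : Set (P.T ⊕ B) := {u | ∃ t : P.T, u = .inl t ∧ P.slow t.1.1}

lemma TP.Net.isNet_bound (hδ : 0 ≤ δ) (hδ' : δ ≤ 1 / 20) (g : P.T ⊕ B → ℝ) :
    (∑ t : P.T, wdeg (N.w δ) (.inl t) * g (.inl t) ^ 2) / (12 * 2 ^ P.m)
        - 7 * ∑ b, g (.inr b) ^ 2 ≤ energy (N.w δ) g / 2 ∧
      ((∀ u ∈ P.Z B, g u = 0) →
        (∑ t : P.T, wdeg (N.w δ) (.inl t) * g (.inl t) ^ 2) / 12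
        - 7 * ∑ b, g (.inr b) ^ 2 ≤ energy (N.w δ) g / 2) := by
  set φ := N.fn (fun x q => P.psi x + P.psi x / (16 * 2 ^ P.m) * tau P.m q) 1 with hφ
  have hpos : ∀ u, 0 < φ u := by
    refine TP.Net.ind (fun x hx => ?_) (fun x q t hx h1 h2 h3 h4 => ?_) fun b => one_pos
    · rw [hφ, N.fn_bv, tau_zero, mul_zero, add_zero]; exact P.psi_pos x
    · have : φ (.inl t) = P.psi x + P.psi x / (16 * 2 ^ P.m) * tau P.m q := by
        subst h3 h4; rfl
      rw [this]
      have := P.psi_pos x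
      have := tau_nonneg h2
      positivity
  have h1m : (1:ℝ) ≤ 2 ^ P.m := one_le_pow₀ (by norm_num)
  have main := sum_sq_mul_drift_le (N.isNet hδ) φ hpos g
  have hbase : ∀ x hx, wdeg (N.w δ) (.inl (P.bv x hx)) / 12
      ≤ -wlap (N.w δ) φ (.inl (P.bv x hx)) / φ (.inl (P.bv x hx)) := fun x hx => by
    rw [N.wlap_bv, N.wdeg_bv, hφ, N.fn_bv, tau_zero, mul_zero, add_zero,
      le_div_iff₀ (P.psi_pos x)]
    linarith [P.LB_psi_le hδ hδ' hx]
  have hhold : ∀ x q (t : P.T), P.slow x → 1 ≤ q → q ≤ P.m → t.1.1 = x → t.1.2.length = q →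
      wdeg (N.w δ) (.inl t) / (12 * 2 ^ P.m) ≤ -wlap (N.w δ) φ (.inl t) / φ (.inl t) := by
    intro x q t hx h1 h2 h3 h4
    have : φ (.inl t) = P.psi x + P.psi x / (16 * 2 ^ P.m) * tau P.m q := by
      subst h3 h4; rfl
    rw [le_div_iff₀ (hpos _), N.wlap_hold _ _ t hx h1 h3 h4, N.wdeg_hold t hx h1 h3 h4, this]
    have := P.LH_psi_le x h1 h2
    rw [div_mul_eq_mul_div]; linarith
  have hbulk : ∀ b : B, -7 ≤ -wlap (N.w δ) φ (.inr b) / φ (.inr b) := by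
    intro b
    have : φ (.inr b) = 1 := rfl
    rw [this, div_one]
    rcases N.wlap_inr (δ := δ) (fun x q => P.psi x + P.psi x / (16 * 2 ^ P.m) * tau P.m q) 1 b
      with ⟨x, hx, h⟩ | h
    · rw [h, tau_zero, mul_zero, add_zero, TP.psi, hx]; norm_num
    · rw [h]; norm_num
  have hT : ∀ t : P.T, wdeg (N.w δ) (.inl t) / (12 * 2 ^ P.m)
      ≤ -wlap (N.w δ) φ (.inl t) / φ (.inl t) := by
    intro t
    refine TP.Net.ind (B := B) (p := fun u => ∀ t, u = .inl t → wdeg (N.w δ) (.inl t) / (12 * 2 ^ P.m)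
      ≤ -wlap (N.w δ) φ (.inl t) / φ (.inl t)) ?_ ?_ ?_ (.inl t) t rfl
    · rintro x hx t ht
      obtain rfl := Sum.inl_injective ht
      refine le_trans ?_ (hbase x hx)
      have := N.one_le_wdeg hδ (.inl (P.bv x hx))
      gcongr
      linarith
    · rintro x q t hx h1 h2 h3 h4 t' ht
      obtain rfl := Sum.inl_injective ht
      exact hhold x q _ hx h1 h2 h3 h4
    · rintro b t ht; cases ht
  have hT' : (∀ u ∈ P.Z B, g u = 0) → ∀ t : P.T, wdeg (N.w δ) (.inl t) / 12 * g (.inl t) ^ 2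
      ≤ -wlap (N.w δ) φ (.inl t) / φ (.inl t) * g (.inl t) ^ 2 := by
    intro hg t
    refine TP.Net.ind (B := B) (p := fun u => ∀ t, u = .inl t →
      wdeg (N.w δ) (.inl t) / 12 * g (.inl t) ^ 2
      ≤ -wlap (N.w δ) φ (.inl t) / φ (.inl t) * g (.inl t) ^ 2) ?_ ?_ ?_ (.inl t) t rfl
    · rintro x hx t ht
      obtain rfl := Sum.inl_injective ht
      exact mul_le_mul_of_nonneg_right (hbase x hx) (sq_nonneg _)
    · rintro x q t hx h1 h2 h3 h4 t' ht
      obtain rfl := Sum.inl_injective ht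
      rw [hg _ ⟨_, rfl, by rw [h3]; exact hx⟩]
      simp
    · rintro b t ht; cases ht
  rw [Fintype.sum_sum_type] at main
  have hB : -7 * ∑ b, g (.inr b) ^ 2
      ≤ ∑ b, g (.inr b) ^ 2 * (-wlap (N.w δ) φ (.inr b) / φ (.inr b)) := by
    rw [mul_sum]
    exact sum_le_sum fun b _ => by
      rw [mul_comm]; exact mul_le_mul_of_nonneg_left (hbulk b) (sq_nonneg _)
  constructor
  · have : (∑ t : P.T, wdeg (N.w δ) (.inl t) * g (.inl t) ^ 2) / (12 * 2 ^ P.m)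
        ≤ ∑ t : P.T, g (.inl t) ^ 2 * (-wlap (N.w δ) φ (.inl t) / φ (.inl t)) := by
      rw [sum_div]
      refine sum_le_sum fun t _ => ?_
      have := mul_le_mul_of_nonneg_left (hT t) (sq_nonneg (g (.inl t)))
      refine le_trans (le_of_eq ?_) this
      ring
    linarith
  · intro hg
    have : (∑ t : P.T, wdeg (N.w δ) (.inl t) * g (.inl t) ^ 2) / 12
        ≤ ∑ t : P.T, g (.inl t) ^ 2 * (-wlap (N.w δ) φ (.inl t) / φ (.inl t)) := by
      rw [sum_div]
      refine sum_le_sum fun t _ => ?_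
      refine le_trans (le_of_eq ?_) ((hT' hg t).trans (le_of_eq ?_)) <;> ring
    linarith

/-- the constant in the Poincaré inequality -/
def pcon (D : ℕ) (Λ : ℝ) : ℝ := 12 + (600 + 6 * D) * Λ

lemma TP.Net.poinc (hδ : 0 ≤ δ) (hδ' : δ ≤ 1 / 20) {D : ℕ} {Λ : ℝ} (hΛ : 0 ≤ Λ)
    (hD : ∀ b, deg N.G b ≤ D)
    (hP : ∀ f : B → ℝ, ∃ a, ∑ b, (f b - a) ^ 2 ≤ Λ * energy (unitW N.G) f) :
    Poinc (N.w δ) (pcon D Λ * 2 ^ P.m) := by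
  intro f
  obtain ⟨a, ha⟩ := hP fun b => f (.inr b)
  refine ⟨a, ?_⟩
  have h1 := (N.isNet_bound hδ hδ' fun u => f u - a).1
  have he : energy (N.w δ) (fun u => f u - a) = energy (N.w δ) f := by
    simp only [energy, sub_sub_sub_cancel_right]
  have hH : energy (unitW N.G) (fun b => f (.inr b)) ≤ energy (N.w δ) f :=
    N.S.energy_H_le (N.isNet hδ) f
  have hE := energy_nonneg (N.isNet hδ) f
  set E := energy (N.w δ) f
  have h2 : ∑ b, (f (.inr b) - a) ^ 2 ≤ Λ * E := ha.trans (mul_le_mul_of_nonneg_left hH hΛ)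
  have h3 : ∑ b, wdeg (N.w δ) (.inr b) * (f (.inr b) - a) ^ 2 ≤ (D + 1) * (Λ * E) := by
    refine le_trans ?_ (mul_le_mul_of_nonneg_left h2 (by positivity))
    rw [mul_sum]
    exact sum_le_sum fun b _ =>
      mul_le_mul_of_nonneg_right (N.wdeg_inr_le hδ hD b) (sq_nonneg _)
  have h4 : (1:ℝ) ≤ 2 ^ P.m := one_le_pow₀ (by norm_num)
  rw [he, sub_le_iff_le_add, div_le_iff₀ (by positivity)] at h1
  rw [Fintype.sum_sum_type, pcon]
  have h5 : 0 ≤ Λ * E := by positivity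
  have h6 : (D + 1) * (Λ * E) ≤ (D + 1) * (Λ * E) * 2 ^ P.m := le_mul_of_one_le_right (by positivity) h4
  have h7 : (E / 2 + 7 * ∑ b, (f (.inr b) - a) ^ 2) * (12 * 2 ^ P.m)
      ≤ (E / 2 + 7 * (Λ * E)) * (12 * 2 ^ P.m) := by gcongr
  have h8 : 0 ≤ E * 2 ^ P.m := by positivity
  have h9 : 0 ≤ Λ * E * 2 ^ P.m := by positivity
  have h10 : 0 ≤ D * (Λ * E * 2 ^ P.m) := by positivity
  linarith

lemma sum_sq_le_of_zero {f : B → ℝ} (Y : Finset B) (hY : ∀ b ∈ Y, f b = 0)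
    (hc : (Fintype.card B : ℝ) ≤ 2 * #Y) (a : ℝ) : ∑ b, f b ^ 2 ≤ 6 * ∑ b, (f b - a) ^ 2 := by
  have h1 : (#Y : ℝ) * a ^ 2 ≤ ∑ b, (f b - a) ^ 2 := by
    calc (#Y : ℝ) * a ^ 2 = ∑ b ∈ Y, (f b - a) ^ 2 := by
          rw [sum_congr rfl (g := fun _ => a ^ 2) fun b hb => by rw [hY b hb]; ring]
          simp
      _ ≤ _ := sum_le_sum_of_subset_of_nonneg (subset_univ _) fun b _ _ => sq_nonneg _
  have h2 : ∑ b, f b ^ 2 ≤ 2 * ∑ b, (f b - a) ^ 2 + 2 * (Fintype.card B * a ^ 2) := by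
    calc ∑ b, f b ^ 2 ≤ ∑ b, (2 * (f b - a) ^ 2 + 2 * a ^ 2) :=
          sum_le_sum fun b _ => by nlinarith [sq_nonneg (f b - 2 * a)]
      _ = _ := by
          rw [sum_add_distrib, ← mul_sum]
          simp only [sum_const, card_univ, nsmul_eq_mul]; ring
  nlinarith [mul_le_mul_of_nonneg_right hc (sq_nonneg a)]

lemma TP.Net.wdeg_inl_le (hδ : 0 ≤ δ) (hδ' : δ ≤ 1 / 20) (t : P.T) :
    wdeg (N.w δ) (.inl t) ≤ 7 := by
  refine TP.Net.ind (B := B) (p := fun u => ∀ t, u = .inl t → wdeg (N.w δ) (.inl t) ≤ 7)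
    ?_ ?_ ?_ (.inl t) t rfl
  · rintro x hx t ht
    obtain rfl := Sum.inl_injective ht
    rw [N.wdeg_bv]
    linarith [P.cB_le hδ x]
  · rintro x q t hx h1 h2 h3 h4 t' ht
    obtain rfl := Sum.inl_injective ht
    rw [N.wdeg_hold t hx h1 h3 h4]
    linarith [(P.cH_pos q).2]
  · rintro b t ht; cases ht

lemma TP.Net.sum_wdeg_le (hδ : 0 ≤ δ) (hδ' : δ ≤ 1 / 20) {D : ℕ} (hD : ∀ b, deg N.G b ≤ D)
    (hTB : Fintype.card P.T ≤ Fintype.card B) :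
    ∑ u, wdeg (N.w δ) u ≤ (D + 8) * Fintype.card B := by
  have h1 := N.wdeg_inl_le hδ hδ'
  rw [Fintype.sum_sum_type]
  have h2 := sum_le_sum fun (t : P.T) (_ : t ∈ univ) => h1 t
  have h3 := sum_le_sum fun (b : B) (_ : b ∈ univ) => N.wdeg_inr_le hδ hD b
  simp only [sum_const, card_univ, nsmul_eq_mul] at h2 h3
  have h4 : (Fintype.card P.T : ℝ) ≤ Fintype.card B := by exact_mod_cast hTB
  nlinarith

lemma TP.Net.dirichlet (hδ : 0 ≤ δ) (hδ' : δ ≤ 1 / 20) {D : ℕ} {Λ : ℝ} (hΛ : 0 ≤ Λ)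
    (hD : ∀ b, deg N.G b ≤ D)
    (hP : ∀ f : B → ℝ, ∃ a, ∑ b, (f b - a) ^ 2 ≤ Λ * energy (unitW N.G) f)
    (hTB : Fintype.card P.T ≤ Fintype.card B) (Q : Set (P.T ⊕ B))
    (hQ : ∑ u, Qᶜ.indicator (wdeg (N.w δ)) u ≤ 1 / (2 * (D + 8)) * ∑ u, wdeg (N.w δ) u)
    (f : P.T ⊕ B → ℝ) (hf : ∀ u ∈ Q ∪ P.Z B, f u = 0) :
    ∑ u, wdeg (N.w δ) u * f u ^ 2 ≤ pcon D Λ * energy (N.w δ) f := by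
  classical
  obtain ⟨a, ha⟩ := hP fun b => f (.inr b)
  have hH : energy (unitW N.G) (fun b => f (.inr b)) ≤ energy (N.w δ) f :=
    N.S.energy_H_le (N.isNet hδ) f
  have h1 := (N.isNet_bound hδ hδ' f).2 fun u hu => hf u (Or.inr hu)
  have hE := energy_nonneg (N.isNet hδ) f
  set E := energy (N.w δ) f
  have hS := N.sum_wdeg_le hδ hδ' hD hTB
  have hcard : (Fintype.card B : ℝ) ≤ 2 * #{b : B | (Sum.inr b : P.T ⊕ B) ∈ Q} := by
    have e1 : (#{b : B | (Sum.inr b : P.T ⊕ B) ∉ Q} : ℝ)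
        ≤ ∑ u, Qᶜ.indicator (wdeg (N.w δ)) u := by
      rw [Fintype.sum_sum_type]
      have : 0 ≤ ∑ t : P.T, Qᶜ.indicator (wdeg (N.w δ)) (.inl t) :=
        sum_nonneg fun t _ => Set.indicator_nonneg (fun u _ => ((N.isNet hδ).pos u).le) _
      have : (#{b : B | (Sum.inr b : P.T ⊕ B) ∉ Q} : ℝ)
          ≤ ∑ b : B, Qᶜ.indicator (wdeg (N.w δ)) (.inr b) := by
        rw [card_filter, Nat.cast_sum]
        refine sum_le_sum fun b _ => ?_
        by_cases hb : (Sum.inr b : P.T ⊕ B) ∈ Q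
        · simp [hb]
        · simp [hb, N.one_le_wdeg hδ (.inr b)]
      linarith
    have e2 : 1 / (2 * ((D:ℝ) + 8)) * ∑ u, wdeg (N.w δ) u ≤ Fintype.card B / 2 := by
      rw [div_mul_eq_mul_div, div_le_iff₀ (by positivity)]
      linarith
    have e3 := card_filter_add_card_filter_not (s := univ) fun b : B => (Sum.inr b : P.T ⊕ B) ∈ Q
    rw [card_univ] at e3
    have e4 : (#{b : B | (Sum.inr b : P.T ⊕ B) ∈ Q} : ℝ)
      + #{b : B | (Sum.inr b : P.T ⊕ B) ∉ Q} = Fintype.card B := by exact_mod_cast e3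
    linarith
  have h2 : ∑ b, f (.inr b) ^ 2 ≤ 6 * (Λ * E) :=
    (sum_sq_le_of_zero {b : B | (Sum.inr b : P.T ⊕ B) ∈ Q}
      (fun b hb => hf _ (Or.inl (by simpa using hb))) hcard a).trans
      (mul_le_mul_of_nonneg_left (ha.trans (mul_le_mul_of_nonneg_left hH hΛ)) (by norm_num))
  have h3 : ∑ b, wdeg (N.w δ) (.inr b) * f (.inr b) ^ 2 ≤ (D + 1) * (6 * (Λ * E)) := by
    refine le_trans ?_ (mul_le_mul_of_nonneg_left h2 (by positivity))
    rw [mul_sum]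
    exact sum_le_sum fun b _ =>
      mul_le_mul_of_nonneg_right (N.wdeg_inr_le hδ hD b) (sq_nonneg _)
  rw [sub_le_iff_le_add, div_le_iff₀ (by norm_num)] at h1
  rw [Fintype.sum_sum_type, pcon]
  have h5 : 0 ≤ Λ * E := by positivity
  linarith

end dirichlet

end

section

section uppers

variable {P : TP} {B : Type} [Fintype B] [DecidableEq B] (N : P.Net B) {δ : ℝ}

lemma TP.LB_len (P : TP) (δ : ℝ) (v : ℕ → ℝ) (c : ℝ) (x : List (Fin 4)) :
    P.LB δ (fun x _ => v x.length) c x = cp δ x * (v (x.length - 1) - v x.length)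
      + if x.length < P.H + P.F then (4 + 2 * δ) * (v (x.length + 1) - v x.length)
        else c - v x.length := by
  rw [TP.LB]
  simp only [List.length_cons, List.length_tail, sum_cw_mul_const, sub_self, ite_self, add_zero]

/-- the vertices of the glued graph -/
def TP.bulk (P : TP) (B : Type) : Set (P.T ⊕ B) := Set.range Sum.inr

/-- from the glued graph, the walk is unlikely to reach a slow vertex -/
lemma TP.Net.surv_inr_le (hδ : 0 ≤ δ) (hδ' : δ ≤ 1 / 20) {D : ℕ} {Λ : ℝ} (hΛ : 0 ≤ Λ)
    (hD : ∀ b, deg N.G b ≤ D)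
    (hP : ∀ f : B → ℝ, ∃ a, ∑ b, (f b - a) ^ 2 ≤ Λ * energy (unitW N.G) f)
    (hTB : Fintype.card P.T ≤ Fintype.card B) (Q : Set (P.T ⊕ B))
    (hQ : ∑ u, Qᶜ.indicator (wdeg (N.w δ)) u ≤ 1 / (2 * (D + 8)) * ∑ u, wdeg (N.w δ) u)
    {κ : ℝ} (hκ : 0 ≤ κ) {t : ℕ}
    (ht : (1 - 1 / (4 * pcon D Λ)) ^ t * ((D + 8) * Fintype.card B) ≤ κ ^ 2) (b : B) :
    surv (N.w δ) Q t (.inr b) ≤ κ + t * (2 / 3) ^ P.F := by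
  classical
  have hw := N.isNet hδ
  have hp1 : 1 ≤ pcon D Λ := by
    rw [pcon]; have : 0 ≤ (600 + 6 * (D:ℝ)) * Λ := by positivity
    linarith
  set e : ℝ := (2 / 3) ^ P.F with he
  have he0 : 0 < e := by positivity
  have h1 := surv_le_surv_union hw Q (P.Z B) (N.fn (fun x _ => e / 8 * P.psi x) 0) e he0.le ?_ ?_ ?_
    t (.inr b)
  · have h2 := surv_sq_le hw (Q ∪ P.Z B) hp1
      (fun f hf => N.dirichlet hδ hδ' hΛ hD hP hTB Q hQ f hf) t (.inr b)
    have h3 : surv (N.w δ) (Q ∪ P.Z B) t (.inr b) ^ 2 ≤ κ ^ 2 := by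
      have hq : 0 ≤ 1 - 1 / (4 * pcon D Λ) := by
        rw [sub_nonneg, div_le_one (by positivity)]; linarith
      have e1 := mul_le_mul_of_nonneg_left (N.sum_wdeg_le hδ hδ' hD hTB) (pow_nonneg hq t)
      have e2 := mul_le_mul_of_nonneg_right (N.one_le_wdeg hδ (.inr b))
        (sq_nonneg (surv (N.w δ) (Q ∪ P.Z B) t (.inr b)))
      linarith
    have h4 := abs_le_of_sq_le_sq h3 hκ
    have h5 : N.fn (fun x _ => e / 8 * P.psi x) 0 (.inr b) = 0 := rfl
    rw [h5] at h1
    linarith [(le_abs_self _).trans h4]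
  · rintro (t | b)
    · exact (mul_pos (by positivity) (P.psi_pos _)).le
    · exact le_rfl
  · rintro u ⟨t, rfl, ht⟩
    change 1 ≤ e / 8 * P.psi t.1.1
    have h2 := ht.2
    have h3 : P.H + P.F - t.1.1.length = P.F + (P.H - t.1.1.length) := by omega
    have h4 : (1:ℝ) ≤ (3 / 2) ^ (P.H - t.1.1.length) := one_le_pow₀ (by norm_num)
    have h5 : e * (3 / 2) ^ P.F = 1 := by rw [he, ← mul_pow]; norm_num
    rw [TP.psi, h3, pow_add]
    calc (1:ℝ) ≤ (3 / 2) ^ (P.H - t.1.1.length) := h4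
      _ = (e * (3 / 2) ^ P.F) * (3 / 2) ^ (P.H - t.1.1.length) := by rw [h5, one_mul]
      _ = _ := by ring
  · intro u
    refine TP.Net.ind (p := fun u => u ∉ Q → u ∉ P.Z B → wop (N.w δ)
      (N.fn (fun x _ => e / 8 * P.psi x) 0) u ≤ N.fn (fun x _ => e / 8 * P.psi x) 0 u + e)
      ?_ ?_ ?_ u
    · intro x hx _ hZ
      rw [N.fn_bv]
      refine (N.wop_bv_le hδ hx (d := 0) ?_).trans (by linarith)
      have hpx := P.psi_pos x
      have hc := cp_bounds hδ x
      have h2 : cp δ x * (e / 8 * P.psi x.tail - e / 8 * P.psi x) ≤ (1 + δ) * (e / 16 * P.psi x) := by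
        have := P.cp_mul_psi_tail hx δ
        have h3 : cp δ x * (e / 16 * P.psi x) ≤ (1 + δ) * (e / 16 * P.psi x) :=
          mul_le_mul_of_nonneg_right hc.2 (by positivity)
        have h4 : cp δ x * (e / 8 * P.psi x.tail - e / 8 * P.psi x)
            = e / 8 * (cp δ x * (P.psi x.tail - P.psi x)) := by ring
        rw [h4, this]; linarith
      have h6 : 0 < e * P.psi x := by positivity
      rw [zero_mul, TP.LB, sub_self, ite_self, add_zero]
      split_ifs with h
      · simp only [P.psi_cons h, sum_cw_mul_const]
        nlinarith
      · nlinarith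
    · intro x q t hx _ _ h3 _ _ hZ
      exact absurd ⟨t, rfl, by rw [h3]; exact hx⟩ hZ
    · intro b _ _
      have hd := N.one_le_wdeg hδ (.inr b)
      rw [wop_eq hw, add_le_add_iff_left, div_le_iff₀ (by positivity)]
      rcases N.wlap_inr (δ := δ) (fun x _ => e / 8 * P.psi x) 0 b with ⟨x, hx, h⟩ | h
      · rw [h, TP.psi, hx, Nat.sub_self, pow_zero]; nlinarith
      · rw [h]; positivity

/-- exponential bound on the time needed to reach the glued graph -/
lemma TP.Net.surv_bulk_le_exp (hδ : 0 ≤ δ) (hδ' : δ ≤ 1 / 20) {θ : ℝ} (hθ : 0 ≤ θ)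
    (hθ' : θ * (10 * 2 ^ P.m) ≤ 1) (t : ℕ) (u : P.T ⊕ B) :
    surv (N.w δ) (P.bulk B) t u
      ≤ Real.exp (θ * ((4 * 2 ^ P.m + 12) / 3 * ((P.H + P.F : ℕ) + 3) + 8 * 2 ^ P.m)
        - (θ - θ ^ 2 * (10 * 2 ^ P.m) ^ 2) * t) := by
  have hw := N.isNet hδ
  have h2m : (2:ℝ) ≤ 2 ^ P.m := by
    simpa using pow_le_pow_right₀ (show (1:ℝ) ≤ 2 by norm_num) N.ok.hm
  set α : ℝ := (4 * 2 ^ P.m + 12) / 3 with hα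
  set β : ℝ := 10 * 2 ^ P.m with hβ
  have hα0 : 0 < α := by positivity
  set v : ℕ → ℝ := fun k => α * (((P.H + P.F : ℕ) : ℝ) - k + 3) with hv
  set Φ : List (Fin 4) → ℕ → ℝ := fun x q => v x.length + 1 * tau P.m q with hΦ
  have hdrift : ∀ u, u ∉ P.bulk B → wop (N.w δ) (N.fn Φ 0) u ≤ N.fn Φ 0 u + (-1) := by
    refine TP.Net.ind ?_ ?_ ?_
    · intro x hx _
      rw [N.fn_bv]
      refine N.wop_bv_le hδ hx ?_
      have hc := cp_bounds hδ x
      have hcB := P.cB_le hδ x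
      rw [hΦ, P.LB_tau δ (fun x => v x.length) (fun _ => 1), P.LB_len]
      have h1 : cp δ x * (v (x.length - 1) - v x.length) ≤ (1 + δ) * α := by
        cases x with
        | nil => simp only [cp, zero_mul]; positivity
        | cons a x =>
          have : v ((a :: x).length - 1) - v (a :: x).length = α := by
            simp only [hv, List.length_cons, Nat.add_sub_cancel]; push_cast; ring
          rw [this]
          exact mul_le_mul_of_nonneg_right hc.2 hα0.le
      have h3 : tau P.m 1 = 3 * α - 18 := by rw [tau_one, hα]; ring
      have h4 : 0 ≤ δ * α := by positivity
      rcases hx.lt_or_eq with h | h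
      · have h2 : v (x.length + 1) - v x.length = -α := by
          simp only [hv]; push_cast; ring
        rw [if_pos h, h2, h3]
        split_ifs <;> nlinarith
      · have hcl := P.cB_leaf_le hδ h
        have hs : ¬ P.slow x := TP.not_slow_of_le (by omega)
        have h2 : v x.length = α * 3 := by simp only [hv, h]; ring
        rw [if_neg (by omega), if_neg hs, h2] 
        have h7 : δ * α ≤ 1 / 20 * α := mul_le_mul_of_nonneg_right hδ' hα0.le
        have h8 : 20 / 3 ≤ α := by rw [hα]; linarith
        rw [h2] at h1
        linarith
    · intro x q t hx h1 h2 h3 h4 _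
      rw [hΦ, N.wop_hold_tau hδ (fun x => v x.length) 1 0 t hx h1 h2 h3 h4]
      subst h3 h4
      exact le_of_eq (by rw [TP.Net.fn]; simp only [Sum.elim_inl]; ring)
    · intro b hb; exact absurd ⟨b, rfl⟩ hb
  have hinc : ∀ u v, N.w δ u v ≠ 0 → |N.fn Φ 0 v - N.fn Φ 0 u| ≤ β := by
    refine N.abs_sub_le hδ (by positivity) ?_ ?_ ?_
    · intro a x _
      have : Φ (a :: x) 0 - Φ x 0 = -α := by
        simp only [hΦ, hv, List.length_cons]; push_cast; ring
      rw [this, abs_neg, abs_of_pos hα0, hα, hβ]; linarith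
    · intro x q _ hq
      have : Φ x (q + 1) - Φ x q = tau P.m (q + 1) - tau P.m q := by simp only [hΦ]; ring
      rw [this]
      exact (abs_tau_succ_sub hq).trans (by rw [hβ]; linarith)
    · intro x hx
      have : Φ x 0 - 0 = α * 3 := by simp only [hΦ, hv, hx, tau_zero]; ring
      rw [this, abs_of_pos (by positivity), hα, hβ]; linarith
  have hnn : ∀ u, 0 ≤ N.fn Φ 0 u ∧ N.fn Φ 0 u ≤ α * ((P.H + P.F : ℕ) + 3) + 8 * 2 ^ P.m := by
    rintro (t | b)
    · have hvd := P.mem_set.mp t.2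
      change 0 ≤ Φ t.1.1 t.1.2.length ∧ Φ t.1.1 t.1.2.length ≤ _
      have h1 : (t.1.1.length : ℝ) ≤ (P.H + P.F : ℕ) := by exact_mod_cast hvd.1
      have h2 := tau_nonneg hvd.2.1
      have h3 := tau_le P.m t.1.2.length
      have h0 : (0:ℝ) ≤ t.1.1.length := by positivity
      simp only [hΦ, hv, one_mul]
      constructor
      · have : 0 ≤ α * (((P.H + P.F : ℕ) : ℝ) - t.1.1.length + 3) := mul_nonneg hα0.le (by linarith)
        linarith
      · have : α * (((P.H + P.F : ℕ) : ℝ) - t.1.1.length + 3) ≤ α * ((P.H + P.F : ℕ) + 3) :=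
          mul_le_mul_of_nonneg_left (by linarith) hα0.le
        linarith
    · change (0:ℝ) ≤ 0 ∧ (0:ℝ) ≤ _
      constructor <;> positivity
  have key := surv_le_of_super hw (P.bulk B)
    (fun t u => Real.exp (-(θ - θ ^ 2 * β ^ 2) * t) * Real.exp (θ * N.fn Φ 0 u)) ?_ ?_ ?_ t u
  · refine key.trans ?_
    rw [← Real.exp_add, Real.exp_le_exp]
    have := mul_le_mul_of_nonneg_left (hnn u).2 hθ
    linarith
  · intro t u _; positivity
  · intro u _
    simp only [Nat.cast_zero, mul_zero, Real.exp_zero, one_mul]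
    exact Real.one_le_exp (mul_nonneg hθ (hnn u).1)
  · intro t u hu
    left
    have h1 := wop_exp_le hw (N.fn Φ 0) u hθ hθ' (hinc u) (hdrift u hu)
    have h2 := wop_smul (N.w δ) (Real.exp (-(θ - θ ^ 2 * β ^ 2) * t))
      (fun y => Real.exp (θ * N.fn Φ 0 y)) u
    rw [h2]
    refine (mul_le_mul_of_nonneg_left h1 (Real.exp_pos _).le).trans (le_of_eq ?_)
    rw [← mul_assoc, ← Real.exp_add]
    push_cast
    ring_nf

end uppers

end

section

section ray

/-- the probability that a simple random walk with `k` steps from `s` ends at a negative value -/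
def negProb : ℕ → ℤ → ℝ
  | 0, s => if s < 0 then 1 else 0
  | k + 1, s => (negProb k (s - 1) + negProb k (s + 1)) / 2

lemma negProb_bounds (k : ℕ) (s : ℤ) : 0 ≤ negProb k s ∧ negProb k s ≤ 1 := by
  induction k generalizing s with
  | zero => rw [negProb]; split_ifs <;> norm_num
  | succ k ih => have h1 := ih (s - 1); have h2 := ih (s + 1); rw [negProb]; constructor <;> linarith

lemma negProb_add_neg (k : ℕ) (s : ℤ) (h : (s + k) % 2 = 1) : negProb k s + negProb k (-s) = 1 := by
  induction k generalizing s with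
  | zero =>
    simp only [negProb]
    push_cast at h
    split_ifs <;> first | omega | norm_num
  | succ k ih =>
    have h1 := ih (s - 1) (by push_cast at h ⊢; omega)
    have h2 := ih (s + 1) (by push_cast at h ⊢; omega)
    simp only [negProb]
    rw [show -s - 1 = -(s + 1) by ring, show -s + 1 = -(s - 1) by ring]
    linarith

lemma negProb_odd {r : ℕ} (hr : r % 2 = 1) : negProb r 0 = 1 / 2 := by
  have := negProb_add_neg r 0 (by omega)
  rw [neg_zero] at this
  linarith

lemma sum_negProb (k : ℕ) (s : ℤ) : ∑ a, negProb k (s + sgn a) = 4 * negProb (k + 1) s := by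
  rw [Fin.sum_univ_four]
  have h0 : sgn 0 = -1 := rfl
  have h1 : sgn 1 = -1 := rfl
  have h2 : sgn 2 = 1 := rfl
  have h3 : sgn 3 = 1 := rfl
  rw [h0, h1, h2, h3, negProb, ← sub_eq_add_neg]
  ring

open Classical in
/-- the probability that a uniform descending path from `x` is alive at level `J * r` -/
def TP.ray (P : TP) (J : ℕ) (x : List (Fin 4)) : ℝ :=
  if x.length < J * P.r then
    if P.alive x then negProb (P.r - x.length % P.r) (P.bs x) * (1 / 2) ^ (J - 1 - x.length / P.r)
    else 0
  else if P.alive (x.drop (x.length - J * P.r)) then 1 else 0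

variable (P : TP) (J : ℕ)

lemma TP.ray_bounds (x : List (Fin 4)) : 0 ≤ P.ray J x ∧ P.ray J x ≤ 1 := by
  rw [TP.ray]
  split_ifs
  · have := negProb_bounds (P.r - x.length % P.r) (P.bs x)
    have h1 : (0:ℝ) ≤ (1 / 2) ^ (J - 1 - x.length / P.r) := by positivity
    have h2 : ((1:ℝ) / 2) ^ (J - 1 - x.length / P.r) ≤ 1 := pow_le_one₀ (by norm_num) (by norm_num)
    constructor
    · exact mul_nonneg this.1 h1
    · exact mul_le_one₀ this.2 h1 h2
  all_goals norm_num

lemma TP.ray_eq_zero {x : List (Fin 4)} (hx : x.length ≤ J * P.r) (h : ¬ P.alive x) :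
    P.ray J x = 0 := by
  rw [TP.ray]
  split_ifs with h1 h2
  · rfl
  · rw [show x.length - J * P.r = 0 by omega] at h2; exact absurd h2 h
  · rfl

lemma TP.alive_drop {x : List (Fin 4)} (h : P.alive x) (k : ℕ) : P.alive (x.drop k) := by
  induction k generalizing x with
  | zero => exact h
  | succ k ih =>
    cases x with
    | nil => exact h
    | cons a x => exact ih h.1

lemma TP.ray_eq_one {x : List (Fin 4)} (hx : J * P.r ≤ x.length) (h : P.alive x) :
    P.ray J x = 1 := by
  rw [TP.ray, if_neg (by omega), if_pos (P.alive_drop h _)]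

lemma TP.ray_cons {x : List (Fin 4)} (hx : J * P.r ≤ x.length) (a : Fin 4) :
    P.ray J (a :: x) = P.ray J x := by
  have h1 : ¬ x.length + 1 < J * P.r := by omega
  have h2 : ¬ x.length < J * P.r := by omega
  simp only [TP.ray, if_neg h1, if_neg h2, List.length_cons]
  classical
  refine if_congr ?_ rfl rfl
  rw [show x.length + 1 - J * P.r = x.length - J * P.r + 1 by omega, List.drop_succ_cons]

lemma TP.ray_le {x : List (Fin 4)} {i k : ℕ} (hJ : J = i + 1 + k) (hr : 0 < P.r)
    (hx : x.length < (i + 1) * P.r) : P.ray J x ≤ (1 / 2) ^ k := by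
  have h0 : (0:ℝ) ≤ (1 / 2) ^ k := by positivity
  have h1 : x.length < J * P.r := lt_of_lt_of_le hx (Nat.mul_le_mul_right _ (by omega))
  rw [TP.ray, if_pos h1]
  split_ifs
  · have h2 : x.length / P.r < i + 1 := (Nat.div_lt_iff_lt_mul hr).mpr hx
    have h3 : ((1:ℝ) / 2) ^ (J - 1 - x.length / P.r) ≤ (1 / 2) ^ k :=
      pow_le_pow_of_le_one (by norm_num) (by norm_num) (by omega)
    have := negProb_bounds (P.r - x.length % P.r) (P.bs x)
    have h4 : (0:ℝ) ≤ (1 / 2) ^ (J - 1 - x.length / P.r) := by positivity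
    nlinarith
  · exact h0

lemma TP.ray_nil (hr : P.r % 2 = 1) (hJ : 1 ≤ J) : P.ray J [] = (1 / 2) ^ J := by
  have h1 : 0 < J * P.r := Nat.mul_pos hJ (by omega)
  rw [TP.ray, if_pos (by simpa using h1), if_pos (show P.alive [] from trivial)]
  simp only [List.length_nil, Nat.zero_mod, Nat.sub_zero, TP.bs, Nat.zero_div, negProb_odd hr]
  rw [← pow_succ']
  congr 1; omega

lemma TP.sum_ray (hr : P.r % 2 = 1) (x : List (Fin 4)) :
    ∑ a, P.ray J (a :: x) = 4 * P.ray J x := by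
  have hr0 : 0 < P.r := by omega
  by_cases hx : J * P.r ≤ x.length
  · simp only [P.ray_cons J hx]; simp
  push Not at hx
  by_cases hal : P.alive x
  swap
  · rw [P.ray_eq_zero J hx.le hal, mul_zero]
    exact sum_eq_zero fun a _ => P.ray_eq_zero J (by rw [List.length_cons]; omega) fun h => hal h.1
  have hxe : P.ray J x
      = negProb (P.r - x.length % P.r) (P.bs x) * (1 / 2) ^ (J - 1 - x.length / P.r) := by
    rw [TP.ray, if_pos hx, if_pos hal]
  have hmod := Nat.mod_lt x.length hr0
  have hdm := Nat.div_add_mod x.length P.r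
  by_cases hm : (x.length + 1) % P.r = 0
  · have hlast : x.length % P.r = P.r - 1 := by
      by_contra hne
      have : (x.length + 1) % P.r = x.length % P.r + 1 := by
        have h2 : x.length + 1 = P.r * (x.length / P.r) + (x.length % P.r + 1) := by omega
        conv_lhs => rw [h2]
        rw [Nat.mul_add_mod, Nat.mod_eq_of_lt (by omega)]
      omega
    have hdiv : (x.length + 1) / P.r = x.length / P.r + 1 := by
      have h2 : x.length + 1 = P.r * (x.length / P.r + 1) := by rw [mul_add, mul_one]; omega
      conv_lhs => rw [h2]
      exact Nat.mul_div_cancel_left _ hr0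
    have hk : P.r - x.length % P.r = 0 + 1 := by omega
    have hchild : ∀ a, P.ray J (a :: x)
        = negProb 0 (P.bs x + sgn a) * (1 / 2) ^ (J - 1 - x.length / P.r) := by
      intro a
      have hal' : P.alive (a :: x) ↔ P.bs x + sgn a < 0 := by
        rw [TP.alive]; exact ⟨fun h => h.2 hm, fun h => ⟨hal, fun _ => h⟩⟩
      rw [TP.ray, List.length_cons, negProb]
      split_ifs with h1 h2 h3 h3 h2 h3 h3
      · have hb : P.bs (a :: x) = 0 := by rw [TP.bs, if_pos hm]
        have h4 : J - 1 - x.length / P.r = J - 1 - (x.length / P.r + 1) + 1 := by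
          have : x.length / P.r + 1 < J := by
            rw [← hdiv]; exact (Nat.div_lt_iff_lt_mul hr0).mpr h1
          omega
        rw [hm, Nat.sub_zero, hb, negProb_odd hr, hdiv, h4, pow_succ]; ring
      · exact absurd (hal'.mp h2) h3
      · exact absurd (hal'.mpr h3) h2
      · simp
      · have h5 : J - 1 - x.length / P.r = 0 := by
          have h6 : x.length + 1 = J * P.r := by omega
          have : (x.length + 1) / P.r = J := by rw [h6]; exact Nat.mul_div_cancel _ hr0
          omega
        rw [h5]; simp
      · rw [show x.length + 1 - J * P.r = 0 by omega] at h2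
        exact absurd (hal'.mp h2) h3
      · rw [show x.length + 1 - J * P.r = 0 by omega] at h2
        exact absurd (hal'.mpr h3) h2
      · simp
    simp only [hchild]
    rw [← sum_mul, sum_negProb, hxe, hk]; ring
  · have hne : x.length % P.r + 1 < P.r := by
      by_contra hcon
      apply hm
      have h2 : x.length + 1 = P.r * (x.length / P.r + 1) := by rw [mul_add, mul_one]; omega
      rw [h2]; exact Nat.mul_mod_right _ _
    have h2 : x.length + 1 = P.r * (x.length / P.r) + (x.length % P.r + 1) := by omega
    have hmod' : (x.length + 1) % P.r = x.length % P.r + 1 := by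
      conv_lhs => rw [h2]
      rw [Nat.mul_add_mod, Nat.mod_eq_of_lt hne]
    have hdiv : (x.length + 1) / P.r = x.length / P.r := by
      conv_lhs => rw [h2]
      rw [Nat.mul_add_div hr0, Nat.div_eq_of_lt hne, add_zero]
    have hlt : x.length + 1 < J * P.r := by
      rcases Nat.lt_or_ge (x.length + 1) (J * P.r) with h | h
      · exact h
      · exact absurd (by rw [show x.length + 1 = J * P.r by omega]; exact Nat.mul_mod_left _ _) hm
    have hk : P.r - x.length % P.r = P.r - (x.length % P.r + 1) + 1 := by omega
    have hchild : ∀ a, P.ray J (a :: x) = negProb (P.r - (x.length % P.r + 1)) (P.bs x + sgn a)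
        * (1 / 2) ^ (J - 1 - x.length / P.r) := by
      intro a
      have hal' : P.alive (a :: x) := ⟨hal, fun h => absurd h hm⟩
      have hb : P.bs (a :: x) = P.bs x + sgn a := by rw [TP.bs, if_neg hm]
      rw [TP.ray, List.length_cons, if_pos hlt, if_pos hal', hb, hmod', hdiv]
    simp only [hchild]
    rw [← sum_mul, sum_negProb, hxe, hk]; ring

/-- the probability that the walk down the tree goes to infinity inside an alive branch -/
def TP.hh (P : TP) (J : ℕ) : List (Fin 4) → ℝ
  | [] => P.ray J []
  | a :: x => (3 * P.ray J (a :: x) + TP.hh P J x) / 4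

lemma TP.hh_bounds (x : List (Fin 4)) : 0 ≤ P.hh J x ∧ P.hh J x ≤ 1 := by
  induction x with
  | nil => exact P.ray_bounds J []
  | cons a x ih => have := P.ray_bounds J (a :: x); rw [TP.hh]; constructor <;> linarith

lemma TP.ray_le_hh (x : List (Fin 4)) : 3 / 4 * P.ray J x ≤ P.hh J x := by
  have := P.ray_bounds J x
  cases x with
  | nil => rw [TP.hh]; linarith
  | cons a x => rw [TP.hh]; linarith [(P.hh_bounds J x).1]

lemma TP.hh_le {x : List (Fin 4)} {i k : ℕ} (hJ : J = i + 1 + k) (hr : 0 < P.r)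
    (hx : x.length < (i + 1) * P.r) : P.hh J x ≤ (1 / 2) ^ k := by
  induction x with
  | nil => exact P.ray_le J hJ hr hx
  | cons a x ih =>
    have h1 := P.ray_le J hJ hr hx
    have h2 := ih (by rw [List.length_cons] at hx; omega)
    rw [TP.hh]; linarith

lemma TP.hh_le_ray_add {x : List (Fin 4)} (hx : J * P.r ≤ x.length) :
    P.hh J x ≤ P.ray J x + (1 / 4) ^ (x.length - J * P.r) := by
  induction x with
  | nil => rw [TP.hh]; simp
  | cons a x ih =>
    rcases hx.eq_or_lt with h | h
    · rw [h, Nat.sub_self, pow_zero]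
      linarith [(P.hh_bounds J (a :: x)).2, (P.ray_bounds J (a :: x)).1]
    · rw [List.length_cons] at h
      have h1 : J * P.r ≤ x.length := by omega
      have h2 := ih h1
      have h3 := P.ray_cons J h1 a
      rw [TP.hh, h3, List.length_cons, show x.length + 1 - J * P.r = x.length - J * P.r + 1 by omega,
        pow_succ]
      linarith

lemma TP.LB_hh (hr : P.r % 2 = 1) (c : ℝ) {x : List (Fin 4)} (hx : x.length < P.H + P.F) :
    P.LB 0 (fun x _ => P.hh J x) c x = 0 := by
  have h1 : ∑ a, cw 0 a * (P.hh J (a :: x) - P.hh J x) = 3 * (P.ray J x - P.hh J x) := by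
    have : ∀ a, cw 0 a * (P.hh J (a :: x) - P.hh J x)
        = 3 / 4 * (P.ray J (a :: x) - P.hh J x) := by
      intro a
      rw [show cw 0 a = 1 by simp [cw], TP.hh]; ring
    simp only [this]
    rw [← mul_sum, sum_sub_distrib, P.sum_ray J hr]
    simp; ring
  rw [TP.LB, if_pos hx, h1, sub_self, ite_self]
  cases x with
  | nil => simp [cp, TP.hh]
  | cons a x => simp [cp, cw, TP.hh]; ring

end ray

end

section

section upper

variable {P : TP} {B : Type} [Fintype B] [DecidableEq B] (N : P.Net B)

/-- profile of the expected time to reach level `k0` or to escape -/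
def prof (k0 k : ℕ) : ℝ := if k ≤ k0 then (k0 - k : ℝ) + 2 else 2 * (1 / 2) ^ (k - k0)

lemma prof_nonneg (k0 k : ℕ) : 0 ≤ prof k0 k := by
  rw [prof]
  split_ifs with h
  · have : (k:ℝ) ≤ k0 := by exact_mod_cast h
    linarith
  · positivity

lemma prof_sub_le (k0 k : ℕ) : prof k0 (k - 1) - prof k0 k ≤ 1 := by
  rcases Nat.eq_zero_or_pos k with rfl | hk
  · simp
  obtain ⟨k, rfl⟩ : ∃ j, k = j + 1 := ⟨k - 1, by omega⟩
  rw [Nat.add_sub_cancel, prof, prof]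
  rcases lt_trichotomy k k0 with h | rfl | h
  · rw [if_pos h.le, if_pos (show k + 1 ≤ k0 from h)]; push_cast; linarith
  · rw [if_pos le_rfl, if_neg (by omega), show k + 1 - k = 1 by omega]; norm_num
  · rw [if_neg (by omega), if_neg (by omega), show k + 1 - k0 = k - k0 + 1 by omega, pow_succ]
    have : ((1:ℝ) / 2) ^ (k - k0) ≤ 1 := pow_le_one₀ (by norm_num) (by norm_num)
    linarith

lemma prof_drift (k0 k : ℕ) :
    (prof k0 (k - 1) - prof k0 k) + 4 * (prof k0 (k + 1) - prof k0 k) ≤ -3 ∨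
      (k0 < k ∧ (prof k0 (k - 1) - prof k0 k) + 4 * (prof k0 (k + 1) - prof k0 k) ≤ 0) := by
  rcases lt_trichotomy k k0 with h | rfl | h
  · left
    have h1 := prof_sub_le k0 k
    have h2 : prof k0 (k + 1) - prof k0 k = -1 := by
      rw [prof, prof, if_pos (by omega), if_pos h.le]; push_cast; ring
    linarith
  · left
    have h1 := prof_sub_le k k
    have h2 : prof k (k + 1) - prof k k = -1 := by
      rw [prof, prof, if_neg (by omega), if_pos le_rfl, show k + 1 - k = 1 by omega]; norm_num
    linarith
  · right
    refine ⟨h, ?_⟩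
    have h3 : prof k0 k = 2 * (1 / 2) ^ (k - k0) := by rw [prof, if_neg (by omega)]
    have h4 : prof k0 (k + 1) = (1 / 2) ^ (k - k0) := by
      rw [prof, if_neg (by omega), show k + 1 - k0 = k - k0 + 1 by omega, pow_succ]; ring
    have h5 : prof k0 (k - 1) = 4 * (1 / 2) ^ (k - k0) := by
      obtain ⟨j, rfl⟩ : ∃ j, k = k0 + j + 1 := ⟨k - k0 - 1, by omega⟩
      rw [Nat.add_sub_cancel, show k0 + j + 1 - k0 = j + 1 by omega, prof]
      split_ifs with hle
      · obtain rfl : j = 0 := by omega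
        norm_num
      · rw [show k0 + j - k0 = j by omega, pow_succ]; ring
    have h6 : (0:ℝ) ≤ (1 / 2) ^ (k - k0) := by positivity
    rw [h3, h4, h5]; linarith

/-- the alive part of the tree below level `k0` -/
def TP.deep (P : TP) (B : Type) (k0 : ℕ) : Set (P.T ⊕ B) :=
  {u | ∃ t : P.T, u = .inl t ∧ P.slow t.1.1 ∧ k0 ≤ t.1.1.length}

lemma TP.Net.mul_surv_deep_le (k0 : ℕ) (t : ℕ) (s : P.T) (hs : s.1.1.length ≤ k0) :
    t * surv (N.w 0) (P.bulk B ∪ P.deep B k0) t (.inl s)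
      ≤ 4 * (P.H + P.F : ℕ) + (4 * 2 ^ P.m - 6) / 3 * (k0 - s.1.1.length + 3) + 8 + 8 * 2 ^ P.m := by
  have hw := N.isNet le_rfl
  have h2m : (2:ℝ) ≤ 2 ^ P.m := by
    simpa using pow_le_pow_right₀ (show (1:ℝ) ≤ 2 by norm_num) N.ok.hm
  set α : ℝ := (4 * 2 ^ P.m - 6) / 3 with hα
  have hα0 : 0 < α := by rw [hα]; linarith
  have h3 : tau P.m 1 = 3 * α := by rw [tau_one, hα]; ring
  set v : ℕ → ℝ := fun k => 4 * (((P.H + P.F : ℕ) : ℝ) - k) + α * prof k0 k + (8 + α) with hv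
  set Φ : List (Fin 4) → ℕ → ℝ := fun x q => v x.length + 1 * tau P.m q with hΦ
  have hdrift : ∀ u, u ∉ P.bulk B ∪ P.deep B k0 → wop (N.w 0) (N.fn Φ 0) u ≤ N.fn Φ 0 u + (-1) := by
    refine TP.Net.ind ?_ ?_ ?_
    · intro x hx hu
      rw [N.fn_bv]
      refine N.wop_bv_le le_rfl hx ?_
      have hc := cp_bounds le_rfl x
      have hcB := P.cB_le le_rfl x
      have hd : ¬ (P.slow x ∧ k0 ≤ x.length) := fun h => hu (Or.inr ⟨_, rfl, h⟩)
      rw [hΦ, P.LB_tau 0 (fun x => v x.length) (fun _ => 1), P.LB_len]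
      have h1 : cp 0 x * (v (x.length - 1) - v x.length)
          ≤ 4 + α * (prof k0 (x.length - 1) - prof k0 x.length) := by
        cases x with
        | nil => simp [cp]
        | cons a x =>
          have : cp 0 (a :: x) = 1 := by simp [cp, cw]
          rw [this, one_mul]
          simp only [hv, List.length_cons, Nat.add_sub_cancel]; push_cast
          linarith
      rcases hx.lt_or_eq with h | h
      · have h2 : v (x.length + 1) - v x.length
            = -4 + α * (prof k0 (x.length + 1) - prof k0 x.length) := by
          simp only [hv]; push_cast; ring
        rw [if_pos h, h2, h3]
        rcases prof_drift k0 x.length with h4 | ⟨h4, h5⟩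
        · have h6 := mul_le_mul_of_nonneg_left h4 hα0.le
          split_ifs <;> linarith
        · have h6 := mul_le_mul_of_nonneg_left h5 hα0.le
          rw [if_neg (fun h => hd ⟨h, h4.le⟩)]
          linarith
      · have hcl := P.cB_leaf_le le_rfl h
        have hs : ¬ P.slow x := TP.not_slow_of_le (by omega)
        have h4 := mul_le_mul_of_nonneg_left (prof_sub_le k0 x.length) hα0.le
        have h5 := mul_nonneg hα0.le (prof_nonneg k0 x.length)
        have h2 : v x.length = α * prof k0 x.length + (8 + α) := by simp only [hv, h]; ring
        rw [if_neg (by omega), if_neg hs]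
        linarith
    · intro x q t hx h1 h2 h3 h4 _
      rw [hΦ, N.wop_hold_tau le_rfl (fun x => v x.length) 1 0 t hx h1 h2 h3 h4]
      subst h3 h4
      exact le_of_eq (by rw [TP.Net.fn]; simp only [Sum.elim_inl]; ring)
    · intro b hb; exact absurd (Or.inl ⟨b, rfl⟩) hb
  have hnn : ∀ u, 0 ≤ N.fn Φ 0 u := by
    rintro (t | b)
    · have hvd := P.mem_set.mp t.2
      change 0 ≤ Φ t.1.1 t.1.2.length
      have h1 : (t.1.1.length : ℝ) ≤ (P.H + P.F : ℕ) := by exact_mod_cast hvd.1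
      have h2 := tau_nonneg hvd.2.1
      have h4 := mul_nonneg hα0.le (prof_nonneg k0 t.1.1.length)
      simp only [hΦ, hv, one_mul]
      linarith
    · exact le_rfl
  have key := mul_surv_le hw _ (N.fn Φ 0) hnn (fun u hu => by linarith [hdrift u hu]) t (.inl s)
  refine key.trans ?_
  change Φ s.1.1 s.1.2.length ≤ _
  have h4 := tau_le P.m s.1.2.length
  have h5 : prof k0 s.1.1.length = (k0 - s.1.1.length : ℝ) + 2 := by rw [prof, if_pos hs]
  have h6 : (0:ℝ) ≤ s.1.1.length := by positivity
  simp only [hΦ, hv, one_mul, h5]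
  linarith

lemma TP.Net.surv_bulk_le_deep (hr : P.r % 2 = 1) {i k : ℕ} (t : ℕ) (s : P.T)
    (hs : s.1.1.length < (i + 1) * P.r) :
    surv (N.w 0) (P.bulk B) t (.inl s)
      ≤ surv (N.w 0) (P.bulk B ∪ P.deep B ((i + 1 + k) * P.r)) t (.inl s)
        + 4 / 3 * (1 / 2) ^ k + t * (1 / 4) ^ P.F := by
  have hw := N.isNet le_rfl
  have hr0 : 0 < P.r := by omega
  have hε : (0:ℝ) ≤ (1 / 4) ^ P.F := by positivity
  set J := i + 1 + k with hJ
  rcases Nat.lt_or_ge (J * P.r) P.H with hH | hH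
  · have := surv_le_surv_union hw (P.bulk B) (P.deep B (J * P.r))
      (N.fn (fun x _ => 4 / 3 * P.hh J x) 0) _ hε ?_ ?_ ?_ t (.inl s)
    · have h1 : N.fn (fun x _ => 4 / 3 * P.hh J x) 0 (.inl s) ≤ 4 / 3 * (1 / 2) ^ k :=
        mul_le_mul_of_nonneg_left (P.hh_le J hJ hr0 hs) (by norm_num)
      linarith
    · rintro (t | b)
      · exact mul_nonneg (by norm_num) (P.hh_bounds J _).1
      · exact le_rfl
    · rintro u ⟨t, rfl, h1, h2⟩
      change 1 ≤ 4 / 3 * P.hh J t.1.1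
      have := P.ray_le_hh J t.1.1
      rw [P.ray_eq_one J h2 h1.1] at this
      linarith
    · have hLB : ∀ x c, P.LB 0 (fun x _ => 4 / 3 * P.hh J x) c x
          = 4 / 3 * P.LB 0 (fun x _ => P.hh J x) (3 / 4 * c) x := by
        intro x c
        simp only [TP.LB, sub_self, ite_self, add_zero, ← mul_sub]
        rw [mul_add, mul_ite, mul_sum]
        congr 1
        · ring
        · split_ifs
          · exact sum_congr rfl fun _ _ => by ring
          · ring
      refine TP.Net.ind ?_ ?_ ?_
      · intro x hx _ _
        rw [N.fn_bv]
        refine N.wop_bv_le le_rfl hx ?_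
        have hcB := P.cB_pos le_rfl x
        rw [hLB]
        rcases hx.lt_or_eq with h | h
        · rw [P.LB_hh J hr _ h]
          have : 0 ≤ (1 / 4) ^ P.F * (2 * P.cB 0 x) := mul_nonneg hε (by linarith)
          linarith
        · have hne : x ≠ [] := by
            rintro rfl
            simp only [List.length_nil] at h
            have := N.ok.hH
            omega
          obtain ⟨a, y, rfl⟩ := List.exists_cons_of_ne_nil hne
          rw [List.length_cons] at h
          have hF := N.ok.hF
          have h1 : J * P.r ≤ y.length := by omega
          have h2 := P.hh_le_ray_add J h1
          have h3 : ((1:ℝ) / 4) ^ (y.length - J * P.r) ≤ (1 / 4) ^ P.F :=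
            pow_le_pow_of_le_one (by norm_num) (by norm_num) (by omega)
          have h4 := (P.ray_bounds J y).1
          rw [TP.LB, if_neg (by rw [List.length_cons]; omega), sub_self, ite_self, add_zero,
            show cp 0 (a :: y) = 1 by simp [cp, cw], List.tail_cons, TP.hh, P.ray_cons J h1]
          have : (1 / 4) ^ P.F * (2 * 1) ≤ (1 / 4) ^ P.F * (2 * P.cB 0 (a :: y)) :=
            mul_le_mul_of_nonneg_left (by linarith) hε
          linarith
      · intro x q t hx h1 h2 h3 h4 _ _
        rw [N.wop_hold le_rfl _ _ t hx h1 h3 h4, TP.LH]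
        subst h3 h4
        simp only [sub_self, mul_zero, ite_self, add_zero, zero_div]
        exact le_add_of_nonneg_right hε
      · intro b hb; exact absurd ⟨b, rfl⟩ hb
  · have : P.deep B (J * P.r) = ∅ := by
      refine Set.eq_empty_of_forall_notMem ?_
      rintro u ⟨t, -, h1, h2⟩
      have := h1.2
      omega
    rw [this, Set.union_empty]
    have : (0:ℝ) ≤ 4 / 3 * (1 / 2) ^ k := by positivity
    have : (0:ℝ) ≤ t * (1 / 4) ^ P.F := by positivity
    linarith

/-- time needed to reach the glued graph in the unweighted case -/
lemma TP.Net.surv_bulk_le (hr : P.r % 2 = 1) (k : ℕ) {t : ℕ} (ht : 0 < t) (u : P.T ⊕ B) :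
    surv (N.w 0) (P.bulk B) t u
      ≤ (4 * (P.H + P.F : ℕ) + (4 * 2 ^ P.m - 6) / 3 * ((k + 1) * P.r + 3) + 8 + 8 * 2 ^ P.m) / t
        + 4 / 3 * (1 / 2) ^ k + t * (1 / 4) ^ P.F := by
  have hr0 : 0 < P.r := by omega
  have h2m : (2:ℝ) ≤ 2 ^ P.m := by
    simpa using pow_le_pow_right₀ (show (1:ℝ) ≤ 2 by norm_num) N.ok.hm
  have hα : (0:ℝ) ≤ (4 * 2 ^ P.m - 6) / 3 := by linarith
  have ht' : (0:ℝ) < t := by exact_mod_cast ht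
  rcases u with s | b
  · set i := s.1.1.length / P.r with hi
    have hs : s.1.1.length < (i + 1) * P.r := (Nat.div_lt_iff_lt_mul hr0).mp (Nat.lt_succ_self _)
    have hs' : s.1.1.length ≤ (i + 1 + k) * P.r := hs.le.trans (Nat.mul_le_mul_right _ (by omega))
    have h1 := N.surv_bulk_le_deep hr (k := k) t s hs
    have h2 := N.mul_surv_deep_le _ t s hs'
    have h3 : (((i + 1 + k) * P.r : ℕ) : ℝ) - s.1.1.length ≤ (k + 1) * P.r := by
      have : (i + 1 + k) * P.r ≤ s.1.1.length + (k + 1) * P.r := by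
        have : i * P.r ≤ s.1.1.length := Nat.div_mul_le_self _ _
        nlinarith
      have : (((i + 1 + k) * P.r : ℕ) : ℝ) ≤ s.1.1.length + (k + 1) * P.r := by exact_mod_cast this
      linarith
    have h4 : surv (N.w 0) (P.bulk B ∪ P.deep B ((i + 1 + k) * P.r)) t (.inl s) ≤
        (4 * (P.H + P.F : ℕ) + (4 * 2 ^ P.m - 6) / 3 * ((k + 1) * P.r + 3) + 8 + 8 * 2 ^ P.m) / t := by
      rw [le_div_iff₀ ht']
      have := mul_le_mul_of_nonneg_left h3 hα
      linarith
    linarith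
  · rw [surv_of_mem _ (show (Sum.inr b : P.T ⊕ B) ∈ P.bulk B from ⟨b, rfl⟩)]
    have : 0 ≤ (4 * 2 ^ P.m - 6) / 3 * (((k:ℝ) + 1) * P.r + 3) := mul_nonneg hα (by positivity)
    positivity

end upper

end

section

section lower

variable {P : TP} {B : Type} [Fintype B] [DecidableEq B] (N : P.Net B)

open Classical in
/-- the level at which the path to `x` leaves the slow region -/
def TP.lev (P : TP) : List (Fin 4) → ℕ
  | [] => 0
  | a :: x => if P.slow (a :: x) then x.length + 1 else TP.lev P x

lemma TP.lev_of_slow {P : TP} {x : List (Fin 4)} (h : P.slow x) : P.lev x = x.length := by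
  cases x with
  | nil => rfl
  | cons a x => rw [TP.lev, if_pos h, List.length_cons]

lemma TP.lev_cons_of_not_slow {P : TP} {a : Fin 4} {x : List (Fin 4)} (h : ¬ P.slow (a :: x)) :
    P.lev (a :: x) = P.lev x := by
  rw [TP.lev, if_neg h]

lemma TP.lev_le_length {P : TP} (x : List (Fin 4)) : P.lev x ≤ x.length := by
  induction x with
  | nil => rfl
  | cons a x ih => rw [TP.lev, List.length_cons]; split_ifs <;> omega

lemma TP.lev_le_cons {P : TP} (a : Fin 4) (x : List (Fin 4)) : P.lev x ≤ P.lev (a :: x) := by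
  have := P.lev_le_length x
  rw [TP.lev]; split_ifs <;> omega

lemma TP.lev_cons_le {P : TP} {a : Fin 4} {x : List (Fin 4)} (h : P.slow x) :
    P.lev (a :: x) ≤ P.lev x + 1 := by
  rw [TP.lev_of_slow h, TP.lev]
  split_ifs
  · rfl
  · rw [TP.lev_of_slow h]; omega

lemma TP.ray_eq_zero_of_lev (hr : P.r % 2 = 1) {j : ℕ} (hH : j * P.r < P.H) {x : List (Fin 4)}
    (hx : ¬ P.slow x) (hl : P.lev x < j * P.r) : P.ray j x = 0 := by
  induction x with
  | nil => exact absurd ⟨trivial, by rw [List.length_nil]; omega⟩ hx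
  | cons a x ih =>
    rw [TP.lev_cons_of_not_slow hx] at hl
    by_cases hs : P.slow x
    · rw [TP.lev_of_slow hs] at hl
      refine P.ray_eq_zero j (by rw [List.length_cons]; omega) fun h => hx ⟨h, ?_⟩
      rw [List.length_cons]; omega
    · have h0 := P.sum_ray j hr x
      rw [ih hs hl, mul_zero] at h0
      exact (sum_eq_zero_iff_of_nonneg fun a _ => (P.ray_bounds j (a :: x)).1).mp h0 a (mem_univ a)

lemma TP.hh_le_of_lev (hr : P.r % 2 = 1) {j : ℕ} (hH : j * P.r < P.H) {x : List (Fin 4)}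
    (hl : P.lev x < j * P.r) : P.hh j x ≤ (1 / 4) ^ (x.length - P.lev x) := by
  induction x with
  | nil => simpa using (P.hh_bounds j []).2
  | cons a x ih =>
    by_cases hs : P.slow (a :: x)
    · rw [TP.lev_of_slow hs]; simpa using (P.hh_bounds j (a :: x)).2
    · have h0 := P.ray_eq_zero_of_lev hr hH hs hl
      rw [TP.lev_cons_of_not_slow hs] at hl ⊢
      have h1 := P.lev_le_length x
      rw [TP.hh, h0, List.length_cons, show x.length + 1 - P.lev x = x.length - P.lev x + 1 by omega,
        pow_succ]
      linarith [ih hl]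

/-- lower bound on the probability of being in the tree, in the unweighted case -/
lemma TP.Net.le_iterate_tree (hr : P.r % 2 = 1) {j : ℕ} (hH : j * P.r < P.H) (hF : j ≤ P.F)
    (t : ℕ) :
    (1 / 2) ^ j - (1 / 4) ^ (j + 1) - 2 * Real.exp (t / (8 * 2 ^ P.m)) / (81 / 80) ^ (j * P.r)
      ≤ (wop (N.w 0))^[t] (N.fn (fun _ _ => 1) 0) (.inl (P.bv [] (Nat.zero_le _))) := by
  classical
  have hw := N.isNet le_rfl
  have hr0 : 0 < P.r := by omega
  have h2m : (2:ℝ) ≤ 2 ^ P.m := by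
    simpa using pow_le_pow_right₀ (show (1:ℝ) ≤ 2 by norm_num) N.ok.hm
  set h : ℝ := 2 ^ P.m with hh
  set ε : ℝ := (1 / 4) ^ (j + 1) with hε
  have hε0 : 0 < ε := by positivity
  set lam : ℝ := 1 / (16 * h) with hlam
  have hlam0 : 0 < lam := by positivity
  have hlh : lam * h = 1 / 16 := by rw [hlam]; field_simp
  set A : List (Fin 4) → ℝ := fun x => 2 * (81 / 80) ^ P.lev x / (81 / 80) ^ (j * P.r) with hA
  have hA0 : ∀ x, 0 < A x := fun x => by positivity
  set E : ℕ → ℝ := fun t => Real.exp (t / (8 * h)) with hE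
  have hE0 : ∀ t, 0 < E t := fun t => Real.exp_pos _
  have hE1 : ∀ t, E t * (1 + 2 * lam) ≤ E (t + 1) := by
    intro t
    have : E (t + 1) = E t * Real.exp (2 * lam) := by
      simp only [hE]; rw [← Real.exp_add]; congr 1; push_cast; rw [hlam]; field_simp; ring
    rw [this]
    exact mul_le_mul_of_nonneg_left (by linarith [Real.add_one_le_exp (2 * lam)]) (hE0 t).le
  set Φ : ℕ → List (Fin 4) → ℕ → ℝ := fun t x q =>
    (P.hh j x - ε - E t * A x) + (E t * (lam * A x)) * tau P.m q with hΦ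
  have hτ : ∀ q, lam * tau P.m q ≤ 1 / 2 := by
    intro q
    have := mul_le_mul_of_nonneg_left (tau_le P.m q) hlam0.le
    linarith
  have hlow : ∀ t x q, j * P.r ≤ P.lev x → Φ t x q ≤ 0 := by
    intro t x q hl
    have h1 : 2 ≤ A x := by
      simp only [hA]
      rw [le_div_iff₀ (by positivity)]
      exact mul_le_mul_of_nonneg_left (pow_le_pow_right₀ (by norm_num) hl) (by norm_num)
    have h2 : 1 ≤ E t := Real.one_le_exp (by positivity)
    have h3 := hτ q
    have h4 := (P.hh_bounds j x).2
    have h5 : 2 ≤ E t * A x := by nlinarith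
    have h6 : E t * A x * (lam * tau P.m q) ≤ E t * A x * (1 / 2) :=
      mul_le_mul_of_nonneg_left h3 (by linarith)
    simp only [hΦ]
    linarith
  have key := sub_le_iterate hw (N.fn (fun _ _ => 1) 0) ?_ (fun t => N.fn (Φ t) 0) ?_ ?_ t
    (.inl (P.bv [] (Nat.zero_le _)))
  · refine le_trans (le_of_eq ?_) key
    rw [N.fn_bv]
    simp only [hΦ, tau_zero, TP.hh, hA, TP.lev, hE]
    rcases Nat.eq_zero_or_pos j with rfl | hj
    · simp [TP.ray, TP.alive]; ring
    · rw [P.ray_nil j hr hj]; ring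
  · rintro (t | b)
    · exact zero_le_one
    · exact le_rfl
  · rintro (s | b)
    · change Φ 0 s.1.1 s.1.2.length ≤ 1
      have h1 := (P.hh_bounds j s.1.1).2
      have h2 : E 0 * A s.1.1 * (lam * tau P.m s.1.2.length) ≤ E 0 * A s.1.1 * 1 :=
        mul_le_mul_of_nonneg_left (by linarith [hτ s.1.2.length]) (mul_pos (hE0 0) (hA0 _)).le
      simp only [hΦ]
      linarith
    · exact le_rfl
  · intro t
    have hEm : E t ≤ E (t + 1) := by nlinarith [hE1 t, hE0 t]
    refine TP.Net.ind ?_ ?_ ?_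
    · intro x hx
      rw [N.fn_bv]
      rcases Nat.lt_or_ge (P.lev x) (j * P.r) with hl | hl
      swap
      · exact Or.inr (hlow _ _ _ hl)
      rcases hx.lt_or_eq with hx' | hx'
      · left
        have h1 : (0:ℝ) * (2 * P.cB 0 x) ≤ P.LB 0 (Φ t) 0 x := by
          rw [zero_mul, hΦ, P.LB_tau 0 _ (fun x => E t * (lam * A x))]
          have h2 : P.LB 0 (fun x _ => P.hh j x - ε - E t * A x) 0 x
              = P.LB 0 (fun x _ => P.hh j x) 0 x - E t * P.LB 0 (fun x _ => A x) 0 x := by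
            rw [TP.LB, TP.LB, TP.LB, if_pos hx', if_pos hx', if_pos hx']
            simp only [sub_self, ite_self, add_zero]
            rw [mul_add, mul_sum, add_sub_add_comm, ← sum_sub_distrib]
            congr 1
            · ring
            · exact sum_congr rfl fun a _ => by ring
          have h3 : P.LB 0 (fun x _ => A x) 0 x ≤ if P.slow x then 1 / 20 * A x else 0 := by
            rw [TP.LB, if_pos hx', sub_self, ite_self, add_zero]
            have h4 : cp 0 x * (A x.tail - A x) ≤ 0 := by
              refine mul_nonpos_of_nonneg_of_nonpos (cp_bounds le_rfl x).1 ?_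
              cases x with
              | nil => simp
              | cons a x =>
                rw [List.tail_cons, sub_nonpos]
                simp only [hA]
                gcongr
                · norm_num
                · exact TP.lev_le_cons a x
            have h5 : ∀ a, cw 0 a * (A (a :: x) - A x) ≤ if P.slow x then 1 / 80 * A x else 0 := by
              intro a
              rw [show cw 0 a = 1 by simp [cw], one_mul]
              split_ifs with hs
              · have : A (a :: x) ≤ 81 / 80 * A x := by
                  have h6 : ((81:ℝ) / 80) ^ P.lev (a :: x) ≤ (81 / 80) ^ (P.lev x + 1) :=
                    pow_le_pow_right₀ (by norm_num) (TP.lev_cons_le hs)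
                  rw [pow_succ] at h6
                  simp only [hA]
                  rw [← mul_div_assoc]
                  exact div_le_div_of_nonneg_right (by linarith) (by positivity)
                linarith
              · have : A (a :: x) = A x := by
                  simp only [hA]
                  rw [TP.lev_cons_of_not_slow fun h => hs h.tail]
                rw [this, sub_self]
            have h6 := sum_le_sum fun a (_ : a ∈ univ) => h5 a
            rw [sum_const, card_univ, Fintype.card_fin] at h6
            split_ifs at h6 ⊢ <;> simp only [nsmul_eq_mul] at h6 <;> push_cast at h6 <;> linarith
          rw [h2, P.LB_hh j hr 0 hx', tau_one]
          have h7 := mul_le_mul_of_nonneg_left h3 (hE0 t).le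
          have h8 : lam ≤ 1 / 32 := by
            rw [hlam, div_le_div_iff₀ (by positivity) (by norm_num)]; linarith
          split_ifs at h7 ⊢
          · have h9 : E t * (lam * A x) * (4 * h - 6) = E t * A x * (4 * (lam * h) - 6 * lam) := by
              ring
            rw [h9, hlh]
            have := mul_le_mul_of_nonneg_left (show (1:ℝ) / 20 ≤ 4 * (1 / 16) - 6 * lam by linarith)
              (mul_pos (hE0 t) (hA0 x)).le
            linarith
          · linarith
        have h10 := N.le_wop_bv le_rfl hx h1
        refine le_trans ?_ h10
        have := mul_le_mul_of_nonneg_right hEm (hA0 x).le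
        simp only [hΦ, tau_zero]
        linarith
      · right
        have h1 := P.hh_le_of_lev hr hH hl
        have h2 : ((1:ℝ) / 4) ^ (x.length - P.lev x) ≤ ε :=
          pow_le_pow_of_le_one (by norm_num) (by norm_num) (by omega)
        have := mul_pos (hE0 (t + 1)) (hA0 x)
        simp only [hΦ, tau_zero]
        linarith
    · intro x q s hx h1 h2 h3 h4
      left
      have hw1 := N.wop_hold le_rfl (Φ t) 0 s hx h1 h3 h4
      have hcH := (P.cH_pos q).1
      rw [hw1, hΦ, P.LH_tau _ (fun x => E t * (lam * A x)) _ h1 h2]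
      subst h3 h4
      rw [TP.Net.fn]
      simp only [Sum.elim_inl]
      have h5 : -(2 * (E t * (lam * A s.1.1)) * P.cH s.1.2.length) / (2 * P.cH s.1.2.length)
          = -(E t * (lam * A s.1.1)) := by field_simp
      rw [h5]
      have h6 := mul_le_mul_of_nonneg_right
        (show E t * (2 * lam) ≤ E (t + 1) - E t by linarith [hE1 t]) (hA0 s.1.1).le
      have h7 := hτ s.1.2.length
      have h8 : (1:ℝ) / 2 ≤ 1 - lam * tau P.m s.1.2.length := by linarith
      have h9 := mul_le_mul_of_nonneg_left h8
        (mul_nonneg (show 0 ≤ E (t + 1) - E t by linarith) (hA0 s.1.1).le)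
      linarith
    · intro b; exact Or.inr le_rfl

end lower

end

section

section lower_perturbed

/-- the sum of the signs of the steps made below level `n` -/
def ssum (n : ℕ) : List (Fin 4) → ℝ
  | [] => 0
  | a :: x => if n ≤ x.length then ssum n x + sgn a else 0

/-- exponential average of the signs of the steps made below level `n` -/
def savg (n : ℕ) : List (Fin 4) → ℝ
  | [] => 0
  | a :: x => if n ≤ x.length then savg n x / 4 + 3 / 4 * sgn a else 0

lemma ssum_eq_zero {n : ℕ} {x : List (Fin 4)} (h : x.length ≤ n) : ssum n x = 0 ∧ savg n x = 0 := by
  cases x with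
  | nil => exact ⟨rfl, rfl⟩
  | cons a x =>
    rw [List.length_cons] at h
    rw [ssum, savg, if_neg (by omega), if_neg (by omega)]; exact ⟨rfl, rfl⟩

lemma abs_savg_le (n : ℕ) (x : List (Fin 4)) : -1 ≤ savg n x ∧ savg n x ≤ 1 := by
  induction x with
  | nil => rw [savg]; norm_num
  | cons a x ih =>
    rw [savg, sgn]
    split_ifs <;> push_cast <;> constructor <;> linarith

lemma TP.ssum_eq_bs (P : TP) {i : ℕ} {x : List (Fin 4)} (h1 : i * P.r ≤ x.length)
    (h2 : x.length < (i + 1) * P.r) : ssum (i * P.r) x = P.bs x := by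
  induction x with
  | nil => simp [ssum, TP.bs]
  | cons a x ih =>
    rw [List.length_cons] at h1 h2
    rw [ssum, TP.bs]
    rcases h1.eq_or_lt with h | h
    · rw [if_neg (by omega), if_pos (by rw [← h]; exact Nat.mul_mod_left _ _)]; simp
    · have hm : (x.length + 1) % P.r ≠ 0 := by
        intro hm
        obtain ⟨k, hk⟩ := Nat.dvd_of_mod_eq_zero hm
        rw [hk, mul_comm P.r] at h h2
        have h3 := Nat.lt_of_mul_lt_mul_right h
        have h4 := Nat.lt_of_mul_lt_mul_right h2
        omega
      rw [if_pos (by omega), if_neg hm, ih (by omega) (by omega)]; push_cast; ring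

/-- corrected sum of signs -/
def yfun (δ : ℝ) (n : ℕ) (R : ℝ) (x : List (Fin 4)) : ℝ :=
  ssum n x - savg n x / 3 + δ / 10 * ((x.length - n : ℕ) - R) + 1 / 3

lemma exp_mul_sub_le {θ s s' : ℝ} (hθ : 0 ≤ θ) (hθ' : 2 * θ ≤ 1) (h : |s' - s| ≤ 2) :
    Real.exp (θ * s') - Real.exp (θ * s) ≤ Real.exp (θ * s) * (θ * (s' - s) + 4 * θ ^ 2) := by
  have h1 : |θ * (s' - s)| ≤ 1 := by
    rw [abs_mul, abs_of_nonneg hθ]; nlinarith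
  have h2 := (abs_le.mp (Real.abs_exp_sub_one_sub_id_le h1)).2
  have h3 : (s' - s) ^ 2 ≤ 4 := by
    rw [← sq_abs]; nlinarith [abs_nonneg (s' - s)]
  have h4 : Real.exp (θ * s') = Real.exp (θ * s) * Real.exp (θ * (s' - s)) := by
    rw [← Real.exp_add]; congr 1; ring
  rw [h4, ← mul_sub_one]
  refine mul_le_mul_of_nonneg_left ?_ (Real.exp_pos _).le
  nlinarith [mul_le_mul_of_nonneg_left h3 (sq_nonneg θ)]

lemma yfun_cons {δ : ℝ} {n : ℕ} (R : ℝ) {x : List (Fin 4)} (h : n ≤ x.length) (a : Fin 4) :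
    yfun δ n R (a :: x) - yfun δ n R x = 3 / 4 * sgn a + savg n x / 4 + δ / 10 := by
  rw [yfun, yfun, ssum, savg, if_pos h, if_pos h, List.length_cons,
    show x.length + 1 - n = x.length - n + 1 by omega]
  push_cast; ring

lemma yfun_eq {δ : ℝ} {n : ℕ} (R : ℝ) {x : List (Fin 4)} (h : x.length ≤ n) :
    yfun δ n R x = 1 / 3 - δ / 10 * R := by
  rw [yfun, (ssum_eq_zero h).1, (ssum_eq_zero h).2, show x.length - n = 0 by omega]
  push_cast; ring

lemma abs_sgn_le (a : Fin 4) : (-1:ℝ) ≤ sgn a ∧ (sgn a : ℝ) ≤ 1 := by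
  rw [sgn]; split_ifs <;> norm_num

lemma TP.LB_exp_yfun_le (P : TP) {δ : ℝ} (hδ : 0 ≤ δ) (hδ' : δ ≤ 1 / 20) (n : ℕ) (R c : ℝ)
    {x : List (Fin 4)} (hx : x.length < P.H + P.F) :
    P.LB δ (fun x _ => Real.exp (δ / 112 * yfun δ n R x)) c x ≤ 0 := by
  rw [TP.LB, if_pos hx, sub_self, ite_self, add_zero]
  rcases Nat.lt_or_ge x.length n with h | h
  · have h1 : yfun δ n R x.tail = yfun δ n R x := by
      rw [yfun_eq R h.le, yfun_eq R (by rw [List.length_tail]; omega)]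
    have h2 : ∀ a, yfun δ n R (a :: x) = yfun δ n R x := fun a => by
      rw [yfun_eq R h.le, yfun_eq R (by rw [List.length_cons]; omega)]
    simp [h1, h2]
  set Y := yfun δ n R with hY
  set θ := δ / 112 with hθ
  have hθ0 : 0 ≤ θ := by positivity
  have hθ1 : 2 * θ ≤ 1 := by rw [hθ]; linarith
  have hσ := abs_savg_le n x
  have hcp := cp_bounds hδ x
  have hchild : ∀ a, cw δ a * (Real.exp (θ * Y (a :: x)) - Real.exp (θ * Y x))
      ≤ cw δ a * (Real.exp (θ * Y x)
        * (θ * (3 / 4 * sgn a + savg n x / 4 + δ / 10) + 4 * θ ^ 2)) := by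
    intro a
    have hs := abs_sgn_le a
    have h1 := yfun_cons (δ := δ) R h a
    rw [← h1]
    refine mul_le_mul_of_nonneg_left (exp_mul_sub_le hθ0 hθ1 ?_)
      (by linarith [(cw_bounds hδ a).1])
    rw [h1, abs_le]
    constructor <;> linarith
  have hsum := sum_le_sum fun a (_ : a ∈ univ) => hchild a
  have hsum' : ∑ a, cw δ a * (Real.exp (θ * Y x)
        * (θ * (3 / 4 * sgn a + savg n x / 4 + δ / 10) + 4 * θ ^ 2))
      = Real.exp (θ * Y x) * (θ * (-(3 / 2 * δ) + (4 + 2 * δ) * (savg n x / 4 + δ / 10))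
        + (4 + 2 * δ) * (4 * θ ^ 2)) := by
    have h0 : sgn 0 = -1 := rfl
    have h1 : sgn 1 = -1 := rfl
    have h2 : sgn 2 = 1 := rfl
    have h3 : sgn 3 = 1 := rfl
    have k0 : cw δ 0 = 1 + δ := rfl
    have k1 : cw δ 1 = 1 + δ := rfl
    have k2 : cw δ 2 = 1 := by simp [cw]
    have k3 : cw δ 3 = 1 := by simp [cw]
    rw [Fin.sum_univ_four, h0, h1, h2, h3, k0, k1, k2, k3]
    push_cast; ring
  rw [hsum'] at hsum
  have he := Real.exp_pos (θ * Y x)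
  have hfin : ∀ p q : ℝ, p = δ * q → q ≤ 0 → Real.exp (θ * Y x) * (θ * p) ≤ 0 := fun p q h hq =>
    mul_nonpos_of_nonneg_of_nonpos he.le (mul_nonpos_of_nonneg_of_nonpos hθ0
      (h ▸ mul_nonpos_of_nonneg_of_nonpos hδ hq))
  rcases h.eq_or_lt with h | h
  · have h1 : Y x.tail = Y x := by
      simp only [hY]
      rw [yfun_eq R h.ge, yfun_eq R (by rw [List.length_tail]; omega)]
    have h2 := hfin (-(3 / 2 * δ) + (4 + 2 * δ) * (0 / 4 + δ / 10) + (4 + 2 * δ) * (4 * θ))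
      (-(3 / 2) + (4 + 2 * δ) / 10 + (4 + 2 * δ) * (4 / 112)) (by rw [hθ]; ring) (by linarith)
    rw [(ssum_eq_zero h.ge).2] at hsum
    rw [h1, sub_self, mul_zero]
    linarith
  · obtain ⟨b, y, rfl⟩ := List.exists_cons_of_ne_nil (List.ne_nil_of_length_pos
      (show 0 < x.length by omega))
    rw [List.length_cons] at h
    have hy : n ≤ y.length := by omega
    set σ := savg n (b :: y) with hσd
    have h1 : Y y - Y (b :: y) = -σ - δ / 10 := by
      have := yfun_cons (δ := δ) R hy b
      rw [hσd, savg, if_pos hy]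
      linarith
    have h2 := exp_mul_sub_le hθ0 hθ1 (s := Y (b :: y)) (s' := Y y)
      (by rw [h1, abs_le]; constructor <;> linarith)
    rw [h1] at h2
    have h3 := mul_le_mul_of_nonneg_left h2 hcp.1
    rw [List.tail_cons]
    have hcase : cp δ (b :: y) = 1 + δ ∨ cp δ (b :: y) = 1 := by
      rw [cp, cw]; split_ifs <;> simp
    rcases hcase with hc | hc <;> rw [hc] at h3 ⊢
    · have h4 := hfin ((1 + δ) * (-σ - δ / 10) + (1 + δ) * (4 * θ) + (-(3 / 2 * δ)
        + (4 + 2 * δ) * (σ / 4 + δ / 10) + (4 + 2 * δ) * (4 * θ)))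
        (-σ / 2 - 3 / 2 + (3 + δ) / 10 + (5 + 3 * δ) * (4 / 112)) (by rw [hθ]; ring) (by linarith)
      linarith
    · have h4 := hfin (1 * (-σ - δ / 10) + 1 * (4 * θ) + (-(3 / 2 * δ)
        + (4 + 2 * δ) * (σ / 4 + δ / 10) + (4 + 2 * δ) * (4 * θ)))
        (σ / 2 - 3 / 2 + (3 + 2 * δ) / 10 + (5 + 2 * δ) * (4 / 112)) (by rw [hθ]; ring) (by linarith)
      linarith

variable {P : TP} {B : Type} [Fintype B] [DecidableEq B] (N : P.Net B) {δ : ℝ}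

lemma TP.LB_le_LB (hδ : 0 ≤ δ) {Φ Ψ : List (Fin 4) → ℕ → ℝ} {c d : ℝ} {x : List (Fin 4)}
    (hx : x.length < P.H + P.F) (h0 : Φ x 0 = Ψ x 0) (h1 : Φ x.tail 0 ≤ Ψ x.tail 0)
    (h2 : ∀ a, Φ (a :: x) 0 ≤ Ψ (a :: x) 0) (h3 : Φ x 1 ≤ Ψ x 1) :
    P.LB δ Φ c x ≤ P.LB δ Ψ d x := by
  have := (cp_bounds hδ x).1
  rw [TP.LB, TP.LB, if_pos hx, if_pos hx, h0]
  refine add_le_add (add_le_add ?_ (sum_le_sum fun a _ => ?_)) ?_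
  · exact mul_le_mul_of_nonneg_left (by linarith) this
  · exact mul_le_mul_of_nonneg_left (by linarith [h2 a]) (by linarith [(cw_bounds hδ a).1])
  · split_ifs <;> linarith

/-- expected time to leave the slow region -/
def TP.rho (P : TP) (k : ℕ) : ℝ := ((P.H : ℝ) - k) - ((1 / 2) ^ k - (1 / 2) ^ P.H)

lemma TP.rho_succ (k : ℕ) : P.rho (k + 1) - P.rho k = -1 + (1 / 2) ^ k / 2 := by
  simp only [TP.rho, pow_succ]; push_cast; ring

lemma TP.abs_rho_succ (k : ℕ) : |P.rho (k + 1) - P.rho k| ≤ 1 := by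
  have h1 : (0:ℝ) ≤ (1 / 2) ^ k := by positivity
  have h2 : ((1:ℝ) / 2) ^ k ≤ 1 := pow_le_one₀ (by norm_num) (by norm_num)
  rw [TP.rho_succ, abs_le]; constructor <;> linarith

lemma TP.LB_rho (hδ : 0 ≤ δ) (c : ℝ) {x : List (Fin 4)} (hx : x.length < P.H + P.F)
    {α : ℝ} (hα : 0 ≤ α) :
    P.LB δ (fun x _ => -α * P.rho x.length) c x ≤ (3 + 2 * δ) * α
      ∧ (x = [] → P.LB δ (fun x _ => -α * P.rho x.length) c x ≤ (2 + δ) * α) := by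
  rw [P.LB_len δ (fun k => -α * P.rho k), if_pos hx]
  have h1 : (0:ℝ) ≤ (1 / 2) ^ x.length := by positivity
  have h2 : -α * P.rho (x.length + 1) - -α * P.rho x.length
      = -α * (-1 + (1 / 2) ^ x.length / 2) := by rw [← mul_sub, TP.rho_succ]
  rw [h2]
  cases x with
  | nil =>
    simp only [cp, List.length_nil, pow_zero]
    constructor
    · nlinarith [mul_nonneg hδ hα]
    · intro; linarith
  | cons a x =>
    refine ⟨?_, fun h => absurd h (by simp)⟩
    have h3 := (cw_bounds hδ a).1
    have h4 : ((1:ℝ) / 2) ^ x.length ≤ 1 := pow_le_one₀ (by norm_num) (by norm_num)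
    have h5 := P.rho_succ x.length
    rw [List.length_cons, Nat.add_sub_cancel, ← mul_sub, ← neg_sub (P.rho (x.length + 1)), h5,
      cp, pow_succ]
    rw [List.length_cons, pow_succ] at h1
    have h6 : α * (1 - (1 / 2) ^ x.length / 2) ≤ cw δ a * (α * (1 - (1 / 2) ^ x.length / 2)) :=
      le_mul_of_one_le_left (mul_nonneg hα (by linarith)) h3
    have h7 : 0 ≤ δ * (α * (1 / 2) ^ x.length) := by positivity
    have h8 : 0 ≤ α * (1 / 2) ^ x.length := by positivity
    nlinarith

/-- lower bound on the probability of being in the tree, in the perturbed case -/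
lemma TP.Net.le_iterate_tree_perturbed (hδ : 0 ≤ δ) (hδ' : δ ≤ 1 / 20) {K : ℕ}
    (hK : P.H = K * P.r) {θ : ℝ} (hθ : 0 ≤ θ) (hθ' : θ * (4 * 2 ^ P.m) ≤ 1) (t : ℕ) :
    1 - K * Real.exp (1 - δ ^ 2 * P.r / 1120)
      - Real.exp ((θ + θ ^ 2 * (4 * 2 ^ P.m) ^ 2) * t
        - θ * ((4 * 2 ^ P.m + 6) / (3 + 2 * δ) * (P.H - 1)))
      ≤ (wop (N.w δ))^[t] (N.fn (fun _ _ => 1) 0) (.inl (P.bv [] (Nat.zero_le _))) := by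
  classical
  have hw := N.isNet hδ
  have h2m : (2:ℝ) ≤ 2 ^ P.m := by
    simpa using pow_le_pow_right₀ (show (1:ℝ) ≤ 2 by norm_num) N.ok.hm
  have hH1 := N.ok.hH
  have hr0 : 0 < P.r := by
    rcases Nat.eq_zero_or_pos P.r with h | h
    · rw [h, mul_zero] at hK; omega
    · exact h
  set h : ℝ := 2 ^ P.m with hh
  set α : ℝ := (4 * h + 6) / (3 + 2 * δ) with hα
  have hα0 : 0 < α := by positivity
  have hα1 : α * (3 + 2 * δ) = 4 * h + 6 := by rw [hα]; field_simp
  have hα2 : α ≤ 4 * h := by nlinarith [mul_nonneg hα0.le hδ]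
  set μ : ℝ := θ + θ ^ 2 * (4 * h) ^ 2 with hμ
  have hμ0 : 0 ≤ μ := by positivity
  set u : List (Fin 4) → ℕ → ℝ := fun x q => -α * P.rho x.length + -1 * tau P.m q with hu
  set cu : ℝ := -α * P.rho (P.H + P.F) with hcu
  set g : List (Fin 4) → ℝ := fun x =>
    ∑ i ∈ range K, Real.exp (δ / 112 * yfun δ (i * P.r) P.r x) with hg
  have hg0 : ∀ x, 0 ≤ g x := fun x => sum_nonneg fun _ _ => (Real.exp_pos _).le
  set Ψ : ℕ → List (Fin 4) → ℕ → ℝ := fun t x q =>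
    1 - g x - Real.exp (μ * t) * Real.exp (θ * u x q) with hΨ
  set cΨ : ℕ → ℝ := fun t => 1 - 0 - Real.exp (μ * t) * Real.exp (θ * cu) with hcΨ
  set Φ : ℕ → List (Fin 4) → ℕ → ℝ := fun t x q => if P.slow x then Ψ t x q else 0 with hΦ
  -- the supersolution is at least one at the exits
  have hexit : ∀ t x a, P.slow x → ¬ P.slow (a :: x) → Ψ t (a :: x) 0 ≤ 0 := by
    intro t x a hx ha
    simp only [hΨ]
    have hE := Real.exp_pos (μ * t)
    have hE2 := Real.exp_pos (θ * u (a :: x) 0)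
    by_cases hal : P.alive (a :: x)
    · have hl : (a :: x).length = P.H := by
        have h1 := hx.2
        by_contra hne
        rw [List.length_cons] at hne
        exact ha ⟨hal, by rw [List.length_cons]; omega⟩
      have h1 : u (a :: x) 0 = 0 := by
        simp only [hu, tau_zero, hl, TP.rho]; ring
      have h2 : 1 ≤ Real.exp (μ * t) := Real.one_le_exp (by positivity)
      rw [h1, mul_zero, Real.exp_zero]
      linarith [hg0 (a :: x)]
    · have h1 : (x.length + 1) % P.r = 0 ∧ 0 ≤ P.bs x + sgn a := by
        by_contra hcon
        exact hal ⟨hx.1, fun hm => by by_contra h2; exact hcon ⟨hm, by omega⟩⟩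
      obtain ⟨k, hk⟩ := Nat.dvd_of_mod_eq_zero h1.1
      obtain ⟨i, rfl⟩ : ∃ i, k = i + 1 := ⟨k - 1, by
        rcases Nat.eq_zero_or_pos k with rfl | h0
        · omega
        · omega⟩
      rw [mul_comm] at hk
      have hi1 : i * P.r ≤ x.length := by rw [add_mul, one_mul] at hk; omega
      have hi2 : x.length < (i + 1) * P.r := by omega
      have hiK : i < K := by
        have : (i + 1) * P.r ≤ K * P.r := by rw [← hk, ← hK]; exact hx.2
        exact Nat.lt_of_succ_le (Nat.le_of_mul_le_mul_right this hr0)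
      have h3 : 0 ≤ yfun δ (i * P.r) P.r (a :: x) := by
        have h4 : (0:ℝ) ≤ (P.bs x : ℝ) + sgn a := by exact_mod_cast h1.2
        have h5 := abs_savg_le (i * P.r) (a :: x)
        rw [yfun, ssum, if_pos hi1, P.ssum_eq_bs hi1 hi2, List.length_cons, hk, add_mul, one_mul,
          Nat.add_sub_cancel_left]
        linarith
      have h4 : 1 ≤ g (a :: x) := by
        refine le_trans ?_ (single_le_sum (fun _ _ => (Real.exp_pos _).le) (mem_range.mpr hiK))
        exact Real.one_le_exp (by positivity)
      nlinarith [mul_pos hE hE2]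
  have hinc : ∀ u' v, N.w δ u' v ≠ 0 →
      |N.fn u cu v - N.fn u cu u'| ≤ 4 * h := by
    refine N.abs_sub_le hδ (by positivity) ?_ ?_ ?_
    · intro a x _
      have h1 := P.abs_rho_succ x.length
      have h2 : u (a :: x) 0 - u x 0 = -(α * (P.rho (x.length + 1) - P.rho x.length)) := by
        simp only [hu, List.length_cons, tau_zero]; ring
      rw [h2, abs_neg, abs_mul, abs_of_pos hα0]
      nlinarith
    · intro x q _ hq
      have h2 : u x (q + 1) - u x q = -(tau P.m (q + 1) - tau P.m q) := by
        simp only [hu]; ring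
      rw [h2, abs_neg]
      exact abs_tau_succ_sub hq
    · intro x hx
      have h2 : u x 0 - cu = 0 := by simp only [hu, hcu, hx, tau_zero]; ring
      rw [h2, abs_zero]; positivity
  have hΨwop : ∀ (t : ℕ) (v : P.T ⊕ B), wop (N.w δ) (N.fn u cu) v ≤ N.fn u cu v + 1 →
      wop (N.w δ) (N.fn (fun x _ => g x) 0) v ≤ N.fn (fun x _ => g x) 0 v →
      N.fn (Ψ (t + 1)) (cΨ (t + 1)) v ≤ wop (N.w δ) (N.fn (Ψ t) (cΨ t)) v := by
    intro t v h1 h2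
    have hsplit : ∀ t, N.fn (Ψ t) (cΨ t) = fun v => (fun v => 1 - N.fn (fun x _ => g x) 0 v) v
        - (fun v => Real.exp (μ * t) * Real.exp (θ * N.fn u cu v)) v := by
      intro t; funext v; rcases v with s | b <;> rfl
    have h3 := wop_exp_le hw (N.fn u cu) v hθ hθ' (hinc v) h1
    have h4 : wop (N.w δ) (fun _ => (1:ℝ)) v = 1 := wop_const hw 1 v
    have h5 := mul_le_mul_of_nonneg_left h3 (Real.exp_pos (μ * t)).le
    have h6 : Real.exp (μ * (t + 1 : ℕ)) = Real.exp (μ * t) * Real.exp (θ * 1 + θ ^ 2 * (4 * h) ^ 2) := by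
      rw [← Real.exp_add]; congr 1; push_cast; rw [hμ]; ring
    rw [hsplit t, wop_sub, wop_sub, wop_smul, h4, hsplit (t + 1), h6]
    linarith
  have key := sub_le_iterate hw (N.fn (fun _ _ => 1) 0) ?_ (fun t => N.fn (Φ t) 0) ?_ ?_ t
    (.inl (P.bv [] (Nat.zero_le _)))
  · refine le_trans ?_ key
    have hs : P.slow [] := ⟨trivial, by rw [List.length_nil]; omega⟩
    rw [N.fn_bv]
    simp only [hΦ, if_pos hs, hΨ]
    have h1 : g [] ≤ K * Real.exp (1 - δ ^ 2 * P.r / 1120) := by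
      have h2 : ∀ i ∈ range K, Real.exp (δ / 112 * yfun δ (i * P.r) P.r [])
          ≤ Real.exp (1 - δ ^ 2 * P.r / 1120) := by
        intro i _
        rw [yfun_eq (P.r : ℝ) (by simp), Real.exp_le_exp]
        nlinarith
      have h3 := sum_le_sum h2
      rw [sum_const, card_range, nsmul_eq_mul] at h3
      exact h3
    have h2 : Real.exp (μ * t) * Real.exp (θ * u [] 0)
        ≤ Real.exp (μ * t - θ * (α * (P.H - 1))) := by
      rw [← Real.exp_add, Real.exp_le_exp]
      have h4 : u [] 0 ≤ -(α * (P.H - 1)) := by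
        simp only [hu, tau_zero, TP.rho, List.length_nil]
        have h5 : (0:ℝ) ≤ α * (1 / 2) ^ P.H := by positivity
        push_cast
        linarith
      nlinarith
    linarith
  · rintro (t | b)
    · exact zero_le_one
    · exact le_rfl
  · rintro (s | b)
    · change Φ 0 s.1.1 s.1.2.length ≤ 1
      simp only [hΦ, hΨ]
      have := mul_pos (Real.exp_pos (μ * (0:ℕ))) (Real.exp_pos (θ * u s.1.1 s.1.2.length))
      split_ifs
      · linarith [hg0 s.1.1]
      · exact zero_le_one
    · exact le_rfl
  · intro t
    refine TP.Net.ind ?_ ?_ ?_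
    · intro x hx
      rw [N.fn_bv]
      by_cases hs : P.slow x
      swap
      · right; simp only [hΦ, if_neg hs]; exact le_rfl
      left
      have hx' : x.length < P.H + P.F := lt_of_lt_of_le hs.2 (Nat.le_add_right _ _)
      have h1 := hΨwop t (.inl (P.bv x hx)) ?_ ?_
      · have h2 : P.LB δ (Ψ t) (cΨ t) x ≤ P.LB δ (Φ t) 0 x := by
          refine TP.LB_le_LB hδ hx' ?_ ?_ ?_ ?_
          · simp only [hΦ, if_pos hs]
          · have : P.slow x.tail := by
              cases x with
              | nil => exact hs
              | cons a x => exact hs.tail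
            simp only [hΦ, if_pos this]; exact le_rfl
          · intro a
            by_cases ha : P.slow (a :: x)
            · simp only [hΦ, if_pos ha]; exact le_rfl
            · simp only [hΦ, if_neg ha]; exact hexit t x a hs ha
          · simp only [hΦ, if_pos hs]; exact le_rfl
        have h3 := P.cB_pos hδ x
        have h4 := div_le_div_of_nonneg_right h2 (show 0 ≤ 2 * P.cB δ x by linarith)
        rw [N.fn_bv, N.wop_bv hδ] at h1
        rw [N.wop_bv hδ]
        simp only [hΦ, if_pos hs] at h4 ⊢
        linarith
      · refine N.wop_bv_le hδ hx ?_
        rw [hu, P.LB_tau δ _ (fun _ => -1), if_pos hs, tau_one]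
        have h2 := TP.LB_rho (P := P) hδ cu hx' hα0.le
        have h3 : P.cB δ x = cp δ x + (4 + 2 * δ) + 1 := by
          rw [TP.cB, if_pos hx', if_pos hs]
        rw [h3]
        by_cases hn : x = []
        · have h4 := h2.2 hn
          have h5 : cp δ x = 0 := by rw [hn]; rfl
          rw [h5]
          have h6 : (2 + δ) * α * 3 ≤ 2 * (4 * h + 6) := by
            rw [← hα1]; nlinarith [mul_nonneg hδ hα0.le]
          linarith
        · have h5 := one_le_cp hδ hn
          linarith [h2.1]
      · have h2 := N.wop_bv_le hδ (Φ := fun x _ => g x) (c := 0) (d := 0) hx ?_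
        · rwa [add_zero] at h2
        · rw [zero_mul]
          have h3 : P.LB δ (fun x _ => g x) 0 x = ∑ i ∈ range K,
              P.LB δ (fun x _ => Real.exp (δ / 112 * yfun δ (i * P.r) P.r x)) 0 x := by
            simp only [TP.LB, if_pos hx', sub_self, ite_self, add_zero, hg, ← sum_sub_distrib,
              mul_sum]
            rw [sum_comm, ← sum_add_distrib]
          rw [h3]
          exact sum_nonpos fun i _ => P.LB_exp_yfun_le hδ hδ' _ _ _ hx'
    · intro x q s hx h1 h2 h3 h4
      left
      have h5 := hΨwop t (.inl s) ?_ ?_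
      · rw [N.wop_hold hδ _ _ s hx h1 h3 h4] at h5 ⊢
        subst h3 h4
        have h6 : ∀ t q, Φ t s.1.1 q = Ψ t s.1.1 q := fun t q => by simp only [hΦ, if_pos hx]
        rw [TP.LH] at h5 ⊢
        simp only [h6]
        change Φ (t + 1) s.1.1 s.1.2.length ≤ _
        rw [h6]
        exact h5
      · rw [hu, N.wop_hold_tau hδ (fun x => -α * P.rho x.length) (-1) cu s hx h1 h2 h3 h4]
        subst h3 h4
        exact le_of_eq (by rw [TP.Net.fn]; simp only [Sum.elim_inl]; ring)
      · rw [N.wop_hold hδ _ _ s hx h1 h3 h4, TP.LH]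
        subst h3 h4
        simp only [sub_self, mul_zero, ite_self, add_zero, zero_div]
        exact le_rfl
    · intro b; exact Or.inr le_rfl

end lower_perturbed

end

section

section mixing

variable {P : TP} {B : Type} [Fintype B] [DecidableEq B] (N : P.Net B) {δ : ℝ}

/-- assumptions on the graph in the bulk -/
structure TP.Net.IsExp (D : ℕ) (Λ : ℝ) : Prop where
  one_le : 1 ≤ Λ
  deg_le : ∀ b, deg N.G b ≤ D
  poinc : ∀ f : B → ℝ, ∃ a, ∑ b, (f b - a) ^ 2 ≤ Λ * energy (unitW N.G) f
  card_le : Fintype.card P.T ≤ Fintype.card B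

instance TP.nonempty : Nonempty P.T := ⟨P.root⟩

lemma one_le_pcon {D : ℕ} {Λ : ℝ} (hΛ : 1 ≤ Λ) : 1 ≤ pcon D Λ := by
  have : 0 ≤ (600 + 6 * (D:ℝ)) * Λ := by positivity
  rw [pcon]; linarith

lemma one_le_pcon_mul {D : ℕ} {Λ : ℝ} (hΛ : 1 ≤ Λ) (m : ℕ) : 1 ≤ pcon D Λ * 2 ^ m :=
  one_le_mul_of_one_le_of_one_le (one_le_pcon hΛ) (one_le_pow₀ one_le_two)

variable {N} {D : ℕ} {Λ : ℝ}

lemma TP.Net.IsExp.poincare (hE : N.IsExp D Λ) (hδ : 0 ≤ δ) (hδ' : δ ≤ 1 / 20) :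
    Poinc (N.w δ) (pcon D Λ * 2 ^ P.m) :=
  N.poinc hδ hδ' (zero_le_one.trans hE.one_le) hE.deg_le hE.poinc

/-- upper bound on the mixing time in terms of the hitting time of the bulk -/
lemma TP.Net.IsExp.tmixW_le (hE : N.IsExp D Λ) (hδ : 0 ≤ δ) (hδ' : δ ≤ 1 / 20)
    {ε ε₁ κ₁ κ : ℝ} (hε : 0 < ε₁) (hκ : 0 ≤ κ) {ta tb t₁ : ℕ}
    (ha : ∀ u, surv (N.w δ) (P.bulk B) ta u ≤ κ₁)
    (hb : (1 - 1 / (4 * pcon D Λ)) ^ tb * ((D + 8) * Fintype.card B) ≤ κ ^ 2)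
    (h₁ : 4 * (pcon D Λ * 2 ^ P.m) * (1 - 1 / (4 * (pcon D Λ * 2 ^ P.m))) ^ t₁
      ≤ ε₁ ^ 2 * (1 / (2 * (D + 8))))
    (h : ε₁ + (κ₁ + (κ + tb * (2 / 3) ^ P.F)) ≤ ε) :
    tmixW (N.w δ) ε ≤ ta + tb + t₁ := by
  refine mixTime_le (le_trans ?_ h)
  refine dTV_le_of_hit (N.isNet hδ) (one_le_pcon_mul hE.one_le _) (hE.poincare hδ hδ') hε _ _ ?_ h₁
  intro Q hQ x
  have hn : 0 ≤ κ + tb * (2 / 3 : ℝ) ^ P.F := by positivity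
  refine (surv_add_le (N.isNet hδ) Q (P.bulk B) tb _ hn ?_ ta x).trans
    (add_le_add_left (ha x) _)
  rintro _ ⟨b, rfl⟩
  exact N.surv_inr_le hδ hδ' (zero_le_one.trans hE.one_le) hE.deg_le hE.poinc hE.card_le Q hQ hκ hb b

lemma TP.Net.sum_wSta_tree_le (N : P.Net B) (hδ : 0 ≤ δ) (hδ' : δ ≤ 1 / 20) :
    ∑ u, wSta (N.w δ) u * N.fn (fun _ _ => 1) 0 u ≤ 7 * Fintype.card P.T / Fintype.card B := by
  have hS : (Fintype.card B : ℝ) ≤ ∑ u, wdeg (N.w δ) u := by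
    rw [Fintype.sum_sum_type]
    have h1 : 0 ≤ ∑ t : P.T, wdeg (N.w δ) (.inl t) :=
      sum_nonneg fun t _ => zero_le_one.trans (N.one_le_wdeg hδ _)
    have h2 := sum_le_sum fun (b : B) (_ : b ∈ univ) => N.one_le_wdeg hδ (.inr b)
    simp only [sum_const, card_univ, nsmul_eq_mul, mul_one] at h2
    linarith
  have hB : (0:ℝ) < Fintype.card B := by
    have : Nonempty B := ⟨N.att P.root⟩
    exact_mod_cast Fintype.card_pos
  have h3 := sum_le_sum fun (t : P.T) (_ : t ∈ univ) => N.wdeg_inl_le hδ hδ' t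
  simp only [sum_const, card_univ, nsmul_eq_mul] at h3
  have h4 : ∑ u, wSta (N.w δ) u * N.fn (fun _ _ => 1) 0 u
      = (∑ t : P.T, wdeg (N.w δ) (.inl t)) / ∑ u, wdeg (N.w δ) u := by
    rw [Fintype.sum_sum_type, sum_div]
    simp only [TP.Net.fn, Sum.elim_inl, Sum.elim_inr, mul_one, mul_zero, sum_const_zero, add_zero]
    rfl
  rw [h4]
  exact div_le_div₀ (by positivity) (by linarith) hB hS

/-- lower bound on the mixing time in terms of the time spent in the tree -/
lemma TP.Net.IsExp.le_tmixW (hE : N.IsExp D Λ) (hδ : 0 ≤ δ) (hδ' : δ ≤ 1 / 20) {ε : ℝ} (hε : 0 < ε)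
    {s : ℕ} {x : P.T ⊕ B} (h : ∀ t < s, ε + 7 * Fintype.card P.T / Fintype.card B
      < (wop (N.w δ))^[t] (N.fn (fun _ _ => 1) 0) x) : s ≤ tmixW (N.w δ) ε := by
  refine _root_.le_tmixW (N.isNet hδ) (one_le_pcon_mul hE.one_le _) (hE.poincare hδ hδ') hε fun t ht => ?_
  have h1 := iterate_sub_le_dTV (N.isNet hδ) (N.fn (fun _ _ => 1) 0)
    (by rintro (t | b) <;> simp [TP.Net.fn]) (by rintro (t | b) <;> simp [TP.Net.fn]) t x
  have h2 := N.sum_wSta_tree_le hδ hδ'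
  have h3 := h t ht
  linarith

lemma TP.Net.IsExp.le_tmixW_zero (hE : N.IsExp D Λ) {ε : ℝ} (hε : 0 < ε) (hr : P.r % 2 = 1) {j : ℕ}
    (hH : j * P.r < P.H) (hF : j ≤ P.F) {s : ℕ}
    (h : ε + 7 * Fintype.card P.T / Fintype.card B < (1 / 2) ^ j - (1 / 4) ^ (j + 1)
      - 2 * Real.exp (s / (8 * 2 ^ P.m)) / (81 / 80) ^ (j * P.r)) :
    s ≤ tmixW (N.w 0) ε := by
  refine hE.le_tmixW le_rfl (by norm_num) hε fun t ht => h.trans_le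
    (le_trans ?_ (N.le_iterate_tree hr hH hF t))
  have h1 : Real.exp (t / (8 * 2 ^ P.m)) ≤ Real.exp (s / (8 * 2 ^ P.m)) := by
    rw [Real.exp_le_exp]
    have : (t:ℝ) ≤ s := by exact_mod_cast ht.le
    exact div_le_div_of_nonneg_right this (by positivity)
  have h2 := div_le_div_of_nonneg_right h1 (show (0:ℝ) ≤ (81 / 80) ^ (j * P.r) by positivity)
  rw [mul_div_assoc, mul_div_assoc]
  linarith

lemma TP.Net.IsExp.le_tmixW_perturbed (hE : N.IsExp D Λ) (hδ : 0 ≤ δ) (hδ' : δ ≤ 1 / 20) {ε : ℝ}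
    (hε : 0 < ε) {K : ℕ} (hK : P.H = K * P.r) {θ : ℝ} (hθ : 0 ≤ θ) (hθ' : θ * (4 * 2 ^ P.m) ≤ 1)
    {s : ℕ} (h : ε + 7 * Fintype.card P.T / Fintype.card B < 1 - K * Real.exp (1 - δ ^ 2 * P.r / 1120)
      - Real.exp ((θ + θ ^ 2 * (4 * 2 ^ P.m) ^ 2) * s
        - θ * ((4 * 2 ^ P.m + 6) / (3 + 2 * δ) * (P.H - 1)))) :
    s ≤ tmixW (N.w δ) ε := by
  refine hE.le_tmixW hδ hδ' hε fun t ht => h.trans_le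
    (le_trans ?_ (N.le_iterate_tree_perturbed hδ hδ' hK hθ hθ' t))
  have h1 : (θ + θ ^ 2 * (4 * 2 ^ P.m) ^ 2) * t ≤ (θ + θ ^ 2 * (4 * 2 ^ P.m) ^ 2) * s :=
    mul_le_mul_of_nonneg_left (by exact_mod_cast ht.le) (by positivity)
  have h2 := Real.exp_le_exp.mpr (sub_le_sub_right h1
    (θ * ((4 * 2 ^ P.m + 6) / (3 + 2 * δ) * (P.H - 1))))
  linarith

end mixing

end

section

section construction

lemma exists_finset_lists (α : Type) [Fintype α] [DecidableEq α] (n : ℕ) :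
    ∃ S : Finset (List α), (∀ l : List α, l.length ≤ n → l ∈ S) ∧ #S ≤ (Fintype.card α + 1) ^ n := by
  induction n with
  | zero => exact ⟨{[]}, fun l hl => by simpa using hl, by simp⟩
  | succ n ih =>
    obtain ⟨S, h1, h2⟩ := ih
    refine ⟨insert [] ((univ ×ˢ S).image fun p : α × List α => p.1 :: p.2), ?_, ?_⟩
    · rintro (_ | ⟨a, l⟩) hl
      · simp
      · simp only [mem_insert, reduceCtorEq, mem_image, mem_product, mem_univ, true_and,
          List.cons.injEq, Prod.exists, false_or]
        exact ⟨a, l, h1 l (by simpa using hl), rfl, rfl⟩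
    · have h3 : #((univ ×ˢ S).image fun p : α × List α => p.1 :: p.2) ≤ Fintype.card α * #S :=
        card_image_le.trans (by rw [card_product, card_univ])
      have h4 : Fintype.card α * #S ≤ Fintype.card α * (Fintype.card α + 1) ^ n :=
        Nat.mul_le_mul_left _ h2
      have h5 := card_insert_le [] ((univ ×ˢ S).image fun p : α × List α => p.1 :: p.2)
      have h6 : 1 ≤ (Fintype.card α + 1) ^ n := Nat.one_le_pow _ _ (Nat.succ_pos _)
      rw [pow_succ, mul_add, mul_one, mul_comm ((Fintype.card α + 1) ^ n)]
      omega

lemma TP.card_T_le (P : TP) : Fintype.card P.T ≤ 5 ^ (P.H + P.F) * 3 ^ P.m := by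
  obtain ⟨S, h1, h2⟩ := exists_finset_lists (Fin 4) (P.H + P.F)
  obtain ⟨S', h3, h4⟩ := exists_finset_lists Bool P.m
  rw [Fintype.card_coe]
  refine (card_le_card (t := S ×ˢ S') fun p hp => ?_).trans ?_
  · have h := P.mem_set.mp hp
    exact mem_product.mpr ⟨h1 _ h.1, h3 _ h.2.1⟩
  · rw [card_product]
    exact Nat.mul_le_mul (by simpa using h2) (by simpa using h4)

variable {P : TP}

/-- a net built on an expander of large girth, with its leaves far apart -/
theorem exists_net : ∃ (D : ℕ) (Λ : ℝ), 1 ≤ D ∧ 1 ≤ Λ ∧ ∀ (P : TP) (M g q : ℕ),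
    P.Ok → Fintype.card P.T ≤ M →
    400 * 60 ^ (g + 1) ≤ M → Fintype.card P.T * (D + 1) ^ (g + 1) ≤ M →
    (D : ℝ) ^ 3 * (M : ℝ) ^ 2 * (1 - 1 / (4 * (D * Λ))) ^ q < 1 →
    ∃ N : P.Net (Fin M), N.IsExp D Λ ∧ N.S.graph.Connected ∧
      ¬ N.S.graph.IsAcyclic ∧ g ≤ N.S.graph.girth ∧ N.S.graph.girth ≤ q + 4 := by
  classical
  obtain ⟨D, Λ, hΛ, h⟩ := exists_expander
  refine ⟨D + 1, Λ, by omega, hΛ, fun P M g q hP hTM hM hW hq => ?_⟩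
  obtain ⟨H, hD, hg, hpoin⟩ := h M g hM
  have hD' : ∀ v, deg H v ≤ D + 1 := fun v => (hD v).trans (Nat.le_succ _)
  have hM1 : 1 < M := by
    have : 1 ≤ 60 ^ (g + 1) := Nat.one_le_pow _ _ (by norm_num)
    omega
  have : Nonempty (Fin M) := ⟨⟨0, by omega⟩⟩
  have hconn := connected_of_poincare H hpoin
  have : Nontrivial (Fin M) := Fin.nontrivial_iff_two_le.mpr hM1
  have hadj := hconn.preconnected.exists_adj_of_nontrivial
  obtain ⟨W, hW1, hW2⟩ := exists_separated H hD' g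
  rw [Fintype.card_fin] at hW2
  have hTW : Fintype.card P.T ≤ Fintype.card W := by
    have h0 : 0 < (D + 1 + 1) ^ (g + 1) := by positivity
    rw [Fintype.card_coe W]
    exact Nat.le_of_mul_le_mul_right (hW.trans hW2) h0
  obtain ⟨e⟩ := Function.Embedding.nonempty_of_card_le hTW
  let N : P.Net (Fin M) :=
    { ok := hP, G := H, hG := hadj, att := fun t => e t
      att_inj := fun t t' _ _ h => e.injective (Subtype.ext h) }
  have hshort := exists_short_walk H hadj hD' (Λ := (D + 1 : ℕ) * Λ)
    (one_le_mul_of_one_le_of_one_le (by push_cast; linarith [Nat.cast_nonneg (α := ℝ) D]) hΛ)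
    (Poinc.of_sum_sq H hD' hpoin) q (by rwa [Fintype.card_fin])
  obtain ⟨x, hx⟩ : ∃ x : List (Fin 4), x.length + 1 = P.H + P.F :=
    ⟨List.replicate (P.H + P.F - 1) 0, by have := hP.hH; rw [List.length_replicate]; omega⟩
  have hl : ∀ a : Fin 4, (a :: x).length ≤ P.H + P.F := fun a => by rw [List.length_cons, hx]
  have hgirth := N.S.girth_bounds (g := g) (C := q) (fun b p hp => (hg b p hp).le)
    (fun t t' ht ht' hne p => hW1 _ (e t).2 _ (e t').2
      (fun h => hne (e.injective (Subtype.ext h))) p) hshort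
    (l := P.bv (0 :: x) (hl 0)) (l' := P.bv (1 :: x) (hl 1)) hx hx
    (fun h => by have := congrArg (fun t : P.T => t.1.1) h; simp [TP.bv] at this)
    rfl
    (fun h => by have := congrArg (fun t : P.T => t.1.1) h; simp [TP.bv, TP.Net.S, TP.root] at this)
    (fun h => by have := congrArg (fun t : P.T => t.1.1) h; simp [TP.bv, TP.Net.S, TP.root] at this)
  exact ⟨N, ⟨hΛ, hD', hpoin, by rwa [Fintype.card_fin]⟩,
    N.S.connected hconn ⟨P.bv (0 :: x) (hl 0), hx⟩, hgirth⟩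

end construction

section transport

variable {W : Type} [Fintype W] [DecidableEq W] (e : W ≃ V)

lemma wdeg_comp (w : V → V → ℝ) (x : W) : wdeg (fun a b => w (e a) (e b)) x = wdeg w (e x) :=
  e.sum_comp fun u => w (e x) u

lemma wMat_comp (w : V → V → ℝ) :
    wMat (fun a b => w (e a) (e b)) = (wMat w).submatrix e e := by
  ext a b
  simp only [wMat, Matrix.of_apply, Matrix.submatrix_apply, e.injective.eq_iff]
  rw [show ∑ x, w (e a) (e x) = ∑ x, w (e a) x from wdeg_comp e w a]

lemma wSta_comp (w : V → V → ℝ) (x : W) : wSta (fun a b => w (e a) (e b)) x = wSta w (e x) := by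
  have h1 := wdeg_comp e w
  simp only [wSta]
  rw [show ∑ y, w (e x) (e y) = ∑ y, w (e x) y from h1 x,
    show ∑ y, ∑ z, w (e y) (e z) = ∑ y, wdeg w (e y) from sum_congr rfl fun y _ => h1 y,
    e.sum_comp (wdeg w)]
  rfl

lemma dTV_comp (Q : Matrix V V ℝ) (π : V → ℝ) (t : ℕ) :
    dTV (Q.submatrix e e) (fun x => π (e x)) t = dTV Q π t := by
  have h : ∀ t : ℕ, (Q.submatrix e e) ^ t = (Q ^ t).submatrix e e := by
    intro t
    induction t with
    | zero => ext a b; simp [Matrix.one_apply]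
    | succ t ih => rw [pow_succ, ih, pow_succ, Matrix.submatrix_mul_equiv]
  rw [dTV, dTV, h]
  refine e.iSup_congr fun x => ?_
  rw [tvDist, tvDist, ← e.sum_comp]
  rfl

lemma tmixW_comp (w : V → V → ℝ) (ε : ℝ) : tmixW (fun a b => w (e a) (e b)) ε = tmixW w ε := by
  rw [tmixW, tmixW, mixTime, mixTime, wMat_comp, show wSta (fun a b => w (e a) (e b))
    = fun x => wSta w (e x) from funext (wSta_comp e w)]
  simp only [dTV_comp]

lemma lam2_comp (Q : Matrix V V ℝ) : lam2 (Q.submatrix e e) = lam2 Q := by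
  have hm : ∀ f : V → ℝ, (Q.submatrix e e).mulVec (fun x => f (e x)) = fun x => Q.mulVec f (e x) := by
    intro f; funext x
    exact e.sum_comp fun u => Q (e x) u * f u
  rw [lam2, lam2]
  congr 1
  ext μ
  simp only [Set.mem_ofPred_eq]
  refine and_congr_right fun _ => ⟨?_, ?_⟩
  · rintro ⟨f, hf, h⟩
    refine ⟨fun v => f (e.symm v), fun h0 => hf ?_, ?_⟩
    · funext x
      have := congrFun h0 (e x)
      simpa using this
    · have h1 := hm fun v => f (e.symm v)
      simp only [Equiv.symm_apply_apply] at h1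
      rw [h] at h1
      funext v
      have := congrFun h1 (e.symm v)
      simpa using this.symm
  · rintro ⟨f, hf, h⟩
    refine ⟨fun x => f (e x), fun h0 => hf ?_, ?_⟩
    · funext v
      have := congrFun h0 (e.symm v)
      simpa using this
    · rw [hm, h]; rfl

lemma unitW_comap (G : SimpleGraph V) : unitW (G.comap e) = fun a b => unitW G (e a) (e b) := by
  classical
  funext a b
  rfl

lemma tmixG_comap (G : SimpleGraph V) (ε : ℝ) : tmixG (G.comap e) ε = tmixG G ε := by
  rw [← tmixW_unitW, unitW_comap, tmixW_comp, tmixW_unitW]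

lemma trelG_comap (G : SimpleGraph V) : trelG (G.comap e) = trelG G := by
  rw [trelG, ← wMat_unitW, unitW_comap, trel, wMat_comp, lam2_comp, wMat_unitW]
  rfl

lemma deg_comap (G : SimpleGraph V) (x : W) : deg (G.comap e) x = deg G (e x) := by
  have h := wdeg_unitW (G.comap e) x
  rw [unitW_comap, wdeg_comp, wdeg_unitW] at h
  exact_mod_cast h.symm

end transport

end

section

section package

/-- the graphs of `exists_net` and their perturbations, with vertex set `Fin n` -/
theorem exists_graph : ∃ (D : ℕ) (Λ : ℝ), 1 ≤ D ∧ 1 ≤ Λ ∧ ∀ (P : TP) (M g q n : ℕ) (δ : ℝ), P.Ok →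
    Fintype.card P.T ≤ M → 400 * 60 ^ (g + 1) ≤ M → Fintype.card P.T * (D + 1) ^ (g + 1) ≤ M →
    (D : ℝ) ^ 3 * (M : ℝ) ^ 2 * (1 - 1 / (4 * (D * Λ))) ^ q < 1 → 0 ≤ δ → δ ≤ 1 / 20 →
    Fintype.card P.T + M = n →
    ∃ (N : P.Net (Fin M)) (G : SimpleGraph (Fin n)) (w : Fin n → Fin n → ℝ), N.IsExp D Λ ∧
      G.Connected ∧ ¬ G.IsAcyclic ∧ g ≤ G.girth ∧ G.girth ≤ q + 4 ∧ (∀ v, deg G v ≤ D + 8) ∧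
      0 ≤ trelG G ∧ trelG G ≤ 8 * (pcon D Λ * 2 ^ P.m) ∧ GoodWeights G w ∧
      (∀ u v, G.Adj u v → 1 ≤ w u v ∧ w u v ≤ 1 + δ) ∧ (∃ u v, G.Adj u v) ∧
      (∀ ε, tmixG G ε = tmixW (N.w 0) ε) ∧ ∀ ε, tmixW w ε = tmixW (N.w δ) ε := by
  classical
  obtain ⟨D, Λ, hD, hΛ, h⟩ := exists_net
  refine ⟨D, Λ, hD, hΛ, fun P M g q n δ hP hTM hM hW hq hδ hδ' hn => ?_⟩
  obtain ⟨N, hE, hconn, hac, hg, hg'⟩ := h P M g q hP hTM hM hW hq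
  have hcard : Fintype.card (Fin n) = Fintype.card (P.T ⊕ Fin M) := by
    rw [Fintype.card_sum, Fintype.card_fin, Fintype.card_fin, hn]
  let e : Fin n ≃ P.T ⊕ Fin M := Fintype.equivOfCardEq hcard
  have h0 : N.w 0 = unitW N.S.graph := N.S.wt_eq_unitW (N.wtOk le_rfl)
  have iso : N.S.graph.comap e ≃g N.S.graph := SimpleGraph.Iso.comap e N.S.graph
  have hgw := N.S.goodWeights hδ (N.wtOk hδ)
  have hgirth : (N.S.graph.comap e).girth = N.S.graph.girth := by
    rw [SimpleGraph.girth, SimpleGraph.girth, iso.egirth_eq]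
  have hrel := trel_le_of_poinc (N.isNet le_rfl) (one_le_pcon_mul (D := D) hE.one_le P.m)
    (hE.poincare le_rfl (by norm_num))
  rw [h0, wMat_unitW] at hrel
  refine ⟨N, N.S.graph.comap e, fun a b => N.w δ (e a) (e b), hE, iso.connected_iff.mpr hconn,
    fun hh => hac (iso.isAcyclic_iff.mp hh), hgirth ▸ hg, hgirth ▸ hg', fun v => ?_, ?_, ?_,
    ⟨fun _ _ => hgw.1 _ _, fun _ _ => hgw.2.1 _ _, fun _ _ => hgw.2.2 _ _⟩,
    fun u v huv => N.S.wt_bounds hδ (N.wtOk hδ) _ _ huv, ?_, fun ε => ?_, fun ε => tmixW_comp e _ ε⟩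
  · rw [deg_comap]
    have h1 : wdeg (N.w 0) (e v) ≤ D + 8 := by
      rcases e v with t | b
      · have := N.wdeg_inl_le le_rfl (by norm_num) t
        linarith [Nat.cast_nonneg (α := ℝ) D]
      · linarith [N.wdeg_inr_le le_rfl hE.deg_le b]
    rw [h0, wdeg_unitW] at h1
    exact_mod_cast h1
  · rw [trelG_comap]; exact hrel.1
  · rw [trelG_comap]; exact hrel.2
  · obtain ⟨b', hb⟩ := N.hG (N.att P.root)
    exact ⟨e.symm (.inr (N.att P.root)), e.symm (.inr b'), by
      simpa [SimpleGraph.comap_adj] using (show N.S.graph.Adj (.inr (N.att P.root)) (.inr b') from hb)⟩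
  · rw [tmixG_comap, h0, tmixW_unitW]

end package

end

section

section parameters

/-- the parameters of the tree used for graphs with `n` vertices and delay `a` -/
def prm (a : ℝ) (n : ℕ) : TP where
  r := 2 * ⌊Real.log n / (40 * 2 ^ Nat.clog 2 ⌈a⌉₊)⌋₊ + 1
  m := Nat.clog 2 ⌈a⌉₊
  H := ⌈a⌉₊ * (2 * ⌊Real.log n / (40 * 2 ^ Nat.clog 2 ⌈a⌉₊)⌋₊ + 1)
  F := ⌈8 * Real.log (Real.log n)⌉₊

/-- the orders of magnitude of the parameters -/
structure Asym (A a : ℝ) (n : ℕ) (K : ℕ) (P : TP) : Prop where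
  hr : P.r % 2 = 1
  hH : P.H = K * P.r
  hA : A ≤ K
  le_K : a ≤ K
  K_le : K ≤ 2 * a
  K_le_h : (K : ℝ) ≤ 2 ^ P.m
  h_le : (2 : ℝ) ^ P.m ≤ 2 * K
  le_ll : A ≤ Real.log (Real.log n)
  hll_le : A * (2 ^ P.m * Real.log (Real.log n)) ≤ Real.log n
  le_hr : Real.log n / 25 ≤ 2 ^ P.m * P.r
  hr_le : 2 ^ P.m * P.r ≤ Real.log n / 16
  le_F : 8 * Real.log (Real.log n) ≤ P.F
  F_le : P.F ≤ 9 * Real.log (Real.log n)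

lemma tendsto_loglog : Tendsto (fun n : ℕ => Real.log (Real.log n)) atTop atTop :=
  Real.tendsto_log_atTop.comp (Real.tendsto_log_atTop.comp tendsto_natCast_atTop_atTop)

theorem eventually_asym {f : ℕ → ℝ} (hfinf : Tendsto f atTop atTop)
    (hfo : Tendsto (fun n => f n * Real.log (Real.log n) / Real.log n) atTop (nhds 0)) (A : ℝ) :
    ∀ᶠ n in atTop, Asym A (f n) n ⌈f n⌉₊ (prm (f n) n) := by
  set A' : ℝ := max A 100 with hA'
  have hA1 : A ≤ A' := le_max_left _ _
  have hA2 : 100 ≤ A' := le_max_right _ _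
  have e1 := hfinf.eventually_ge_atTop A'
  have e2 := tendsto_loglog.eventually_ge_atTop A'
  have e3 := (Real.tendsto_log_atTop.comp tendsto_natCast_atTop_atTop).eventually_ge_atTop 1
  have e4 := hfo.eventually (eventually_lt_nhds (show (0:ℝ) < 1 / (4 * A') by positivity))
  filter_upwards [e1, e2, e3, e4] with n h1 h2 h3 h4
  simp only [Function.comp] at h3
  set l := Real.log n with hl
  set ll := Real.log l with hll
  set K := ⌈f n⌉₊ with hK
  have hK1 : f n ≤ K := Nat.le_ceil _
  have hK2 : (K : ℝ) < f n + 1 := Nat.ceil_lt_add_one (by linarith)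
  have hKn : 1 < K := by
    have : (1:ℝ) < K := by linarith
    exact_mod_cast this
  have hh1 : (K : ℝ) ≤ 2 ^ Nat.clog 2 K := by exact_mod_cast Nat.le_pow_clog one_lt_two K
  have hh2 : (2 : ℝ) ^ Nat.clog 2 K ≤ 2 * K := by
    have h5 := Nat.pow_pred_clog_lt_self one_lt_two hKn
    have h6 : 0 < Nat.clog 2 K := Nat.clog_pos one_lt_two hKn
    have h7 : 2 ^ Nat.clog 2 K = 2 * 2 ^ (Nat.clog 2 K).pred := by
      rw [← pow_succ', Nat.pred_eq_sub_one, Nat.sub_add_cancel h6]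
    have h8 : 2 ^ Nat.clog 2 K ≤ 2 * K := by omega
    exact_mod_cast h8
  set h : ℝ := 2 ^ Nat.clog 2 K with hh
  have hh0 : 0 < h := by positivity
  have hl0 : 0 < l := by linarith
  have hfl : A' * (h * ll) ≤ l := by
    rw [div_lt_iff₀ hl0] at h4
    have h5 : h ≤ 4 * f n := by linarith
    have h6 : A' * (h * ll) ≤ A' * (4 * f n * ll) :=
      mul_le_mul_of_nonneg_left (mul_le_mul_of_nonneg_right h5 (by linarith)) (by linarith)
    have h7 : 4 * A' * (f n * ll) < 4 * A' * (1 / (4 * A') * l) :=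
      mul_lt_mul_of_pos_left h4 (by linarith)
    have h8 : 4 * A' * (1 / (4 * A') * l) = l := by field_simp
    linarith
  have hhl : 100 * h ≤ l := by
    have h5 : 0 ≤ h * ll := mul_nonneg hh0.le (by linarith)
    nlinarith
  have hx : 0 ≤ l / (40 * h) := by positivity
  have hf1 := Nat.floor_le hx
  have hf2 := Nat.lt_floor_add_one (l / (40 * h))
  have hxh : h * (l / (40 * h)) = l / 40 := by field_simp
  have hf1' := mul_le_mul_of_nonneg_left hf1 hh0.le
  have hf2' := mul_le_mul_of_nonneg_left hf2.le hh0.le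
  constructor
  · change (2 * _ + 1) % 2 = 1; omega
  · rfl
  · linarith
  · exact hK1
  · linarith
  · exact hh1
  · exact hh2
  · linarith
  · refine le_trans (mul_le_mul_of_nonneg_right hA1 ?_) hfl
    exact mul_nonneg hh0.le (by linarith)
  · change l / 25 ≤ h * ((2 * ⌊l / (40 * h)⌋₊ + 1 : ℕ) : ℝ)
    push_cast
    linarith
  · change h * ((2 * ⌊l / (40 * h)⌋₊ + 1 : ℕ) : ℝ) ≤ l / 16
    push_cast
    linarith
  · exact Nat.le_ceil _
  · change ((⌈8 * ll⌉₊ : ℕ) : ℝ) ≤ 9 * ll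
    have := Nat.ceil_lt_add_one (show 0 ≤ 8 * ll by linarith)
    linarith

end parameters

end

section

section asymptotics

namespace Asym

variable {A a : ℝ} {n K : ℕ} {P : TP}

lemma one_lt_log (hA : 10 ^ 9 ≤ A) (h : Asym A a n K P) : 1 < Real.log n := by
  have h1 := h.le_ll
  have h0 : 0 ≤ Real.log n := Real.log_natCast_nonneg n
  by_contra hc
  have := Real.log_nonpos h0 (not_lt.mp hc)
  linarith

lemma exp_loglog (hA : 10 ^ 9 ≤ A) (h : Asym A a n K P) :
    Real.exp (Real.log (Real.log n)) = Real.log n :=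
  Real.exp_log (by linarith [one_lt_log hA h])

lemma n_pos (hA : 10 ^ 9 ≤ A) (h : Asym A a n K P) : 0 < n := by
  rcases Nat.eq_zero_or_pos n with h0 | h0
  · have := one_lt_log hA h
    rw [h0] at this; norm_num at this
  · exact h0

lemma exp_log_n (hA : 10 ^ 9 ≤ A) (h : Asym A a n K P) : Real.exp (Real.log n) = n :=
  Real.exp_log (by exact_mod_cast n_pos hA h)

lemma loglog_lt (hA : 10 ^ 9 ≤ A) (h : Asym A a n K P) :
    Real.log (Real.log n) + 1 ≤ Real.log n := by
  have := Real.add_one_le_exp (Real.log (Real.log n))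
  rwa [exp_loglog hA h] at this

lemma le_log (hA : 10 ^ 9 ≤ A) (h : Asym A a n K P) : A ≤ Real.log n := by
  linarith [h.le_ll, loglog_lt hA h]

lemma le_pow (h : Asym A a n K P) : A ≤ 2 ^ P.m := h.hA.trans h.K_le_h

lemma le_r (h : Asym A a n K P) : A * Real.log (Real.log n) ≤ 25 * P.r := by
  have h1 := h.hll_le
  have h2 := h.le_hr
  have h3 : (0:ℝ) < 2 ^ P.m := by positivity
  have h4 : 2 ^ P.m * (A * Real.log (Real.log n)) ≤ 2 ^ P.m * (25 * P.r) := by nlinarith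
  exact le_of_mul_le_mul_left h4 h3

lemma sq_le_r (hA : 10 ^ 9 ≤ A) (h : Asym A a n K P) : A ^ 2 ≤ 25 * P.r := by
  nlinarith [le_r h, h.le_ll]

lemma pow_mul_loglog_le (hA : 10 ^ 9 ≤ A) (h : Asym A a n K P) :
    10 ^ 9 * (2 ^ P.m * Real.log (Real.log n)) ≤ Real.log n := by
  refine le_trans (mul_le_mul_of_nonneg_right hA ?_) h.hll_le
  have := h.le_ll
  exact mul_nonneg (by positivity) (by linarith)

lemma pow_le (hA : 10 ^ 9 ≤ A) (h : Asym A a n K P) :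
    10 ^ 9 * (2:ℝ) ^ P.m ≤ Real.log n := by
  have h1 := pow_mul_loglog_le hA h
  have h2 := h.le_ll
  have h3 : (0:ℝ) < 2 ^ P.m := by positivity
  nlinarith

lemma mul_loglog_le (hA : 10 ^ 9 ≤ A) (h : Asym A a n K P) :
    10 ^ 9 * Real.log (Real.log n) ≤ Real.log n := by
  have h1 := pow_mul_loglog_le hA h
  have h2 := h.le_ll
  have h3 := le_pow h
  nlinarith

lemma cast_H (h : Asym A a n K P) : (P.H : ℝ) = K * P.r := by
  rw [h.hH]; push_cast; ring

lemma H_le (h : Asym A a n K P) : (P.H : ℝ) ≤ Real.log n / 16 := by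
  rw [cast_H h]
  exact (mul_le_mul_of_nonneg_right h.K_le_h (Nat.cast_nonneg _)).trans h.hr_le

lemma ok (hA : 10 ^ 9 ≤ A) (h : Asym A a n K P) : P.Ok := by
  refine ⟨?_, ?_, ?_⟩
  · by_contra hc
    have h1 := le_pow h
    rw [show P.m = 0 by omega] at h1
    norm_num at h1; linarith
  · have h1 := h.hA
    have h2 := h.hr
    have h3 : 0 < K := by
      have : (0:ℝ) < K := by linarith
      exact_mod_cast this
    rw [h.hH]
    exact Nat.mul_pos h3 (by omega)
  · have h1 := h.le_F
    have h2 := h.le_ll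
    have : (0:ℝ) < P.F := by linarith
    exact_mod_cast this

lemma card_le (hA : 10 ^ 9 ≤ A) (h : Asym A a n K P) :
    (Fintype.card P.T : ℝ) ≤ Real.exp (Real.log n / 4) := by
  have h1 : (Fintype.card P.T : ℝ) ≤ 5 ^ (P.H + P.F) * 3 ^ P.m := by
    exact_mod_cast TP.card_T_le P
  have e5 : (5:ℝ) ≤ Real.exp 2 := by
    have := Real.quadratic_le_exp_of_nonneg (show (0:ℝ) ≤ 2 by norm_num)
    linarith
  have h2 : (5:ℝ) ^ (P.H + P.F) * 3 ^ P.m ≤ Real.exp 2 ^ (P.H + P.F) * Real.exp 2 ^ P.m := by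
    gcongr; linarith
  refine (h1.trans h2).trans ?_
  rw [← pow_add, ← Real.exp_nat_mul]
  apply Real.exp_le_exp.mpr
  push_cast
  have hm : (P.m : ℝ) ≤ 2 ^ P.m := by exact_mod_cast P.m.lt_two_pow_self.le
  have := H_le h
  have := h.F_le
  have := pow_le hA h
  have := mul_loglog_le hA h
  linarith

lemma exp_quarter (hA : 10 ^ 9 ≤ A) (h : Asym A a n K P) :
    Real.exp (Real.log n / 4) ^ 4 = n ∧ A / 4 + 1 ≤ Real.exp (Real.log n / 4) := by
  constructor
  · rw [← Real.exp_nat_mul, ← exp_log_n hA h]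
    congr 1
    rw [exp_log_n hA h]; push_cast; ring
  · have := Real.add_one_le_exp (Real.log n / 4)
    linarith [le_log hA h]

lemma card_lt (hA : 10 ^ 9 ≤ A) (h : Asym A a n K P) :
    2 * (Fintype.card P.T : ℝ) ≤ n := by
  have h1 := card_le hA h
  obtain ⟨h2, h3⟩ := exp_quarter hA h
  set x := Real.exp (Real.log n / 4)
  have h4 : 2 ≤ x := by linarith
  have h5 : (2:ℝ) ^ 3 ≤ x ^ 3 := by gcongr
  have h6 : x ^ 4 = x ^ 3 * x := by ring
  nlinarith

/-- the number of vertices outside the tree -/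
lemma half_le (hA : 10 ^ 9 ≤ A) (h : Asym A a n K P) {M : ℕ} (hM : Fintype.card P.T + M = n) :
    (n:ℝ) / 2 ≤ M := by
  have h1 := card_lt hA h
  have h2 : (Fintype.card P.T : ℝ) + M = n := by exact_mod_cast hM
  linarith

lemma card_div_le (hA : 10 ^ 9 ≤ A) (h : Asym A a n K P) {M : ℕ}
    (hM : Fintype.card P.T + M = n) : 7 * (Fintype.card P.T : ℝ) / M ≤ 1 / A := by
  have h1 := card_le hA h
  have h0 := half_le hA h hM
  obtain ⟨h2, h3⟩ := exp_quarter hA h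
  set x := Real.exp (Real.log n / 4)
  have h4 : 14 ≤ x := by linarith
  have h4' : A ≤ 4 * x := by linarith
  have hn : (0:ℝ) < n := by exact_mod_cast n_pos hA h
  have hx : 0 < x := by linarith
  rw [div_le_div_iff₀ (by linarith) (by linarith)]
  have : 7 * (Fintype.card P.T : ℝ) * A ≤ 7 * x * (4 * x) := by gcongr
  have h6 : x ^ 4 = x ^ 2 * x ^ 2 := by ring
  have h7 : (14:ℝ) ^ 2 ≤ x ^ 2 := by gcongr
  nlinarith

lemma graph_conditions (hA : 10 ^ 9 ≤ A) (h : Asym A a n K P) {D : ℕ} {Λ : ℝ} (hD : 1 ≤ D)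
    (hΛ : 1 ≤ Λ) (hAD : D + 8 ≤ A) {M : ℕ} (hM : Fintype.card P.T + M = n) {g q : ℕ}
    (hg : (g : ℝ) ≤ Real.log n / (4 * (60 + D))) (hq : 16 * D * Λ * Real.log n ≤ q) :
    Fintype.card P.T ≤ M ∧ 400 * 60 ^ (g + 1) ≤ M ∧ Fintype.card P.T * (D + 1) ^ (g + 1) ≤ M ∧
      (D : ℝ) ^ 3 * (M : ℝ) ^ 2 * (1 - 1 / (4 * (D * Λ))) ^ q < 1 := by
  have h0 := half_le hA h hM
  have hT := card_le hA h
  obtain ⟨h2, h3⟩ := exp_quarter hA h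
  have hl := le_log hA h
  have hD' : (1:ℝ) ≤ D := by exact_mod_cast hD
  have hb : (60 + D : ℝ) ^ g ≤ Real.exp (Real.log n / 4) := by
    have h5 : (60 + D : ℝ) ≤ Real.exp (60 + D) := by
      linarith [Real.add_one_le_exp (60 + D : ℝ)]
    refine (pow_le_pow_left₀ (by positivity) h5 g).trans ?_
    rw [← Real.exp_nat_mul]
    apply Real.exp_le_exp.mpr
    rw [le_div_iff₀ (by positivity)] at hg
    linarith
  have hq' : (1 - 1 / (4 * (D * Λ))) ^ q ≤ Real.exp (-(4 * Real.log n)) := by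
    have h5 : 1 - 1 / (4 * (D * Λ)) ≤ Real.exp (-(1 / (4 * (D * Λ)))) := by
      linarith [Real.add_one_le_exp (-(1 / (4 * (D * Λ))))]
    have h6 : 1 / (4 * (D * Λ)) ≤ 1 := by
      rw [div_le_one (by positivity)]; nlinarith
    refine (pow_le_pow_left₀ (by linarith) h5 q).trans ?_
    rw [← Real.exp_nat_mul]
    apply Real.exp_le_exp.mpr
    have h7 : 4 * Real.log n = 16 * D * Λ * Real.log n * (1 / (4 * (D * Λ))) := by field_simp; ring
    have h8 := mul_le_mul_of_nonneg_right hq (show 0 ≤ 1 / (4 * (D * Λ)) by positivity)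
    linarith
  have hq0 : 0 ≤ (1 - 1 / (4 * (D * Λ))) ^ q := by
    have h6 : 1 / (4 * (D * Λ)) ≤ 1 := by
      rw [div_le_one (by positivity)]; nlinarith
    exact pow_nonneg (by linarith) q
  have hMn : (M : ℝ) ≤ n := by
    have : M ≤ n := by omega
    exact_mod_cast this
  have hE : Real.exp (-(4 * Real.log n)) * (n:ℝ) ^ 4 = 1 := by
    have h5 : (n:ℝ) ^ 4 = Real.exp (4 * Real.log n) := by
      have := Real.exp_nat_mul (Real.log n) 4
      rw [exp_log_n hA h] at this
      exact_mod_cast this.symm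
    rw [h5, ← Real.exp_add, neg_add_cancel, Real.exp_zero]
  set x := Real.exp (Real.log n / 4)
  have hx : (10:ℝ) ^ 8 ≤ x := by linarith
  have hxD : (D + 8 : ℝ) ≤ 4 * x := by linarith
  have hx0 : 0 < x := by linarith
  have h6 : x ^ 4 = x * x * x ^ 2 := by ring
  have h7 : (10:ℝ) ^ 8 * 10 ^ 8 ≤ x ^ 2 := by nlinarith
  refine ⟨?_, ?_, ?_, ?_⟩
  · have h1 := card_lt hA h
    have : (Fintype.card P.T : ℝ) ≤ M := by linarith
    exact_mod_cast this
  · have h8 : (60:ℝ) ^ g ≤ x := (pow_le_pow_left₀ (by norm_num) (by linarith) g).trans hb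
    have h9 : x * 1 ≤ x * x := by nlinarith
    have : (400 * 60 ^ (g + 1) : ℝ) ≤ M := by
      rw [pow_succ]; nlinarith
    exact_mod_cast this
  · have h8 : (D + 1:ℝ) ^ g ≤ x := (pow_le_pow_left₀ (by positivity) (by linarith) g).trans hb
    have h9 : (Fintype.card P.T : ℝ) * (D + 1:ℝ) ^ g ≤ x * x := by gcongr
    have h10 : (Fintype.card P.T : ℝ) * (D + 1:ℝ) ^ g * (D + 1) ≤ x * x * (4 * x) := by
      gcongr; linarith
    have h11 : x * x * x * (10 ^ 8) ≤ x * x * x * x := by gcongr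
    have : (Fintype.card P.T * (D + 1) ^ (g + 1) : ℝ) ≤ M := by
      rw [pow_succ, ← mul_assoc]; nlinarith
    exact_mod_cast this
  · have h8 : (D:ℝ) ^ 3 ≤ (4 * x) ^ 3 := by gcongr; linarith
    have hE' : 0 < Real.exp (-(4 * Real.log n)) := Real.exp_pos _
    have h9 : (D : ℝ) ^ 3 * (M : ℝ) ^ 2 * (1 - 1 / (4 * (D * Λ))) ^ q ≤
        (4 * x) ^ 3 * (n:ℝ) ^ 2 * Real.exp (-(4 * Real.log n)) := by gcongr
    refine h9.trans_lt ?_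
    rw [← hE, mul_comm (Real.exp _)]
    refine mul_lt_mul_of_pos_right ?_ hE'
    have hn : (0:ℝ) < n := by exact_mod_cast n_pos hA h
    have h10 : (4 * x) ^ 3 < (n:ℝ) ^ 2 := by
      rw [← h2]
      have h11 : (x ^ 4) ^ 2 = x ^ 3 * (x ^ 3 * x ^ 2) := by ring
      have h12 : (10:ℝ) ^ 8 * 10 ^ 8 ≤ x ^ 3 * x ^ 2 := by
        have : 1 * x ^ 2 ≤ x ^ 3 * x ^ 2 :=
          mul_le_mul_of_nonneg_right (one_le_pow₀ (by linarith)) (by positivity)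
        linarith
      rw [h11, mul_pow, mul_comm]
      exact mul_lt_mul_of_pos_left (by linarith) (by positivity)
    calc (4 * x) ^ 3 * (n:ℝ) ^ 2 < (n:ℝ) ^ 2 * (n:ℝ) ^ 2 := by gcongr
      _ = (n:ℝ) ^ 4 := by ring

end Asym

end asymptotics

end

section

section mixing

lemma one_sub_inv_pow_le {x y : ℝ} (hx : 1 ≤ x) {k : ℕ} (hk : x * y ≤ k) :
    (1 - 1 / x) ^ k ≤ Real.exp (-y) := by
  have h1 : 1 - 1 / x ≤ Real.exp (-(1 / x)) := by linarith [Real.add_one_le_exp (-(1 / x))]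
  have h2 : 1 / x ≤ 1 := by rw [div_le_one (by linarith)]; exact hx
  refine (pow_le_pow_left₀ (by linarith) h1 k).trans ?_
  rw [← Real.exp_nat_mul]
  apply Real.exp_le_exp.mpr
  have h3 : y ≤ k / x := by rw [le_div_iff₀ (by linarith)]; linarith
  have h4 : (k:ℝ) * -(1 / x) = -(k / x) := by ring
  linarith

lemma exp_neg_le_inv {x : ℝ} (hx : 0 < x) : Real.exp (-x) ≤ 1 / x := by
  rw [Real.exp_neg, ← one_div]
  exact one_div_le_one_div_of_le hx (by linarith [Real.add_one_le_exp x])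

namespace Asym

variable {A a : ℝ} {n K : ℕ} {P : TP}

lemma exp_neg_mul_loglog (hA : 10 ^ 9 ≤ A) (h : Asym A a n K P) (k : ℕ) :
    Real.exp (-(k * Real.log (Real.log n))) = 1 / Real.log n ^ k := by
  rw [Real.exp_neg, Real.exp_nat_mul, exp_loglog hA h, one_div]

lemma pow_F_le (hA : 10 ^ 9 ≤ A) (h : Asym A a n K P) :
    (2 / 3 : ℝ) ^ P.F ≤ 1 / Real.log n ^ 2 := by
  have h1 := one_sub_inv_pow_le (x := 3) (y := 2 * Real.log (Real.log n)) (k := P.F) (by norm_num)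
    (by linarith [h.le_F, h.le_ll])
  have h2 := exp_neg_mul_loglog hA h 2
  push_cast at h2
  rw [← h2]
  refine le_trans (le_of_eq ?_) h1
  norm_num

variable {D : ℕ} {Λ : ℝ} {M : ℕ} {N : P.Net (Fin M)} {δ : ℝ}

/-- the mixing time is at most the hitting time of the bulk plus a multiple of `log n` -/
lemma tmixW_le (hA : 10 ^ 9 ≤ A) (h : Asym A a n K P) (hE : N.IsExp D Λ)
    (hM : Fintype.card P.T + M = n) (hδ : 0 ≤ δ) (hδ' : δ ≤ 1 / 20)
    (hAD : 48 * (D + 8) * pcon D Λ ≤ A) {ε κ₁ : ℝ} {ta : ℕ}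
    (ha : ∀ u, surv (N.w δ) (P.bulk (Fin M)) ta u ≤ κ₁)
    (hε : κ₁ + 11 * pcon D Λ / A ≤ ε) :
    (tmixW (N.w δ) ε : ℝ) ≤ ta + 10 * pcon D Λ * Real.log n := by
  have hp := one_le_pcon (D := D) hE.one_le
  have hl := le_log hA h
  have hll := h.le_ll
  have hpF := pow_F_le hA h
  have hh := pow_mul_loglog_le hA h
  have hhl := pow_le hA h
  have hhA := le_pow h
  have hMn : (M : ℝ) ≤ n := by
    have : M ≤ n := by omega
    exact_mod_cast this
  set p := pcon D Λ
  have e4 := exp_neg_mul_loglog hA h 4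
  have en := exp_log_n hA h
  have hAll : 0 ≤ 2 ^ P.m * Real.log (Real.log n) := mul_nonneg (by positivity) (by linarith)
  set l := Real.log n with hl'
  set ll := Real.log l
  set y : ℝ := 2 ^ P.m
  have hl0 : 0 < l := by linarith
  have hD0 : (0:ℝ) ≤ D := Nat.cast_nonneg D
  have hDp : 48 * (D + 8) * p ≤ l := hAD.trans hl
  have hDl : 48 * (D + 8 : ℝ) ≤ l := by nlinarith
  have htb := Nat.ceil_lt_add_one (show 0 ≤ 8 * p * l by positivity)
  have htb' := Nat.le_ceil (8 * p * l)
  have ht₁ := Nat.ceil_lt_add_one (show 0 ≤ 16 * p * (y * ll) by positivity)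
  have ht₁' := Nat.le_ceil (16 * p * (y * ll))
  have hpl : l ≤ p * l := by nlinarith
  have hphl : p * (10 ^ 9 * (y * ll)) ≤ p * l := mul_le_mul_of_nonneg_left hh (by linarith)
  have hb : (1 - 1 / (4 * p)) ^ ⌈8 * p * l⌉₊ * ((D + 8) * Fintype.card (Fin M)) ≤ (1 / l) ^ 2 := by
    rw [Fintype.card_fin]
    have h1 := one_sub_inv_pow_le (x := 4 * p) (y := 2 * l) (k := ⌈8 * p * l⌉₊) (by linarith)
      (by linarith)
    have h2 : Real.exp (-(2 * l)) * (n:ℝ) ^ 2 = 1 := by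
      rw [← en, ← Real.exp_nat_mul, ← Real.exp_add]; push_cast
      rw [neg_add_cancel, Real.exp_zero]
    have h3 : l ^ 3 / 6 ≤ n := by
      have := Real.pow_div_factorial_le_exp l hl0.le 3
      rw [en] at this
      norm_num [Nat.factorial] at this
      linarith
    have hn0 : (0:ℝ) < n := by rw [← en]; positivity
    have h4 : (D + 8 : ℝ) * l ^ 2 ≤ n := by
      have : (D + 8 : ℝ) * l ^ 2 ≤ l / 48 * l ^ 2 := by gcongr; linarith
      nlinarith [pow_pos hl0 3]
    calc _ ≤ Real.exp (-(2 * l)) * ((D + 8) * n) := by gcongr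
      _ = (D + 8) / n := by
          rw [eq_div_iff hn0.ne']
          linear_combination (D + 8 : ℝ) * h2
      _ ≤ (1 / l) ^ 2 := by
          rw [div_pow, one_pow, div_le_div_iff₀ hn0 (by positivity)]
          linarith
  have h₁ : 4 * (p * y) * (1 - 1 / (4 * (p * y))) ^ ⌈16 * p * (y * ll)⌉₊ ≤
      (1 / l) ^ 2 * (1 / (2 * (D + 8))) := by
    have h1 := one_sub_inv_pow_le (x := 4 * (p * y)) (y := (4:ℕ) * ll)
      (k := ⌈16 * p * (y * ll)⌉₊) (by nlinarith) (by push_cast; linarith)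
    rw [e4] at h1
    have h2 : 4 * p / l ≤ 1 / (2 * (D + 8)) := by
      rw [div_le_div_iff₀ hl0 (by linarith)]
      have : 0 ≤ (D + 8) * p := by positivity
      linarith
    have h3 : 4 * (p * y) ≤ 4 * (p * l) := by
      have : p * y ≤ p * l := mul_le_mul_of_nonneg_left (by linarith) (by linarith)
      linarith
    have hy0 : 0 ≤ 4 * (p * y) := by positivity
    have hl4 : 0 ≤ 1 / l ^ 4 := by positivity
    calc _ ≤ 4 * (p * y) * (1 / l ^ 4) := mul_le_mul_of_nonneg_left h1 hy0
      _ ≤ 4 * (p * l) * (1 / l ^ 4) := mul_le_mul_of_nonneg_right h3 hl4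
      _ = (1 / l) ^ 2 * (4 * p / l) := by field_simp
      _ ≤ _ := mul_le_mul_of_nonneg_left h2 (by positivity)
  have htF : (⌈8 * p * l⌉₊ : ℝ) * (2 / 3) ^ P.F ≤ 9 * p / l := by
    calc _ ≤ (9 * p * l) * (1 / l ^ 2) := by gcongr; linarith
      _ = _ := by field_simp
  have key : tmixW (N.w δ) ε ≤ ta + ⌈8 * p * l⌉₊ + ⌈16 * p * (y * ll)⌉₊ := by
    refine hE.tmixW_le hδ hδ' (ε₁ := 1 / l) (κ := 1 / l) (by positivity) (by positivity)
      ha hb h₁ ?_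
    have h1 : 11 * p / l ≤ 11 * p / A := by gcongr
    have h2 : 1 / l ≤ p / l := by gcongr
    have h3 : 11 * p / l = p / l + p / l + 9 * p / l := by ring
    linarith
  have key' : (tmixW (N.w δ) ε : ℝ) ≤ ta + ⌈8 * p * l⌉₊ + ⌈16 * p * (y * ll)⌉₊ := by
    exact_mod_cast key
  linarith

lemma tmixW_zero_le (hA : 10 ^ 9 ≤ A) (h : Asym A a n K P) (hE : N.IsExp D Λ)
    (hM : Fintype.card P.T + M = n) (hAD : 110 * (D + 8) * pcon D Λ ≤ A) :
    (tmixW (N.w 0) (1 / 4) : ℝ) ≤ (25 + 10 * pcon D Λ) * Real.log n := by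
  have hp := one_le_pcon (D := D) hE.one_le
  have hl := le_log hA h
  have hll := h.le_ll
  have hpF := pow_F_le hA h
  have hhl := pow_le hA h
  have hhr := h.hr_le
  have hmll := mul_loglog_le hA h
  have hH := H_le h
  have hF := h.F_le
  have hD0 : (0:ℝ) ≤ D := Nat.cast_nonneg D
  have hl0 : 0 < Real.log n := by linarith
  have hta := Nat.ceil_lt_add_one (show 0 ≤ 24 * Real.log n by positivity)
  have hta' := Nat.le_ceil (24 * Real.log n)
  have ht0 : 0 < ⌈24 * Real.log n⌉₊ := Nat.ceil_pos.mpr (by positivity)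
  have key := tmixW_le hA h hE hM le_rfl (by norm_num) (by nlinarith)
    (ε := 1 / 4) (κ₁ := 3 / 25) (ta := ⌈24 * Real.log n⌉₊) (fun u => ?_) ?_
  · linarith
  · refine (N.surv_bulk_le h.hr 5 ht0 u).trans ?_
    have h1 : (4 * ((P.H + P.F : ℕ) : ℝ) + (4 * 2 ^ P.m - 6) / 3 * (((5 : ℕ) + 1) * P.r + 3) + 8 +
        8 * 2 ^ P.m) / ⌈24 * Real.log n⌉₊ ≤ 1 / 24 := by
      rw [div_le_iff₀ (by exact_mod_cast ht0)]
      have hr0 : (0:ℝ) ≤ P.r := Nat.cast_nonneg _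
      push_cast
      nlinarith
    have h2 : (1 / 4 : ℝ) ^ P.F ≤ 1 / Real.log n ^ 2 :=
      (pow_le_pow_left₀ (by norm_num) (by norm_num) _).trans hpF
    have h3 : (⌈24 * Real.log n⌉₊ : ℝ) * (1 / 4) ^ P.F ≤ 1 / 300 := by
      calc _ ≤ (25 * Real.log n) * (1 / Real.log n ^ 2) := by gcongr; linarith
        _ = 25 / Real.log n := by field_simp
        _ ≤ 1 / 300 := by rw [div_le_div_iff₀ hl0 (by norm_num)]; linarith
    norm_num at h1 h3 ⊢
    linarith
  · have : 11 * pcon D Λ / A ≤ 1 / 10 := by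
      rw [div_le_div_iff₀ (by linarith) (by norm_num)]; nlinarith
    linarith

lemma le_tmixW_zero (hA : 10 ^ 9 ≤ A) (h : Asym A a n K P) (hE : N.IsExp D Λ)
    (hM : Fintype.card P.T + M = n) {j : ℕ} (hj : 1 ≤ j) (hAj : 10 ^ 6 * 2 ^ j ≤ A) :
    j / 1000 * Real.log n ≤ tmixW (N.w 0) ((1 / 2) ^ (j + 1)) := by
  have hl := le_log hA h
  have hr := le_r h
  have hll := h.le_ll
  have hhr := h.le_hr
  have hT := card_div_le hA h hM
  have hj0 : (1:ℝ) ≤ j := by exact_mod_cast hj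
  have hj2 : (j:ℝ) ≤ 2 ^ j := by exact_mod_cast j.lt_two_pow_self.le
  have hy : (0:ℝ) < 2 ^ P.m := by positivity
  have hrr := sq_le_r hA h
  have hr0 : (0:ℝ) < P.r := by nlinarith
  have hjr : (P.r : ℝ) ≤ j * P.r := by nlinarith
  have hx : 0 ≤ (j * P.r * 2 ^ P.m / 20 : ℝ) := by positivity
  have hs := Nat.floor_le hx
  have hs' := Nat.lt_floor_add_one (j * P.r * 2 ^ P.m / 20 : ℝ)
  have key := hE.le_tmixW_zero (ε := (1 / 2) ^ (j + 1)) (by positivity) h.hr (j := j)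
    (s := ⌊(j * P.r * 2 ^ P.m / 20 : ℝ)⌋₊) ?_ ?_ ?_
  · have key' : ((⌊(j * P.r * 2 ^ P.m / 20 : ℝ)⌋₊ : ℕ) : ℝ) ≤ tmixW (N.w 0) ((1 / 2) ^ (j + 1)) := by
      exact_mod_cast key
    have h1 : (j:ℝ) * (Real.log n / 25) ≤ j * (2 ^ P.m * P.r) :=
      mul_le_mul_of_nonneg_left hhr (by linarith)
    nlinarith
  · rw [h.hH]
    have h1 : (j:ℝ) < K := by linarith [h.hA]
    have h2 : j < K := by exact_mod_cast h1
    exact Nat.mul_lt_mul_of_pos_right h2 (by exact_mod_cast hr0)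
  · have : (j:ℝ) ≤ P.F := by linarith [h.le_F]
    exact_mod_cast this
  · rw [Fintype.card_fin]
    refine lt_of_le_of_lt (add_le_add le_rfl hT) ?_
    have h1 : Real.exp ((⌊(j * P.r * 2 ^ P.m / 20 : ℝ)⌋₊ : ℕ) / (8 * 2 ^ P.m)) ≤
        Real.exp (j * P.r / 160) := by
      apply Real.exp_le_exp.mpr
      rw [div_le_div_iff₀ (by positivity) (by norm_num)]
      nlinarith
    have h2 : Real.exp (j * P.r / 81) ≤ (81 / 80 : ℝ) ^ (j * P.r) := by
      have h3 : Real.exp (1 / 81) ≤ 81 / 80 := by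
        have h4 := Real.add_one_le_exp (-(1 / 81 : ℝ))
        rw [Real.exp_neg] at h4
        have h5 : (80 / 81 : ℝ) ≤ (Real.exp (1 / 81))⁻¹ := by linarith
        have h6 := (le_inv_comm₀ (by norm_num) (Real.exp_pos _)).mp h5
        norm_num at h6 ⊢; exact h6
      calc Real.exp (j * P.r / 81) = Real.exp (1 / 81) ^ (j * P.r) := by
            rw [← Real.exp_nat_mul]; congr 1; push_cast; ring
        _ ≤ _ := by gcongr
    have h4 : 2 * Real.exp ((⌊(j * P.r * 2 ^ P.m / 20 : ℝ)⌋₊ : ℕ) / (8 * 2 ^ P.m)) /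
        (81 / 80) ^ (j * P.r) ≤ 2 * (1 / (P.r / 200)) := by
      calc _ ≤ 2 * Real.exp (j * P.r / 160) / Real.exp (j * P.r / 81) := by gcongr
        _ = 2 * Real.exp (-(j * P.r / 81 - j * P.r / 160)) := by
            rw [mul_div_assoc, ← Real.exp_sub]; congr 2; ring
        _ ≤ 2 * Real.exp (-(P.r / 200)) := by gcongr; linarith
        _ ≤ _ := by gcongr; exact exp_neg_le_inv (by positivity)
    have h5 : 2 * (1 / ((P.r:ℝ) / 200)) ≤ 1 / A := by
      rw [one_div_div, ← mul_div_assoc, div_le_div_iff₀ hr0 (by linarith)]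
      nlinarith
    have h6 : 1 / A ≤ 1 / 10 ^ 6 * (1 / 2) ^ j := by
      rw [one_div_pow, one_div_mul_one_div]
      exact one_div_le_one_div_of_le (by positivity) hAj
    have h7 : (1 / 4 : ℝ) ^ (j + 1) ≤ (1 / 2) ^ j * (1 / 8) := by
      have h8 : (1 / 4 : ℝ) ^ (j + 1) = (1 / 2) ^ j * ((1 / 2) ^ j * (1 / 4)) := by
        rw [show (1 / 4 : ℝ) = 1 / 2 * (1 / 2) by norm_num, mul_pow]; ring
      have h9 : (1 / 2 : ℝ) ^ j ≤ (1 / 2) ^ 1 := pow_le_pow_of_le_one (by norm_num) (by norm_num) hj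
      rw [h8]; gcongr; linarith
    have h8 : (1 / 2 : ℝ) ^ (j + 1) = (1 / 2) ^ j * (1 / 2) := pow_succ _ _
    have h9 : (0:ℝ) < (1 / 2) ^ j := by positivity
    rw [h8]
    generalize 2 * Real.exp ((⌊(j * P.r * 2 ^ P.m / 20 : ℝ)⌋₊ : ℕ) / (8 * 2 ^ P.m)) /
        (81 / 80) ^ (j * P.r) = z at h4 ⊢
    linarith

lemma one_le_tmixW (hA : 10 ^ 9 ≤ A) (h : Asym A a n K P) (hE : N.IsExp D Λ)
    (hM : Fintype.card P.T + M = n) (hδ : 0 ≤ δ) (hδ' : δ ≤ 1 / 20) {ε : ℝ} (hε : 0 < ε)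
    (hε1 : ε + 1 / A < 1) : 1 ≤ tmixW (N.w δ) ε := by
  refine hE.le_tmixW hδ hδ' hε (x := .inl P.root) fun t ht => ?_
  rw [Fintype.card_fin, show t = 0 by omega]
  have hT := card_div_le hA h hM
  have h1 : (N.fn (fun _ _ => (1:ℝ)) 0) (.inl P.root) = 1 := by simp [TP.Net.fn]
  rw [Function.iterate_zero, id, h1]
  linarith

end Asym

end mixing

end

section

section perturbed

/-- the size of the perturbation -/
def pert (n : ℕ) (P : TP) : ℝ := √√(Real.log (Real.log n) / P.r)

lemma upper_exponent {η x y r t U : ℝ} (hη : 0 < η) (hη1 : η ≤ 1) (hx : 0 < x) (hy : 0 < y)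
    (hyr : y * r ≤ 2 * x) (hU : U ≤ (1 + η / 4) * (4 / 3 * y * x))
    (ht : (1 + 3 / 4 * η) * (4 / 3 * y * x) ≤ t) :
    η / 4 / (10 * y) ^ 2 * U - (η / 4 / (10 * y) ^ 2 - (η / 4 / (10 * y) ^ 2) ^ 2 * (10 * y) ^ 2) * t
      ≤ -(η ^ 2 * r / 10000) := by
  have h1 : (η / 4 / (10 * y) ^ 2) ^ 2 * (10 * y) ^ 2 = η / 4 / (10 * y) ^ 2 * (η / 4) := by
    field_simp
  have h3 : (1 - η / 4) * ((1 + 3 / 4 * η) * (4 / 3 * y * x)) ≤ (1 - η / 4) * t :=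
    mul_le_mul_of_nonneg_left ht (by linarith)
  have h5 : (1 + η / 4) - (1 - η / 4) * (1 + 3 / 4 * η) ≤ -(η / 16) := by nlinarith
  have h6 : ((1 + η / 4) - (1 - η / 4) * (1 + 3 / 4 * η)) * (4 / 3 * y * x) ≤
      -(η / 16) * (4 / 3 * y * x) := mul_le_mul_of_nonneg_right h5 (by positivity)
  have h7 : U - (1 - η / 4) * t ≤ -(η / 16) * (4 / 3 * y * x) := by linarith
  rw [h1]
  calc _ = η / 4 / (10 * y) ^ 2 * (U - (1 - η / 4) * t) := by ring
    _ ≤ η / 4 / (10 * y) ^ 2 * (-(η / 16) * (4 / 3 * y * x)) :=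
        mul_le_mul_of_nonneg_left h7 (by positivity)
    _ = -(η ^ 2 * (x / y) / 4800) := by field_simp; ring
    _ ≤ -(η ^ 2 * r / 10000) := by
        have h8 : r ≤ 2 * (x / y) := by
          rw [← mul_div_assoc, le_div_iff₀ hy]; linarith
        have h9 := mul_le_mul_of_nonneg_left h8 (sq_nonneg η)
        have h10 : 0 ≤ η ^ 2 * (x / y) := by positivity
        linarith

lemma upper_drift {η x y F : ℝ} (hη : 0 < η) (hη1 : η ≤ 1) (hx : 0 < x) (hy : 0 < y)
    (hF0 : 0 ≤ F) (hF : 100 * F ≤ η * x) (hηx : 10 ^ 6 ≤ η * x) (hηy : 10 ^ 6 ≤ η * y) :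
    (4 * y + 12) / 3 * (x + F + 3) + 8 * y ≤ (1 + η / 4) * (4 / 3 * y * x) := by
  have h4 : x + F + 3 ≤ (1 + η / 50) * x := by linarith
  have h5 : 4 * y + 12 ≤ (1 + η / 50) * (4 * y) := by linarith
  have h6 : 8 * y ≤ η / 50 * x * y := by
    have : 8 ≤ η / 50 * x := by linarith
    exact mul_le_mul_of_nonneg_right this hy.le
  have h7 : (4 * y + 12) / 3 * (x + F + 3) ≤ ((1 + η / 50) * (4 * y)) / 3 * ((1 + η / 50) * x) := by
    gcongr
  have h8 : (1 + η / 50) * (1 + η / 50) ≤ 1 + η / 10 := by nlinarith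
  have h9 : ((1 + η / 50) * (1 + η / 50)) * (4 / 3 * y * x) ≤ (1 + η / 10) * (4 / 3 * y * x) :=
    mul_le_mul_of_nonneg_right h8 (by positivity)
  have h10 : 0 ≤ η * y * x := by positivity
  linarith

lemma lower_exponent {η x y r s V : ℝ} (hη : 0 < η) (hx : 0 < x) (hy : 0 < y)
    (hyr : y * r ≤ 2 * x) (hV : (1 - η / 4) * (4 / 3 * y * x) ≤ V)
    (hs : s ≤ (1 - η / 2) * (4 / 3 * y * x)) :
    (η / 8 / (4 * y) ^ 2 + (η / 8 / (4 * y) ^ 2) ^ 2 * (4 * y) ^ 2) * s - η / 8 / (4 * y) ^ 2 * V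
      ≤ -(η ^ 2 * r / 2000) := by
  have h1 : (η / 8 / (4 * y) ^ 2) ^ 2 * (4 * y) ^ 2 = η / 8 / (4 * y) ^ 2 * (η / 8) := by
    field_simp
  have h3 := mul_le_mul_of_nonneg_left hs (show 0 ≤ 1 + η / 8 by positivity)
  have h5 : (1 + η / 8) * (1 - η / 2) - (1 - η / 4) ≤ -(η / 8) := by nlinarith
  have h6 := mul_le_mul_of_nonneg_right h5 (show 0 ≤ 4 / 3 * y * x by positivity)
  have h7 : (1 + η / 8) * s - V ≤ -(η / 8) * (4 / 3 * y * x) := by linarith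
  rw [h1]
  calc _ = η / 8 / (4 * y) ^ 2 * ((1 + η / 8) * s - V) := by ring
    _ ≤ η / 8 / (4 * y) ^ 2 * (-(η / 8) * (4 / 3 * y * x)) :=
        mul_le_mul_of_nonneg_left h7 (by positivity)
    _ = -(η ^ 2 * (x / y) / 768) := by field_simp; ring
    _ ≤ -(η ^ 2 * r / 2000) := by
        have h8 : r ≤ 2 * (x / y) := by
          rw [← mul_div_assoc, le_div_iff₀ hy]; linarith
        have h9 := mul_le_mul_of_nonneg_left h8 (sq_nonneg η)
        have h10 : 0 ≤ η ^ 2 * (x / y) := by positivity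
        linarith

lemma lower_drift {η x y δ : ℝ} (hη : 0 < η) (hη1 : η ≤ 1) (hx : 0 < x) (hy : 0 < y)
    (hδ : 0 ≤ δ) (hδη : δ ≤ η / 8) (hηx : 10 ^ 6 ≤ η * x) :
    (1 - η / 4) * (4 / 3 * y * x) ≤ (4 * y + 6) / (3 + 2 * δ) * (x - 1) := by
  have h1 : (1 - η / 8) * (4 / 3 * y) ≤ (4 * y + 6) / (3 + 2 * δ) := by
    rw [le_div_iff₀ (by linarith)]
    have h3 : (1 - η / 8) * (3 + 2 * δ) ≤ 3 := by nlinarith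
    have h4 := mul_le_mul_of_nonneg_right h3 (show 0 ≤ 4 / 3 * y by positivity)
    linarith
  have h2 : (1 - η / 8) * x ≤ x - 1 := by linarith
  have h3 : (1 - η / 4) ≤ (1 - η / 8) * (1 - η / 8) := by nlinarith
  calc (1 - η / 4) * (4 / 3 * y * x) ≤ ((1 - η / 8) * (1 - η / 8)) * (4 / 3 * y * x) :=
        mul_le_mul_of_nonneg_right h3 (by positivity)
    _ = ((1 - η / 8) * (4 / 3 * y)) * ((1 - η / 8) * x) := by ring
    _ ≤ (4 * y + 6) / (3 + 2 * δ) * (x - 1) :=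
        mul_le_mul h1 h2 (mul_nonneg (by linarith) hx.le) (by positivity)

namespace Asym

variable {A a : ℝ} {n K : ℕ} {P : TP}

lemma r_pos (hA : 10 ^ 9 ≤ A) (h : Asym A a n K P) : (0:ℝ) < P.r := by
  nlinarith [sq_le_r hA h]

lemma pert_pow_four (hA : 10 ^ 9 ≤ A) (h : Asym A a n K P) :
    pert n P ^ 4 = Real.log (Real.log n) / P.r := by
  have h1 : 0 ≤ Real.log (Real.log n) / P.r :=
    div_nonneg (by linarith [h.le_ll]) (Nat.cast_nonneg _)
  have h2 : pert n P ^ 4 = (√√(Real.log (Real.log n) / P.r) ^ 2) ^ 2 := by rw [pert]; ring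
  rw [h2, Real.sq_sqrt (Real.sqrt_nonneg _), Real.sq_sqrt h1]

lemma pert_le (hA : 10 ^ 9 ≤ A) (h : Asym A a n K P) {x : ℝ} (hx : 0 ≤ x)
    (hxA : 25 ≤ x ^ 4 * A) : pert n P ≤ x := by
  refine le_of_pow_le_pow_left₀ (n := 4) (by norm_num) hx ?_
  rw [pert_pow_four hA h, div_le_iff₀ (r_pos hA h)]
  have h1 := le_r h
  have h2 := h.le_ll
  have h3 : 25 * Real.log (Real.log n) ≤ x ^ 4 * A * Real.log (Real.log n) :=
    mul_le_mul_of_nonneg_right hxA (by linarith)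
  have h4 : x ^ 4 * (A * Real.log (Real.log n)) ≤ x ^ 4 * (25 * P.r) :=
    mul_le_mul_of_nonneg_left h1 (by positivity)
  nlinarith

lemma pert_nonneg (n : ℕ) (P : TP) : 0 ≤ pert n P := Real.sqrt_nonneg _

lemma pert_le_twentieth (hA : 10 ^ 9 ≤ A) (h : Asym A a n K P) : pert n P ≤ 1 / 20 :=
  pert_le hA h (by norm_num) (by linarith)

lemma mul_exp_pert_le (hA : 10 ^ 9 ≤ A) (h : Asym A a n K P) :
    K * Real.exp (1 - pert n P ^ 2 * P.r / 1120) ≤ 3 / A := by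
  have h1 := le_r h
  have h2 := h.le_ll
  have hr := r_pos hA h
  have h3 : 3360 * Real.log (Real.log n) ≤ pert n P ^ 2 * P.r := by
    refine le_of_pow_le_pow_left₀ (n := 2) (by norm_num) (by positivity) ?_
    have h4 : (pert n P ^ 2 * P.r) ^ 2 = Real.log (Real.log n) * P.r := by
      rw [mul_pow, ← pow_mul, pert_pow_four hA h]; field_simp
    rw [h4]
    have h5 : 0 ≤ Real.log (Real.log n) := by linarith
    nlinarith
  have hl := le_log hA h
  have hK : (K:ℝ) ≤ Real.log n := by linarith [pow_le hA h, h.K_le_h]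
  have h4 : Real.exp (1 - pert n P ^ 2 * P.r / 1120) ≤ 3 * (1 / Real.log n ^ 3) := by
    rw [← exp_neg_mul_loglog hA h 3]
    have h5 : Real.exp 1 ≤ 3 := by linarith [Real.exp_one_lt_d9]
    calc _ ≤ Real.exp (1 + -((3:ℕ) * Real.log (Real.log n))) := by
          apply Real.exp_le_exp.mpr; push_cast; linarith
      _ = Real.exp 1 * Real.exp (-((3:ℕ) * Real.log (Real.log n))) := Real.exp_add _ _
      _ ≤ _ := mul_le_mul_of_nonneg_right h5 (Real.exp_pos _).le
  have hl0 : 0 < Real.log n := by linarith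
  calc _ ≤ Real.log n * (3 * (1 / Real.log n ^ 3)) := by gcongr
    _ = 3 / (Real.log n * Real.log n) := by field_simp
    _ ≤ 3 / A := by
      apply div_le_div_of_nonneg_left (by norm_num) (by linarith)
      nlinarith

/-- the cutoff time of the perturbed walk -/
lemma le_time (hA : 10 ^ 9 ≤ A) (h : Asym A a n K P) :
    A * Real.log n / 20 ≤ 4 / 3 * 2 ^ P.m * P.H := by
  rw [cast_H h]
  have h1 : K * (Real.log n / 25) ≤ K * (2 ^ P.m * P.r) :=
    mul_le_mul_of_nonneg_left h.le_hr (Nat.cast_nonneg _)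
  have h2 : A * (Real.log n / 25) ≤ K * (Real.log n / 25) :=
    mul_le_mul_of_nonneg_right h.hA (by linarith [le_log hA h])
  nlinarith [le_log hA h]

lemma pow_mul_r_le (h : Asym A a n K P) : (2:ℝ) ^ P.m * P.r ≤ 2 * P.H := by
  rw [cast_H h]
  have := mul_le_mul_of_nonneg_right h.h_le (Nat.cast_nonneg P.r)
  linarith

lemma cube_le_H (hA : 10 ^ 9 ≤ A) (h : Asym A a n K P) : A ^ 3 ≤ 25 * P.H := by
  rw [cast_H h]
  have h1 := sq_le_r hA h
  have h2 := mul_le_mul_of_nonneg_right h.hA (Nat.cast_nonneg P.r)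
  have h3 : A * A ^ 2 ≤ A * (25 * P.r) := mul_le_mul_of_nonneg_left h1 (by linarith)
  nlinarith

lemma F_le_H (hA : 10 ^ 9 ≤ A) (h : Asym A a n K P) : A * P.F ≤ P.H := by
  rw [cast_H h]
  have h1 := le_r h
  have h2 := mul_le_mul_of_nonneg_right h.hA (Nat.cast_nonneg P.r)
  have h3 := mul_le_mul_of_nonneg_left h.F_le (show 0 ≤ A by linarith)
  have := h.le_ll
  nlinarith [r_pos hA h]

variable {D : ℕ} {Λ : ℝ} {M : ℕ} {N : P.Net (Fin M)} {δ : ℝ}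

/-- exponential decay of the time to reach the bulk, past the cutoff time -/
lemma surv_le (hA : 10 ^ 9 ≤ A) (h : Asym A a n K P) (hδ : 0 ≤ δ) (hδ' : δ ≤ 1 / 20)
    {η : ℝ} (hη : 0 < η) (hη1 : η ≤ 1) (hηA : 10 ^ 6 ≤ η ^ 2 * A) {t : ℕ}
    (ht : (1 + 3 / 4 * η) * (4 / 3 * 2 ^ P.m * P.H) ≤ t) (u : P.T ⊕ Fin M) :
    surv (N.w δ) (P.bulk (Fin M)) t u ≤ 10 ^ 6 / (η ^ 2 * A) / 10 := by
  have hr := r_pos hA h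
  have hr2 := sq_le_r hA h
  have hF := F_le_H hA h
  have hH3 := cube_le_H hA h
  have hyr := pow_mul_r_le h
  have hyA := le_pow h
  have hηA' : 10 ^ 6 ≤ η * A := by nlinarith
  set y : ℝ := 2 ^ P.m with hy
  have hy0 : 0 < y := by positivity
  set x : ℝ := (P.H : ℝ) with hx
  set F : ℝ := (P.F : ℝ) with hFd
  have hF0 : 0 ≤ F := Nat.cast_nonneg _
  have hx0 : 0 < x := by nlinarith
  have hθ : η / 4 / (10 * y) ^ 2 * (10 * y) ≤ 1 := by
    rw [div_mul_eq_mul_div, div_le_one (by positivity)]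
    nlinarith
  refine (N.surv_bulk_le_exp hδ hδ' (θ := η / 4 / (10 * y) ^ 2) (by positivity) hθ t u).trans ?_
  have hU : (4 * y + 12) / 3 * (((P.H + P.F : ℕ) : ℝ) + 3) + 8 * y ≤
      (1 + η / 4) * (4 / 3 * y * x) := by
    have h1 : 100 * F ≤ η * x := by
      have h2 : 100 * F ≤ η * (A * F) := by nlinarith
      have h3 : η * (A * F) ≤ η * x := mul_le_mul_of_nonneg_left hF hη.le
      linarith
    have h2 : 10 ^ 6 ≤ η * x := by
      have : A ≤ x := by nlinarith
      exact hηA'.trans (mul_le_mul_of_nonneg_left this hη.le)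
    have h3 : 10 ^ 6 ≤ η * y := hηA'.trans (mul_le_mul_of_nonneg_left hyA hη.le)
    push_cast
    exact upper_drift hη hη1 hx0 hy0 hF0 h1 h2 h3
  have hexp := upper_exponent hη hη1 hx0 hy0 hyr hU ht
  refine (Real.exp_le_exp.mpr hexp).trans ((exp_neg_le_inv (by positivity)).trans ?_)
  rw [one_div_div, div_div, div_le_div_iff₀ (by positivity) (by nlinarith)]
  have : η ^ 2 * A ^ 2 ≤ η ^ 2 * (25 * P.r) := mul_le_mul_of_nonneg_left hr2 (by positivity)
  have h2 : (η ^ 2 * A) * 10 ^ 9 ≤ η ^ 2 * A * A := by gcongr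
  nlinarith

lemma tmixW_pert_le (hA : 10 ^ 9 ≤ A) (h : Asym A a n K P) (hE : N.IsExp D Λ)
    (hM : Fintype.card P.T + M = n) (hδ : 0 ≤ δ) (hδ' : δ ≤ 1 / 20)
    (hAD : 48 * (D + 8) * pcon D Λ ≤ A) {η ε : ℝ} (hη : 0 < η) (hη1 : η ≤ 1)
    (hε1 : ε ≤ 1) (hηA : 10 ^ 6 * pcon D Λ ≤ η ^ 2 * A * ε) :
    (tmixW (N.w δ) ε : ℝ) ≤ (1 + η) * (4 / 3 * 2 ^ P.m * P.H) := by
  have hp := one_le_pcon (D := D) hE.one_le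
  have hl := le_log hA h
  have hT := le_time hA h
  set p := pcon D Λ
  have hη2 : 0 < η ^ 2 * A := by have : 0 < A := by linarith
                                 positivity
  have hη3 : 10 ^ 6 * p ≤ η ^ 2 * A := by nlinarith
  have hη4 : 10 ^ 6 * p ≤ η * A := by
    have : η ^ 2 * A ≤ η * A := by
      have h1 : η ^ 2 ≤ η := by nlinarith
      exact mul_le_mul_of_nonneg_right h1 (by linarith)
    linarith
  set T : ℝ := 4 / 3 * 2 ^ P.m * (P.H : ℝ)
  have hT0 : 0 < T := by nlinarith
  have ht := Nat.le_ceil ((1 + 3 / 4 * η) * T)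
  have ht' := Nat.ceil_lt_add_one (show 0 ≤ (1 + 3 / 4 * η) * T by positivity)
  have key := tmixW_le hA h hE hM hδ hδ' hAD (ε := ε) (fun u =>
    surv_le hA h hδ hδ' hη hη1 (by linarith) ht u) ?_
  · have h1 : 10 ^ 6 * p * Real.log n ≤ η * A * Real.log n :=
      mul_le_mul_of_nonneg_right hη4 (by linarith)
    have h2 : η * (A * Real.log n / 20) ≤ η * T := mul_le_mul_of_nonneg_left hT hη.le
    have h3 : 1 ≤ p * Real.log n := by nlinarith
    linarith
  · have h1 : 10 ^ 6 / (η ^ 2 * A) ≤ ε := by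
      rw [div_le_iff₀ hη2]
      linarith
    have h2 : 11 * p / A ≤ ε / 10 := by
      rw [div_le_div_iff₀ (by linarith) (by norm_num)]
      have h3 : 0 ≤ A * ε := by
        by_contra hc
        nlinarith [sq_nonneg η]
      have h4 : η ^ 2 * (A * ε) ≤ 1 * (A * ε) :=
        mul_le_mul_of_nonneg_right (pow_le_one₀ hη.le hη1) h3
      nlinarith
    change 10 ^ 6 / (η ^ 2 * A) / 10 + 11 * p / A ≤ ε
    have h0 : 0 < 10 ^ 6 / (η ^ 2 * A) := by positivity
    linarith

lemma le_tmixW_pert (hA : 10 ^ 9 ≤ A) (h : Asym A a n K P) (hE : N.IsExp D Λ)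
    (hM : Fintype.card P.T + M = n) {η ε : ℝ} (hη : 0 < η) (hη1 : η ≤ 1)
    (hε : 0 < ε) (hηA : 10 ^ 6 ≤ η ^ 4 * A * (1 - ε)) :
    (1 - η) * (4 / 3 * 2 ^ P.m * P.H) ≤ tmixW (N.w (pert n P)) ε := by
  have hl := le_log hA h
  have hT := le_time hA h
  have hr := r_pos hA h
  have hr2 := sq_le_r hA h
  have hH3 := cube_le_H hA h
  have hyr := pow_mul_r_le h
  have hyA := le_pow h
  have hKe := mul_exp_pert_le hA h
  have hcT := card_div_le hA h hM
  have hA0 : 0 < A := by linarith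
  have hη5 : 10 ^ 6 ≤ η ^ 4 * A := by
    have : 0 ≤ η ^ 4 * A := by positivity
    nlinarith
  have hη3 : 10 ^ 6 ≤ η * A := by
    have : η ^ 4 * A ≤ η ^ 1 * A := by
      gcongr ?_ * A
      exact pow_le_pow_of_le_one hη.le hη1 (by norm_num)
    linarith
  have hη4 : 10 ^ 6 ≤ η ^ 2 * A * (1 - ε) := by
    have h0 : 0 ≤ 1 - ε := by
      by_contra hc
      have : 0 ≤ η ^ 4 * A := by positivity
      nlinarith
    have : η ^ 4 * A * (1 - ε) ≤ η ^ 2 * A * (1 - ε) := by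
      gcongr ?_ * A * (1 - ε)
      exact pow_le_pow_of_le_one hη.le hη1 (by norm_num)
    linarith
  have hδη : pert n P ≤ η / 8 := pert_le hA h (by positivity) (by
    have : (η / 8) ^ 4 * A = η ^ 4 * A / 4096 := by ring
    rw [this]; linarith)
  have hδ := pert_nonneg n P
  have hδ' := pert_le_twentieth hA h
  set δ := pert n P
  set y : ℝ := 2 ^ P.m with hy
  have hy0 : 0 < y := by positivity
  set x : ℝ := (P.H : ℝ) with hx
  have hx0 : 0 < x := by nlinarith
  have hTT : 0 < 4 / 3 * y * x := by positivity
  have hs := Nat.floor_le (show 0 ≤ (1 - η / 2) * (4 / 3 * y * x) from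
    mul_nonneg (by linarith) hTT.le)
  have hs' := Nat.lt_floor_add_one ((1 - η / 2) * (4 / 3 * y * x))
  have hθ : η / 8 / (4 * y) ^ 2 * (4 * y) ≤ 1 := by
    rw [div_mul_eq_mul_div, div_le_one (by positivity)]
    nlinarith
  have key := hE.le_tmixW_perturbed hδ hδ' hε h.hH (θ := η / 8 / (4 * y) ^ 2) (by positivity) hθ
    (s := ⌊(1 - η / 2) * (4 / 3 * y * x)⌋₊) ?_
  · have key' : ((⌊(1 - η / 2) * (4 / 3 * y * x)⌋₊ : ℕ) : ℝ) ≤ tmixW (N.w δ) ε := by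
      exact_mod_cast key
    have h1 : 10 ^ 6 * Real.log n ≤ η * A * Real.log n :=
      mul_le_mul_of_nonneg_right hη3 (by linarith)
    have h2 : η * (A * Real.log n / 20) ≤ η * (4 / 3 * y * x) := mul_le_mul_of_nonneg_left hT hη.le
    linarith
  rw [Fintype.card_fin]
  have hηx : 10 ^ 6 ≤ η * x := by
    have : A ≤ x := by nlinarith
    exact hη3.trans (mul_le_mul_of_nonneg_left this hη.le)
  have hexp := lower_exponent hη hx0 hy0 hyr (lower_drift hη hη1 hx0 hy0 hδ hδη hηx) hs
  have h1 := (Real.exp_le_exp.mpr hexp).trans (exp_neg_le_inv (by positivity))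
  have h2 : 1 / (η ^ 2 * (P.r:ℝ) / 2000) ≤ 1 / (η ^ 2 * A) := by
    apply one_div_le_one_div_of_le (by positivity)
    have h3 : η ^ 2 * A ^ 2 ≤ η ^ 2 * (25 * P.r) := mul_le_mul_of_nonneg_left hr2 (by positivity)
    have h4 : (η ^ 2 * A) * 10 ^ 9 ≤ η ^ 2 * A * A := by gcongr
    nlinarith
  have h3 : 1 / (η ^ 2 * A) ≤ (1 - ε) / 10 ^ 6 := by
    rw [div_le_div_iff₀ (by positivity) (by norm_num)]
    linarith
  have h4 : 1 / A ≤ 1 / (η ^ 2 * A) := by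
    apply one_div_le_one_div_of_le (by positivity)
    have : η ^ 2 * A ≤ 1 * A := mul_le_mul_of_nonneg_right (pow_le_one₀ hη.le hη1) hA0.le
    linarith
  have h5 : 3 / A = 3 * (1 / A) := by ring
  have h6 : 0 < 1 - ε := by
    by_contra hc
    have h7 := mul_nonpos_of_nonneg_of_nonpos (show 0 ≤ η ^ 2 * A by positivity) (not_lt.mp hc)
    linarith
  linarith

end Asym

end perturbed

end

section

section sequence

open Asym

/-- the facts used about the graph built for a fixed number of vertices -/
theorem exists_graph_of_asym : ∃ (D : ℕ) (p A₀ c C : ℝ), 1 ≤ p ∧ 10 ^ 9 + 10 ^ 8 * p ≤ A₀ ∧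
    0 < c ∧ 0 < C ∧
    ∀ (a : ℝ) (n K : ℕ) (P : TP), Asym A₀ a n K P →
    ∃ (G : SimpleGraph (Fin n)) (w : Fin n → Fin n → ℝ),
      G.Connected ∧ ¬ G.IsAcyclic ∧ (∀ v, deg G v ≤ D) ∧
      c * Real.log n ≤ G.girth ∧ G.girth ≤ C * Real.log n ∧
      0 ≤ trelG G ∧ trelG G ≤ C * 2 ^ P.m ∧ GoodWeights G w ∧
      (∀ u v, G.Adj u v → 1 ≤ w u v ∧ w u v ≤ 1 + pert n P) ∧ (∃ u v, G.Adj u v) ∧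
      (tmixG G (1 / 4) ≤ C * Real.log n) ∧
      (∀ ε ε', 0 < ε → ε ≤ ε' → tmixG G ε' ≤ tmixG G ε) ∧
      (∀ (A : ℝ) (j : ℕ), A₀ ≤ A → Asym A a n K P → 1 ≤ j → 10 ^ 6 * 2 ^ j ≤ A →
        j / 1000 * Real.log n ≤ tmixG G ((1 / 2) ^ (j + 1))) ∧
      (∀ A ε : ℝ, A₀ ≤ A → Asym A a n K P → 0 < ε → ε + 1 / A < 1 → 1 ≤ tmixG G ε) ∧
      (∀ A η ε : ℝ, A₀ ≤ A → Asym A a n K P → 0 < η → η ≤ 1 → 0 < ε → ε < 1 →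
        10 ^ 6 * p ≤ η ^ 2 * A * ε → 10 ^ 6 ≤ η ^ 4 * A * (1 - ε) →
        (1 - η) * (4 / 3 * 2 ^ P.m * P.H) ≤ tmixW w ε ∧
          tmixW w ε ≤ (1 + η) * (4 / 3 * 2 ^ P.m * P.H)) := by
  obtain ⟨D, Λ, hD, hΛ, key⟩ := exists_graph
  have hp := one_le_pcon (D := D) hΛ
  have hD' : (1:ℝ) ≤ D := by exact_mod_cast hD
  have hDp : (D + 8 : ℝ) ≤ (D + 8) * pcon D Λ := by nlinarith
  have hA1 : (10:ℝ) ^ 9 ≤ 10 ^ 9 + 10 ^ 8 * ((D + 8) * pcon D Λ) := by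
    have : 0 ≤ (D + 8) * pcon D Λ := by positivity
    linarith
  have hA2 : pcon D Λ ≤ (D + 8) * pcon D Λ := by nlinarith
  have hDΛ : 1 ≤ D * Λ := by nlinarith
  refine ⟨D + 8, pcon D Λ, 10 ^ 9 + 10 ^ 8 * ((D + 8) * pcon D Λ), 1 / (8 * (60 + D)),
    25 + 10 * pcon D Λ + 16 * D * Λ, hp, by linarith, by positivity, by positivity,
    fun a n K P h => ?_⟩
  have hl := le_log hA1 h
  obtain ⟨hT, hg1, hg2, hq⟩ := graph_conditions hA1 h hD hΛ (by linarith)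
    (M := n - Fintype.card P.T) (g := ⌊Real.log n / (4 * (60 + D))⌋₊)
    (q := ⌈16 * D * Λ * Real.log n⌉₊) (by
      have := card_lt hA1 h
      have h1 : Fintype.card P.T ≤ n := by
        have : (Fintype.card P.T : ℝ) ≤ n := by
          linarith [Nat.cast_nonneg (α := ℝ) (Fintype.card P.T)]
        exact_mod_cast this
      omega) (Nat.floor_le (by positivity)) (Nat.le_ceil _)
  have hM : Fintype.card P.T + (n - Fintype.card P.T) = n := by omega
  obtain ⟨N, G, w, hE, hconn, hac, hgl, hgu, hdeg, hrel0, hrel, hgw, hwb, hadj, hmixG, hmixW⟩ :=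
    key P (n - Fintype.card P.T) _ _ n (pert n P) (ok hA1 h) hT hg1 hg2 hq (pert_nonneg n P)
      (pert_le_twentieth hA1 h) hM
  refine ⟨G, w, hconn, hac, hdeg, ?_, ?_, hrel0, ?_, hgw, hwb, hadj, ?_, ?_, ?_, ?_, ?_⟩
  · have h1 := Nat.lt_floor_add_one (Real.log n / (4 * (60 + D)))
    have h2 : ((⌊Real.log n / (4 * (60 + D))⌋₊ : ℕ) : ℝ) ≤ G.girth := by exact_mod_cast hgl
    have h3 : 1 ≤ 1 / (8 * (60 + D)) * Real.log n := by
      rw [one_div_mul_eq_div, le_div_iff₀ (by positivity)]; linarith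
    have h4 : Real.log n / (4 * (60 + D)) = 2 * (1 / (8 * (60 + D)) * Real.log n) := by
      field_simp; ring
    linarith
  · have h1 := Nat.ceil_lt_add_one (show 0 ≤ 16 * D * Λ * Real.log n by positivity)
    have h2 : (G.girth : ℝ) ≤ (⌈16 * D * Λ * Real.log n⌉₊ : ℕ) + 4 := by exact_mod_cast hgu
    have h3 : 0 ≤ pcon D Λ * Real.log n := mul_nonneg (by linarith) (by linarith)
    linarith
  · refine hrel.trans ?_
    rw [← mul_assoc]
    refine mul_le_mul_of_nonneg_right ?_ (by positivity)
    linarith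
  · rw [hmixG]
    refine (tmixW_zero_le hA1 h hE hM (by linarith)).trans ?_
    refine mul_le_mul_of_nonneg_right ?_ (by linarith)
    linarith
  · intro ε ε' hε hεε
    rw [hmixG, hmixG]
    exact tmixW_anti (N.isNet le_rfl) (one_le_pcon_mul hΛ P.m) (hE.poincare le_rfl (by norm_num))
      hε hεε
  · intro A j hA hh hj hAj
    rw [hmixG]
    exact le_tmixW_zero (hA1.trans hA) hh hE hM hj hAj
  · intro A ε hA hh hε hε1
    rw [hmixG]
    exact one_le_tmixW (hA1.trans hA) hh hE hM le_rfl (by norm_num) hε hε1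
  · intro A η ε hA hh hη hη1 hε hε1 hu hlow
    rw [hmixW]
    exact ⟨le_tmixW_pert (hA1.trans hA) hh hE hM hη hη1 hε hlow,
      tmixW_pert_le (hA1.trans hA) hh hE hM (pert_nonneg n P) (pert_le_twentieth hA1 h)
        (by linarith) hη hη1 hε1.le hu⟩

end sequence

end

section

section conclusion

lemma tendsto_div_of_bounds {x T : ℕ → ℝ} (hT : ∀ n, 0 < T n)
    (h : ∀ η : ℝ, 0 < η → η ≤ 1 → ∀ᶠ n in atTop, (1 - η) * T n ≤ x n ∧ x n ≤ (1 + η) * T n) :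
    Tendsto (fun n => x n / T n) atTop (nhds 1) := by
  rw [Metric.tendsto_nhds]
  intro ε hε
  filter_upwards [h (min (ε / 2) 1) (by positivity) (min_le_right _ _)] with n hn
  have h1 : min (ε / 2) 1 < ε := (min_le_left _ _).trans_lt (by linarith)
  rw [Real.dist_eq, abs_lt]
  have h2 := (le_div_iff₀ (hT n)).mpr hn.1
  have h3 := (div_le_iff₀ (hT n)).mpr hn.2
  constructor <;> linarith

theorem exists_graphs_without_precutoff
    (f : ℕ → ℝ)
    (hfinf : Tendsto f atTop atTop)
    (hfo : Tendsto (fun n => f n * Real.log (Real.log n) / Real.log n) atTop (nhds 0)) :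
    ∃ (D : ℕ) (N : ℕ → ℕ) (G : ∀ n, SimpleGraph (Fin (N n))),
      (∀ n, (G n).Connected) ∧
      (∀ n v, deg (G n) v ≤ D) ∧
      Tendsto N atTop atTop ∧
      (∃ c C : ℝ, 0 < c ∧ 0 < C ∧ ∀ n,
        ¬ (G n).IsAcyclic ∧
        c * (tmixG (G n) (1/4) : ℝ) ≤ ((G n).girth : ℝ) ∧
        ((G n).girth : ℝ) ≤ C * (tmixG (G n) (1/4) : ℝ)) ∧
      Tendsto (fun n => trelG (G n) / (tmixG (G n) (1/4) : ℝ)) atTop (nhds 0) ∧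
      ¬ (∃ B : ENNReal, B ≠ ⊤ ∧ ∀ ε : ℝ, 0 < ε → ε < 1/2 →
          Filter.limsup
            (fun n => ENNReal.ofReal ((tmixG (G n) ε : ℝ) / (tmixG (G n) (1 - ε) : ℝ)))
            atTop ≤ B) ∧
      (∃ w : ∀ n, Fin (N n) → Fin (N n) → ℝ,
        (∀ n, GoodWeights (G n) (w n)) ∧
        (∀ n u v, (G n).Adj u v → 1 ≤ w n u v) ∧
        Tendsto
          (fun n => ⨆ p : {p : Fin (N n) × Fin (N n) // (G n).Adj p.1 p.2}, w n p.1.1 p.1.2)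
          atTop (nhds 1) ∧
        (∀ ε : ℝ, 0 < ε → ε ≤ 1/2 →
          Tendsto (fun n => (tmixW (w n) ε : ℝ) / (tmixW (w n) (1 - ε) : ℝ)) atTop (nhds 1)) ∧
        (∃ c' C' : ℝ, 0 < c' ∧ 0 < C' ∧ ∀ n,
          c' * f (N n) ≤ (tmixW (w n) (1/4) : ℝ) / (tmixG (G n) (1/4) : ℝ) ∧
          (tmixW (w n) (1/4) : ℝ) / (tmixG (G n) (1/4) : ℝ) ≤ C' * f (N n))) := by
  obtain ⟨D, p, A₀, c, C, hp, hA₀, hc, hC, key⟩ := exists_graph_of_asym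
  obtain ⟨N₀, hN₀⟩ := eventually_atTop.mp (eventually_asym hfinf hfo A₀)
  have hA₀' : 10 ^ 9 ≤ A₀ := by linarith
  have has : ∀ n, Asym A₀ (f (n + N₀)) (n + N₀) ⌈f (n + N₀)⌉₊ (prm (f (n + N₀)) (n + N₀)) :=
    fun n => hN₀ _ (Nat.le_add_left _ _)
  have hev : ∀ A, ∀ᶠ n in atTop,
      Asym A (f (n + N₀)) (n + N₀) ⌈f (n + N₀)⌉₊ (prm (f (n + N₀)) (n + N₀)) := fun A =>
    (tendsto_add_atTop_nat N₀).eventually (eventually_asym hfinf hfo A)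
  choose G w hconn hac hdeg hgl hgu hrel0 hrel hgw hwb hadj hmix hanti hlow hone hpert using
    fun n => key _ _ _ _ (has n)
  have hl0 : ∀ n, 0 < Real.log ((n + N₀ : ℕ) : ℝ) := fun n => by
    linarith [Asym.le_log hA₀' (has n)]
  have hquarter : ∀ n, 1 / 1000 * Real.log ((n + N₀ : ℕ) : ℝ) ≤ tmixG (G n) (1 / 4) := fun n => by
    have := hlow n A₀ 1 le_rfl (has n) le_rfl (by linarith)
    norm_num at this ⊢
    exact this
  have hmix0 : ∀ n, (0:ℝ) < tmixG (G n) (1 / 4) := fun n => by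
    linarith [hl0 n, hquarter n]
  have hT0 : ∀ n, 0 < 4 / 3 * 2 ^ (prm (f (n + N₀)) (n + N₀)).m *
      ((prm (f (n + N₀)) (n + N₀)).H : ℝ) := fun n => by
    have h1 := Asym.le_time hA₀' (has n)
    have h2 := mul_pos (show 0 < A₀ by linarith) (hl0 n)
    linarith
  have hratio : ∀ ε : ℝ, 0 < ε → ε < 1 → Tendsto (fun n => (tmixW (w n) ε : ℝ) /
      (4 / 3 * 2 ^ (prm (f (n + N₀)) (n + N₀)).m * ((prm (f (n + N₀)) (n + N₀)).H : ℝ)))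
      atTop (nhds 1) := by
    intro ε hε hε1
    refine tendsto_div_of_bounds hT0 fun η hη hη1 => ?_
    have h1ε : 0 < 1 - ε := by linarith
    set A := max A₀ (max (10 ^ 6 * p / (η ^ 2 * ε)) (10 ^ 6 / (η ^ 4 * (1 - ε)))) with hA
    filter_upwards [hev A] with n hn
    refine hpert n A η ε (le_max_left _ _) hn hη hη1 hε hε1 ?_ ?_
    · have h1 : 10 ^ 6 * p / (η ^ 2 * ε) ≤ A := (le_max_left _ _).trans (le_max_right _ _)
      rw [div_le_iff₀ (by positivity)] at h1
      linarith
    · have h1 : 10 ^ 6 / (η ^ 4 * (1 - ε)) ≤ A := (le_max_right _ _).trans (le_max_right _ _)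
      rw [div_le_iff₀ (by positivity)] at h1
      linarith
  refine ⟨D, fun n => n + N₀, G, hconn, hdeg, tendsto_add_atTop_nat N₀, ?_, ?_, ?_, w, hgw,
    fun n u v huv => (hwb n u v huv).1, ?_, ?_, ?_⟩
  · refine ⟨c / C, C * 1000, by positivity, by positivity, fun n => ⟨hac n, ?_, ?_⟩⟩
    · refine le_trans ?_ (hgl n)
      calc c / C * (tmixG (G n) (1 / 4) : ℝ) ≤ c / C * (C * Real.log ((n + N₀ : ℕ) : ℝ)) :=
            mul_le_mul_of_nonneg_left (hmix n) (by positivity)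
        _ = c * Real.log ((n + N₀ : ℕ) : ℝ) := by field_simp
    · refine (hgu n).trans ?_
      have := mul_le_mul_of_nonneg_left (hquarter n) hC.le
      linarith
  · rw [Metric.tendsto_nhds]
    intro ε hε
    filter_upwards [hev (max A₀ (2000 * C / ε))] with n hn
    have hA1 : 10 ^ 9 ≤ max A₀ (2000 * C / ε) := hA₀'.trans (le_max_left _ _)
    have hA2 : 2000 * C / ε ≤ max A₀ (2000 * C / ε) := le_max_right _ _
    rw [Real.dist_eq, sub_zero, abs_of_nonneg (div_nonneg (hrel0 n) (hmix0 n).le),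
      div_lt_iff₀ (hmix0 n)]
    have h1 := hn.hll_le
    have h2 := hn.le_ll
    set A := max A₀ (2000 * C / ε)
    set y : ℝ := 2 ^ (prm (f (n + N₀)) (n + N₀)).m
    have hy : 0 < y := by positivity
    have h3 : y ≤ y * Real.log (Real.log ((n + N₀ : ℕ) : ℝ)) := by nlinarith
    have h4 : A * y ≤ Real.log ((n + N₀ : ℕ) : ℝ) :=
      (mul_le_mul_of_nonneg_left h3 (by linarith)).trans h1
    have h5 : 2000 * C / ε * y ≤ Real.log ((n + N₀ : ℕ) : ℝ) :=
      (mul_le_mul_of_nonneg_right hA2 hy.le).trans h4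
    have h6 : 2 * (C * y) ≤ ε * (1 / 1000 * Real.log ((n + N₀ : ℕ) : ℝ)) := by
      have := mul_le_mul_of_nonneg_left h5 hε.le
      rw [div_mul_eq_mul_div, mul_div_cancel₀ _ hε.ne'] at this
      linarith
    have h7 := mul_le_mul_of_nonneg_left (hquarter n) hε.le
    have h8 : 0 < C * y := by positivity
    have h9 := hrel n
    change _ ≤ C * y at h9
    linarith
  · rintro ⟨B, hB, hlim⟩
    obtain ⟨j, hj⟩ := exists_nat_gt (max 1 (B.toReal * (1000 * C)))
    have hj1 : (1:ℝ) < j := (le_max_left _ _).trans_lt hj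
    have hj1' : 1 ≤ j := by exact_mod_cast hj1.le
    have hjB : B.toReal * (1000 * C) < j := (le_max_right _ _).trans_lt hj
    have hε1 : ((1:ℝ) / 2) ^ (j + 1) ≤ (1 / 2) ^ 2 :=
      pow_le_pow_of_le_one (by norm_num) (by norm_num) (by omega)
    have hε0 : (0:ℝ) < (1 / 2) ^ (j + 1) := by positivity
    have h1 := hlim ((1 / 2) ^ (j + 1)) hε0 (by linarith)
    have h2 : ENNReal.ofReal (j / (1000 * C)) ≤ B := by
      refine le_trans (le_limsup_of_frequently_le' (Eventually.frequently ?_)) h1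
      set A := max A₀ (max (10 ^ 6 * 2 ^ j) (2 / (1 / 2) ^ (j + 1))) with hA
      have hA1 : A₀ ≤ A := le_max_left _ _
      have hA2 : 10 ^ 6 * 2 ^ j ≤ A := (le_max_left _ _).trans (le_max_right _ _)
      have hA3 : 2 / (1 / 2) ^ (j + 1) ≤ A := (le_max_right _ _).trans (le_max_right _ _)
      filter_upwards [hev A] with n hn
      apply ENNReal.ofReal_le_ofReal
      have h3 := hlow n A j hA1 hn hj1' hA2
      have h4 : 1 ≤ tmixG (G n) (1 - (1 / 2) ^ (j + 1)) := by
        refine hone n A _ hA1 hn (by linarith) ?_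
        rw [div_le_iff₀ hε0] at hA3
        have : 1 / A < (1 / 2) ^ (j + 1) := by
          rw [div_lt_iff₀ (by linarith)]; linarith
        linarith
      have h4' : (1:ℝ) ≤ tmixG (G n) (1 - (1 / 2) ^ (j + 1)) := by exact_mod_cast h4
      have h5 : (tmixG (G n) (1 - (1 / 2) ^ (j + 1)) : ℝ) ≤ C * Real.log ((n + N₀ : ℕ) : ℝ) := by
        refine le_trans ?_ (hmix n)
        exact_mod_cast hanti n (1 / 4) _ (by norm_num) (by linarith)
      rw [div_le_div_iff₀ (by positivity) (by linarith)]
      calc (j:ℝ) * tmixG (G n) (1 - (1 / 2) ^ (j + 1))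
          ≤ j * (C * Real.log ((n + N₀ : ℕ) : ℝ)) := by gcongr
        _ = j / 1000 * Real.log ((n + N₀ : ℕ) : ℝ) * (1000 * C) := by ring
        _ ≤ _ := mul_le_mul_of_nonneg_right h3 (by positivity)
    rw [ENNReal.ofReal_le_iff_le_toReal hB, div_le_iff₀ (by positivity)] at h2
    linarith
  · rw [Metric.tendsto_nhds]
    intro ε hε
    filter_upwards [hev (max A₀ (25 / (ε / 2) ^ 4))] with n hn
    have hA1 : 10 ^ 9 ≤ max A₀ (25 / (ε / 2) ^ 4) := hA₀'.trans (le_max_left _ _)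
    have hA2 : 25 / (ε / 2) ^ 4 ≤ max A₀ (25 / (ε / 2) ^ 4) := le_max_right _ _
    rw [div_le_iff₀ (by positivity), mul_comm] at hA2
    have h1 := Asym.pert_le hA1 hn (by positivity) hA2
    obtain ⟨u, v, huv⟩ := hadj n
    have hne : Nonempty {p : Fin (n + N₀) × Fin (n + N₀) // (G n).Adj p.1 p.2} := ⟨⟨(u, v), huv⟩⟩
    have h2 : (⨆ p : {p : Fin (n + N₀) × Fin (n + N₀) // (G n).Adj p.1 p.2}, w n p.1.1 p.1.2) ≤
        1 + ε / 2 := ciSup_le fun q => by linarith [(hwb n _ _ q.2).2]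
    have h3 : 1 ≤ (⨆ p : {p : Fin (n + N₀) × Fin (n + N₀) // (G n).Adj p.1 p.2}, w n p.1.1 p.1.2) :=
      (hwb n u v huv).1.trans (le_ciSup (f := fun p : {p : Fin (n + N₀) × Fin (n + N₀) //
        (G n).Adj p.1 p.2} => w n p.1.1 p.1.2) (Set.finite_range _).bddAbove ⟨(u, v), huv⟩)
    rw [Real.dist_eq, abs_lt]
    constructor <;> linarith
  · intro ε hε hε2
    have h1 := (hratio ε hε (by linarith)).div (hratio (1 - ε) (by linarith) (by linarith))
      one_ne_zero
    rw [div_one] at h1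
    refine h1.congr fun n => ?_
    rw [Pi.div_apply, div_div_div_cancel_right₀ (hT0 n).ne']
  · refine ⟨2 / (75 * C), 250, by positivity, by norm_num, fun n => ?_⟩
    obtain ⟨h1, h2⟩ := hpert n A₀ (1 / 2) (1 / 4) le_rfl (has n) (by norm_num) (by norm_num)
      (by norm_num) (by norm_num) (by linarith) (by linarith)
    have h3 := Asym.cast_H (has n)
    have h4 := (has n).le_hr
    have h5 := (has n).hr_le
    have h6 := (has n).le_K
    have h7 := (has n).K_le
    have h8 := hmix n
    have h9 := hquarter n
    have h10 := hl0 n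
    have hA := (has n).hA
    change 2 / (75 * C) * f (n + N₀) ≤ _ ∧ _ ≤ 250 * f (n + N₀)
    set P := prm (f (n + N₀)) (n + N₀)
    set K : ℝ := (⌈f (n + N₀)⌉₊ : ℝ)
    set l := Real.log ((n + N₀ : ℕ) : ℝ)
    have hT : 4 / 3 * 2 ^ P.m * (P.H : ℝ) = 4 / 3 * (K * (2 ^ P.m * P.r)) := by rw [h3]; ring
    rw [hT] at h1 h2
    have hK0 : 0 < K := by linarith
    have hf0 : 0 < f (n + N₀) := by linarith
    have h11 : f (n + N₀) * (l / 25) ≤ K * (2 ^ P.m * P.r) := by gcongr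
    have h12 : K * (2 ^ P.m * P.r) ≤ 2 * f (n + N₀) * (l / 16) := by gcongr
    constructor
    · rw [le_div_iff₀ (hmix0 n)]
      calc 2 / (75 * C) * f (n + N₀) * tmixG (G n) (1 / 4)
          ≤ 2 / (75 * C) * f (n + N₀) * (C * l) := by gcongr
        _ = 2 / 3 * (f (n + N₀) * (l / 25)) := by field_simp; norm_num
        _ ≤ _ := by linarith
    · rw [div_le_iff₀ (hmix0 n)]
      have h13 : f (n + N₀) * (1 / 1000 * l) ≤ f (n + N₀) * tmixG (G n) (1 / 4) := by gcongr
      linarith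

end conclusion

end

open ENNReal in
/-- **Theorem 2.** For every `f(n) = o(log n / log log n)` with `f(n) → ∞` there is a sequence
of bounded degree graphs whose girth is of the order of the mixing time, whose LSRWs satisfy
the product condition but exhibit no pre-cutoff, and on which some `o(1)`-perturbation of the
edge weights produces cutoff and increases the mixing time by a factor of order `f(|V_n|)`. -/
theorem product_condition_without_precutoff
    (f : ℕ → ℝ) (hfpos : ∀ n, 0 < f n)
    (hfinf : Tendsto f atTop atTop)
    (hfo : Tendsto (fun n => f n * Real.log (Real.log n) / Real.log n) atTop (nhds 0)) :
    ∃ (D : ℕ) (N : ℕ → ℕ) (G : ∀ n, SimpleGraph (Fin (N n))),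
      (∀ n, (G n).Connected) ∧
      (∀ n v, deg (G n) v ≤ D) ∧
      Tendsto N atTop atTop ∧
      -- (i) girth(G_n) = Θ(t_mix(G_n))
      (∃ c C : ℝ, 0 < c ∧ 0 < C ∧ ∀ n,
        ¬ (G n).IsAcyclic ∧
        c * (tmixG (G n) (1/4) : ℝ) ≤ ((G n).girth : ℝ) ∧
        ((G n).girth : ℝ) ≤ C * (tmixG (G n) (1/4) : ℝ)) ∧
      -- (ii) the product condition holds ...
      Tendsto (fun n => trelG (G n) / (tmixG (G n) (1/4) : ℝ)) atTop (nhds 0) ∧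
      -- ... but there is no pre-cutoff
      ¬ (∃ B : ℝ≥0∞, B ≠ ⊤ ∧ ∀ ε : ℝ, 0 < ε → ε < 1/2 →
          Filter.limsup
            (fun n => ENNReal.ofReal ((tmixG (G n) ε : ℝ) / (tmixG (G n) (1 - ε) : ℝ)))
            atTop ≤ B) ∧
      -- (iii) an `o(1)`-perturbation producing cutoff and increasing the mixing time
      (∃ w : ∀ n, Fin (N n) → Fin (N n) → ℝ,
        (∀ n, GoodWeights (G n) (w n)) ∧
        (∀ n u v, (G n).Adj u v → 1 ≤ w n u v) ∧
        Tendsto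
          (fun n => ⨆ p : {p : Fin (N n) × Fin (N n) // (G n).Adj p.1 p.2}, w n p.1.1 p.1.2)
          atTop (nhds 1) ∧
        (∀ ε : ℝ, 0 < ε → ε ≤ 1/2 →
          Tendsto (fun n => (tmixW (w n) ε : ℝ) / (tmixW (w n) (1 - ε) : ℝ)) atTop (nhds 1)) ∧
        (∃ c' C' : ℝ, 0 < c' ∧ 0 < C' ∧ ∀ n,
          c' * f (N n) ≤ (tmixW (w n) (1/4) : ℝ) / (tmixG (G n) (1/4) : ℝ) ∧
          (tmixW (w n) (1/4) : ℝ) / (tmixG (G n) (1/4) : ℝ) ≤ C' * f (N n))) :=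
  exists_graphs_without_precutoff f hfinf hfo

end
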